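/- Let c ∈ (1, 1.16) be a fixed real number, and for each positive integer Q let B_Q^{(1)} = {p ≤ Q : p prime and p = ⌊n^c⌋ for some positive integer n} be the set of Piatetski-Shapiro primes not exceeding Q. Let ν ≥ 2 and let P(X) = c_ν X^ν + ⋯ + c_1 X ∈ ℤ[X] have nonzero discriminant. Then the limiting pair correlation of the sequence (M_{B_Q^{(1)},P})_{Q ∈ ℕ} exists and is Poissonian: for every Λ > 0, lim_{Q→∞} S_{M_{B_Q^{(1)},P}}(Λ) = Λ. -/

import Mathlib

open Finset Filter

/-- The pairs `(a, q)` with `1 ≤ a ≤ q ≤ Q` and `gcd (P(a), q) = 1`, indexing the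
polynomial Farey fractions `a / q` of order `Q`. -/
def fareyPairs (P : Polynomial ℤ) (Q : ℕ) : Finset (ℕ × ℕ) :=
  (Finset.Icc 1 Q ×ˢ Finset.Icc 1 Q).filter
    (fun x => x.1 ≤ x.2 ∧ Int.gcd (P.eval (x.1 : ℤ)) (x.2 : ℤ) = 1)

/-- The set of polynomial Farey fractions of order `Q`. -/
def fareySet (P : Polynomial ℤ) (Q : ℕ) : Finset ℚ :=
  (fareyPairs P Q).image (fun x => (x.1 : ℚ) / (x.2 : ℚ))

/-- `f_P(m)` is the number of `1 ≤ d ≤ m` with `P(d) ≡ 0 (mod m)`. -/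
def fP (P : Polynomial ℤ) (m : ℕ) : ℕ :=
  ((Finset.Icc 1 m).filter (fun d : ℕ => (m : ℤ) ∣ P.eval (d : ℤ))).card

/-- `β_P = ∏_p (1 - f_P(p)/p²)`, the product over all primes. -/
noncomputable def betaP (P : Polynomial ℤ) : ℝ :=
  ∏' p : Nat.Primes, (1 - (fP P (p : ℕ) : ℝ) / ((p : ℕ) : ℝ) ^ 2)

open scoped Classical in
/-- Pair correlation measure `S_F(Λ)` of a finite set `F ⊂ ℝ/ℤ` (represented by
rationals): `(1/N) · #{(a,b) ∈ F² : a ≠ b, a - b ∈ (1/N)(0,Λ) + ℤ}`. -/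
noncomputable def pairCorr (F : Finset ℚ) (Λ : ℝ) : ℝ :=
  (((F ×ˢ F).filter (fun x => x.1 ≠ x.2 ∧
      ∃ k : ℤ, ((x.1 : ℝ) - (x.2 : ℝ) - (k : ℝ)) * (F.card : ℝ) ∈ Set.Ioo 0 Λ)).card : ℝ) /
    (F.card : ℝ)

/-- The polynomial Farey fractions with prime denominators in `B`:
`M_{B,P} = {a/p : 1 ≤ a ≤ p, gcd(P(a), p) = 1, p ∈ B}`. -/
def fareyPrimeSet (P : Polynomial ℤ) (B : Finset ℕ) : Finset ℚ :=
  B.biUnion fun p =>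
    ((Finset.Icc 1 p).filter fun a : ℕ => Int.gcd (P.eval (a : ℤ)) (p : ℤ) = 1).image
      fun a : ℕ => (a : ℚ) / (p : ℚ)

open scoped Classical in
/-- The set of Piatetski-Shapiro primes `p ≤ Q`, i.e. primes of the form `⌊n^c⌋`. -/
noncomputable def psPrimes (cexp : ℝ) (Q : ℕ) : Finset ℕ :=
  (Finset.Icc 1 Q).filter fun p => Nat.Prime p ∧ ∃ n : ℕ, 0 < n ∧ p = Nat.floor ((n : ℝ) ^ cexp)

open Real
open scoped ComplexConjugate

/-- The additive character `e(t) = exp (2πit)`. -/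
noncomputable def ee (t : ℝ) : ℂ := Complex.exp ((2 * π * t : ℝ) * Complex.I)

lemma norm_ee (t : ℝ) : ‖ee t‖ = 1 := Complex.norm_exp_ofReal_mul_I _

lemma ee_add (s t : ℝ) : ee (s + t) = ee s * ee t := by
  simp only [ee, ← Complex.exp_add]; congr 1; push_cast; ring

lemma ee_zero : ee 0 = 1 := by simp [ee]

lemma ee_neg (t : ℝ) : ee (-t) = conj (ee t) := by
  simp only [ee, ← Complex.exp_conj, map_mul, Complex.conj_ofReal, Complex.conj_I]
  congr 1; push_cast; ring

lemma ee_int (k : ℤ) : ee k = 1 := by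
  rw [ee, Complex.exp_eq_one_iff]; exact ⟨k, by push_cast; ring⟩

lemma ee_sub_int_mul (t : ℝ) (k : ℤ) (n : ℕ) : ee (t - k * n) = ee t := by
  have : t - k * n = t + ((-(k * n) : ℤ) : ℝ) := by push_cast; ring
  rw [this, ee_add, ee_int, mul_one]

lemma ee_mul_conj (s t : ℝ) : ee s * conj (ee t) = ee (s - t) := by
  rw [← ee_neg, ← ee_add, sub_eq_add_neg]

lemma ee_eq (t : ℝ) : ee t = Complex.cos (2 * π * t) + Complex.sin (2 * π * t) * Complex.I := by
  rw [ee, Complex.exp_mul_I]; push_cast; rfl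

noncomputable def halfCot (t : ℝ) : ℝ := cos (π * t) / sin (π * t)

lemma two_mul_le_sin_pi_mul {δ t : ℝ} (hδ : 0 < δ) (h1 : δ ≤ t) (h2 : t ≤ 1 - δ) :
    2 * δ ≤ sin (π * t) := by
  have hpi := pi_pos
  rcases le_total t (1 / 2) with h | h
  · have := mul_le_sin (x := π * t) (by nlinarith) (by nlinarith)
    have e : 2 / π * (π * t) = 2 * t := by field_simp
    linarith
  · have := mul_le_sin (x := π * (1 - t)) (by nlinarith) (by nlinarith)
    have e : 2 / π * (π * (1 - t)) = 2 * (1 - t) := by field_simp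
    have e2 : sin (π * (1 - t)) = sin (π * t) := by
      rw [mul_sub, mul_one, sin_pi_sub]
    linarith

lemma halfCot_antitone {δ s t : ℝ} (hδ : 0 < δ) (h1 : δ ≤ s) (hst : s ≤ t) (h2 : t ≤ 1 - δ) :
    halfCot t ≤ halfCot s := by
  have hs := two_mul_le_sin_pi_mul hδ h1 (hst.trans h2)
  have ht := two_mul_le_sin_pi_mul hδ (h1.trans hst) h2
  unfold halfCot
  rw [div_le_div_iff₀ (by linarith) (by linarith)]
  have : 0 ≤ sin (π * t - π * s) := by
    apply sin_nonneg_of_nonneg_of_le_pi <;> nlinarith [pi_pos]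
  rw [sin_sub] at this
  linarith

lemma abs_halfCot_le {δ t : ℝ} (hδ : 0 < δ) (h1 : δ ≤ t) (h2 : t ≤ 1 - δ) :
    |halfCot t| ≤ 1 / (2 * δ) := by
  have hs := two_mul_le_sin_pi_mul hδ h1 h2
  unfold halfCot
  rw [abs_div, abs_of_pos (a := sin _) (by linarith)]
  exact div_le_div₀ zero_le_one (abs_cos_le_one _) (by linarith) hs

noncomputable def cotCoef (t : ℝ) : ℂ := (1 + halfCot t * Complex.I) / 2

lemma norm_cotCoef_le {δ t : ℝ} (hδ : 0 < δ) (h1 : δ ≤ t) (h2 : t ≤ 1 - δ) :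
    ‖cotCoef t‖ ≤ 1 / (4 * δ) := by
  have hs := two_mul_le_sin_pi_mul hδ h1 h2
  have hs0 : 0 < sin (π * t) := by linarith
  have : ‖cotCoef t‖ = 1 / (2 * sin (π * t)) := by
    have e : cotCoef t = ((1 / (2 * sin (π * t)) : ℝ) : ℂ) *
        (Complex.I * Complex.exp ((-(π * t) : ℝ) * Complex.I)) := by
      rw [Complex.exp_mul_I, cotCoef, halfCot]
      have : (Complex.sin (π * t)) ≠ 0 := by
        have : ((sin (π * t) : ℝ) : ℂ) ≠ 0 := mod_cast hs0.ne'
        simpa using this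
      push_cast
      rw [Complex.cos_neg, Complex.sin_neg]
      field_simp
      ring_nf
      simp
    rw [e, norm_mul, norm_mul, Complex.norm_exp_ofReal_mul_I, Complex.norm_real, Complex.norm_I,
      norm_of_nonneg (by positivity)]
    ring
  rw [this]
  exact div_le_div_of_nonneg_left zero_le_one (by linarith) (by linarith)

lemma one_sub_ee_mul_cotCoef {t : ℝ} (hs : sin (π * t) ≠ 0) :
    (1 - ee t) * cotCoef t = 1 := by
  have hs' : Complex.sin (π * t) ≠ 0 := by
    have : ((sin (π * t) : ℝ) : ℂ) ≠ 0 := mod_cast hs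
    simpa using this
  have e : (2 * π * t : ℂ) = 2 * (π * t) := by ring
  rw [ee_eq, cotCoef, halfCot, e, Complex.cos_two_mul, Complex.sin_two_mul]
  push_cast
  have h := Complex.sin_sq_add_cos_sq (π * t)
  have h2 := Complex.I_sq
  generalize Complex.sin (π * t) = s at *
  generalize Complex.cos (π * t) = c at *
  field_simp
  linear_combination (-2 * c * Complex.I) * h - 2 * s * c ^ 2 * h2

/-- **Kusmin–Landau inequality** for a sequence with monotone differences. -/
theorem kusmin_landau (g : ℕ → ℝ) (a b : ℕ) {δ : ℝ} (hδ : 0 < δ)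
    (h1 : ∀ n, a ≤ n → n < b → δ ≤ g (n + 1) - g n ∧ g (n + 1) - g n ≤ 1 - δ)
    (hm : ∀ n, a ≤ n → n + 1 < b → g (n + 1) - g n ≤ g (n + 2) - g (n + 1)) :
    ‖∑ n ∈ Ico a b, ee (g n)‖ ≤ 1 / δ := by
  rcases le_or_gt b a with hab | hab
  · rw [Ico_eq_empty (by omega)]; simp; positivity
  set D : ℕ → ℝ := fun n => g (n + 1) - g n with hD
  have hz : ∀ n, a ≤ n → n < b → ee (g n) = (ee (g n) - ee (g (n + 1))) * cotCoef (D n) := fun n hn hb => by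
    have := two_mul_le_sin_pi_mul hδ (h1 n hn hb).1 (h1 n hn hb).2
    have h := one_sub_ee_mul_cotCoef (t := D n) (by simp only [hD]; linarith)
    have e : ee (g (n + 1)) = ee (g n) * ee (D n) := by rw [← ee_add]; congr 1; simp [hD]
    rw [e]
    linear_combination (-ee (g n)) * h
  have key : ∀ m, a + 1 ≤ m → m ≤ b →
      ‖∑ n ∈ Ico a m, ee (g n) + ee (g m) * cotCoef (D (m - 1))‖ ≤
        ‖cotCoef (D a)‖ + (halfCot (D a) - halfCot (D (m - 1))) / 2 := fun m hm1 => by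
    induction m, hm1 using Nat.le_induction with
    | base =>
      intro _
      rw [sum_Ico_succ_top le_rfl, Ico_self, sum_empty, zero_add, Nat.add_sub_cancel]
      have : ee (g a) + ee (g (a + 1)) * cotCoef (D a) = ee (g a) * cotCoef (D a) := by
        have := hz a le_rfl hab
        linear_combination this
      rw [this, norm_mul, norm_ee]; simp
    | succ m hm1 ih =>
      intro hmb
      have ih := ih (by omega)
      rw [sum_Ico_succ_top (by omega), Nat.add_sub_cancel]
      have e : ∑ n ∈ Ico a m, ee (g n) + ee (g m) + ee (g (m + 1)) * cotCoef (D m) =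
          (∑ n ∈ Ico a m, ee (g n) + ee (g m) * cotCoef (D (m - 1))) +
            ee (g m) * (cotCoef (D m) - cotCoef (D (m - 1))) := by
        have := hz m (by omega) (by omega)
        linear_combination this
      rw [e]
      refine (norm_add_le _ _).trans ?_
      have hmono : halfCot (D m) ≤ halfCot (D (m - 1)) := by
        have h3 := hm (m - 1) (by omega) (by omega)
        have e1 : m - 1 + 1 = m := by omega
        have e2 : m - 1 + 2 = m + 1 := by omega
        rw [e1, e2] at h3
        refine halfCot_antitone hδ (h1 (m - 1) (by omega) (by omega)).1 ?_
          (h1 m (by omega) (by omega)).2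
        simp only [hD, e1]; exact h3
      have : ‖ee (g m) * (cotCoef (D m) - cotCoef (D (m - 1)))‖ =
          (halfCot (D (m - 1)) - halfCot (D m)) / 2 := by
        have : cotCoef (D m) - cotCoef (D (m - 1)) =
            (((halfCot (D m) - halfCot (D (m - 1))) / 2 : ℝ) : ℂ) * Complex.I := by
          simp only [cotCoef]; push_cast; ring
        rw [norm_mul, norm_ee, this, norm_mul, Complex.norm_real, Complex.norm_I, norm_eq_abs,
          abs_of_nonpos (by linarith)]
        ring
      rw [this]; linarith
  have k := key b hab le_rfl
  have ha := h1 a le_rfl hab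
  have hb := h1 (b - 1) (by omega) (by omega)
  have c1 := norm_cotCoef_le hδ ha.1 ha.2
  have c2 := norm_cotCoef_le hδ hb.1 hb.2
  have d1 := (abs_le.1 (abs_halfCot_le hδ ha.1 ha.2)).2
  have d2 := (abs_le.1 (abs_halfCot_le hδ hb.1 hb.2)).1
  have t : ‖∑ n ∈ Ico a b, ee (g n)‖ ≤ ‖∑ n ∈ Ico a b, ee (g n) + ee (g b) * cotCoef (D (b - 1))‖ +
      ‖ee (g b) * cotCoef (D (b - 1))‖ := by
    have := norm_sub_le (∑ n ∈ Ico a b, ee (g n) + ee (g b) * cotCoef (D (b - 1)))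
      (ee (g b) * cotCoef (D (b - 1)))
    simpa using this
  rw [norm_mul (ee _), norm_ee, one_mul] at t
  have e1 : 1 / (4 * δ) = 1 / δ / 4 := by ring
  have e2 : 1 / (2 * δ) = 1 / δ / 2 := by ring
  simp only [hD] at *
  linarith

lemma filter_eq_Ico_of_monotone (D : ℕ → ℝ) (a b : ℕ)
    (hD : ∀ i j, a ≤ i → i ≤ j → j < b → D i ≤ D j) (u v : ℝ) :
    ∃ a' b', a ≤ a' ∧ b' ≤ b ∧ (Ico a b).filter (fun n => u ≤ D n ∧ D n ≤ v) = Ico a' b' := by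
  set S := (Ico a b).filter (fun n => u ≤ D n ∧ D n ≤ v) with hS
  rcases S.eq_empty_or_nonempty with h | h
  · exact ⟨a, 0, le_rfl, Nat.zero_le _, by rw [h]; simp⟩
  · have hm := S.min'_mem h
    have hM := S.max'_mem h
    have hmem : ∀ n, n ∈ S ↔ (a ≤ n ∧ n < b) ∧ u ≤ D n ∧ D n ≤ v := by
      intro n; rw [hS, mem_filter, mem_Ico]
    rw [hmem] at hm hM
    refine ⟨S.min' h, S.max' h + 1, hm.1.1, hM.1.2, ?_⟩
    ext n
    constructor
    · intro hn
      rw [mem_Ico]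
      exact ⟨S.min'_le n hn, Nat.lt_succ_of_le (S.le_max' n hn)⟩
    · intro hn
      rw [mem_Ico] at hn
      rw [hS, mem_filter, mem_Ico]
      refine ⟨⟨by omega, by omega⟩, ?_, ?_⟩
      · exact hm.2.1.trans (hD _ _ hm.1.1 hn.1 (by omega))
      · exact (hD _ _ (by omega) (Nat.lt_succ_iff.1 hn.2) hM.1.2).trans hM.2.2

lemma card_filter_le_of_separated (D : ℕ → ℝ) (a b : ℕ) {lam : ℝ} (hl : 0 < lam)
    (hD : ∀ i j, a ≤ i → i ≤ j → j < b → lam * (j - i) ≤ D j - D i) (u v : ℝ) (huv : u ≤ v) :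
    (((Ico a b).filter (fun n => u ≤ D n ∧ D n ≤ v)).card : ℝ) ≤ (v - u) / lam + 1 := by
  set S := (Ico a b).filter (fun n => u ≤ D n ∧ D n ≤ v) with hS
  rcases S.eq_empty_or_nonempty with h | h
  · rw [h]; simp only [card_empty, Nat.cast_zero]
    have := div_nonneg (sub_nonneg.2 huv) hl.le
    linarith
  · have hmem : ∀ n, n ∈ S ↔ (a ≤ n ∧ n < b) ∧ u ≤ D n ∧ D n ≤ v := by
      intro n; rw [hS, mem_filter, mem_Ico]
    have hm := (hmem _).1 (S.min'_mem h)
    have hM := (hmem _).1 (S.max'_mem h)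
    have hle : S.min' h ≤ S.max' h := S.min'_le _ (S.max'_mem h)
    have hsub : S ⊆ Icc (S.min' h) (S.max' h) := fun n hn =>
      mem_Icc.2 ⟨S.min'_le n hn, S.le_max' n hn⟩
    have hc := card_le_card hsub
    rw [Nat.card_Icc] at hc
    have hc' : (S.card : ℝ) ≤ (S.max' h : ℝ) - S.min' h + 1 := by
      have : S.card + S.min' h ≤ S.max' h + 1 := by omega
      have : ((S.card + S.min' h : ℕ) : ℝ) ≤ ((S.max' h + 1 : ℕ) : ℝ) := mod_cast this
      push_cast at this; linarith
    have := hD _ _ hm.1.1 hle hM.1.2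
    have : (S.max' h : ℝ) - S.min' h ≤ (v - u) / lam := by
      rw [le_div_iff₀ hl]; linarith [hm.2.1, hM.2.2]
    linarith

lemma norm_sum_ee_le_card {ι : Type*} (S : Finset ι) (g : ι → ℝ) :
    ‖∑ n ∈ S, ee (g n)‖ ≤ S.card := by
  refine (norm_sum_le _ _).trans ?_
  simp [norm_ee]

/-- **Van der Corput's second derivative test**, for second differences. -/
theorem vdc_second_difference (g : ℕ → ℝ) (a b : ℕ) {lam al : ℝ} (hl : 0 < lam) (hal : 1 ≤ al)
    (h : ∀ n, a ≤ n → n + 1 < b → lam ≤ (g (n + 2) - g (n + 1)) - (g (n + 1) - g n) ∧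
      (g (n + 2) - g (n + 1)) - (g (n + 1) - g n) ≤ al * lam) :
    ‖∑ n ∈ Ico a b, ee (g n)‖ ≤ 10 * (al * (b - a : ℕ) * √lam + 1 / √lam) := by
  have hsq : 0 < √lam := sqrt_pos.2 hl
  have hsq2 : √lam * √lam = lam := mul_self_sqrt hl.le
  rcases le_or_gt (1 / 2) √lam with hbig | hsmall
  · refine (norm_sum_ee_le_card _ _).trans ?_
    rw [Nat.card_Ico]
    have : 0 ≤ 1 / √lam := by positivity
    have h0 : (0 : ℝ) ≤ ((b - a : ℕ) : ℝ) := Nat.cast_nonneg _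
    have : ((b - a : ℕ) : ℝ) * 1 * (1 / 2) ≤ al * (b - a : ℕ) * √lam := by
      have : ((b - a : ℕ) : ℝ) * 1 ≤ al * (b - a : ℕ) := by nlinarith
      exact mul_le_mul this hbig (by norm_num) (by positivity)
    linarith
  rcases le_or_gt b a with hab | hab
  · rw [Ico_eq_empty (by omega)]; simp; positivity
  set D : ℕ → ℝ := fun n => g (n + 1) - g n with hDdef
  have hD : ∀ i j, a ≤ i → i ≤ j → j < b →
      lam * (j - i) ≤ D j - D i ∧ D j - D i ≤ al * lam * (j - i) := fun i j hi hij => by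
    induction j, hij using Nat.le_induction with
    | base => intro _; simp
    | succ j hij ih =>
      intro hj
      have ih := ih (by omega)
      have := h j (by omega) hj
      simp only [hDdef] at *
      push_cast
      constructor <;> nlinarith
  have hmono : ∀ i j, a ≤ i → i ≤ j → j < b → D i ≤ D j := fun i j hi hij hj => by
    have := (hD i j hi hij hj).1
    have h2 : (0 : ℝ) ≤ lam * (j - i) := mul_nonneg hl.le (by
      have : (i : ℝ) ≤ j := mod_cast hij
      linarith)
    linarith
  set δ := √lam
  have hmaps : ∀ n ∈ Ico a b, ⌊D n⌋ ∈ Icc ⌊D a⌋ ⌊D (b - 1)⌋ := fun n hn => by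
    rw [mem_Ico] at hn
    exact mem_Icc.2 ⟨Int.floor_le_floor (hmono _ _ le_rfl hn.1 hn.2),
      Int.floor_le_floor (hmono _ _ hn.1 (by omega) (by omega))⟩
  rw [← sum_fiberwise_of_maps_to hmaps]
  have hblock : ∀ k : ℤ, ‖∑ n ∈ (Ico a b).filter (fun n => ⌊D n⌋ = k), ee (g n)‖ ≤ 5 / δ := fun k => by
    set S := (Ico a b).filter (fun n => ⌊D n⌋ = k) with hS
    have hSmem : ∀ n ∈ S, (a ≤ n ∧ n < b) ∧ (k : ℝ) ≤ D n ∧ D n < k + 1 := fun n hn => by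
      rwa [hS, mem_filter, mem_Ico, Int.floor_eq_iff] at hn
    set M := (Ico a b).filter (fun n => k + δ ≤ D n ∧ D n ≤ k + 1 - δ) with hM
    set L := (Ico a b).filter (fun n => (k : ℝ) ≤ D n ∧ D n ≤ k + δ) with hL
    set R := (Ico a b).filter (fun n => k + 1 - δ ≤ D n ∧ D n ≤ k + 1) with hR
    have hMS : M ⊆ S := fun n hn => by
      rw [hM, mem_filter] at hn
      rw [hS, mem_filter, Int.floor_eq_iff]
      exact ⟨hn.1, by linarith, by linarith⟩
    have hdiff : S \ M ⊆ L ∪ R := fun n hn => by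
      rw [Finset.mem_sdiff] at hn
      have h1 := hSmem n hn.1
      have h2 := hn.2
      rw [hM, mem_filter, mem_Ico] at h2
      rw [mem_union, hL, hR, mem_filter, mem_filter, mem_Ico]
      by_contra hcon
      push Not at hcon
      apply h2
      refine ⟨h1.1, ?_, ?_⟩
      · by_contra h3
        exact absurd (hcon.1 h1.1 h1.2.1) (by linarith)
      · by_contra h3
        have := hcon.2 h1.1 (by linarith)
        linarith
    have hLc : (L.card : ℝ) ≤ δ / lam + 1 := by
      have := card_filter_le_of_separated D a b hl (fun i j h1 h2 h3 => (hD i j h1 h2 h3).1)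
        k (k + δ) (by linarith)
      simpa using this
    have hRc : (R.card : ℝ) ≤ δ / lam + 1 := by
      have := card_filter_le_of_separated D a b hl (fun i j h1 h2 h3 => (hD i j h1 h2 h3).1)
        (k + 1 - δ) (k + 1) (by linarith)
      rwa [show ((k : ℝ) + 1 - (k + 1 - δ)) = δ by ring] at this
    have hMb : ‖∑ n ∈ M, ee (g n)‖ ≤ 1 / δ := by
      obtain ⟨a', b', ha', hb', he⟩ := filter_eq_Ico_of_monotone D a b hmono (k + δ) (k + 1 - δ)
      have hmemM : ∀ n, a' ≤ n → n < b' → k + δ ≤ D n ∧ D n ≤ k + 1 - δ := fun n h1 h2 => by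
        have : n ∈ Ico a' b' := mem_Ico.2 ⟨h1, h2⟩
        rw [← he, mem_filter] at this
        exact this.2
      rw [hM, he]
      have := kusmin_landau (fun n => g n - k * n) a' b' hsq ?_ ?_
      · simpa only [ee_sub_int_mul] using this
      · intro n h1 h2
        have := hmemM n h1 h2
        simp only [hDdef] at this
        push_cast
        constructor <;> linarith
      · intro n h1 h2
        have := hmono n (n + 1) (by omega) (by omega) (by omega)
        simp only [hDdef] at this
        push_cast
        linarith
    rw [← sum_sdiff hMS]
    refine (norm_add_le _ _).trans ?_
    have h4 : ‖∑ n ∈ S \ M, ee (g n)‖ ≤ 2 * (δ / lam + 1) := by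
      refine (norm_sum_ee_le_card _ _).trans ?_
      have := (card_le_card hdiff).trans (card_union_le L R)
      have : ((S \ M).card : ℝ) ≤ L.card + R.card := mod_cast this
      linarith
    have e1 : δ / lam = 1 / δ := by rw [← hsq2]; field_simp
    have e2 : 1 ≤ 1 / δ := by rw [le_div_iff₀ hsq]; linarith
    have e3 : 5 / δ = 5 * (1 / δ) := by ring
    rw [e1] at h4
    linarith
  have hcard : ((Icc ⌊D a⌋ ⌊D (b - 1)⌋).card : ℝ) ≤ al * lam * (b - a : ℕ) + 2 := by
    rw [Int.card_Icc]
    have h1 := (hD a (b - 1) le_rfl (by omega) (by omega)).2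
    have h0 : ⌊D a⌋ ≤ ⌊D (b - 1)⌋ := Int.floor_le_floor (hmono _ _ le_rfl (by omega) (by omega))
    have h2 : (((⌊D (b - 1)⌋ + 1 - ⌊D a⌋).toNat : ℤ) : ℝ) = ⌊D (b - 1)⌋ + 1 - ⌊D a⌋ := by
      rw [Int.toNat_of_nonneg (by omega)]; push_cast; ring
    have h3 : (((⌊D (b - 1)⌋ + 1 - ⌊D a⌋).toNat : ℕ) : ℝ) = ⌊D (b - 1)⌋ + 1 - ⌊D a⌋ := by
      rw [← h2]; norm_cast
    rw [h3]
    have := Int.floor_le (D (b - 1))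
    have := Int.lt_floor_add_one (D a)
    have h5 : ((b - 1 : ℕ) : ℝ) - a ≤ ((b - a : ℕ) : ℝ) := by
      rw [Nat.cast_sub (by omega), Nat.cast_sub (by omega)]; push_cast; linarith
    have : al * lam * (((b - 1 : ℕ) : ℝ) - a) ≤ al * lam * ((b - a : ℕ) : ℝ) :=
      mul_le_mul_of_nonneg_left h5 (by positivity)
    linarith
  refine (norm_sum_le _ _).trans ((sum_le_sum fun k _ => hblock k).trans ?_)
  rw [sum_const, nsmul_eq_mul]
  refine (mul_le_mul_of_nonneg_right hcard (by positivity)).trans ?_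
  have e : al * lam * ((b - a : ℕ) : ℝ) * (5 / δ) = 5 * (al * (b - a : ℕ) * δ) := by
    rw [← hsq2]; field_simp
  have : 0 ≤ al * ((b - a : ℕ) : ℝ) * δ := by positivity
  have e2 : 2 * (5 / δ) = 10 * (1 / δ) := by ring
  rw [add_mul, e, e2]
  linarith

lemma second_difference_rpow {s : ℝ} {x : ℝ} (hx : 0 < x) :
    ∃ ζ, x < ζ ∧ ζ < x + 2 ∧
      ((x + 2) ^ s - (x + 1) ^ s) - ((x + 1) ^ s - x ^ s) = s * ((s - 1) * ζ ^ (s - 2)) := by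
  have hder : ∀ y : ℝ, 0 < y → HasDerivAt (fun y : ℝ => y ^ s) (s * y ^ (s - 1)) y := fun y hy =>
    hasDerivAt_rpow_const (Or.inl hy.ne')
  have hder1 : ∀ y : ℝ, 0 < y →
      HasDerivAt (fun y : ℝ => (y + 1) ^ s - y ^ s) (s * (y + 1) ^ (s - 1) - s * y ^ (s - 1)) y := fun y hy => by
    exact ((hder (y + 1) (by linarith)).comp_add_const y 1).sub (hder y hy)
  obtain ⟨c, hc, hce⟩ := exists_hasDerivAt_eq_slope (fun y : ℝ => (y + 1) ^ s - y ^ s) _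
    (show x < x + 1 by linarith)
    (fun y hy => (hder1 y (by linarith [hy.1])).continuousAt.continuousWithinAt)
    (fun y hy => hder1 y (by linarith [hy.1]))
  have hder2 : ∀ y : ℝ, 0 < y →
      HasDerivAt (fun y : ℝ => s * y ^ (s - 1)) (s * ((s - 1) * y ^ (s - 2))) y := fun y hy => by
    have := (hasDerivAt_rpow_const (x := y) (p := s - 1) (Or.inl hy.ne')).const_mul s
    rwa [show s - 1 - 1 = s - 2 by ring] at this
  have hc0 : 0 < c := by linarith [hc.1]
  obtain ⟨ζ, hz, hze⟩ := exists_hasDerivAt_eq_slope (fun y : ℝ => s * y ^ (s - 1)) _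
    (show c < c + 1 by linarith)
    (fun y hy => (hder2 y (by linarith [hy.1])).continuousAt.continuousWithinAt)
    (fun y hy => hder2 y (by linarith [hy.1]))
  refine ⟨ζ, by linarith [hz.1, hc.1], by linarith [hz.2, hc.2], ?_⟩
  rw [hze, show c + 1 - c = (1 : ℝ) by ring, div_one, hce,
    show x + 1 - x = (1 : ℝ) by ring, div_one, show x + 1 + 1 = x + 2 by ring]

/-- Van der Corput's bound for `∑ e(βn^γ + ξn)` over an interval in `[N, 2N]`. -/
theorem vdc_rpow {γ : ℝ} (h0 : 0 < γ) (h1 : γ < 1) : ∃ C : ℝ, 0 < C ∧ ∀ (N a b : ℕ) (β ξ : ℝ),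
    0 < N → N ≤ a → b ≤ 2 * N → 0 < |β| →
    ‖∑ n ∈ Ico a b, ee (β * (n : ℝ) ^ γ + ξ * n)‖ ≤
      C * (√(|β| * (N : ℝ) ^ γ) + N / √(|β| * (N : ℝ) ^ γ)) := by
  set c := γ * (1 - γ)
  have hc0 : 0 < c := mul_pos h0 (by linarith)
  have hc1 : c ≤ 1 := by nlinarith
  refine ⟨40 * (1 + 2 / √c), by positivity, ?_⟩
  -- the case of negative `β`, where second differences are positive
  have main : ∀ (N a b : ℕ) (β ξ : ℝ), 0 < N → N ≤ a → b ≤ 2 * N → 0 < β →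
      ‖∑ n ∈ Ico a b, ee (-β * (n : ℝ) ^ γ + ξ * n)‖ ≤
        40 * (1 + 2 / √c) * (√(β * (N : ℝ) ^ γ) + N / √(β * (N : ℝ) ^ γ)) := fun N a b β ξ hN ha hb hβ => by
    have hNr : (0 : ℝ) < N := mod_cast hN
    set lam := β * (c * (2 * (N : ℝ)) ^ (γ - 2)) with hlam
    have hl : 0 < lam := by positivity
    have key := vdc_second_difference (fun n => -β * (n : ℝ) ^ γ + ξ * n) a b hl
      (show (1 : ℝ) ≤ 4 by norm_num) ?_
    · refine key.trans ?_
      set G := β * (N : ℝ) ^ γ with hG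
      have hG0 : 0 < G := by positivity
      have e1 : lam = G * (c * 2 ^ (γ - 2)) / (N : ℝ) ^ 2 := by
        rw [hlam, hG, mul_rpow (by norm_num) hNr.le, rpow_sub hNr, rpow_two]
        field_simp
      have h2a : (2 : ℝ) ^ (γ - 2) ≤ 1 := rpow_le_one_of_one_le_of_nonpos (by norm_num) (by linarith)
      have h2b : (1 / 4 : ℝ) ≤ (2 : ℝ) ^ (γ - 2) := by
        have : (2 : ℝ) ^ (-2 : ℝ) ≤ (2 : ℝ) ^ (γ - 2) :=
          rpow_le_rpow_of_exponent_le (by norm_num) (by linarith)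
        refine le_trans (le_of_eq ?_) this
        rw [rpow_neg (by norm_num)]; norm_num
      have e2 : √lam ≤ √G / N := by
        rw [e1, sqrt_div (by positivity), sqrt_sq hNr.le]
        gcongr
        exact mul_le_of_le_one_right hG0.le (mul_le_one₀ hc1 (by positivity) h2a)
      have e3 : 1 / √lam ≤ 2 / √c * (N / √G) := by
        have : √G * (√c / 2) / N ≤ √lam := by
          rw [e1, sqrt_div (by positivity), sqrt_sq hNr.le, sqrt_mul hG0.le]
          gcongr
          rw [show √c / 2 = √(c * (1 / 4)) by
            rw [sqrt_mul hc0.le, show (1 / 4 : ℝ) = (1 / 2) ^ 2 by norm_num,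
              sqrt_sq (by norm_num)]; ring]
          gcongr
        have hp : 0 < √G * (√c / 2) / N := by positivity
        refine (one_div_le_one_div_of_le hp this).trans (le_of_eq ?_)
        field_simp
      have e4 : ((b - a : ℕ) : ℝ) ≤ N := mod_cast (by omega : b - a ≤ N)
      have e5 : ((b - a : ℕ) : ℝ) * √lam ≤ √G := by
        calc ((b - a : ℕ) : ℝ) * √lam ≤ N * (√G / N) := by gcongr
          _ = √G := by field_simp
      have p1 : 0 ≤ √G := by positivity
      have p2 : 0 ≤ N / √G := by positivity
      have p3 : 0 ≤ 2 / √c := by positivity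
      nlinarith [mul_nonneg p3 p1, mul_nonneg p3 p2]
    · intro n hn hn2
      have hn0 : (0 : ℝ) < n := mod_cast (by omega : 0 < n)
      have hnN : (N : ℝ) ≤ n := mod_cast (by omega : N ≤ n)
      have hn2N : (n : ℝ) + 2 ≤ 2 * N := mod_cast (by omega : n + 2 ≤ 2 * N)
      obtain ⟨ζ, z1, z2, hz⟩ := second_difference_rpow (s := γ) hn0
      have hz0 : 0 < ζ := by linarith
      have e : (-β * ((n + 2 : ℕ) : ℝ) ^ γ + ξ * ((n + 2 : ℕ) : ℝ) -
          (-β * ((n + 1 : ℕ) : ℝ) ^ γ + ξ * ((n + 1 : ℕ) : ℝ))) -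
          ((-β * ((n + 1 : ℕ) : ℝ) ^ γ + ξ * ((n + 1 : ℕ) : ℝ)) - (-β * (n : ℝ) ^ γ + ξ * n)) =
          β * (c * ζ ^ (γ - 2)) := by
        push_cast
        linear_combination (-β) * hz
      rw [e]
      have u1 : (2 * (N : ℝ)) ^ (γ - 2) ≤ ζ ^ (γ - 2) :=
        rpow_le_rpow_of_nonpos hz0 (by linarith) (by linarith)
      have u2 : ζ ^ (γ - 2) ≤ 4 * (2 * (N : ℝ)) ^ (γ - 2) := by
        have : ζ ^ (γ - 2) ≤ (N : ℝ) ^ (γ - 2) :=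
          rpow_le_rpow_of_nonpos hNr (by linarith) (by linarith)
        refine this.trans ?_
        rw [mul_rpow (by norm_num) hNr.le]
        have h2b : (1 / 4 : ℝ) ≤ (2 : ℝ) ^ (γ - 2) := by
          have : (2 : ℝ) ^ (-2 : ℝ) ≤ (2 : ℝ) ^ (γ - 2) :=
            rpow_le_rpow_of_exponent_le (by norm_num) (by linarith)
          refine le_trans (le_of_eq ?_) this
          rw [rpow_neg (by norm_num)]; norm_num
        have : 0 < (N : ℝ) ^ (γ - 2) := by positivity
        nlinarith
      constructor
      · rw [hlam]; gcongr
      · rw [hlam]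
        calc β * (c * ζ ^ (γ - 2)) ≤ β * (c * (4 * (2 * (N : ℝ)) ^ (γ - 2))) := by gcongr
          _ = _ := by ring
  intro N a b β ξ hN ha hb hβ
  rcases lt_or_gt_of_ne (abs_pos.1 hβ) with hneg | hpos
  · have := main N a b (-β) ξ hN ha hb (by linarith)
    rw [abs_of_neg hneg]
    simpa using this
  · have := main N a b β (-ξ) hN ha hb hpos
    rw [abs_of_pos hpos]
    have e : ∑ n ∈ Ico a b, ee (-β * (n : ℝ) ^ γ + -ξ * n) =
        conj (∑ n ∈ Ico a b, ee (β * (n : ℝ) ^ γ + ξ * n)) := by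
      rw [map_sum]
      refine sum_congr rfl fun n _ => ?_
      rw [← ee_neg]; congr 1; ring
    rwa [e, RCLike.norm_conj] at this

lemma card_le_of_separated {ι : Type*} (T : Finset ι) (g : ι → ℝ) {t u L : ℝ} (ht : 0 < t)
    (hL : 0 ≤ L) (hsep : ∀ y ∈ T, ∀ y' ∈ T, y ≠ y' → t ≤ |g y - g y'|)
    (hT : ∀ y ∈ T, u ≤ g y ∧ g y ≤ u + L) : (T.card : ℝ) ≤ L / t + 1 := by
  have hmaps : ∀ y ∈ T, ⌊(g y - u) / t⌋₊ ∈ range (⌊L / t⌋₊ + 1) := fun y hy => by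
    rw [mem_range, Nat.lt_succ_iff]
    apply Nat.floor_le_floor
    gcongr
    linarith [(hT y hy).2]
  have hinj : Set.InjOn (fun y => ⌊(g y - u) / t⌋₊) (T : Set ι) := fun y hy y' hy' he => by
    by_contra hne
    have h := hsep y hy y' hy' hne
    simp only at he
    have h1 : 0 ≤ (g y - u) / t := div_nonneg (by linarith [(hT y hy).1]) ht.le
    have h2 : 0 ≤ (g y' - u) / t := div_nonneg (by linarith [(hT y' hy').1]) ht.le
    have a1 := Nat.floor_le h1
    have a2 := Nat.floor_le h2
    have b1 := Nat.lt_floor_add_one ((g y - u) / t)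
    have b2 := Nat.lt_floor_add_one ((g y' - u) / t)
    rw [he] at a1 b1
    have : |(g y - u) / t - (g y' - u) / t| < 1 := by rw [abs_lt]; constructor <;> linarith
    rw [← sub_div, abs_div, abs_of_pos ht, div_lt_one ht] at this
    rw [show g y - u - (g y' - u) = g y - g y' by ring] at this
    linarith
  have := card_le_card_of_injOn _ hmaps hinj
  rw [card_range] at this
  have h3 : (T.card : ℝ) ≤ (⌊L / t⌋₊ : ℝ) + 1 := mod_cast this
  have := Nat.floor_le (div_nonneg hL ht.le)
  linarith

lemma card_close_le {ι κ : Type*} (S : Finset ι) (T : Finset κ) (f : ι → ℝ) (g : κ → ℝ)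
    {t η : ℝ} (ht : 0 < t) (hη : 0 ≤ η)
    (hsep : ∀ y ∈ T, ∀ y' ∈ T, y ≠ y' → t ≤ |g y - g y'|) :
    (((S ×ˢ T).filter (fun p => |f p.1 - g p.2| ≤ η)).card : ℝ) ≤ S.card * (2 * η / t + 1) := by
  classical
  rw [card_filter, sum_product]
  push_cast
  rw [← nsmul_eq_mul, ← sum_const]
  refine sum_le_sum fun x _ => ?_
  rw [← Nat.cast_one, ← Nat.cast_zero]
  have : (∑ y ∈ T, if |f x - g y| ≤ η then ((1 : ℕ) : ℝ) else ((0 : ℕ) : ℝ)) =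
      ((T.filter (fun y => |f x - g y| ≤ η)).card : ℝ) := by
    rw [card_filter]; push_cast; rfl
  rw [this]
  refine (card_le_of_separated (u := f x - η) (L := 2 * η) _ g ht (by linarith) ?_ ?_).trans
    (by simp)
  · intro y hy y' hy'
    exact hsep y (mem_filter.1 hy).1 y' (mem_filter.1 hy').1
  · intro y hy
    have := abs_le.1 (mem_filter.1 hy).2
    constructor <;> linarith

lemma card_close_le' {ι κ : Type*} (S : Finset ι) (T : Finset κ) (f : ι → ℝ) (g : κ → ℝ)
    {t η : ℝ} (ht : 0 < t) (hη : 0 ≤ η)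
    (hsep : ∀ x ∈ S, ∀ x' ∈ S, x ≠ x' → t ≤ |f x - f x'|) :
    (((S ×ˢ T).filter (fun p => |f p.1 - g p.2| ≤ η)).card : ℝ) ≤ T.card * (2 * η / t + 1) := by
  classical
  refine le_trans ?_ (card_close_le T S g f ht hη hsep)
  norm_cast
  refine card_le_card_of_injOn (fun p => (p.2, p.1)) ?_ ?_
  · intro p hp
    simp only [coe_filter, mem_product, Set.mem_ofPred_eq] at hp ⊢
    exact ⟨⟨hp.1.2, hp.1.1⟩, by rw [abs_sub_comm]; exact hp.2⟩
  · rintro ⟨a, b⟩ _ ⟨c, d⟩ _ h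
    simp only [Prod.mk.injEq] at h ⊢
    exact ⟨h.2, h.1⟩

/-- Pairs of coprime positive integers at most `R`. -/
def coprimePairs (R : ℕ) : Finset (ℕ × ℕ) :=
  (Icc 1 R ×ˢ Icc 1 R).filter (fun p => Nat.Coprime p.1 p.2)

lemma card_coprimePairs_le (R : ℕ) : ((coprimePairs R).card : ℝ) ≤ (R : ℝ) ^ 2 := by
  have := card_filter_le (Icc 1 R ×ˢ Icc 1 R) (fun p => Nat.Coprime p.1 p.2)
  rw [card_product, Nat.card_Icc, Nat.add_sub_cancel] at this
  rw [sq]; exact_mod_cast this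

lemma one_div_le_abs_log_sub {m n : ℕ} (hm : 0 < m) (hn : 0 < n) (hmn : m ≠ n) {R : ℝ}
    (hmR : (m : ℝ) ≤ R) (hnR : (n : ℝ) ≤ R) : 1 / R ≤ |log m - log n| := by
  wlog h : n < m generalizing m n with H
  · rw [abs_sub_comm]
    exact H hn hm hmn.symm hnR hmR (by omega)
  have hm' : (0 : ℝ) < m := mod_cast hm
  have hn' : (0 : ℝ) < n := mod_cast hn
  have h1 : (n : ℝ) + 1 ≤ m := mod_cast h
  have := one_sub_inv_le_log_of_pos (show 0 < (m : ℝ) / n by positivity)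
  rw [log_div hm'.ne' hn'.ne', inv_div] at this
  refine le_trans ?_ (le_abs_self _)
  refine le_trans ?_ this
  have h2 : 1 / R ≤ 1 / (m : ℝ) := one_div_le_one_div_of_le hm' hmR
  refine h2.trans ?_
  rw [show (1 : ℝ) - n / m = (m - n) / m by field_simp]
  gcongr
  linarith

lemma coprimePairs_separated {R : ℕ} (p q : ℕ × ℕ) (hp : p ∈ coprimePairs R)
    (hq : q ∈ coprimePairs R) (hpq : p ≠ q) :
    1 / (R : ℝ) ^ 2 ≤ |(log p.1 - log p.2) - (log q.1 - log q.2)| := by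
  simp only [coprimePairs, mem_filter, mem_product, mem_Icc] at hp hq
  obtain ⟨⟨⟨a1, a2⟩, a3, a4⟩, a5⟩ := hp
  obtain ⟨⟨⟨b1, b2⟩, b3, b4⟩, b5⟩ := hq
  have hne : p.1 * q.2 ≠ q.1 * p.2 := fun h => by
    apply hpq
    have h1 : p.1 ∣ q.1 := a5.dvd_of_dvd_mul_right (Dvd.intro _ h)
    have h2 : q.1 ∣ p.1 := b5.dvd_of_dvd_mul_right (Dvd.intro _ h.symm)
    have h3 := Nat.dvd_antisymm h1 h2
    rw [h3] at h
    have h4 := Nat.eq_of_mul_eq_mul_left (by omega) h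
    exact Prod.ext h3 h4.symm
  have := one_div_le_abs_log_sub (R := (R : ℝ) ^ 2) (Nat.mul_pos a1 b3) (Nat.mul_pos b1 a3) hne
    (by rw [sq]; exact_mod_cast Nat.mul_le_mul a2 b4) (by rw [sq]; exact_mod_cast Nat.mul_le_mul b2 a4)
  push_cast at this
  rw [log_mul (by positivity) (by positivity), log_mul (by positivity) (by positivity)] at this
  refine this.trans (le_of_eq ?_)
  congr 1; ring

/-- Quadruples `((a, a'), (b, b'))` with `a / a'` close to `(b / b') ^ σ`. -/
noncomputable def closeQuads (σ η : ℝ) (D0 : ℝ) (A B : ℕ) : Finset ((ℕ × ℕ) × (ℕ × ℕ)) :=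
  ((Icc 1 A ×ˢ Icc 1 A) ×ˢ (Icc 1 B ×ˢ Icc 1 B)).filter (fun p =>
    D0 ≤ (Nat.gcd p.1.1 p.1.2 : ℝ) ∧
    |(log p.1.1 - log p.1.2) - σ * (log p.2.1 - log p.2.2)| ≤ η)

lemma card_close_coprimePairs {σ η : ℝ} (hσ : 0 < σ) (hη : 0 ≤ η) (R T : ℕ) :
    (((coprimePairs R ×ˢ coprimePairs T).filter (fun p =>
      |(log p.1.1 - log p.1.2) - σ * (log p.2.1 - log p.2.2)| ≤ η)).card : ℝ) ≤
      (2 + 2 / σ) * ((R : ℝ) * T + η * R ^ 2 * T ^ 2) := by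
  rcases Nat.eq_zero_or_pos R with rfl | hR
  · simp [coprimePairs]
  rcases Nat.eq_zero_or_pos T with rfl | hT
  · simp [coprimePairs]
  have h1 := card_close_le (coprimePairs R) (coprimePairs T)
    (fun p => log p.1 - log p.2) (fun p => σ * (log p.1 - log p.2))
    (t := σ * (1 / (T : ℝ) ^ 2)) (by positivity) hη (by
      intro y hy y' hy' hne
      rw [← mul_sub, abs_mul, abs_of_pos hσ]
      exact mul_le_mul_of_nonneg_left (coprimePairs_separated y y' hy hy' hne) hσ.le)
  have h2 := card_close_le' (coprimePairs R) (coprimePairs T)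
    (fun p => log p.1 - log p.2) (fun p => σ * (log p.1 - log p.2))
    (t := 1 / (R : ℝ) ^ 2) (by positivity) hη (fun y hy y' hy' hne =>
      coprimePairs_separated y y' hy hy' hne)
  have hs : 0 < 2 / σ := by positivity
  have hP : 0 ≤ η * (R : ℝ) ^ 2 * T ^ 2 := by positivity
  have hRT : 0 < (R : ℝ) * T := by positivity
  rcases le_total (R : ℝ) T with h | h
  · refine h1.trans ((mul_le_mul_of_nonneg_right (card_coprimePairs_le R) (by positivity)).trans ?_)
    have e : (R : ℝ) ^ 2 * (2 * η / (σ * (1 / (T : ℝ) ^ 2)) + 1) =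
        2 / σ * (η * R ^ 2 * T ^ 2) + R * R := by field_simp
    rw [e]
    nlinarith
  · refine h2.trans ((mul_le_mul_of_nonneg_right (card_coprimePairs_le T) (by positivity)).trans ?_)
    have e : (T : ℝ) ^ 2 * (2 * η / (1 / (R : ℝ) ^ 2) + 1) =
        2 * (η * R ^ 2 * T ^ 2) + T * T := by field_simp
    rw [e]
    nlinarith

lemma sum_inv_le_one_add_log (A : ℕ) : ∑ d ∈ Icc 1 A, (1 / (d : ℝ)) ≤ 1 + log A := by
  have := harmonic_le_one_add_log A
  rw [harmonic_eq_sum_Icc] at this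
  push_cast at this
  simpa using this

lemma sum_inv_sq_le (A : ℕ) {D : ℝ} (hD : 1 ≤ D) :
    ∑ d ∈ (Icc 1 A).filter (fun d : ℕ => D ≤ (d : ℝ)), (1 / (d : ℝ) ^ 2) ≤ 2 / D := by
  have key : ∀ A : ℕ, ∑ d ∈ (Icc 1 A).filter (fun d : ℕ => D ≤ (d : ℝ)), (1 / (d : ℝ) ^ 2) ≤
      if D ≤ A then 2 / D - 1 / A else 0 := fun A => by
    induction A with
    | zero => simp only [Nat.cast_zero]; rw [if_neg (by linarith)]; simp
    | succ A ih =>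
      rw [show Icc 1 (A + 1) = insert (A + 1) (Icc 1 A) by ext; simp; omega, filter_insert]
      have hA1 : (0 : ℝ) < (A : ℝ) + 1 := by positivity
      by_cases h : D ≤ ((A + 1 : ℕ) : ℝ)
      · rw [if_pos h, if_pos h, sum_insert (by simp)]
        by_cases h' : D ≤ (A : ℝ)
        · rw [if_pos h'] at ih
          have hA : (0 : ℝ) < A := by linarith
          have : 1 / ((A + 1 : ℕ) : ℝ) ^ 2 ≤ 1 / A - 1 / ((A + 1 : ℕ) : ℝ) := by
            push_cast
            rw [div_sub_div _ _ hA.ne' hA1.ne', div_le_div_iff₀ (by positivity) (by positivity)]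
            nlinarith
          linarith
        · rw [if_neg h'] at ih
          have h2 : 1 / ((A + 1 : ℕ) : ℝ) ^ 2 ≤ 1 / ((A + 1 : ℕ) : ℝ) := by
            push_cast
            rw [div_le_div_iff₀ (by positivity) (by positivity)]
            nlinarith [show (0:ℝ) ≤ A from Nat.cast_nonneg A]
          have h3 : 1 / ((A + 1 : ℕ) : ℝ) ≤ 1 / D := one_div_le_one_div_of_le (by linarith) h
          have h4 : 2 / D = 1 / D + 1 / D := by ring
          linarith
      · have h' : ¬ D ≤ (A : ℝ) := by push_cast at h; linarith
        rw [if_neg h, if_neg h]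
        rwa [if_neg h'] at ih
  refine (key A).trans ?_
  split_ifs with h
  · have : 0 ≤ 1 / (A : ℝ) := by positivity
    linarith
  · positivity

/-- The number of close quadruples with `gcd (a, a') ≥ D0`. -/
theorem card_closeQuads_le {σ : ℝ} (hσ : 0 < σ) {η D0 : ℝ} (hη : 0 ≤ η) (hD : 1 ≤ D0) (A B : ℕ) :
    ((closeQuads σ η D0 A B).card : ℝ) ≤ (8 + 8 / σ) *
      ((A : ℝ) * B * ((1 + log A) * (1 + log B)) + η * A ^ 2 * B ^ 2 / D0) := by
  classical
  set I := ((Icc 1 A).filter (fun d : ℕ => D0 ≤ (d : ℝ))) ×ˢ Icc 1 B with hI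
  have hmaps : ∀ p ∈ closeQuads σ η D0 A B,
      (Nat.gcd p.1.1 p.1.2, Nat.gcd p.2.1 p.2.2) ∈ I := fun p hp => by
    simp only [closeQuads, mem_filter, mem_product, mem_Icc] at hp
    obtain ⟨⟨⟨⟨h1, h2⟩, h3, h4⟩, ⟨h5, h6⟩, h7, h8⟩, h9, h10⟩ := hp
    simp only [hI, mem_product, mem_filter, mem_Icc]
    exact ⟨⟨⟨Nat.gcd_pos_of_pos_left _ h1, (Nat.gcd_le_left _ h1).trans h2⟩, h9⟩,
      Nat.gcd_pos_of_pos_left _ h5, (Nat.gcd_le_left _ h5).trans h6⟩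
  rw [card_eq_sum_card_fiberwise hmaps]
  push_cast
  have hfib : ∀ i ∈ I, ((((closeQuads σ η D0 A B).filter (fun p =>
      (Nat.gcd p.1.1 p.1.2, Nat.gcd p.2.1 p.2.2) = i)).card : ℕ) : ℝ) ≤
      (2 + 2 / σ) * ((A : ℝ) * B * ((1 / (i.1 : ℝ)) * (1 / (i.2 : ℝ))) +
        η * A ^ 2 * B ^ 2 * ((1 / (i.1 : ℝ) ^ 2) * (1 / (i.2 : ℝ) ^ 2))) := by
    rintro ⟨d, e⟩ hi
    simp only [hI, mem_product, mem_filter, mem_Icc] at hi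
    obtain ⟨⟨⟨hd1, hd2⟩, hd3⟩, he1, he2⟩ := hi
    have hle : (((closeQuads σ η D0 A B).filter (fun p =>
        (Nat.gcd p.1.1 p.1.2, Nat.gcd p.2.1 p.2.2) = (d, e))).card) ≤
        ((coprimePairs (A / d) ×ˢ coprimePairs (B / e)).filter (fun p =>
          |(log p.1.1 - log p.1.2) - σ * (log p.2.1 - log p.2.2)| ≤ η)).card := by
      refine card_le_card_of_injOn
        (fun p => ((p.1.1 / d, p.1.2 / d), (p.2.1 / e, p.2.2 / e))) ?_ ?_
      · rintro ⟨⟨a, a'⟩, ⟨b, b'⟩⟩ hp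
        simp only [closeQuads, coe_filter, mem_filter, mem_product, mem_Icc, Set.mem_ofPred_eq,
          Prod.mk.injEq] at hp
        obtain ⟨⟨⟨⟨⟨h1, h2⟩, h3, h4⟩, ⟨h5, h6⟩, h7, h8⟩, h9, h10⟩, hgd, hge⟩ := hp
        have da : d ∣ a := hgd ▸ Nat.gcd_dvd_left a a'
        have da' : d ∣ a' := hgd ▸ Nat.gcd_dvd_right a a'
        have eb : e ∣ b := hge ▸ Nat.gcd_dvd_left b b'
        have eb' : e ∣ b' := hge ▸ Nat.gcd_dvd_right b b'
        have ca : Nat.Coprime (a / d) (a' / d) := by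
          have := Nat.coprime_div_gcd_div_gcd (m := a) (n := a') (by omega)
          rwa [hgd] at this
        have cb : Nat.Coprime (b / e) (b' / e) := by
          have := Nat.coprime_div_gcd_div_gcd (m := b) (n := b') (by omega)
          rwa [hge] at this
        have lg : ∀ m k : ℕ, 0 < m → 0 < k → k ∣ m →
            log ((m / k : ℕ) : ℝ) = log m - log k := fun m k hm hk hkm => by
          rw [Nat.cast_div hkm (by positivity), log_div (by positivity) (by positivity)]
        simp only [coprimePairs, coe_filter, mem_filter, mem_product, mem_Icc, Set.mem_ofPred_eq]
        refine ⟨⟨⟨⟨⟨Nat.div_pos (Nat.le_of_dvd h1 da) hd1, Nat.div_le_div_right h2⟩,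
          Nat.div_pos (Nat.le_of_dvd h3 da') hd1, Nat.div_le_div_right h4⟩, ca⟩,
          ⟨⟨Nat.div_pos (Nat.le_of_dvd h5 eb) he1, Nat.div_le_div_right h6⟩,
          Nat.div_pos (Nat.le_of_dvd h7 eb') he1, Nat.div_le_div_right h8⟩, cb⟩, ?_⟩
        rw [lg a d h1 hd1 da, lg a' d h3 hd1 da', lg b e h5 he1 eb, lg b' e h7 he1 eb']
        convert h10 using 2
        ring
      · rintro ⟨⟨a, a'⟩, ⟨b, b'⟩⟩ hp ⟨⟨c, c'⟩, ⟨f, f'⟩⟩ hq h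
        simp only [closeQuads, coe_filter, mem_filter, Set.mem_ofPred_eq, Prod.mk.injEq] at hp hq h ⊢
        obtain ⟨_, hgd, hge⟩ := hp
        obtain ⟨_, hgd2, hge2⟩ := hq
        have da : d ∣ a := hgd ▸ Nat.gcd_dvd_left a a'
        have da' : d ∣ a' := hgd ▸ Nat.gcd_dvd_right a a'
        have eb : e ∣ b := hge ▸ Nat.gcd_dvd_left b b'
        have eb' : e ∣ b' := hge ▸ Nat.gcd_dvd_right b b'
        have dc : d ∣ c := hgd2 ▸ Nat.gcd_dvd_left c c'
        have dc' : d ∣ c' := hgd2 ▸ Nat.gcd_dvd_right c c'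
        have ef : e ∣ f := hge2 ▸ Nat.gcd_dvd_left f f'
        have ef' : e ∣ f' := hge2 ▸ Nat.gcd_dvd_right f f'
        exact ⟨⟨Nat.div_left_inj da dc |>.1 h.1.1, Nat.div_left_inj da' dc' |>.1 h.1.2⟩,
          Nat.div_left_inj eb ef |>.1 h.2.1, Nat.div_left_inj eb' ef' |>.1 h.2.2⟩
    have h2 := card_close_coprimePairs hσ hη (A / d) (B / e)
    have hA : ((A / d : ℕ) : ℝ) ≤ A * (1 / d) := by
      rw [mul_one_div]; exact Nat.cast_div_le
    have hB : ((B / e : ℕ) : ℝ) ≤ B * (1 / e) := by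
      rw [mul_one_div]; exact Nat.cast_div_le
    refine (Nat.cast_le.2 hle).trans (h2.trans ?_)
    have hs : 0 < 2 + 2 / σ := by positivity
    refine mul_le_mul_of_nonneg_left ?_ hs.le
    refine add_le_add ?_ ?_
    · calc ((A / d : ℕ) : ℝ) * (B / e : ℕ) ≤ (A * (1 / d)) * (B * (1 / e)) := by gcongr
        _ = _ := by ring
    · calc η * ((A / d : ℕ) : ℝ) ^ 2 * ((B / e : ℕ) : ℝ) ^ 2 ≤
          η * (A * (1 / d)) ^ 2 * (B * (1 / e)) ^ 2 := by gcongr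
        _ = _ := by ring
  refine (sum_le_sum hfib).trans ?_
  rw [← mul_sum, sum_add_distrib, ← mul_sum, ← mul_sum, hI]
  have p1 : ∑ i ∈ ((Icc 1 A).filter (fun d : ℕ => D0 ≤ (d : ℝ))) ×ˢ Icc 1 B,
      (1 / (i.1 : ℝ)) * (1 / (i.2 : ℝ)) ≤ (1 + log A) * (1 + log B) := by
    rw [sum_product]; dsimp only; rw [← sum_mul_sum]
    have q1 : ∑ d ∈ (Icc 1 A).filter (fun d : ℕ => D0 ≤ (d : ℝ)), (1 / (d : ℝ)) ≤ 1 + log A :=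
      (sum_le_sum_of_subset_of_nonneg (filter_subset _ _) (fun _ _ _ => by positivity)).trans
        (sum_inv_le_one_add_log A)
    exact mul_le_mul q1 (sum_inv_le_one_add_log B) (sum_nonneg fun _ _ => by positivity)
      (le_trans (sum_nonneg fun _ _ => by positivity) q1)
  have p2 : ∑ i ∈ ((Icc 1 A).filter (fun d : ℕ => D0 ≤ (d : ℝ))) ×ˢ Icc 1 B,
      (1 / (i.1 : ℝ) ^ 2) * (1 / (i.2 : ℝ) ^ 2) ≤ 4 / D0 := by
    rw [sum_product]; dsimp only; rw [← sum_mul_sum]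
    have q2 := sum_inv_sq_le B le_rfl
    have q3 : (Icc 1 B).filter (fun d : ℕ => (1 : ℝ) ≤ (d : ℝ)) = Icc 1 B := by
      apply filter_true_of_mem
      intro d hd
      exact_mod_cast (mem_Icc.1 hd).1
    rw [q3] at q2
    calc _ ≤ (2 / D0) * (2 / 1) := mul_le_mul (sum_inv_sq_le A hD) q2
          (sum_nonneg fun _ _ => by positivity) (by positivity)
      _ = _ := by ring
  have p3 : 0 ≤ (A : ℝ) * B := by positivity
  have p4 : 0 ≤ η * (A : ℝ) ^ 2 * B ^ 2 := by positivity
  have r1 := mul_le_mul_of_nonneg_left p1 p3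
  have r2 := mul_le_mul_of_nonneg_left p2 p4
  have r3 : 0 ≤ (A : ℝ) * B * ((1 + log A) * (1 + log B)) :=
    le_trans (mul_nonneg p3 (sum_nonneg fun _ _ => by positivity)) r1
  have e1 : (8 + 8 / σ) = 4 * (2 + 2 / σ) := by ring
  rw [e1, mul_assoc 4, mul_left_comm]
  refine mul_le_mul_of_nonneg_left ?_ (by positivity)
  have e2 : η * (A : ℝ) ^ 2 * B ^ 2 * (4 / D0) = 4 * (η * A ^ 2 * B ^ 2 / D0) := by ring
  rw [e2] at r2
  linarith

/-- `B` bounds the bilinear form with kernel `K` on all coefficients of modulus at most one. -/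
def BilBound {ι κ : Type*} (X : Finset ι) (Y : Finset κ) (K : ι → κ → ℂ) (B : ℝ) : Prop :=
  ∀ (a : ι → ℂ) (b : κ → ℂ), (∀ x, ‖a x‖ ≤ 1) → (∀ y, ‖b y‖ ≤ 1) →
    ‖∑ x ∈ X, ∑ y ∈ Y, a x * b y * K x y‖ ≤ B

namespace BilBound

variable {ι κ : Type*} {X : Finset ι} {Y : Finset κ} {K K' : ι → κ → ℂ} {B B' : ℝ}

lemma mono (h : BilBound X Y K B) (hB : B ≤ B') : BilBound X Y K B' :=
  fun a b ha hb => (h a b ha hb).trans hB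

lemma congr (h : BilBound X Y K B) (hK : ∀ x ∈ X, ∀ y ∈ Y, K x y = K' x y) :
    BilBound X Y K' B := fun a b ha hb => by
  have := h a b ha hb
  rwa [sum_congr rfl fun x hx => sum_congr rfl fun y hy => by rw [hK x hx y hy]] at this

lemma zero : BilBound X Y (fun _ _ => 0) 0 := by intro a b _ _; simp

lemma add (h : BilBound X Y K B) (h' : BilBound X Y K' B') :
    BilBound X Y (fun x y => K x y + K' x y) (B + B') := fun a b ha hb => by
  have e : ∑ x ∈ X, ∑ y ∈ Y, a x * b y * (K x y + K' x y) =
      ∑ x ∈ X, ∑ y ∈ Y, a x * b y * K x y + ∑ x ∈ X, ∑ y ∈ Y, a x * b y * K' x y := by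
    rw [← sum_add_distrib]
    refine sum_congr rfl fun x _ => ?_
    rw [← sum_add_distrib]
    exact sum_congr rfl fun y _ => by ring
  rw [e]
  exact (norm_add_le _ _).trans (add_le_add (h a b ha hb) (h' a b ha hb))

lemma const_mul (h : BilBound X Y K B) (c : ℂ) :
    BilBound X Y (fun x y => c * K x y) (‖c‖ * B) := fun a b ha hb => by
  have e : ∑ x ∈ X, ∑ y ∈ Y, a x * b y * (c * K x y) =
      c * ∑ x ∈ X, ∑ y ∈ Y, a x * b y * K x y := by
    simp_rw [mul_sum]
    exact sum_congr rfl fun x _ => sum_congr rfl fun y _ => by ring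
  rw [e, norm_mul]
  exact mul_le_mul_of_nonneg_left (h a b ha hb) (norm_nonneg _)

lemma mul_mul (h : BilBound X Y K B) (f : ι → ℂ) (g : κ → ℂ) (hf : ∀ x, ‖f x‖ ≤ 1)
    (hg : ∀ y, ‖g y‖ ≤ 1) : BilBound X Y (fun x y => f x * g y * K x y) B := fun a b ha hb => by
  have := h (fun x => a x * f x) (fun y => b y * g y)
    (fun x => by rw [norm_mul]; exact mul_le_one₀ (ha x) (norm_nonneg _) (hf x))
    (fun y => by rw [norm_mul]; exact mul_le_one₀ (hb y) (norm_nonneg _) (hg y))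
  rwa [sum_congr rfl fun x _ => sum_congr rfl fun y _ =>
    show a x * f x * (b y * g y) * K x y = a x * b y * (f x * g y * K x y) by ring] at this

lemma eq_coupling_aux (L : ℕ) : ∀ (α : ι → ℕ) (β : κ → ℕ), (∀ x ∈ X, α x < 2 ^ L) →
    (∀ y ∈ Y, β y < 2 ^ L) → BilBound X Y K B →
    BilBound X Y (fun x y => if α x = β y then K x y else 0) B := by
  induction L with
  | zero =>
    intro α β hα hβ h
    refine h.congr fun x hx y hy => ?_
    have := hα x hx
    have := hβ y hy
    rw [if_pos (by simp at *; omega)]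
  | succ L ih =>
    intro α β hα hβ h
    have h1 := ih (fun x => α x / 2) (fun y => β y / 2)
      (fun x hx => by have := hα x hx; rw [pow_succ] at this; omega)
      (fun y hy => by have := hβ y hy; rw [pow_succ] at this; omega) h
    have h2 := h1.mul_mul (fun x => (-1 : ℂ) ^ α x) (fun y => (-1 : ℂ) ^ β y)
      (by simp) (by simp)
    have h3 := (h1.add h2).const_mul (1 / 2 : ℂ)
    refine (h3.mono (le_of_eq ?_)).congr fun x _ y _ => ?_
    · simp; ring
    · by_cases e : α x / 2 = β y / 2
      · simp only [e, if_true]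
        by_cases e2 : α x = β y
        · rw [if_pos e2, e2, ← pow_add, Even.neg_one_pow ⟨_, rfl⟩]; ring
        · rw [if_neg e2, ← pow_add, Odd.neg_one_pow (by rw [Nat.odd_iff]; omega)]; ring
      · rw [if_neg e, if_neg (fun h => e (by rw [h]))]; ring

lemma eq_coupling (h : BilBound X Y K B) (α : ι → ℕ) (β : κ → ℕ) :
    BilBound X Y (fun x y => if α x = β y then K x y else 0) B := by
  set M := X.sup α + Y.sup β
  refine eq_coupling_aux M α β (fun x hx => ?_) (fun y hy => ?_) h
  · have : α x ≤ X.sup α := le_sup hx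
    exact lt_of_le_of_lt (by omega) (Nat.lt_two_pow_self (n := M))
  · have : β y ≤ Y.sup β := le_sup hy
    exact lt_of_le_of_lt (by omega) (Nat.lt_two_pow_self (n := M))

/-- A factor `1[α(x) < β(y)]` costs a logarithm. -/
lemma lt_coupling (h : BilBound X Y K B) (L : ℕ) : ∀ (α : ι → ℕ) (β : κ → ℕ),
    (∀ x ∈ X, α x < 2 ^ L) → (∀ y ∈ Y, β y < 2 ^ L) →
    BilBound X Y (fun x y => if α x < β y then K x y else 0) (L * B) := by
  induction L with
  | zero =>
    intro α β hα hβ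
    refine (zero.mono (by simp)).congr fun x hx y hy => ?_
    have := hα x hx
    have := hβ y hy
    rw [if_neg (by simp at *; omega)]
  | succ L ih =>
    intro α β hα hβ
    have h1 := ih (fun x => α x / 2) (fun y => β y / 2)
      (fun x hx => by have := hα x hx; rw [pow_succ] at this; omega)
      (fun y hy => by have := hβ y hy; rw [pow_succ] at this; omega)
    have h2 := (h.eq_coupling (fun x => α x / 2) (fun y => β y / 2)).mul_mul
      (fun x => if α x % 2 = 0 then 1 else 0) (fun y => if β y % 2 = 1 then 1 else 0)
      (by intro x; split_ifs <;> simp) (by intro x; split_ifs <;> simp)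
    refine ((h1.add h2).mono (le_of_eq (by push_cast; ring))).congr fun x _ y _ => ?_
    rcases lt_trichotomy (α x / 2) (β y / 2) with e | e | e
    · rw [if_pos e, if_neg e.ne, if_pos (show α x < β y by omega)]; ring
    · rw [if_neg e.not_lt, if_pos e]
      by_cases h3 : α x < β y
      · rw [if_pos h3, if_pos (by omega), if_pos (by omega)]; ring
      · rw [if_neg h3]
        by_cases h4 : α x % 2 = 0
        · rw [if_neg (show ¬ β y % 2 = 1 by omega)]; ring
        · rw [if_neg h4]; ring
    · rw [if_neg e.not_gt, if_neg e.ne', if_neg (show ¬ α x < β y by omega)]; ring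

lemma le_coupling (h : BilBound X Y K B) (L : ℕ) (α : ι → ℕ) (β : κ → ℕ)
    (hα : ∀ x ∈ X, α x < 2 ^ L) (hβ : ∀ y ∈ Y, β y + 1 < 2 ^ L) :
    BilBound X Y (fun x y => if α x ≤ β y then K x y else 0) (L * B) :=
  (h.lt_coupling L α (fun y => β y + 1) hα hβ).congr fun x _ y _ => by
    simp only [Nat.lt_succ_iff]

lemma swap (h : BilBound X Y K B) : BilBound Y X (fun y x => K x y) B := fun a b ha hb => by
  have := h b a hb ha
  rw [sum_comm] at this
  rwa [sum_congr rfl fun y _ => sum_congr rfl fun x _ =>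
    show b x * a y * K x y = a y * b x * K x y by ring] at this

/-- Coefficients bounded by `c` and `d`. -/
lemma apply_of_le (h : BilBound X Y K B) {a : ι → ℂ} {b : κ → ℂ} {c d : ℝ} (hc : 0 ≤ c)
    (hd : 0 ≤ d) (ha : ∀ x ∈ X, ‖a x‖ ≤ c) (hb : ∀ y ∈ Y, ‖b y‖ ≤ d) :
    ‖∑ x ∈ X, ∑ y ∈ Y, a x * b y * K x y‖ ≤ c * d * B := by
  classical
  rcases hc.eq_or_lt with rfl | hc
  · have : ∑ x ∈ X, ∑ y ∈ Y, a x * b y * K x y = 0 :=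
      sum_eq_zero fun x hx => sum_eq_zero fun y _ => by
        rw [norm_le_zero_iff.1 (ha x hx)]; ring
    rw [this]; simp
  rcases hd.eq_or_lt with rfl | hd
  · have : ∑ x ∈ X, ∑ y ∈ Y, a x * b y * K x y = 0 :=
      sum_eq_zero fun x hx => sum_eq_zero fun y hy => by
        rw [norm_le_zero_iff.1 (hb y hy)]; ring
    rw [this]; simp
  have := h (fun x => if x ∈ X then a x / c else 0) (fun y => if y ∈ Y then b y / d else 0)
    (by
      intro x; split_ifs with hx
      · rw [norm_div, Complex.norm_real, norm_of_nonneg hc.le, div_le_one hc]; exact ha x hx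
      · simp)
    (by
      intro x; split_ifs with hx
      · rw [norm_div, Complex.norm_real, norm_of_nonneg hd.le, div_le_one hd]; exact hb x hx
      · simp)
  have e : ∑ x ∈ X, ∑ y ∈ Y, a x * b y * K x y = ((c * d : ℝ) : ℂ) *
      ∑ x ∈ X, ∑ y ∈ Y, (if x ∈ X then a x / c else 0) * (if y ∈ Y then b y / d else 0) * K x y := by
    rw [mul_sum]
    refine sum_congr rfl fun x hx => ?_
    rw [mul_sum]
    refine sum_congr rfl fun y hy => ?_
    rw [if_pos hx, if_pos hy]
    have : (c : ℂ) ≠ 0 := mod_cast hc.ne'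
    have : (d : ℂ) ≠ 0 := mod_cast hd.ne'
    push_cast
    field_simp
  rw [e, norm_mul, Complex.norm_real, norm_of_nonneg (by positivity)]
  exact mul_le_mul_of_nonneg_left this (by positivity)

/-- A factor `e(φ(x)ψ(y))` with `|φ|, |ψ| ≤ 1` costs a constant. -/
lemma perturb (h : BilBound X Y K B) (φ : ι → ℝ) (ψ : κ → ℝ) (hφ : ∀ x ∈ X, |φ x| ≤ 1)
    (hψ : ∀ y ∈ Y, |ψ y| ≤ 1) :
    BilBound X Y (fun x y => ee (φ x * ψ y) * K x y) (exp (2 * π) * B) := fun a b ha hb => by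
  set z : ℂ := 2 * π * Complex.I with hz
  have hzn : ‖z‖ = 2 * π := by
    simp [hz, abs_of_pos pi_pos]
  have hs : ∀ x y, HasSum (fun n : ℕ => (z ^ n / n.factorial) * (φ x : ℂ) ^ n * (ψ y : ℂ) ^ n)
      (ee (φ x * ψ y)) := fun x y => by
    have := NormedSpace.expSeries_div_hasSum_exp (𝔸 := ℂ) (z * φ x * ψ y)
    rw [← Complex.exp_eq_exp_ℂ] at this
    have e : ee (φ x * ψ y) = Complex.exp (z * φ x * ψ y) := by
      rw [ee, hz]; congr 1; push_cast; ring
    rw [e]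
    refine this.congr_fun ?_
    intro n
    rw [mul_pow, mul_pow]; ring
  have hS : HasSum (fun n : ℕ => (z ^ n / n.factorial) * ∑ x ∈ X, ∑ y ∈ Y,
      (a x * (φ x : ℂ) ^ n) * (b y * (ψ y : ℂ) ^ n) * K x y)
      (∑ x ∈ X, ∑ y ∈ Y, a x * b y * (ee (φ x * ψ y) * K x y)) := by
    have : HasSum (fun n : ℕ => ∑ x ∈ X, ∑ y ∈ Y, (a x * b y * K x y) *
        ((z ^ n / n.factorial) * (φ x : ℂ) ^ n * (ψ y : ℂ) ^ n))
        (∑ x ∈ X, ∑ y ∈ Y, (a x * b y * K x y) * ee (φ x * ψ y)) :=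
      hasSum_sum fun x _ => hasSum_sum fun y _ => (hs x y).mul_left _
    convert this using 1
    · ext n
      simp_rw [mul_sum]
      exact sum_congr rfl fun x _ => sum_congr rfl fun y _ => by ring
    · exact sum_congr rfl fun x _ => sum_congr rfl fun y _ => by ring
  have hR : HasSum (fun n : ℕ => (2 * π) ^ n / n.factorial * B)
      (exp (2 * π) * B) := by
    have := NormedSpace.expSeries_div_hasSum_exp (𝔸 := ℝ) (2 * π)
    rw [← exp_eq_exp_ℝ] at this
    exact this.mul_right B
  rw [← hS.tsum_eq]
  refine tsum_of_norm_bounded hR fun n => ?_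
  rw [norm_mul, norm_div, norm_pow, hzn]
  have h1 : ‖((n.factorial : ℕ) : ℂ)‖ = n.factorial := by simp
  rw [h1]
  refine mul_le_mul_of_nonneg_left ?_ (by positivity)
  have := h.apply_of_le (a := fun x => a x * (φ x : ℂ) ^ n) (b := fun y => b y * (ψ y : ℂ) ^ n)
    zero_le_one zero_le_one ?_ ?_
  · simpa using this
  · intro x hx
    rw [norm_mul, norm_pow, Complex.norm_real, norm_eq_abs]
    exact mul_le_one₀ (ha x) (by positivity) (pow_le_one₀ (abs_nonneg _) (hφ x hx))
  · intro y hy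
    rw [norm_mul, norm_pow, Complex.norm_real, norm_eq_abs]
    exact mul_le_one₀ (hb y) (by positivity) (pow_le_one₀ (abs_nonneg _) (hψ y hy))

end BilBound

lemma sum_range_ee_eq_zero {K : ℕ} {m : ℤ} (hK : 0 < K) (hm : m ≠ 0) (hmK : |m| < K) :
    ∑ j ∈ range K, ee (j * (m / K)) = 0 := by
  have hK' : (K : ℝ) ≠ 0 := by positivity
  have hpow : ∀ j : ℕ, ee (j * (m / K)) = ee (m / K) ^ j := fun j => by
    rw [ee, ee, ← Complex.exp_nat_mul]; congr 1; push_cast; ring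
  simp_rw [hpow]
  have hne : ee (m / K) ≠ 1 := fun h => by
    rw [ee, Complex.exp_eq_one_iff] at h
    obtain ⟨n, hn⟩ := h
    have h1 : (2 * π * Complex.I : ℂ) ≠ 0 := by simp [pi_ne_zero]
    have h2 : (((m / K : ℝ)) : ℂ) = n := by
      apply mul_left_cancel₀ h1
      rw [mul_comm _ (n : ℂ), ← hn]; push_cast; ring
    have h3 : (m / K : ℝ) = n := mod_cast h2
    rw [div_eq_iff hK'] at h3
    have h4 : m = n * K := mod_cast h3
    rcases eq_or_ne n 0 with rfl | hn0
    · simp at h4; exact hm h4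
    · rw [h4, abs_mul] at hmK
      have : 1 ≤ |n| := Int.one_le_abs hn0
      simp only [Nat.abs_cast] at hmK
      have : (K : ℤ) ≤ |n| * K := le_mul_of_one_le_left (by positivity) this
      omega
  have := geom_sum_eq hne K
  rw [this, ← hpow, show (K : ℝ) * (m / K) = (m : ℤ) by field_simp, ee_int]
  simp

lemma sum_norm_sq_dft_le {κ : Type*} (Y : Finset κ) (b : κ → ℂ) (hb : ∀ y, ‖b y‖ ≤ 1)
    (k : κ → ℕ) {K : ℕ} (hK : 0 < K) (hk : ∀ y ∈ Y, k y < K) :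
    ∑ j ∈ range K, ‖∑ y ∈ Y, b y * ee (j * (k y / K))‖ ^ 2 ≤
      K * ((Y ×ˢ Y).filter (fun p => k p.1 = k p.2)).card := by
  have e : ((∑ j ∈ range K, ‖∑ y ∈ Y, b y * ee (j * (k y / K))‖ ^ 2 : ℝ) : ℂ) =
      ∑ p ∈ Y ×ˢ Y, b p.1 * conj (b p.2) *
        (if k p.1 = k p.2 then (K : ℂ) else 0) := by
    push_cast
    have : ∀ j ∈ range K, ((‖∑ y ∈ Y, b y * ee (j * (k y / K))‖ : ℂ)) ^ 2 =
        ∑ p ∈ Y ×ˢ Y, b p.1 * conj (b p.2) *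
          ee (j * ((((k p.1 : ℤ) - (k p.2 : ℤ) : ℤ) : ℝ) / K)) := fun j _ => by
      rw [← Complex.mul_conj', map_sum, sum_mul_sum, sum_product]
      refine sum_congr rfl fun x _ => sum_congr rfl fun y _ => ?_
      rw [map_mul, mul_mul_mul_comm, ee_mul_conj]
      congr 2
      push_cast; ring
    rw [sum_congr rfl this, sum_comm]
    refine sum_congr rfl fun p hp => ?_
    rw [← mul_sum]
    congr 1
    rw [mem_product] at hp
    by_cases h : k p.1 = k p.2
    · rw [if_pos h, h]; simp [ee_zero]
    · rw [if_neg h]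
      have h1 := hk _ hp.1
      have h2 := hk _ hp.2
      exact sum_range_ee_eq_zero hK (by omega) (by rw [abs_lt]; omega)
  have h0 : 0 ≤ ∑ j ∈ range K, ‖∑ y ∈ Y, b y * ee (j * (k y / K))‖ ^ 2 :=
    sum_nonneg fun _ _ => by positivity
  calc ∑ j ∈ range K, ‖∑ y ∈ Y, b y * ee (j * (k y / K))‖ ^ 2
      = ‖((∑ j ∈ range K, ‖∑ y ∈ Y, b y * ee (j * (k y / K))‖ ^ 2 : ℝ) : ℂ)‖ := by
        rw [Complex.norm_real, norm_of_nonneg h0]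
    _ ≤ ∑ p ∈ Y ×ˢ Y, (if k p.1 = k p.2 then (K : ℝ) else 0) := by
        rw [e]
        refine norm_sum_le_of_le _ fun p _ => ?_
        rw [norm_mul, norm_mul, RCLike.norm_conj]
        have := mul_le_one₀ (hb p.1) (norm_nonneg _) (hb p.2)
        split_ifs
        · rw [Complex.norm_natCast]; exact mul_le_of_le_one_left (by positivity) this
        · simp
    _ = _ := by rw [← sum_filter, sum_const, nsmul_eq_mul, mul_comm]

lemma sum_card_fiber_sq {ι : Type*} (X : Finset ι) (j : ι → ℕ) (K : ℕ)
    (hj : ∀ x ∈ X, j x ∈ range K) :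
    ∑ i ∈ range K, ((X.filter (fun x => j x = i)).card : ℝ) ^ 2 =
      ((X ×ˢ X).filter (fun p => j p.1 = j p.2)).card := by
  classical
  rw [card_filter, sum_product]
  push_cast
  rw [← sum_fiberwise_of_maps_to hj]
  refine sum_congr rfl fun i _ => ?_
  have : ∀ x ∈ X.filter (fun x => j x = i), (∑ y ∈ X, if j x = j y then (1 : ℝ) else 0) =
      (X.filter (fun x => j x = i)).card := fun x hx => by
    rw [(mem_filter.1 hx).2, card_filter]
    push_cast
    exact sum_congr rfl fun y _ => by simp only [eq_comm]
  rw [sum_congr rfl this, sum_const, nsmul_eq_mul, sq]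

/-- **Double large sieve** of Bombieri and Iwaniec. -/
theorem double_large_sieve {ι κ : Type*} (X : Finset ι) (Y : Finset κ) (f : ι → ℝ) (g : κ → ℝ)
    {X0 Y0 : ℝ} (hX0 : 0 < X0) (hY0 : 0 < Y0) (hf : ∀ x ∈ X, 0 ≤ f x ∧ f x ≤ X0)
    (hg : ∀ y ∈ Y, 0 ≤ g y ∧ g y ≤ Y0) :
    BilBound X Y (fun x y => ee (f x * g y)) (2 * exp (4 * π) * √((1 + X0 * Y0) *
      (((X ×ˢ X).filter (fun p => |f p.1 - f p.2| ≤ 1 / Y0)).card *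
       ((Y ×ˢ Y).filter (fun p => |g p.1 - g p.2| ≤ 1 / X0)).card))) := by
  classical
  set K := ⌊4 * (X0 * Y0)⌋₊ + 1 with hKdef
  have hK : 0 < K := by omega
  have hKr : (0 : ℝ) < K := mod_cast hK
  have hXY : 0 < X0 * Y0 := by positivity
  have hK1 : 4 * (X0 * Y0) ≤ K := by rw [hKdef]; push_cast; exact (Nat.lt_floor_add_one _).le
  have hK2 : (K : ℝ) ≤ 4 * (1 + X0 * Y0) := by
    have := Nat.floor_le (show 0 ≤ 4 * (X0 * Y0) by positivity)
    rw [hKdef]; push_cast; linarith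
  set j : ι → ℕ := fun x => ⌊4 * Y0 * f x⌋₊
  set k : κ → ℕ := fun y => ⌊K * (g y / (4 * Y0))⌋₊
  have hj1 : ∀ x ∈ X, (j x : ℝ) ≤ 4 * Y0 * f x ∧ 4 * Y0 * f x < j x + 1 := fun x hx =>
    ⟨Nat.floor_le (mul_nonneg (by positivity) (hf x hx).1), Nat.lt_floor_add_one _⟩
  have hk1 : ∀ y ∈ Y, (k y : ℝ) ≤ K * (g y / (4 * Y0)) ∧ K * (g y / (4 * Y0)) < k y + 1 :=
    fun y hy => ⟨Nat.floor_le (mul_nonneg hKr.le (div_nonneg (hg y hy).1 (by positivity))),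
      Nat.lt_floor_add_one _⟩
  have hjK : ∀ x ∈ X, j x ∈ range K := fun x hx => by
    rw [mem_range, hKdef, Nat.lt_succ_iff]
    apply Nat.floor_le_floor
    nlinarith [(hf x hx).2]
  have hgy : ∀ y ∈ Y, g y / (4 * Y0) ≤ 1 / 4 := fun y hy => by
    rw [div_le_div_iff₀ (by positivity) (by positivity)]
    linarith [(hg y hy).2]
  have hkK : ∀ y ∈ Y, k y < K := fun y hy => by
    have h1 := (hk1 y hy).1
    have h2 : (K : ℝ) * (g y / (4 * Y0)) ≤ K * (1 / 4) :=
      mul_le_mul_of_nonneg_left (hgy y hy) hKr.le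
    have : (k y : ℝ) < K := by linarith
    exact_mod_cast this
  set NX := (((X ×ˢ X).filter (fun p => |f p.1 - f p.2| ≤ 1 / Y0)).card : ℝ) with hNX
  set NY := (((Y ×ˢ Y).filter (fun p => |g p.1 - g p.2| ≤ 1 / X0)).card : ℝ) with hNY
  have cX : (((X ×ˢ X).filter (fun p => j p.1 = j p.2)).card : ℝ) ≤ NX := by
    rw [hNX]
    norm_cast
    apply card_le_card
    intro p hp
    rw [mem_filter, mem_product] at hp ⊢
    refine ⟨hp.1, ?_⟩
    have a1 := hj1 _ hp.1.1
    have a2 := hj1 _ hp.1.2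
    rw [hp.2] at a1
    rw [le_div_iff₀ hY0, ← abs_of_pos hY0, ← abs_mul, abs_le]
    constructor <;> nlinarith
  have cY : (((Y ×ˢ Y).filter (fun p => k p.1 = k p.2)).card : ℝ) ≤ NY := by
    rw [hNY]
    norm_cast
    apply card_le_card
    intro p hp
    rw [mem_filter, mem_product] at hp ⊢
    refine ⟨hp.1, ?_⟩
    have a1 := hk1 _ hp.1.1
    have a2 := hk1 _ hp.1.2
    rw [hp.2] at a1
    have h1 : |K * (g p.1 / (4 * Y0)) - K * (g p.2 / (4 * Y0))| ≤ 1 := by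
      rw [abs_le]; constructor <;> linarith
    rw [← mul_sub, ← sub_div, abs_mul, abs_div, abs_of_pos hKr, abs_of_pos (by positivity : 0 < 4 * Y0),
      ← mul_div_assoc, div_le_one (by positivity)] at h1
    rw [le_div_iff₀ hX0]
    have h2 : 4 * (X0 * Y0) * |g p.1 - g p.2| ≤ 4 * Y0 :=
      (mul_le_mul_of_nonneg_right hK1 (abs_nonneg _)).trans h1
    have h3 : (|g p.1 - g p.2| * X0) * (4 * Y0) ≤ 1 * (4 * Y0) := by linarith
    exact le_of_mul_le_mul_right h3 (by positivity)
  have base : BilBound X Y (fun x y => ee (j x * (k y / K))) (√(K * (NX * NY))) := fun a b ha hb => by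
    set G : ℕ → ℂ := fun i => ∑ y ∈ Y, b y * ee (i * (k y / K)) with hG
    have e : ∑ x ∈ X, ∑ y ∈ Y, a x * b y * ee (j x * (k y / K)) =
        ∑ i ∈ range K, (∑ x ∈ X.filter (fun x => j x = i), a x) * G i := by
      rw [← sum_fiberwise_of_maps_to hjK]
      refine sum_congr rfl fun i _ => ?_
      rw [sum_mul]
      refine sum_congr rfl fun x hx => ?_
      rw [(mem_filter.1 hx).2, hG, mul_sum]
      exact sum_congr rfl fun y _ => by ring
    rw [e]
    have h1 : ‖∑ i ∈ range K, (∑ x ∈ X.filter (fun x => j x = i), a x) * G i‖ ≤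
        ∑ i ∈ range K, ((X.filter (fun x => j x = i)).card : ℝ) * ‖G i‖ := by
      refine norm_sum_le_of_le _ fun i _ => ?_
      rw [norm_mul]
      refine mul_le_mul_of_nonneg_right ?_ (norm_nonneg _)
      refine (norm_sum_le_of_le _ (fun x _ => ha x)).trans ?_
      simp
    refine h1.trans (le_sqrt_of_sq_le ?_)
    refine (sum_mul_sq_le_sq_mul_sq _ _ _).trans ?_
    have h2 := sum_norm_sq_dft_le Y b hb k hK hkK
    rw [sum_card_fiber_sq X j K hjK]
    calc _ ≤ NX * (K * NY) := mul_le_mul cX (h2.trans (mul_le_mul_of_nonneg_left cY hKr.le))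
          (sum_nonneg fun _ _ => by positivity) (by positivity)
      _ = _ := by ring
  have p1 := base.perturb (fun x => j x / K) (fun y => K * (g y / (4 * Y0)) - k y)
    (by
      intro x hx
      have := mem_range.1 (hjK x hx)
      rw [abs_of_nonneg (by positivity), div_le_one hKr]
      exact_mod_cast this.le)
    (by
      intro y hy
      have := hk1 y hy
      rw [abs_le]; constructor <;> linarith)
  have p2 := p1.perturb (fun x => 4 * Y0 * f x - j x) (fun y => g y / (4 * Y0))
    (by
      intro x hx
      have := hj1 x hx
      rw [abs_le]; constructor <;> linarith)
    (by
      intro y hy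
      have := hgy y hy
      rw [abs_of_nonneg (div_nonneg (hg y hy).1 (by positivity))]; linarith)
  refine (p2.mono ?_).congr ?_
  · rw [← mul_assoc, ← exp_add, show 2 * π + 2 * π = 4 * π by ring]
    have : √(K * (NX * NY)) ≤ 2 * √((1 + X0 * Y0) * (NX * NY)) := by
      rw [show (2 : ℝ) = √4 by rw [show (4 : ℝ) = 2 ^ 2 by norm_num, sqrt_sq (by norm_num)],
        ← sqrt_mul (by norm_num)]
      apply sqrt_le_sqrt
      rw [← mul_assoc 4]
      exact mul_le_mul_of_nonneg_right hK2 (by positivity)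
    calc _ ≤ exp (4 * π) * (2 * √((1 + X0 * Y0) * (NX * NY))) :=
          mul_le_mul_of_nonneg_left this (exp_pos _).le
      _ = _ := by ring
  · intro x hx y hy
    rw [← ee_add, ← ee_add]
    congr 1
    field_simp
    ring

/-- Cauchy–Schwarz after splitting the outer index set into windows. -/
lemma sum_norm_sq_le_windows {ι κ : Type*} (X : Finset ι) (Y : Finset κ)
    (z : ι → κ → ℂ) (win : ι → ℤ) :
    ∑ v ∈ Y, ‖∑ p ∈ X, z p v‖ ^ 2 ≤ (X.image win).card *
      ∑ p ∈ (X ×ˢ X).filter (fun p => win p.1 = win p.2),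
        ‖∑ v ∈ Y, z p.1 v * conj (z p.2 v)‖ := by
  have h1 : ∀ v ∈ Y, ‖∑ p ∈ X, z p v‖ ^ 2 ≤ (X.image win).card *
      ∑ w ∈ X.image win, ‖∑ p ∈ X.filter (fun p => win p = w), z p v‖ ^ 2 := fun v _ => by
    rw [← sum_fiberwise_of_maps_to (fun p hp => mem_image_of_mem win hp)]
    refine (pow_le_pow_left₀ (norm_nonneg _) (norm_sum_le _ _) 2).trans ?_
    exact sq_sum_le_card_mul_sum_sq
  refine (sum_le_sum h1).trans ?_
  rw [← mul_sum]
  refine mul_le_mul_of_nonneg_left ?_ (Nat.cast_nonneg _)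
  have e : ((∑ v ∈ Y, ∑ w ∈ X.image win, ‖∑ p ∈ X.filter (fun p => win p = w), z p v‖ ^ 2 : ℝ) : ℂ) =
      ∑ p ∈ (X ×ˢ X).filter (fun p => win p.1 = win p.2),
        ∑ v ∈ Y, z p.1 v * conj (z p.2 v) := by
    rw [sum_comm (s := (X ×ˢ X).filter (fun p => win p.1 = win p.2))]
    push_cast
    refine sum_congr rfl fun v _ => ?_
    rw [sum_filter, sum_product, ← sum_fiberwise_of_maps_to (fun p hp => mem_image_of_mem win hp)]
    refine sum_congr rfl fun w _ => ?_
    rw [← Complex.mul_conj', map_sum, sum_mul_sum]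
    refine sum_congr rfl fun p hp => ?_
    rw [sum_filter]
    refine sum_congr rfl fun q _ => ?_
    rw [(mem_filter.1 hp).2]
    simp only [eq_comm]
  have h0 : 0 ≤ ∑ v ∈ Y, ∑ w ∈ X.image win, ‖∑ p ∈ X.filter (fun p => win p = w), z p v‖ ^ 2 :=
    sum_nonneg fun _ _ => sum_nonneg fun _ _ => by positivity
  calc _ = ‖((∑ v ∈ Y, ∑ w ∈ X.image win,
        ‖∑ p ∈ X.filter (fun p => win p = w), z p v‖ ^ 2 : ℝ) : ℂ)‖ := by
        rw [Complex.norm_real, norm_of_nonneg h0]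
    _ ≤ _ := by rw [e]; exact norm_sum_le _ _

/-- `h u^γ` for a pair `(h, u)`. -/
noncomputable def mono2 (γ : ℝ) (p : ℕ × ℕ) : ℝ := (p.1 : ℝ) * (p.2 : ℝ) ^ γ

lemma mono2_pos {γ : ℝ} {p : ℕ × ℕ} (h1 : 0 < p.1) (h2 : 0 < p.2) : 0 < mono2 γ p := by
  have : (0 : ℝ) < p.1 := mod_cast h1
  have : (0 : ℝ) < p.2 := mod_cast h2
  unfold mono2; positivity

lemma log_mono2 {γ : ℝ} {p : ℕ × ℕ} (h1 : 0 < p.1) (h2 : 0 < p.2) :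
    log (mono2 γ p) = log p.1 + γ * log p.2 := by
  have : (0 : ℝ) < p.1 := mod_cast h1
  have : (0 : ℝ) < p.2 := mod_cast h2
  rw [mono2, log_mul (by positivity) (by positivity), log_rpow (by positivity)]

/-- The dyadic block `[H, 2H) × [U, 2U)`. -/
def dyadicBlock (H U : ℕ) : Finset (ℕ × ℕ) := Ico H (2 * H) ×ˢ Ico U (2 * U)

lemma mem_dyadicBlock {H U : ℕ} {p : ℕ × ℕ} :
    p ∈ dyadicBlock H U ↔ (H ≤ p.1 ∧ p.1 < 2 * H) ∧ U ≤ p.2 ∧ p.2 < 2 * U := by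
  simp [dyadicBlock]

lemma mono2_bounds {γ : ℝ} (h0 : 0 < γ) (h1 : γ < 1) {H U : ℕ} {p : ℕ × ℕ}
    (hp : p ∈ dyadicBlock H U) :
    (H : ℝ) * (U : ℝ) ^ γ ≤ mono2 γ p ∧ mono2 γ p ≤ 4 * ((H : ℝ) * (U : ℝ) ^ γ) := by
  rw [mem_dyadicBlock] at hp
  obtain ⟨⟨a1, a2⟩, a3, a4⟩ := hp
  have b1 : (H : ℝ) ≤ p.1 := mod_cast a1
  have b2 : (p.1 : ℝ) ≤ 2 * H := mod_cast a2.le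
  have b3 : (U : ℝ) ≤ p.2 := mod_cast a3
  have b4 : (p.2 : ℝ) ≤ 2 * U := mod_cast a4.le
  have c1 : (p.2 : ℝ) ^ γ ≤ 2 * (U : ℝ) ^ γ := by
    calc (p.2 : ℝ) ^ γ ≤ (2 * (U : ℝ)) ^ γ := rpow_le_rpow (by positivity) b4 h0.le
      _ = 2 ^ γ * (U : ℝ) ^ γ := mul_rpow (by norm_num) (by positivity)
      _ ≤ 2 * (U : ℝ) ^ γ := by
        gcongr
        calc (2 : ℝ) ^ γ ≤ 2 ^ (1 : ℝ) := rpow_le_rpow_of_exponent_le (by norm_num) h1.le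
          _ = 2 := by simp
  unfold mono2
  constructor
  · gcongr
  · calc (p.1 : ℝ) * (p.2 : ℝ) ^ γ ≤ (2 * H) * (2 * (U : ℝ) ^ γ) := by gcongr
      _ = _ := by ring

lemma abs_sub_bounds_of_log {y y' Y0 : ℝ} (h1 : Y0 ≤ y) (h2 : y ≤ 4 * Y0) (h3 : Y0 ≤ y')
    (h4 : y' ≤ 4 * Y0) (h0 : 0 < Y0) :
    Y0 * |log y - log y'| ≤ |y - y'| ∧ |y - y'| ≤ 4 * Y0 * |log y - log y'| := by
  wlog h : y' ≤ y generalizing y y' with Hw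
  · rw [abs_sub_comm y, abs_sub_comm (log y)]
    exact Hw h3 h4 h1 h2 (by linarith)
  have p1 : 0 < y := by linarith
  have p2 : 0 < y' := by linarith
  have hl : log y' ≤ log y := log_le_log p2 h
  rw [abs_of_nonneg (by linarith), abs_of_nonneg (by linarith)]
  have u1 := log_le_sub_one_of_pos (show 0 < y / y' by positivity)
  have u2 := one_sub_inv_le_log_of_pos (show 0 < y / y' by positivity)
  rw [log_div p1.ne' p2.ne'] at u1 u2
  rw [inv_div] at u2
  have v1 : y' * (log y - log y') ≤ y - y' := by
    have := mul_le_mul_of_nonneg_left u1 p2.le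
    have e : y' * (y / y' - 1) = y - y' := by field_simp
    linarith
  have v2 : y - y' ≤ y * (log y - log y') := by
    have := mul_le_mul_of_nonneg_left u2 p1.le
    have e : y * (1 - y' / y) = y - y' := by field_simp
    linarith
  constructor
  · nlinarith
  · nlinarith

/-- Pairs in a dyadic block whose monomials are close, with a lower bound for `gcd (u, u')`. -/
theorem card_close_mono2 {γ : ℝ} (hγ : 0 < γ) (H U : ℕ) {η : ℝ} (hη : 0 ≤ η) :
    ((((dyadicBlock H U) ×ˢ (dyadicBlock H U)).filter (fun p =>
      |log (mono2 γ p.1) - log (mono2 γ p.2)| ≤ η)).card : ℝ) ≤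
      (128 + 128 / γ) * ((1 + log (2 * H : ℕ)) * (1 + log (2 * U : ℕ))) *
        ((H : ℝ) * U + η * H ^ 2 * U ^ 2) := by
  have h1 := card_closeQuads_le hγ hη (le_refl 1) (2 * H) (2 * U)
  rcases Nat.eq_zero_or_pos H with rfl | hH
  · simp [dyadicBlock]
  rcases Nat.eq_zero_or_pos U with rfl | hU
  · simp [dyadicBlock]
  have hle : (((dyadicBlock H U) ×ˢ (dyadicBlock H U)).filter (fun p =>
      |log (mono2 γ p.1) - log (mono2 γ p.2)| ≤ η)).card ≤
      (closeQuads γ η 1 (2 * H) (2 * U)).card := by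
    refine card_le_card_of_injOn (fun p => ((p.1.1, p.2.1), (p.2.2, p.1.2))) ?_ ?_
    · rintro ⟨⟨h, u⟩, ⟨h', u'⟩⟩ hp
      simp only [coe_filter, mem_product, mem_dyadicBlock, Set.mem_ofPred_eq] at hp
      obtain ⟨⟨⟨⟨a1, a2⟩, a3, a4⟩, ⟨a5, a6⟩, a7, a8⟩, hc⟩ := hp
      rw [log_mono2 (by simp; omega) (by simp; omega), log_mono2 (by simp; omega) (by simp; omega)] at hc
      simp only [closeQuads, coe_filter, mem_product, mem_Icc, Set.mem_ofPred_eq]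
      refine ⟨⟨⟨⟨by omega, by omega⟩, by omega, by omega⟩, ⟨by omega, by omega⟩, by omega, by omega⟩, ?_, ?_⟩
      · exact_mod_cast Nat.gcd_pos_of_pos_left _ (by omega)
      · convert hc using 2; ring
    · rintro ⟨⟨h, u⟩, ⟨h', u'⟩⟩ _ ⟨⟨k, v⟩, ⟨k', v'⟩⟩ _ h
      simp only [Prod.mk.injEq] at h ⊢
      tauto
  refine (Nat.cast_le.2 hle).trans (h1.trans ?_)
  have l1 : 0 ≤ log (2 * H : ℕ) := log_natCast_nonneg _
  have l2 : 0 ≤ log (2 * U : ℕ) := log_natCast_nonneg _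
  have hL : 1 ≤ (1 + log (2 * H : ℕ)) * (1 + log (2 * U : ℕ)) := by nlinarith
  generalize (1 + log (2 * H : ℕ)) * (1 + log (2 * U : ℕ)) = L at *
  have e1 : (128 + 128 / γ) * L * ((H : ℝ) * U + η * H ^ 2 * U ^ 2) =
      (8 + 8 / γ) * (16 * (H * U * L) + 16 * η * H ^ 2 * U ^ 2 * L) := by ring
  rw [e1]
  have : 0 ≤ η * (H : ℝ) ^ 2 * U ^ 2 := by positivity
  have h3 : 0 ≤ (H : ℝ) * U * L := by positivity
  refine mul_le_mul_of_nonneg_left ?_ (by positivity)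
  push_cast
  nlinarith

set_option maxHeartbeats 1000000 in
/-- Bilinear estimate with windows in `h u^γ`. -/
theorem typeII_raw {γ : ℝ} (h0 : 0 < γ) (h1 : γ < 1) : ∃ C : ℝ, 0 < C ∧
    ∀ (H U V : ℕ) (W : ℝ), 0 < H → 0 < U → 0 < V → 1 ≤ W → W ≤ H * U →
    ∀ (a : ℕ × ℕ → ℂ) (b : ℕ → ℂ), (∀ p, ‖a p‖ ≤ 1) → (∀ v, ‖b v‖ ≤ 1) →
    ‖∑ p ∈ dyadicBlock H U, ∑ v ∈ Ico V (2 * V), a p * b v * ee (mono2 γ p * (v : ℝ) ^ γ)‖ ^ 2 ≤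
      C * ((1 + log (2 * H : ℕ)) * (1 + log (2 * U : ℕ))) *
        ((V : ℝ) ^ 2 * W * (H * U) + V * H ^ 2 * U ^ 2 *
          (√(H * U ^ γ * V ^ γ / W) + V * √(H * U / (H * U ^ γ * V ^ γ)))) := by
  classical
  obtain ⟨C0, hC0, hvdc⟩ := vdc_rpow h0 h1
  refine ⟨8 * (1 + 2 * C0) * (2 * (128 + 128 / γ)), by positivity, ?_⟩
  intro H U V W hH hU hV hW hWHU a b ha hb
  have hVr : (0 : ℝ) < V := mod_cast hV
  set X := dyadicBlock H U with hX
  set Y := Ico V (2 * V) with hY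
  set F := (H : ℝ) * U ^ γ * V ^ γ with hF
  set L := (1 + log (2 * H : ℕ)) * (1 + log (2 * U : ℕ)) with hL
  have hYc : (Y.card : ℝ) = V := by rw [hY, Nat.card_Ico]; norm_cast; omega
  set z : ℕ × ℕ → ℕ → ℂ := fun p v => a p * ee (mono2 γ p * (v : ℝ) ^ γ) with hz
  set win : ℕ × ℕ → ℤ := fun p => ⌊W * log (mono2 γ p)⌋ with hwin
  -- Cauchy over `v`
  have hc1 : ‖∑ p ∈ X, ∑ v ∈ Y, a p * b v * ee (mono2 γ p * (v : ℝ) ^ γ)‖ ^ 2 ≤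
      V * ∑ v ∈ Y, ‖∑ p ∈ X, z p v‖ ^ 2 := by
    have e : ∑ p ∈ X, ∑ v ∈ Y, a p * b v * ee (mono2 γ p * (v : ℝ) ^ γ) =
        ∑ v ∈ Y, b v * ∑ p ∈ X, z p v := by
      rw [sum_comm]
      refine sum_congr rfl fun v _ => ?_
      rw [mul_sum]
      exact sum_congr rfl fun p _ => by rw [hz]; ring
    rw [e]
    have h2 : ‖∑ v ∈ Y, b v * ∑ p ∈ X, z p v‖ ≤ ∑ v ∈ Y, ‖∑ p ∈ X, z p v‖ := by
      refine norm_sum_le_of_le _ fun v _ => ?_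
      rw [norm_mul]
      exact mul_le_of_le_one_left (norm_nonneg _) (hb v)
    refine (pow_le_pow_left₀ (norm_nonneg _) h2 2).trans ?_
    rw [← hYc]
    exact sq_sum_le_card_mul_sum_sq
  have hc2 := sum_norm_sq_le_windows X Y z win
  -- the number of windows
  have hwc : ((X.image win).card : ℝ) ≤ 4 * W := by
    set y0 := (H : ℝ) * (U : ℝ) ^ γ
    have hy0p : 0 < y0 := by positivity
    have hsub : X.image win ⊆ Icc ⌊W * log y0⌋ ⌊W * (log y0 + log 4)⌋ := fun w hw => by
      obtain ⟨p, hp, rfl⟩ := mem_image.1 hw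
      obtain ⟨b1, b2⟩ := mono2_bounds h0 h1 (hX ▸ hp)
      have l1 : log y0 ≤ log (mono2 γ p) := log_le_log hy0p b1
      have l2 : log (mono2 γ p) ≤ log y0 + log 4 := by
        rw [add_comm, ← log_mul (by norm_num) hy0p.ne']
        exact log_le_log (by linarith) b2
      exact mem_Icc.2 ⟨Int.floor_le_floor (by gcongr), Int.floor_le_floor (by gcongr)⟩
    have hc := card_le_card hsub
    rw [Int.card_Icc] at hc
    have hle : ⌊W * log y0⌋ ≤ ⌊W * (log y0 + log 4)⌋ :=
      Int.floor_le_floor (by gcongr; linarith [log_pos (show (1:ℝ) < 4 by norm_num)])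
    have hc' : ((X.image win).card : ℝ) ≤ ⌊W * (log y0 + log 4)⌋ + 1 - ⌊W * log y0⌋ := by
      have : ((X.image win).card : ℤ) ≤ ⌊W * (log y0 + log 4)⌋ + 1 - ⌊W * log y0⌋ := by
        omega
      exact_mod_cast this
    have f1 := Int.floor_le (W * (log y0 + log 4))
    have f2 := Int.lt_floor_add_one (W * log y0)
    have l4 : log 4 ≤ 2 := by
      rw [show (4 : ℝ) = 2 ^ 2 by norm_num, log_pow]
      have := log_two_lt_d9; push_cast; linarith
    nlinarith
  -- the pairs in a common window
  set D : (ℕ × ℕ) × (ℕ × ℕ) → ℝ := fun p => |log (mono2 γ p.1) - log (mono2 γ p.2)| with hD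
  set P := (X ×ˢ X).filter (fun p => win p.1 = win p.2)
  set D1 := 1 / ((H : ℝ) * U) with hD1
  have hDW : ∀ p ∈ P, D p ≤ 1 / W := fun p hp => by
    have he := (mem_filter.1 hp).2
    have f1 := Int.floor_le (W * log (mono2 γ p.1))
    have f2 := Int.lt_floor_add_one (W * log (mono2 γ p.1))
    have f3 := Int.floor_le (W * log (mono2 γ p.2))
    have f4 := Int.lt_floor_add_one (W * log (mono2 γ p.2))
    simp only [hwin] at he
    rw [he] at f1 f2
    have : |W * log (mono2 γ p.1) - W * log (mono2 γ p.2)| ≤ 1 := by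
      rw [abs_le]; constructor <;> linarith
    rw [← mul_sub, abs_mul, abs_of_pos (by linarith)] at this
    rw [hD, le_div_iff₀ (by linarith)]; linarith
  have hinner : ∀ p ∈ X ×ˢ X, ‖∑ v ∈ Y, z p.1 v * conj (z p.2 v)‖ ≤
      ‖∑ v ∈ Y, ee ((mono2 γ p.1 - mono2 γ p.2) * (v : ℝ) ^ γ + 0 * v)‖ := fun p _ => by
    have e : ∑ v ∈ Y, z p.1 v * conj (z p.2 v) = (a p.1 * conj (a p.2)) *
        ∑ v ∈ Y, ee ((mono2 γ p.1 - mono2 γ p.2) * (v : ℝ) ^ γ + 0 * v) := by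
      rw [mul_sum]
      refine sum_congr rfl fun v _ => ?_
      simp only [hz]
      rw [map_mul, mul_mul_mul_comm, ee_mul_conj]
      congr 2; ring
    rw [e, norm_mul, norm_mul, RCLike.norm_conj]
    exact mul_le_of_le_one_left (norm_nonneg _) (mul_le_one₀ (ha _) (norm_nonneg _) (ha _))
  have hbig : ∀ p ∈ P, D1 < D p → ‖∑ v ∈ Y, z p.1 v * conj (z p.2 v)‖ ≤
      C0 * (2 * √(F / W) + V * √(H * U / F)) := fun p hp hDp => by
    have hp' := (mem_filter.1 hp).1
    obtain ⟨hp1, hp2⟩ := mem_product.1 hp'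
    obtain ⟨b1, b2⟩ := mono2_bounds h0 h1 (hX ▸ hp1)
    obtain ⟨b3, b4⟩ := mono2_bounds h0 h1 (hX ▸ hp2)
    have hy0p : 0 < (H : ℝ) * (U : ℝ) ^ γ := by positivity
    obtain ⟨c1, c2⟩ := abs_sub_bounds_of_log b1 b2 b3 b4 hy0p
    have hD1p : 0 < D1 := by positivity
    have hDpos : 0 < D p := by linarith
    have hβ : 0 < |mono2 γ p.1 - mono2 γ p.2| := lt_of_lt_of_le (mul_pos hy0p hDpos) c1
    refine (hinner p hp').trans ((hvdc V V (2 * V) _ 0 hV le_rfl le_rfl hβ).trans ?_)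
    have g1 : |mono2 γ p.1 - mono2 γ p.2| * (V : ℝ) ^ γ ≤ 4 * (F / W) := by
      calc |mono2 γ p.1 - mono2 γ p.2| * (V : ℝ) ^ γ
          ≤ (4 * ((H : ℝ) * (U : ℝ) ^ γ) * (1 / W)) * (V : ℝ) ^ γ := by
            gcongr
            exact c2.trans (mul_le_mul_of_nonneg_left (hDW p hp) (by positivity))
        _ = _ := by rw [hF]; ring
    have g2 : F / (H * U) ≤ |mono2 γ p.1 - mono2 γ p.2| * (V : ℝ) ^ γ := by
      calc F / (H * U) = ((H : ℝ) * (U : ℝ) ^ γ * D1) * (V : ℝ) ^ γ := by rw [hF, hD1]; ring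
        _ ≤ _ := by
          gcongr
          exact le_trans (mul_le_mul_of_nonneg_left hDp.le hy0p.le) c1
    refine mul_le_mul_of_nonneg_left (add_le_add ?_ ?_) hC0.le
    · calc √(|mono2 γ p.1 - mono2 γ p.2| * (V : ℝ) ^ γ) ≤ √(4 * (F / W)) := sqrt_le_sqrt g1
        _ = 2 * √(F / W) := by
          rw [sqrt_mul (by norm_num), show (4 : ℝ) = 2 ^ 2 by norm_num, sqrt_sq (by norm_num)]
    · rw [div_eq_mul_inv, ← sqrt_inv]
      gcongr
      rw [show (H : ℝ) * U / F = (F / (H * U))⁻¹ by rw [inv_div]]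
      exact inv_anti₀ (by positivity) g2
  have hsmall : ∀ p ∈ P, ‖∑ v ∈ Y, z p.1 v * conj (z p.2 v)‖ ≤ V := fun p hp => by
    refine (hinner p (mem_filter.1 hp).1).trans ((norm_sum_ee_le_card _ _).trans ?_)
    rw [hYc]
  set cnt : ℝ → ℝ := fun η => (((X ×ˢ X).filter (fun p => D p ≤ η)).card : ℝ)
  have hcnt1 : cnt D1 ≤ (128 + 128 / γ) * L * (2 * (H * U)) := by
    refine (card_close_mono2 h0 H U (show 0 ≤ D1 by positivity)).trans (le_of_eq ?_)
    rw [hD1, hL]; field_simp; ring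
  have hcntW : cnt (1 / W) ≤ (128 + 128 / γ) * L * (2 * (H ^ 2 * U ^ 2 / W)) := by
    refine (card_close_mono2 h0 H U (show 0 ≤ 1 / W by positivity)).trans ?_
    have hLn : 0 ≤ L := by positivity
    refine mul_le_mul_of_nonneg_left ?_ (by positivity)
    have : (H : ℝ) * U ≤ H ^ 2 * U ^ 2 / W := by
      rw [le_div_iff₀ (by linarith)]
      calc (H : ℝ) * U * W ≤ (H * U) * (H * U) := by gcongr
        _ = _ := by ring
    have e : 1 / W * (H : ℝ) ^ 2 * U ^ 2 = H ^ 2 * U ^ 2 / W := by ring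
    rw [e]; linarith
  set T := C0 * (2 * √(F / W) + V * √(H * U / F)) with hT
  have hT0 : 0 ≤ T := by positivity
  have hsum : ∑ p ∈ P, ‖∑ v ∈ Y, z p.1 v * conj (z p.2 v)‖ ≤
      V * cnt D1 + T * cnt (1 / W) := by
    rw [← sum_filter_add_sum_filter_not P (fun p => D p ≤ D1)]
    refine add_le_add ?_ ?_
    · refine (sum_le_sum fun p hp => hsmall p (mem_filter.1 hp).1).trans ?_
      rw [sum_const, nsmul_eq_mul, mul_comm]
      refine mul_le_mul_of_nonneg_left ?_ hVr.le
      refine Nat.cast_le.2 (card_le_card ?_)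
      intro p hp
      rw [mem_filter] at hp ⊢
      exact ⟨(mem_filter.1 hp.1).1, hp.2⟩
    · refine (sum_le_sum fun p hp => hbig p (mem_filter.1 hp).1
        (not_le.1 (mem_filter.1 hp).2)).trans ?_
      rw [sum_const, nsmul_eq_mul, mul_comm]
      refine mul_le_mul_of_nonneg_left ?_ hT0
      refine Nat.cast_le.2 (card_le_card ?_)
      intro p hp
      rw [mem_filter] at hp ⊢
      exact ⟨(mem_filter.1 hp.1).1, hDW p hp.1⟩
  have hS0 : 0 ≤ ∑ p ∈ P, ‖∑ v ∈ Y, z p.1 v * conj (z p.2 v)‖ :=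
    sum_nonneg fun _ _ => norm_nonneg _
  set R := (128 + 128 / γ) * L with hR
  calc ‖∑ p ∈ X, ∑ v ∈ Y, a p * b v * ee (mono2 γ p * (v : ℝ) ^ γ)‖ ^ 2
      ≤ V * (4 * W * (V * cnt D1 + T * cnt (1 / W))) := by
        refine hc1.trans (mul_le_mul_of_nonneg_left (hc2.trans ?_) hVr.le)
        exact mul_le_mul hwc hsum hS0 (by linarith)
    _ ≤ V * (4 * W * (V * (R * (2 * (H * U))) + T * (R * (2 * (H ^ 2 * U ^ 2 / W))))) := by
        gcongr
    _ = 8 * R * (V ^ 2 * W * (H * U) + V * H ^ 2 * U ^ 2 * T) := by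
        have : W ≠ 0 := by linarith
        field_simp
        ring
    _ ≤ 8 * R * ((1 + 2 * C0) * 2 * (V ^ 2 * W * (H * U) + V * H ^ 2 * U ^ 2 *
          (√(F / W) + V * √(H * U / F)))) := by
        refine mul_le_mul_of_nonneg_left ?_ (by positivity)
        have t1 : 0 ≤ (V : ℝ) ^ 2 * W * (H * U) := by positivity
        have t2 : T ≤ (1 + 2 * C0) * 2 * (√(F / W) + V * √(H * U / F)) := by
          have s1 : 0 ≤ √(F / W) := by positivity
          have s2 : 0 ≤ V * √(H * U / F) := by positivity
          rw [hT]; nlinarith [mul_nonneg hC0.le s1, mul_nonneg hC0.le s2]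
        have t3 := mul_le_mul_of_nonneg_left t2 (show (0 : ℝ) ≤ V * H ^ 2 * U ^ 2 by positivity)
        nlinarith [mul_nonneg hC0.le t1]
    _ = _ := by rw [hR]; ring

lemma exists_rpow_eq {x : ℝ} (hx : 1 < x) {H : ℕ} (hH : 0 < H) : ∃ h : ℝ, 0 ≤ h ∧ (H : ℝ) = x ^ h :=
  ⟨logb x H, logb_nonneg hx (mod_cast hH), (rpow_logb (by linarith) hx.ne' (mod_cast hH)).symm⟩

lemma ceil_rpow_bounds {x b : ℝ} (hx : 1 < x) (hb : 0 ≤ b) : x ^ b ≤ ⌈x ^ b⌉₊ ∧ (⌈x ^ b⌉₊ : ℝ) ≤ 2 * x ^ b := by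
  have h1 : 1 ≤ x ^ b := one_le_rpow hx.le hb
  exact ⟨Nat.le_ceil _, by have := Nat.ceil_lt_add_one (zero_le_one.trans h1); linarith⟩

lemma sqrt_rpow_eq {x : ℝ} (hx : 0 < x) (a : ℝ) : √(x ^ a) = x ^ (a / 2) := by
  rw [sqrt_eq_rpow, ← rpow_mul hx.le]; congr 1; ring

lemma rpow_npow_eq {x : ℝ} (hx : 0 < x) (a : ℝ) (n : ℕ) : (x ^ a) ^ n = x ^ (n * a) := by
  rw [← rpow_natCast, ← rpow_mul hx.le]; congr 1; ring

lemma eventually_const_mul_log_pow_le (C : ℝ) (k : ℕ) {s : ℝ} (hs : 0 < s) :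
    ∀ᶠ x : ℝ in atTop, C * (2 + 4 * log x) ^ k ≤ x ^ s := by
  set δ := s / (2 * (k + 1)) with hδ
  have hδ0 : 0 < δ := by positivity
  set C' := |C| * (2 + 4 / δ) ^ k with hC'
  have h1 := (tendsto_rpow_atTop (show 0 < s / 2 by linarith)).eventually_ge_atTop C'
  filter_upwards [h1, eventually_ge_atTop 1] with x hx hx1
  have hx0 : 0 < x := by linarith
  have hl : log x ≤ x ^ δ / δ := log_le_rpow_div hx0.le hδ0
  have hl0 : 0 ≤ log x := log_nonneg hx1
  have hxd : 1 ≤ x ^ δ := one_le_rpow hx1 hδ0.le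
  have h2 : 2 + 4 * log x ≤ (2 + 4 / δ) * x ^ δ := by
    have : 4 * (x ^ δ / δ) = 4 / δ * x ^ δ := by ring
    nlinarith
  calc C * (2 + 4 * log x) ^ k ≤ |C| * (2 + 4 * log x) ^ k := by
        gcongr; exact le_abs_self C
    _ ≤ |C| * ((2 + 4 / δ) * x ^ δ) ^ k := by gcongr
    _ = C' * x ^ (k * δ) := by rw [mul_pow, rpow_npow_eq hx0, hC']; ring
    _ ≤ x ^ (s / 2) * x ^ (s / 2) := by
        gcongr
        rw [hδ, mul_div_assoc', div_le_div_iff₀ (by positivity) (by positivity)]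
        nlinarith
    _ = x ^ s := by rw [← rpow_add hx0]; congr 1; ring

set_option maxHeartbeats 1000000 in
/-- Type II sums with one variable in `[x^(8/58), x^(18/58)]`. -/
theorem typeII_short {γ : ℝ} (h0 : 50 / 58 < γ) (h1 : γ < 1) : ∃ s : ℝ, 0 < s ∧ ∀ᶠ x : ℝ in atTop,
    ∀ H U V : ℕ, 0 < H → 0 < U → 0 < V → (H : ℝ) ≤ x ^ (1 - γ + s) → x ^ (8 / 58 - s) ≤ U →
    (U : ℝ) ≤ x ^ (18 / 58 + s) → x ^ (1 - s) ≤ (U : ℝ) * V → (U : ℝ) * V ≤ x ^ (1 + s) →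
    BilBound (dyadicBlock H U) (Ico V (2 * V)) (fun p v => ee (mono2 γ p * (v : ℝ) ^ γ))
      (x ^ (1 - s)) := by
  obtain ⟨C, hC, hraw⟩ := typeII_raw (γ := γ) (by linarith) h1
  set σ := γ - 50 / 58 with hσ
  have hσ0 : 0 < σ := by linarith
  set s := σ / 100 with hs
  have hs0 : 0 < s := by positivity
  refine ⟨s, hs0, ?_⟩
  filter_upwards [eventually_const_mul_log_pow_le (3 * C) 2 hs0, eventually_gt_atTop 2] with x hlog hx2
  intro H U V hH hU hV hHx hUx1 hUx2 hUV1 hUV2 a b ha hb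
  have hx : 1 < x := by linarith
  have hx0 : 0 < x := by linarith
  obtain ⟨h, hh0, eh⟩ := exists_rpow_eq hx hH
  obtain ⟨u, -, eu⟩ := exists_rpow_eq hx hU
  obtain ⟨v, -, ev⟩ := exists_rpow_eq hx hV
  have hle := fun a b : ℝ => rpow_le_rpow_left_iff (y := a) (z := b) hx
  rw [eh, hle] at hHx
  rw [eu, hle] at hUx1 hUx2
  rw [eu, ev, ← rpow_add hx0, hle] at hUV1 hUV2
  set κ := σ / 2 with hκ
  set w := u - h - κ
  have hw0 : 0 ≤ w := by linarith
  have hW1 : 1 ≤ x ^ w := one_le_rpow hx.le hw0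
  have hW2 : x ^ w ≤ (H : ℝ) * U := by
    rw [eh, eu, ← rpow_add hx0, hle]; linarith
  have key := hraw H U V (x ^ w) hH hU hV hW1 hW2 a b ha hb
  have hL : 3 * C * ((1 + log (2 * H : ℕ)) * (1 + log (2 * U : ℕ))) ≤ x ^ s := by
    refine le_trans ?_ hlog
    have lx : 0 ≤ log x := log_nonneg hx.le
    have l2 : log 2 ≤ 1 := by have := log_two_lt_d9; linarith
    have lH : 1 + log (2 * H : ℕ) ≤ 2 + 4 * log x := by
      push_cast
      rw [log_mul (by norm_num) (by positivity), eh, log_rpow hx0]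
      have : h * log x ≤ 1 * log x := mul_le_mul_of_nonneg_right (by linarith) lx
      linarith
    have lU : 1 + log (2 * U : ℕ) ≤ 2 + 4 * log x := by
      push_cast
      rw [log_mul (by norm_num) (by positivity), eu, log_rpow hx0]
      have : u * log x ≤ 1 * log x := mul_le_mul_of_nonneg_right (by linarith) lx
      linarith
    have l3 : 0 ≤ log (2 * H : ℕ) := log_natCast_nonneg _
    have l4 : 0 ≤ log (2 * U : ℕ) := log_natCast_nonneg _
    rw [sq]
    gcongr
  set q := γ * (u + v) with hq
  have hγ0 : 0 < γ := by linarith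
  have hq1 : γ - s ≤ q := by
    have := mul_le_mul_of_nonneg_left hUV1 hγ0.le
    have := mul_lt_mul_of_pos_right h1 hs0
    linarith
  have hq2 : q ≤ γ + s := by
    have := mul_le_mul_of_nonneg_left hUV2 hγ0.le
    have := mul_lt_mul_of_pos_right h1 hs0
    linarith
  have eF : (H : ℝ) * (U : ℝ) ^ γ * (V : ℝ) ^ γ = x ^ (h + q) := by
    rw [eh, eu, ev, ← rpow_mul hx0.le, ← rpow_mul hx0.le, ← rpow_add hx0,
      ← rpow_add hx0]
    congr 1; rw [hq]; ring
  have t1 : (V : ℝ) ^ 2 * x ^ w * (H * U) ≤ x ^ (2 - 3 * s) := by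
    rw [ev, eh, eu, rpow_npow_eq hx0, ← rpow_add hx0, ← rpow_add hx0,
      ← rpow_add hx0, hle]
    push_cast; linarith
  have t2 : (V : ℝ) * H ^ 2 * U ^ 2 * √(H * U ^ γ * V ^ γ / x ^ w) ≤ x ^ (2 - 3 * s) := by
    rw [eF, ← rpow_sub hx0, sqrt_rpow_eq hx0, ev, eh, eu, rpow_npow_eq hx0, rpow_npow_eq hx0,
      ← rpow_add hx0, ← rpow_add hx0, ← rpow_add hx0, hle]
    push_cast; linarith
  have t3 : (V : ℝ) * H ^ 2 * U ^ 2 * (V * √(H * U / (H * U ^ γ * V ^ γ))) ≤ x ^ (2 - 3 * s) := by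
    rw [eF, eh, eu, ev, ← rpow_add hx0, ← rpow_sub hx0, sqrt_rpow_eq hx0,
      rpow_npow_eq hx0, rpow_npow_eq hx0,
      ← rpow_add hx0, ← rpow_add hx0, ← rpow_add hx0, ← rpow_add hx0, hle]
    push_cast; linarith
  have hfin : ‖∑ p ∈ dyadicBlock H U, ∑ v ∈ Ico V (2 * V), a p * b v *
      ee (mono2 γ p * (v : ℝ) ^ γ)‖ ^ 2 ≤ (x ^ (1 - s)) ^ 2 := by
    refine key.trans ?_
    have hL0 : 0 ≤ C * ((1 + log (2 * H : ℕ)) * (1 + log (2 * U : ℕ))) := by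
      have l3 : 0 ≤ log (2 * H : ℕ) := log_natCast_nonneg _
      have l4 : 0 ≤ log (2 * U : ℕ) := log_natCast_nonneg _
      positivity
    calc _ ≤ C * ((1 + log (2 * H : ℕ)) * (1 + log (2 * U : ℕ))) * (3 * x ^ (2 - 3 * s)) := by
          refine mul_le_mul_of_nonneg_left ?_ hL0
          rw [mul_add ((V : ℝ) * H ^ 2 * U ^ 2)]
          linarith
      _ = 3 * C * ((1 + log (2 * H : ℕ)) * (1 + log (2 * U : ℕ))) * x ^ (2 - 3 * s) := by ring
      _ ≤ x ^ s * x ^ (2 - 3 * s) := by gcongr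
      _ = _ := by
        rw [← rpow_add hx0, rpow_npow_eq hx0]; congr 1; push_cast; ring
  exact le_of_sq_le_sq hfin (by positivity)

/-- `ψ(z) = (1+z)^γ - (1-z)^γ`. -/
noncomputable def symDiff (γ z : ℝ) : ℝ := (1 + z) ^ γ - (1 - z) ^ γ

lemma hasDerivAt_symDiff {γ z : ℝ} (h1 : -1 < z) (h2 : z < 1) :
    HasDerivAt (symDiff γ) (γ * ((1 + z) ^ (γ - 1) + (1 - z) ^ (γ - 1))) z := by
  have a := ((hasDerivAt_id z).const_add 1).rpow_const (p := γ) (Or.inl (by simp; linarith))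
  have b := ((hasDerivAt_id z).const_sub 1).rpow_const (p := γ) (Or.inl (by simp; linarith))
  refine (a.sub b).congr_deriv ?_
  simp only [id]; ring

lemma hasDerivAt_symDiff' {γ z : ℝ} (h1 : -1 < z) (h2 : z < 1) :
    HasDerivAt (fun z => γ * ((1 + z) ^ (γ - 1) + (1 - z) ^ (γ - 1)))
      (γ * (γ - 1) * ((1 + z) ^ (γ - 2) - (1 - z) ^ (γ - 2))) z := by
  have a := ((hasDerivAt_id z).const_add 1).rpow_const (p := γ - 1) (Or.inl (by simp; linarith))
  have b := ((hasDerivAt_id z).const_sub 1).rpow_const (p := γ - 1) (Or.inl (by simp; linarith))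
  refine ((a.add b).const_mul γ).congr_deriv ?_
  simp only [id, show γ - 1 - 1 = γ - 2 by ring]; ring

lemma abs_rpow_sub_two_le {γ η : ℝ} (h0 : 0 < γ) (h1 : γ < 1) (hη : 0 < η) (hη2 : η ≤ 1 / 2) :
    |(1 + η) ^ (γ - 2) - (1 - η) ^ (γ - 2)| ≤ 32 * η := by
  obtain ⟨c, hc, hce⟩ := exists_hasDerivAt_eq_slope (fun y : ℝ => y ^ (γ - 2))
    (fun y => (γ - 2) * y ^ (γ - 2 - 1)) (show 1 - η < 1 + η by linarith)
    (fun y hy => (hasDerivAt_rpow_const (Or.inl (by linarith [hy.1]))).continuousAt.continuousWithinAt)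
    (fun y hy => hasDerivAt_rpow_const (Or.inl (by linarith [hy.1])))
  have hc1 : 1 / 2 ≤ c := by linarith [hc.1]
  have e : (1 + η) ^ (γ - 2) - (1 - η) ^ (γ - 2) = (γ - 2) * c ^ (γ - 2 - 1) * (2 * η) := by
    rw [eq_div_iff (by linarith)] at hce
    rw [← hce]; ring
  rw [e, abs_mul, abs_mul, abs_of_neg (by linarith : γ - 2 < 0), abs_of_pos (by linarith : 0 < 2 * η),
    abs_of_pos (rpow_pos_of_pos (by linarith) _)]
  have h8 : c ^ (γ - 2 - 1) ≤ 8 := by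
    calc c ^ (γ - 2 - 1) ≤ (1 / 2 : ℝ) ^ (γ - 2 - 1) :=
          rpow_le_rpow_of_nonpos (by norm_num) hc1 (by linarith)
      _ ≤ (1 / 2 : ℝ) ^ (-3 : ℝ) :=
          rpow_le_rpow_of_exponent_ge (by norm_num) (by norm_num) (by linarith)
      _ = 8 := by rw [rpow_neg (by norm_num)]; norm_num
  have : 0 < c ^ (γ - 2 - 1) := rpow_pos_of_pos (by linarith) _
  have : -(γ - 2) * c ^ (γ - 2 - 1) ≤ 2 * 8 := by
    apply mul_le_mul _ h8 this.le (by norm_num); linarith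
  nlinarith

lemma le_symDiff {γ z : ℝ} (h0 : 0 < γ) (h1 : γ < 1) (hz : 0 < z) (hz2 : z ≤ 1 / 2) :
    γ * z ≤ symDiff γ z := by
  obtain ⟨c, hc, hce⟩ := exists_hasDerivAt_eq_slope (fun y : ℝ => y ^ γ)
    (fun y => γ * y ^ (γ - 1)) (show 1 - z < 1 + z by linarith)
    (fun y hy => (hasDerivAt_rpow_const (Or.inl (by linarith [hy.1]))).continuousAt.continuousWithinAt)
    (fun y hy => hasDerivAt_rpow_const (Or.inl (by linarith [hy.1])))
  have e : symDiff γ z = γ * c ^ (γ - 1) * (2 * z) := by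
    rw [eq_div_iff (by linarith)] at hce
    rw [symDiff, ← hce]; ring
  have hc0 : 0 < c := by linarith [hc.1]
  have : (1 / 2 : ℝ) ≤ c ^ (γ - 1) := by
    calc (1 / 2 : ℝ) = (2 : ℝ) ^ (-1 : ℝ) := by rw [rpow_neg_one]; norm_num
      _ ≤ (2 : ℝ) ^ (γ - 1) := rpow_le_rpow_of_exponent_le (by norm_num) (by linarith)
      _ ≤ c ^ (γ - 1) := rpow_le_rpow_of_nonpos hc0 (by linarith [hc.2]) (by linarith)
  rw [e]
  have : 0 < γ * z := by positivity
  nlinarith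

lemma abs_mul_deriv_symDiff_sub_le {γ z : ℝ} (h0 : 0 < γ) (h1 : γ < 1) (hz : 0 < z)
    (hz2 : z ≤ 1 / 2) :
    |z * (γ * ((1 + z) ^ (γ - 1) + (1 - z) ^ (γ - 1))) - symDiff γ z| ≤ γ * (32 * z ^ 3) := by
  obtain ⟨ξ, hξ, hξe⟩ := exists_hasDerivAt_eq_slope (symDiff γ)
    (fun z => γ * ((1 + z) ^ (γ - 1) + (1 - z) ^ (γ - 1))) hz
    (fun y hy => (hasDerivAt_symDiff (by linarith [hy.1]) (by linarith [hy.2])).continuousAt.continuousWithinAt)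
    (fun y hy => hasDerivAt_symDiff (by linarith [hy.1]) (by linarith [hy.2]))
  obtain ⟨η, hη, hηe⟩ := exists_hasDerivAt_eq_slope
    (fun z => γ * ((1 + z) ^ (γ - 1) + (1 - z) ^ (γ - 1)))
    (fun z => γ * (γ - 1) * ((1 + z) ^ (γ - 2) - (1 - z) ^ (γ - 2))) hξ.2
    (fun y hy => (hasDerivAt_symDiff' (by linarith [hy.1, hξ.1]) (by linarith [hy.2])).continuousAt.continuousWithinAt)
    (fun y hy => hasDerivAt_symDiff' (by linarith [hy.1, hξ.1]) (by linarith [hy.2]))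
  have hs0 : symDiff γ 0 = 0 := by simp [symDiff]
  have hη0 : 0 < η := by linarith [hη.1, hξ.1]
  have hzξ : 0 < z - ξ := by linarith [hξ.2]
  rw [hs0, sub_zero, sub_zero, eq_div_iff hz.ne'] at hξe
  rw [eq_div_iff hzξ.ne'] at hηe
  have e : z * (γ * ((1 + z) ^ (γ - 1) + (1 - z) ^ (γ - 1))) - symDiff γ z =
      z * (γ * (γ - 1) * ((1 + η) ^ (γ - 2) - (1 - η) ^ (γ - 2)) * (z - ξ)) := by
    rw [hηe, ← hξe]; ring
  have hb := abs_rpow_sub_two_le h0 h1 hη0 (by linarith [hη.2])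
  rw [e, abs_mul, abs_mul, abs_mul, abs_mul, abs_of_pos hz, abs_of_pos hzξ, abs_of_pos h0,
    abs_of_neg (by linarith : γ - 1 < 0)]
  have hA := abs_nonneg ((1 + η) ^ (γ - 2) - (1 - η) ^ (γ - 2))
  have h5 : γ * -(γ - 1) * |(1 + η) ^ (γ - 2) - (1 - η) ^ (γ - 2)| ≤ γ * (32 * z) := by
    have : γ * -(γ - 1) ≤ γ := by nlinarith
    exact mul_le_mul this (by linarith [hη.2]) hA h0.le
  calc z * (γ * -(γ - 1) * |(1 + η) ^ (γ - 2) - (1 - η) ^ (γ - 2)| * (z - ξ))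
      ≤ z * (γ * (32 * z) * z) := by
        gcongr
        linarith [hξ.1]
    _ = _ := by ring

/-- The even correction `log (ψ(z)/z)` varies slowly. -/
lemma abs_log_symDiff_sub_le {γ z z' Z : ℝ} (h0 : 0 < γ) (h1 : γ < 1) (hz : 0 < z) (hzZ : z ≤ Z)
    (hz' : 0 < z') (hzZ' : z' ≤ Z) (hZ : Z ≤ 1 / 2) :
    |(log (symDiff γ z) - log z) - (log (symDiff γ z') - log z')| ≤
      32 * Z * |z - z'| := by
  wlog h : z' ≤ z generalizing z z' with Hw
  · rw [abs_sub_comm, abs_sub_comm z]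
    exact Hw hz' hzZ' hz hzZ (by linarith)
  rcases h.eq_or_lt with rfl | h
  · simp
  have hd : ∀ y, 0 < y → y ≤ 1 / 2 → HasDerivAt (fun y => log (symDiff γ y) - log y)
      (γ * ((1 + y) ^ (γ - 1) + (1 - y) ^ (γ - 1)) / symDiff γ y - y⁻¹) y := fun y hy hy2 => by
    have := le_symDiff h0 h1 hy hy2
    have hp : 0 < γ * y := by positivity
    exact ((hasDerivAt_symDiff (by linarith) (by linarith)).log (by linarith)).sub
      (hasDerivAt_log hy.ne')
  obtain ⟨c, hc, hce⟩ := exists_hasDerivAt_eq_slope (fun y => log (symDiff γ y) - log y)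
    _ h
    (fun y hy => (hd y (by linarith [hy.1]) (by linarith [hy.2])).continuousAt.continuousWithinAt)
    (fun y hy => hd y (by linarith [hy.1]) (by linarith [hy.2]))
  have hc0 : 0 < c := by linarith [hc.1]
  have hc2 : c ≤ 1 / 2 := by linarith [hc.2]
  have hzz : 0 < z - z' := by linarith
  rw [eq_div_iff hzz.ne'] at hce
  rw [← hce, abs_mul]
  refine mul_le_mul_of_nonneg_right ?_ (abs_nonneg _)
  have hp : 0 < γ * c := by positivity
  have hs := le_symDiff h0 h1 hc0 hc2
  have hsp : 0 < symDiff γ c := by linarith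
  have e : γ * ((1 + c) ^ (γ - 1) + (1 - c) ^ (γ - 1)) / symDiff γ c - c⁻¹ =
      (c * (γ * ((1 + c) ^ (γ - 1) + (1 - c) ^ (γ - 1))) - symDiff γ c) / (c * symDiff γ c) := by
    field_simp
  rw [e, abs_div, abs_of_pos (by positivity : 0 < c * symDiff γ c), div_le_iff₀ (by positivity)]
  refine (abs_mul_deriv_symDiff_sub_le h0 h1 hc0 hc2).trans ?_
  calc γ * (32 * c ^ 3) = 32 * c * (c * (γ * c)) := by ring
    _ ≤ 32 * Z * (c * symDiff γ c) := by
      have hcZ : c ≤ Z := by linarith [hc.2]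
      have hZ0 : 0 ≤ Z := by linarith
      exact mul_le_mul (by linarith) (mul_le_mul_of_nonneg_left hs hc0.le) (by positivity) (by positivity)

/-- `(n+q)^γ - n^γ` for a pair `(q, n)`. -/
noncomputable def shiftDiff (γ : ℝ) (p : ℕ × ℕ) : ℝ := ((p.2 : ℝ) + p.1) ^ γ - (p.2 : ℝ) ^ γ

lemma shiftDiff_eq {γ : ℝ} {q n : ℕ} (hn : 0 < n) :
    shiftDiff γ (q, n) = ((2 * n + q : ℝ) / 2) ^ γ * symDiff γ (q / (2 * n + q)) := by
  have hn' : (0 : ℝ) < n := mod_cast hn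
  have hp : (0 : ℝ) < 2 * n + q := by positivity
  rw [shiftDiff, symDiff, mul_sub, ← mul_rpow (by positivity) (by positivity),
    ← mul_rpow (by positivity)]
  · congr 2
    · field_simp; ring
    · field_simp; ring
  · rw [sub_nonneg, div_le_one hp]; linarith

/-- `log ((n+q)^γ - n^γ)` up to a constant, with its main term made explicit. -/
noncomputable def evenCorr (γ : ℝ) (q n : ℕ) : ℝ :=
  log (symDiff γ (q / (2 * n + q))) - log ((q : ℝ) / (2 * n + q))

lemma log_shiftDiff {γ : ℝ} (h0 : 0 < γ) (h1 : γ < 1) {q n : ℕ} (hq : 0 < q) (hn : 0 < n)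
    (hqn : q ≤ 2 * n) :
    log (shiftDiff γ (q, n)) = -γ * log 2 + log q -
      (1 - γ) * log (2 * n + q) + evenCorr γ q n := by
  have hq' : (0 : ℝ) < q := mod_cast hq
  have hp : (0 : ℝ) < 2 * n + q := by positivity
  have hqn' : (q : ℝ) ≤ 2 * n := mod_cast hqn
  have hz2 : (q : ℝ) / (2 * n + q) ≤ 1 / 2 := by
    rw [div_le_div_iff₀ hp (by norm_num)]; linarith
  have hs := le_symDiff h0 h1 (show 0 < (q : ℝ) / (2 * n + q) by positivity) hz2
  have hs0 : 0 < γ * ((q : ℝ) / (2 * n + q)) := by positivity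
  rw [shiftDiff_eq hn, log_mul (by positivity) (by linarith), log_rpow (by positivity),
    log_div hp.ne' (by norm_num), evenCorr, log_div hq'.ne' hp.ne']
  ring

lemma evenCorr_arg {Q N q n : ℕ} (hN : 0 < N) (hq : Q ≤ q) (hq2 : q < 2 * Q) (hn : N ≤ n) :
    0 < (q : ℝ) / (2 * n + q) ∧ (q : ℝ) / (2 * n + q) ≤ (Q : ℝ) / N := by
  have h1 : (0 : ℝ) < q := mod_cast (by omega : 0 < q)
  have h2 : (N : ℝ) ≤ n := mod_cast hn
  have h3 : (0 : ℝ) < N := mod_cast hN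
  have h4 : (q : ℝ) ≤ 2 * Q := mod_cast hq2.le
  refine ⟨by positivity, ?_⟩
  rw [div_le_div_iff₀ (by positivity) h3]
  nlinarith

lemma abs_evenCorr_sub_le {γ : ℝ} (h0 : 0 < γ) (h1 : γ < 1) {Q N q n q' n' : ℕ} (hQ : 0 < Q)
    (hN : 0 < N) (hQN : (Q : ℝ) / N ≤ 1 / 2) (hq : Q ≤ q) (hq2 : q < 2 * Q) (hn : N ≤ n)
    (hq' : Q ≤ q') (hq2' : q' < 2 * Q) (hn' : N ≤ n') :
    |evenCorr γ q n - evenCorr γ q' n'| ≤ 32 * ((Q : ℝ) / N) ^ 2 := by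
  obtain ⟨a1, a2⟩ := evenCorr_arg hN hq hq2 hn
  obtain ⟨b1, b2⟩ := evenCorr_arg hN hq' hq2' hn'
  refine (abs_log_symDiff_sub_le h0 h1 a1 a2 b1 b2 hQN).trans ?_
  rw [sq, ← mul_assoc]
  refine mul_le_mul_of_nonneg_left ?_ (by positivity)
  rw [abs_le]; constructor <;> linarith

lemma abs_evenCorr_sub_le' {γ : ℝ} (h0 : 0 < γ) (h1 : γ < 1) {Q N q n m : ℕ} (hQ : 0 < Q)
    (hN : 0 < N) (hQN : (Q : ℝ) / N ≤ 1 / 2) (hq : Q ≤ q) (hq2 : q < 2 * Q) (hn : N ≤ n)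
    (hm : N ≤ m) :
    |evenCorr γ q n - evenCorr γ q m| ≤ 32 * ((Q : ℝ) / N) ^ 2 * (|(n : ℝ) - m| / N) := by
  obtain ⟨a1, a2⟩ := evenCorr_arg hN hq hq2 hn
  obtain ⟨b1, b2⟩ := evenCorr_arg hN hq hq2 hm
  refine (abs_log_symDiff_sub_le h0 h1 a1 a2 b1 b2 hQN).trans ?_
  have hq' : (0 : ℝ) < q := mod_cast (by omega : 0 < q)
  have hn' : (N : ℝ) ≤ n := mod_cast hn
  have hm' : (N : ℝ) ≤ m := mod_cast hm
  have h4 : (q : ℝ) ≤ 2 * Q := mod_cast hq2.le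
  have e : (q : ℝ) / (2 * n + q) - q / (2 * m + q) = q * (2 * (m - n)) / ((2 * n + q) * (2 * m + q)) := by
    field_simp; ring
  rw [e, abs_div, abs_mul, abs_mul, abs_of_pos hq', abs_of_pos (by positivity : (0 : ℝ) < 2),
    abs_of_pos (by positivity : (0 : ℝ) < (2 * n + q) * (2 * m + q)), abs_sub_comm (m : ℝ)]
  rw [sq, ← mul_assoc 32, mul_assoc (32 * ((Q : ℝ) / N))]
  refine mul_le_mul_of_nonneg_left ?_ (by positivity)
  rw [div_mul_div_comm]
  have hd : (2 * N) * (2 * N) ≤ (2 * (n : ℝ) + q) * (2 * m + q) := by gcongr <;> linarith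
  calc (q : ℝ) * (2 * |(n : ℝ) - m|) / ((2 * n + q) * (2 * m + q))
      ≤ (2 * Q) * (2 * |(n : ℝ) - m|) / ((2 * N) * (2 * N)) := by gcongr
    _ = _ := by field_simp

lemma abs_log_sub_bounds {q n m N : ℕ} (hN : 0 < N) (hn : N ≤ n) (hn2 : n < 2 * N) (hm : N ≤ m)
    (hm2 : m < 2 * N) (hq : q ≤ 2 * N) :
    |(m : ℝ) - n| / (3 * N) ≤ |log (2 * m + q) - log (2 * n + q)| ∧
    |log (2 * m + q) - log (2 * n + q)| ≤ |(m : ℝ) - n| / N := by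
  have hN' : (0 : ℝ) < N := mod_cast hN
  wlog h : n ≤ m generalizing n m with Hw
  · rw [abs_sub_comm (m : ℝ), abs_sub_comm (log (2 * m + q))]
    exact Hw hm hm2 hn hn2 (by omega)
  have hq3 : (q : ℝ) ≤ 2 * N := mod_cast hq
  have hn' : (N : ℝ) ≤ n := mod_cast hn
  have hm' : (N : ℝ) ≤ m := mod_cast hm
  have hm3 : (m : ℝ) ≤ 2 * N := mod_cast hm2.le
  have hnm : (n : ℝ) ≤ m := mod_cast h
  have p1 : (0 : ℝ) < 2 * m + q := by linarith
  have p2 : (0 : ℝ) < 2 * n + q := by linarith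
  have hl : log (2 * n + q) ≤ log (2 * m + q) := log_le_log p2 (by linarith)
  rw [abs_of_nonneg (by linarith), abs_of_nonneg (by linarith)]
  have u1 := log_le_sub_one_of_pos (show 0 < (2 * (m : ℝ) + q) / (2 * n + q) by positivity)
  have u2 := one_sub_inv_le_log_of_pos (show 0 < (2 * (m : ℝ) + q) / (2 * n + q) by positivity)
  rw [log_div p1.ne' p2.ne'] at u1 u2
  rw [inv_div] at u2
  constructor
  · refine le_trans ?_ u2
    rw [show 1 - (2 * (n : ℝ) + q) / (2 * m + q) = 2 * (m - n) / (2 * m + q) by field_simp; ring]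
    rw [div_le_div_iff₀ (by positivity) p1]
    have := mul_nonneg (sub_nonneg.2 hnm) (show (0 : ℝ) ≤ 6 * N - (2 * m + q) by linarith)
    linarith
  · refine u1.trans ?_
    rw [show (2 * (m : ℝ) + q) / (2 * n + q) - 1 = 2 * (m - n) / (2 * n + q) by field_simp; ring]
    rw [div_le_div_iff₀ p2 hN']
    have := mul_nonneg (sub_nonneg.2 hnm) (show (0 : ℝ) ≤ (2 * n + q) - 2 * N by linarith)
    linarith

/-- For fixed `q` the values `log ((n+q)^γ - n^γ)` are separated. -/
lemma shiftDiff_separated {γ : ℝ} (h0 : 0 < γ) (h1 : γ < 1) {Q N q n m : ℕ} (hQ : 0 < Q)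
    (hN : 0 < N) (hQN : 32 * ((Q : ℝ) / N) ^ 2 ≤ (1 - γ) / 100) (hQ2 : 2 * Q ≤ N)
    (hq : Q ≤ q) (hq2 : q < 2 * Q) (hn : N ≤ n) (hn2 : n < 2 * N) (hm : N ≤ m) (hm2 : m < 2 * N) :
    3 / 10 * (1 - γ) * (|(n : ℝ) - m| / N) ≤
      |log (shiftDiff γ (q, n)) - log (shiftDiff γ (q, m))| := by
  have hN' : (0 : ℝ) < N := mod_cast hN
  have hz : (Q : ℝ) / N ≤ 1 / 2 := by
    rw [div_le_div_iff₀ hN' (by norm_num)]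
    have : ((2 * Q : ℕ) : ℝ) ≤ N := mod_cast hQ2
    push_cast at this; linarith
  rw [log_shiftDiff h0 h1 (by omega) (by omega) (by omega),
    log_shiftDiff h0 h1 (by omega) (by omega) (by omega)]
  have e1 := abs_evenCorr_sub_le' h0 h1 hQ hN hz hq hq2 hn hm
  have e2 := (abs_log_sub_bounds (q := q) hN hn hn2 hm hm2 (by omega)).1
  set A := log (2 * (m : ℝ) + q) - log (2 * n + q) with hA
  set E := evenCorr γ q n - evenCorr γ q m with hE
  have e3 : -γ * log 2 + log q - (1 - γ) * log (2 * n + q) + evenCorr γ q n -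
      (-γ * log 2 + log q - (1 - γ) * log (2 * m + q) + evenCorr γ q m) =
      (1 - γ) * A + E := by rw [hA, hE]; ring
  rw [e3]
  have e4 : |(1 - γ) * A| - |E| ≤ |(1 - γ) * A + E| := by
    have := abs_sub_abs_le_abs_sub ((1 - γ) * A) (-E)
    rwa [abs_neg, sub_neg_eq_add] at this
  rw [abs_mul, abs_of_pos (by linarith : 0 < 1 - γ)] at e4
  rw [abs_sub_comm (m : ℝ)] at e2
  set r := |(n : ℝ) - m| / N with hr
  have hr0 : 0 ≤ r := by positivity
  have e5 : |(n : ℝ) - m| / (3 * N) = r / 3 := by rw [hr]; field_simp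
  rw [e5] at e2
  have e6 : 32 * ((Q : ℝ) / N) ^ 2 * r ≤ (1 - γ) / 100 * r := mul_le_mul_of_nonneg_right hQN hr0
  have e7 := mul_le_mul_of_nonneg_left e2 (show 0 ≤ 1 - γ by linarith)
  have e8 : 0 ≤ (1 - γ) * r := mul_nonneg (by linarith) hr0
  linarith

/-- `|b - c| ≤ R |log b - log c|` for `b, c ∈ (0, R]`. -/
lemma abs_sub_le_mul_abs_log_sub {b c R : ℝ} (hb : 0 < b) (hc : 0 < c) (hbR : b ≤ R) (hcR : c ≤ R) :
    |b - c| ≤ R * |log b - log c| := by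
  wlog h : c ≤ b generalizing b c with Hw
  · rw [abs_sub_comm, abs_sub_comm (log b)]
    exact Hw hc hb hcR hbR (by linarith)
  have hl : log c ≤ log b := log_le_log hc h
  rw [abs_of_nonneg (by linarith), abs_of_nonneg (by linarith)]
  have u2 := one_sub_inv_le_log_of_pos (show 0 < b / c by positivity)
  rw [log_div hb.ne' hc.ne', inv_div] at u2
  have := mul_le_mul_of_nonneg_left u2 hb.le
  have e : b * (1 - c / b) = b - c := by field_simp
  rw [e] at this
  exact this.trans (mul_le_mul_of_nonneg_right hbR (by linarith))

/-- `|log b - log c| ≤ |b - c| / r` for `b, c ≥ r > 0`. -/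
lemma abs_log_sub_le_div {b c r : ℝ} (hr : 0 < r) (hb : r ≤ b) (hc : r ≤ c) :
    |log b - log c| ≤ |b - c| / r := by
  wlog h : c ≤ b generalizing b c with Hw
  · rw [abs_sub_comm, abs_sub_comm b]
    exact Hw hc hb (by linarith)
  have hb0 : 0 < b := by linarith
  have hc0 : 0 < c := by linarith
  have hl : log c ≤ log b := log_le_log hc0 h
  rw [abs_of_nonneg (by linarith), abs_of_nonneg (by linarith)]
  have u1 := log_le_sub_one_of_pos (show 0 < b / c by positivity)
  rw [log_div hb0.ne' hc0.ne'] at u1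
  refine u1.trans ?_
  rw [show b / c - 1 = (b - c) / c by field_simp]
  exact div_le_div_of_nonneg_left (by linarith) hr hc

lemma log_ratio_bounds {N n m q : ℕ} {κ : ℝ} (hN : 0 < N) (hn : N ≤ n) (hn2 : n < 2 * N) (hm2 : m < 2 * N)
    (hq : q ≤ 2 * N) (hκ0 : 0 < κ) (hκ : κ ≤ 4 * ((m : ℝ) - n)) :
    κ / (12 * N) ≤ 2 * ((m : ℝ) - n) / (2 * n + q) ∧
    log (1 + 2 * ((m : ℝ) - n) / (2 * n + q)) = log (2 * m + q) - log (2 * n + q) ∧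
    1 + 2 * ((m : ℝ) - n) / (2 * n + q) ≤ 3 ∧
    log (2 * ((m : ℝ) - n) / (2 * n + q)) = log 2 + log ((m : ℝ) - n) - log (2 * n + q) := by
  have h1 : (0 : ℝ) < N := mod_cast hN
  have h2 : (N : ℝ) ≤ n := mod_cast hn
  have h3 : (n : ℝ) ≤ 2 * N := mod_cast hn2.le
  have h4 : (m : ℝ) ≤ 2 * N := mod_cast hm2.le
  have h5 : (q : ℝ) ≤ 2 * N := mod_cast hq
  have h6 : (0 : ℝ) ≤ q := Nat.cast_nonneg q
  have pn : (0 : ℝ) < 2 * n + q := by linarith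
  have pm : (0 : ℝ) < 2 * m + q := by linarith
  have e : 1 + 2 * ((m : ℝ) - n) / (2 * n + q) = (2 * m + q) / (2 * n + q) := by field_simp; ring
  refine ⟨?_, by rw [e, log_div pm.ne' pn.ne'], by rw [e, div_le_iff₀ pn]; linarith, ?_⟩
  · rw [div_le_div_iff₀ (by positivity) pn]
    calc κ * (2 * n + q) ≤ 4 * ((m : ℝ) - n) * (6 * N) := mul_le_mul hκ (by linarith) pn.le (by linarith)
      _ = _ := by ring
  · rw [log_div (by linarith) pn.ne', log_mul (by norm_num) (by linarith)]

set_option maxHeartbeats 1000000 in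
/-- Two solutions `(n, n')`, `(n+k, n'+k')` for the same `(q, q')` force `k'/k` to be close to a
power of `q'/q`. -/
lemma gap_ratio {γ : ℝ} (h0 : 0 < γ) (h1 : γ < 1) {Q N q q' n n' m m' : ℕ} {Δ : ℝ} (hQ : 0 < Q)
    (hN : 0 < N) (hQN : 32 * ((Q : ℝ) / N) ^ 2 ≤ (1 - γ) / 100) (hQ2 : 2 * Q ≤ N)
    (hΔ0 : 0 ≤ Δ) (hΔ : 2 * (Δ * N) ≤ (1 - γ) / 100)
    (hq : Q ≤ q) (hq2 : q < 2 * Q) (hq' : Q ≤ q') (hq2' : q' < 2 * Q)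
    (hn : N ≤ n) (hn2 : n < 2 * N) (hm : n < m) (hm2 : m < 2 * N)
    (hn' : N ≤ n') (hn2' : n' < 2 * N) (hm' : N ≤ m') (hm2' : m' < 2 * N)
    (s1 : |log (shiftDiff γ (q, n)) - log (shiftDiff γ (q', n'))| ≤ Δ)
    (s2 : |log (shiftDiff γ (q, m)) - log (shiftDiff γ (q', m'))| ≤ Δ) :
    n' < m' ∧ m' - n' ≤ 4 * (m - n) ∧
    |(log ((m - n : ℕ) : ℝ) - log ((m' - n' : ℕ) : ℝ)) -
      1 / (1 - γ) * (log q - log q')| ≤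
      6000 / (1 - γ) * (Δ * N / ((m - n : ℕ) : ℝ) + ((Q : ℝ) / N) ^ 2) := by
  have hθ : 0 < 1 - γ := by linarith
  have hN' : (0 : ℝ) < N := mod_cast hN
  have hz : (Q : ℝ) / N ≤ 1 / 2 := by
    rw [div_le_div_iff₀ hN' (by norm_num)]
    have : ((2 * Q : ℕ) : ℝ) ≤ N := mod_cast hQ2
    push_cast at this; linarith
  set θ := 1 - γ
  set Z2 := ((Q : ℝ) / N) ^ 2 with hZ2
  rw [log_shiftDiff h0 h1 (by omega) (by omega) (by omega),
    log_shiftDiff h0 h1 (by omega) (by omega) (by omega)] at s1 s2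
  have eE := abs_evenCorr_sub_le h0 h1 hQ hN hz hq hq2 hn hq' hq2' hn'
  have eE1 := abs_evenCorr_sub_le' h0 h1 hQ hN hz hq hq2 (show N ≤ m by omega) hn
  have eE2 := abs_evenCorr_sub_le' h0 h1 hQ hN hz hq' hq2' hm' hn'
  have bA := abs_log_sub_bounds (q := q) hN hn hn2 (show N ≤ m by omega) hm2 (by omega)
  have bA' := abs_log_sub_bounds (q := q') hN hn' hn2' hm' hm2' (by omega)
  rw [← hZ2] at eE eE1 eE2
  set k : ℝ := (m : ℝ) - n with hk
  set k' : ℝ := (m' : ℝ) - n' with hk'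
  have hk1 : 1 ≤ k := by
    have : (n : ℝ) + 1 ≤ m := mod_cast hm
    rw [hk]; linarith
  have hkN : k ≤ N := by
    have : (m : ℝ) ≤ 2 * N := mod_cast hm2.le
    have : (N : ℝ) ≤ n := mod_cast hn
    rw [hk]; linarith
  rw [abs_of_pos (by linarith : 0 < k)] at eE1 bA
  set ln := log (2 * (n : ℝ) + q)
  set lm := log (2 * (m : ℝ) + q)
  set ln' := log (2 * (n' : ℝ) + q')
  set lm' := log (2 * (m' : ℝ) + q')
  have hApos : ln ≤ lm := by
    apply log_le_log
    · have : (0 : ℝ) < n := mod_cast (by omega : 0 < n)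
      positivity
    · have : (n : ℝ) ≤ m := mod_cast hm.le
      linarith
  rw [abs_of_nonneg (by linarith : 0 ≤ lm - ln)] at bA
  -- difference of the two relations
  have d1 : θ * |(lm - ln) - (lm' - ln')| ≤ 2 * Δ + 32 * Z2 * (k / N) + 32 * Z2 * (|k'| / N) := by
    have e : θ * |(lm - ln) - (lm' - ln')| = |(θ * lm - θ * ln) - (θ * lm' - θ * ln')| := by
      rw [← mul_sub, ← mul_sub, ← mul_sub, abs_mul, abs_of_pos hθ]
    rw [e]
    rw [abs_le] at s1 s2 eE1 eE2 ⊢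
    constructor <;> linarith
  set ε := |(lm - ln) - (lm' - ln')|
  have d2 : |k'| / (3 * N) ≤ k / N + ε := by
    have : |lm' - ln'| ≤ |lm - ln| + ε := by
      have := abs_sub_abs_le_abs_sub (lm' - ln') (lm - ln)
      rw [abs_sub_comm (lm' - ln') (lm - ln)] at this
      linarith
    rw [abs_of_nonneg (by linarith : 0 ≤ lm - ln)] at this
    linarith [bA'.1, bA.2]
  have hΔk : 2 * (Δ * N) ≤ θ / 100 * k :=
    hΔ.trans (le_mul_of_one_le_right (by positivity) hk1)
  -- multiply by `N`
  set εN := ε * N with hεN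
  have d1' : θ * εN ≤ 2 * (Δ * N) + 32 * Z2 * k + 32 * Z2 * |k'| := by
    have := mul_le_mul_of_nonneg_right d1 hN'.le
    have e1 : k / N * N = k := by field_simp
    have e2 : |k'| / N * N = |k'| := by field_simp
    rw [hεN]
    calc θ * (ε * N) = θ * ε * N := by ring
      _ ≤ _ := this
      _ = 2 * (Δ * N) + 32 * Z2 * (k / N * N) + 32 * Z2 * (|k'| / N * N) := by ring
      _ = _ := by rw [e1, e2]
  have d2' : |k'| / 3 ≤ k + εN := by
    have := mul_le_mul_of_nonneg_right d2 hN'.le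
    have e1 : |k'| / (3 * N) * N = |k'| / 3 := by field_simp
    have e2 : (k / N + ε) * N = k + εN := by rw [hεN]; field_simp
    rwa [e1, e2] at this
  have hk'0 := abs_nonneg k'
  have hεN1 : εN ≤ 2 / 100 * k + 1 / 100 * |k'| := by
    have c1 : 32 * Z2 * k ≤ θ / 100 * k := mul_le_mul_of_nonneg_right hQN (by linarith)
    have c2 : 32 * Z2 * |k'| ≤ θ / 100 * |k'| := mul_le_mul_of_nonneg_right hQN hk'0
    have : θ * εN ≤ θ * (2 / 100 * k + 1 / 100 * |k'|) := by linarith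
    exact le_of_mul_le_mul_left this hθ
  have hk'4 : |k'| ≤ 4 * k := by linarith
  have hεN2 : εN ≤ 6 / 100 * k := by linarith
  have hA' : k / 4 / N ≤ lm' - ln' := by
    have a1 := bA.1
    have a2 : lm - ln - (lm' - ln') ≤ ε := le_abs_self _
    have a3 : ε ≤ 6 / 100 * k / N := by rw [le_div_iff₀ hN']; exact hεN2
    have a4 : k / (3 * N) = k / 3 / N := by field_simp
    rw [a4] at a1
    have a5 : k / 4 / N ≤ k / 3 / N - 6 / 100 * k / N := by
      rw [← sub_div]; gcongr; linarith
    linarith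
  have hk'pos : 0 < k' := by
    by_contra hcon
    have : lm' ≤ ln' := by
      apply log_le_log
      · have : (0 : ℝ) < m' := mod_cast (by omega : 0 < m')
        positivity
      · rw [hk'] at hcon; linarith
    have : 0 < k / 4 / N := by positivity
    linarith
  have hnm' : n' < m' := by
    have : (n' : ℝ) < m' := by rw [hk'] at hk'pos; linarith
    exact_mod_cast this
  rw [abs_of_pos hk'pos] at *
  have hk'low : k / 4 ≤ k' := by
    have := hA'.trans ((le_abs_self _).trans bA'.2)
    rwa [div_le_div_iff_of_pos_right hN'] at this
  have ck : ((m - n : ℕ) : ℝ) = k := by rw [Nat.cast_sub hm.le]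
  have ck' : ((m' - n' : ℕ) : ℝ) = k' := by rw [Nat.cast_sub hnm'.le]
  refine ⟨hnm', ?_, ?_⟩
  · have : ((m' - n' : ℕ) : ℝ) ≤ ((4 * (m - n) : ℕ) : ℝ) := by
      rw [ck']; push_cast [ck]; exact hk'4
    exact_mod_cast this
  rw [ck, ck']
  obtain ⟨a_low, l1, u3, la⟩ := log_ratio_bounds (κ := k) hN hn hn2 hm2 (q := q) (by omega) (by linarith) (by linarith)
  obtain ⟨a_low', l1', u3', la'⟩ := log_ratio_bounds (κ := k) hN hn' hn2' hm2' (q := q') (by omega) (by linarith)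
    (by linarith)
  rw [← hk] at a_low l1 u3 la
  rw [← hk'] at a_low' l1' u3' la'
  set a := 2 * k / (2 * n + q)
  set a' := 2 * k' / (2 * n' + q')
  have hr0 : 0 < k / (12 * N) := by positivity
  have f1 : |a - a'| ≤ 3 * ε := by
    have := abs_sub_le_mul_abs_log_sub (show 0 < 1 + a by linarith) (show 0 < 1 + a' by linarith) u3 u3'
    rw [l1, l1'] at this
    rwa [show 1 + a - (1 + a') = a - a' by ring] at this
  have f2 : |log a - log a'| ≤ 36 * εN / k := by
    refine (abs_log_sub_le_div hr0 a_low a_low').trans ?_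
    calc |a - a'| / (k / (12 * N)) ≤ 3 * ε / (k / (12 * N)) := by gcongr
      _ = 36 * εN / k := by rw [hεN]; field_simp; ring
  rw [la, la'] at f2
  -- the first-order relation
  have g1 : |(ln - ln') - 1 / θ * (log q - log q')| ≤ (Δ + 32 * Z2) / θ := by
    have : |θ * ((ln - ln') - 1 / θ * (log q - log q'))| ≤ Δ + 32 * Z2 := by
      rw [mul_sub θ (ln - ln'), ← mul_assoc, mul_one_div_cancel hθ.ne', one_mul, mul_sub θ]
      rw [abs_le] at s1 eE ⊢
      constructor <;> linarith
    rw [abs_mul, abs_of_pos hθ] at this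
    rw [le_div_iff₀ hθ]; linarith
  have g2 : εN ≤ (2 * (Δ * N) + 160 * Z2 * k) / θ := by
    rw [le_div_iff₀ hθ]
    have : 32 * Z2 * k' ≤ 32 * Z2 * (4 * k) := by gcongr
    linarith
  have g3 : 36 * εN / k ≤ 36 / θ * (2 * (Δ * N / k) + 160 * Z2) := by
    rw [div_le_iff₀ (by linarith)]
    calc 36 * εN ≤ 36 * ((2 * (Δ * N) + 160 * Z2 * k) / θ) := by linarith
      _ = _ := by field_simp
  have g4 : Δ ≤ Δ * N / k := by
    rw [le_div_iff₀ (by linarith)]; exact mul_le_mul_of_nonneg_left hkN hΔ0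
  have g5 : (Δ + 32 * Z2) / θ ≤ 1 / θ * (Δ * N / k + 32 * Z2) := by
    rw [div_eq_mul_one_div, mul_comm]; gcongr
  calc |(log k - log k') - 1 / θ * (log q - log q')|
      = |(log 2 + log k - ln - (log 2 + log k' - ln')) +
          ((ln - ln') - 1 / θ * (log q - log q'))| := by congr 1; ring
    _ ≤ 36 * εN / k + (Δ + 32 * Z2) / θ := (abs_add_le _ _).trans (add_le_add f2 g1)
    _ ≤ 36 / θ * (2 * (Δ * N / k) + 160 * Z2) + 1 / θ * (Δ * N / k + 32 * Z2) := by linarith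
    _ ≤ _ := by
      have e : 6000 / θ * (Δ * N / k + Z2) - (36 / θ * (2 * (Δ * N / k) + 160 * Z2) +
        1 / θ * (Δ * N / k + 32 * Z2)) = 1 / θ * (5927 * (Δ * N / k) + 208 * Z2) := by ring
      have : 0 ≤ 1 / θ * (5927 * (Δ * N / k) + 208 * Z2) := by positivity
      linarith

/-- The elements of `S` whose successor in `S`, if any, is at distance at least `K`. -/
def gapSet (S : Finset ℕ) (K : ℕ) : Finset ℕ := S.filter (fun n => ∀ m ∈ S, n < m → n + K ≤ m)

lemma card_gapSet_le {S : Finset ℕ} {N K : ℕ} (hK : 0 < K) (hS : S ⊆ Ico N (2 * N)) :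
    ((gapSet S K).card : ℝ) ≤ (N : ℝ) / K + 1 := by
  have hK' : (0 : ℝ) < K := mod_cast hK
  refine card_le_of_separated (gapSet S K) (fun n : ℕ => (n : ℝ)) (u := N) hK' (Nat.cast_nonneg N) ?_ ?_
  · have key : ∀ y ∈ gapSet S K, ∀ y' ∈ gapSet S K, y < y' → (K : ℝ) ≤ |(y : ℝ) - y'| := fun y hy y' hy' h => by
      simp only [gapSet, mem_filter] at hy hy'
      have : ((y + K : ℕ) : ℝ) ≤ y' := mod_cast hy.2 y' hy'.1 h
      push_cast at this
      rw [abs_sub_comm, abs_of_nonneg (by linarith)]; linarith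
    intro y hy y' hy' hne
    rcases lt_or_gt_of_ne hne with h | h
    · exact key y hy y' hy' h
    · rw [abs_sub_comm]; exact key y' hy' y hy h
  · intro y hy
    have := mem_Ico.1 (hS (mem_filter.1 hy).1)
    have h2 : (y : ℝ) ≤ ((2 * N : ℕ) : ℝ) := mod_cast this.2.le
    push_cast at h2
    exact ⟨mod_cast this.1, by linarith⟩

/-- The elements of `S` whose successor is at distance in `[2^j, 2^(j+1))`. -/
def dyadicGap (S : Finset ℕ) (j : ℕ) : Finset ℕ :=
  (gapSet S (2 ^ j)).filter (fun n => ∃ m ∈ S, n + 2 ^ j ≤ m ∧ m < n + 2 ^ (j + 1))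

lemma card_le_gapSet_add (S : Finset ℕ) (J : ℕ) :
    S.card ≤ (gapSet S (2 ^ J)).card + ∑ j ∈ range J, (dyadicGap S j).card := by
  induction J with
  | zero =>
    simp only [pow_zero, range_zero, sum_empty, add_zero]
    refine card_le_card fun n hn => ?_
    simp only [gapSet, mem_filter]
    exact ⟨hn, fun m _ h => h⟩
  | succ J ih =>
    have h : (gapSet S (2 ^ J)).card ≤ (gapSet S (2 ^ (J + 1))).card + (dyadicGap S J).card := by
      refine (card_le_card ?_).trans (card_union_le _ _)
      intro n hn
      rw [mem_union]
      by_cases hc : ∃ m ∈ S, n + 2 ^ J ≤ m ∧ m < n + 2 ^ (J + 1)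
      · right; exact mem_filter.2 ⟨hn, hc⟩
      · left
        have hn' := mem_filter.1 hn
        refine mem_filter.2 ⟨hn'.1, fun m hm hnm => ?_⟩
        by_contra hcon
        exact hc ⟨m, hm, hn'.2 m hm hnm, by omega⟩
    rw [sum_range_succ]; omega

open scoped Classical in
/-- The `n` for which `log t(q,n)` is close to some `log t(q',n')`. -/
noncomputable def closeShift (γ Δ : ℝ) (N q q' : ℕ) : Finset ℕ :=
  (Ico N (2 * N)).filter (fun n => ∃ n' ∈ Ico N (2 * N),
    |log (shiftDiff γ (q, n)) - log (shiftDiff γ (q', n'))| ≤ Δ)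

lemma closeShift_subset (γ Δ : ℝ) (N q q' : ℕ) : closeShift γ Δ N q q' ⊆ Ico N (2 * N)  := fun n hn => by
  simp only [closeShift, mem_filter] at hn
  exact hn.1

lemma sum_card_dyadicGap_le {γ : ℝ} (h0 : 0 < γ) (h1 : γ < 1) {Q N : ℕ} {Δ : ℝ} (hQ : 0 < Q)
    (hN : 0 < N) (hQN : 32 * ((Q : ℝ) / N) ^ 2 ≤ (1 - γ) / 100) (hQ2 : 2 * Q ≤ N)
    (hΔ0 : 0 ≤ Δ) (hΔ : 2 * (Δ * N) ≤ (1 - γ) / 100) {j : ℕ} (hj : 2 ^ j * Q ≤ N) :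
    (∑ r ∈ Ico Q (2 * Q) ×ˢ Ico Q (2 * Q), ((dyadicGap (closeShift γ Δ N r.1 r.2) j).card : ℝ)) ≤
      10 ^ 9 / (1 - γ) * ((1 + log (16 * N)) ^ 2 * ((N : ℝ) * Q) + Δ * N ^ 2 * Q ^ 2 + Q ^ 3) := by
  classical
  have hθ : 0 < 1 - γ := by linarith
  have hN' : (0 : ℝ) < N := mod_cast hN
  have hQ' : (0 : ℝ) < Q := mod_cast hQ
  set R := Ico Q (2 * Q) ×ˢ Ico Q (2 * Q) with hR
  set η := 6000 / (1 - γ) * (Δ * N / 2 ^ j + ((Q : ℝ) / N) ^ 2) with hη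
  have hη0 : 0 ≤ η := by positivity
  set T := R.sigma (fun r => dyadicGap (closeShift γ Δ N r.1 r.2) j) with hT
  have hTcard : (∑ r ∈ R, ((dyadicGap (closeShift γ Δ N r.1 r.2) j).card : ℝ)) = T.card := by
    rw [hT, card_sigma]; push_cast; rfl
  -- every element of `T` yields a close quadruple
  have hex : ∀ t : (_ : ℕ × ℕ) × ℕ, ∃ k : ℕ × ℕ, t ∈ T →
      (k, (t.1.1, t.1.2)) ∈ closeQuads (1 / (1 - γ)) η 1 (8 * 2 ^ j) (2 * Q) := by
    rintro ⟨⟨q, q'⟩, n⟩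
    by_cases ht : (⟨(q, q'), n⟩ : (_ : ℕ × ℕ) × ℕ) ∈ T
    swap
    · exact ⟨(0, 0), fun h => absurd h ht⟩
    have ht' := ht
    simp only [hT, mem_sigma, hR, mem_product, mem_Ico, dyadicGap, mem_filter, gapSet] at ht'
    obtain ⟨⟨⟨a1, a2⟩, a3, a4⟩, ⟨hnS, -⟩, m, hmS, b1, b2⟩ := ht'
    simp only [closeShift, mem_filter, mem_Ico] at hnS hmS
    obtain ⟨⟨c1, c2⟩, n', ⟨c3, c4⟩, s1⟩ := hnS
    obtain ⟨⟨d1, d2⟩, m', ⟨d3, d4⟩, s2⟩ := hmS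
    rw [pow_succ] at b2
    obtain ⟨g1, g2, g3⟩ := gap_ratio h0 h1 hQ hN hQN hQ2 hΔ0 hΔ a1 a2 a3 a4 c1 c2 (by omega : n < m) d2 c3 c4 d3 d4 s1 s2
    refine ⟨(m - n, m' - n'), fun _ => ?_⟩
    simp only [closeQuads, mem_filter, mem_product, mem_Icc]
    refine ⟨⟨⟨⟨by omega, by omega⟩, by omega, by omega⟩, ⟨by omega, by omega⟩, by omega, by omega⟩, ?_, ?_⟩
    · exact_mod_cast Nat.gcd_pos_of_pos_left _ (by omega)
    · refine g3.trans ?_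
      have : ((2 : ℝ)) ^ j ≤ ((m - n : ℕ) : ℝ) := mod_cast (by omega : 2 ^ j ≤ m - n)
      rw [hη]; gcongr
  choose κ hκ using hex
  have hfib : T.card ≤ (⌊(N : ℝ) / 2 ^ j + 1⌋₊) *
      (closeQuads (1 / (1 - γ)) η 1 (8 * 2 ^ j) (2 * Q)).card := by
    refine card_le_mul_card_image_of_maps_to (f := fun t => (κ t, (t.1.1, t.1.2))) (fun t ht => hκ t ht) _ ?_
    rintro ⟨k, q, q'⟩ -
    apply Nat.le_floor
    have := card_gapSet_le (K := 2 ^ j) (by positivity) (closeShift_subset γ Δ N q q')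
    push_cast at this
    refine le_trans ?_ this
    norm_cast
    refine card_le_card_of_injOn (fun t => t.2) ?_ ?_
    · rintro ⟨⟨p, p'⟩, n⟩ ht
      simp only [coe_filter, Set.mem_ofPred_eq, Prod.mk.injEq, hT, mem_sigma, dyadicGap, mem_filter] at ht
      obtain ⟨⟨-, h, -⟩, -, rfl, rfl⟩ := ht
      exact h
    · rintro ⟨⟨p, p'⟩, n⟩ ht ⟨⟨r, r'⟩, n'⟩ ht' h
      simp only [coe_filter, Set.mem_ofPred_eq, Prod.mk.injEq] at ht ht' h
      obtain ⟨-, -, rfl, rfl⟩ := ht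
      obtain ⟨-, -, rfl, rfl⟩ := ht'
      subst h; rfl
  rw [hTcard]
  have hcq := card_closeQuads_le (σ := 1 / (1 - γ)) (by positivity) hη0 (le_refl 1) (8 * 2 ^ j) (2 * Q)
  set u : ℝ := 2 ^ j with hu
  have hu1 : 1 ≤ u := one_le_pow₀ (by norm_num)
  have hu0 : 0 < u := by linarith
  have hjR : u * Q ≤ N := by rw [hu]; exact_mod_cast hj
  have hQ1 : (1 : ℝ) ≤ Q := mod_cast hQ
  have huN : u ≤ N := by nlinarith
  set ℒ := 1 + log (16 * N) with hℒ
  have lA : 1 + log ((8 * 2 ^ j : ℕ) : ℝ) ≤ ℒ := by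
    push_cast; rw [← hu, hℒ]
    gcongr; linarith
  have lB : 1 + log ((2 * Q : ℕ) : ℝ) ≤ ℒ := by
    have : ((2 * Q : ℕ) : ℝ) ≤ N := mod_cast hQ2
    rw [hℒ]; gcongr; linarith
  have lA0 : 0 ≤ 1 + log ((8 * 2 ^ j : ℕ) : ℝ) := by
    have := log_natCast_nonneg (8 * 2 ^ j); linarith
  have lB0 : 0 ≤ 1 + log ((2 * Q : ℕ) : ℝ) := by
    have := log_natCast_nonneg (2 * Q); linarith
  have hlog : (1 + log ((8 * 2 ^ j : ℕ) : ℝ)) * (1 + log ((2 * Q : ℕ) : ℝ)) ≤ ℒ ^ 2 := by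
    rw [sq]; exact mul_le_mul lA lB lB0 (lA0.trans lA)
  have hfloor : (⌊(N : ℝ) / u + 1⌋₊ : ℝ) ≤ 2 * (N / u) := by
    refine (Nat.floor_le (by positivity)).trans ?_
    have : 1 ≤ (N : ℝ) / u := by rwa [le_div_iff₀ hu0, one_mul]
    linarith
  have hcq2 : ((closeQuads (1 / (1 - γ)) η 1 (8 * 2 ^ j) (2 * Q)).card : ℝ) ≤
      16 * (16 * u * Q * ℒ ^ 2 + η * 256 * u ^ 2 * Q ^ 2) := by
    refine hcq.trans ?_
    have e : 8 + 8 / (1 / (1 - γ)) ≤ 16 := by rw [div_div_eq_mul_div]; linarith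
    refine mul_le_mul e ?_ ?_ (by norm_num)
    · push_cast at hlog ⊢
      rw [← hu] at hlog ⊢
      have : 8 * u * (2 * Q) * ((1 + log (8 * u)) * (1 + log (2 * Q))) ≤ 8 * u * (2 * Q) * ℒ ^ 2 := by
        gcongr
      rw [div_one]
      nlinarith [this]
    · have : 0 ≤ (1 + log ((8 * 2 ^ j : ℕ) : ℝ)) * (1 + log ((2 * Q : ℕ) : ℝ)) := mul_nonneg lA0 lB0
      positivity
  have hfin : (T.card : ℝ) ≤ 2 * (N / u) * (16 * (16 * u * Q * ℒ ^ 2 + η * 256 * u ^ 2 * Q ^ 2)) := by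
    have : (T.card : ℝ) ≤ (⌊(N : ℝ) / u + 1⌋₊ : ℝ) *
      (closeQuads (1 / (1 - γ)) η 1 (8 * 2 ^ j) (2 * Q)).card := mod_cast hfib
    refine this.trans ?_
    gcongr
  refine hfin.trans ?_
  have e : 2 * (N / u) * (16 * (16 * u * Q * ℒ ^ 2 + η * 256 * u ^ 2 * Q ^ 2)) =
      512 * (ℒ ^ 2 * (N * Q)) + 8192 * 6000 / (1 - γ) * (Δ * N ^ 2 * Q ^ 2 + (u * Q) * Q ^ 3 / N) := by
    rw [hη]; field_simp; ring
  rw [e]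
  have f1 : (u * Q) * (Q : ℝ) ^ 3 / N ≤ Q ^ 3 := by
    rw [div_le_iff₀ hN', mul_comm]; gcongr
  have f2 : 512 * (ℒ ^ 2 * ((N : ℝ) * Q)) ≤ 10 ^ 9 / (1 - γ) * (ℒ ^ 2 * (N * Q)) := by
    gcongr
    rw [le_div_iff₀ hθ]; linarith
  have f3 : 8192 * 6000 / (1 - γ) * (Δ * N ^ 2 * Q ^ 2 + (u * Q) * Q ^ 3 / N) ≤
      10 ^ 9 / (1 - γ) * (Δ * N ^ 2 * Q ^ 2 + Q ^ 3) := by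
    gcongr; norm_num
  calc _ ≤ 10 ^ 9 / (1 - γ) * (ℒ ^ 2 * (N * Q)) + 10 ^ 9 / (1 - γ) * (Δ * N ^ 2 * Q ^ 2 + (Q : ℝ) ^ 3) := add_le_add f2 f3
    _ = _ := by ring

/-- Spacing of the numbers `(n+q)^γ - n^γ`. -/
theorem card_close_shiftDiff {γ : ℝ} (h0 : 0 < γ) (h1 : γ < 1) {Q N : ℕ} {Δ : ℝ} (hQ : 0 < Q)
    (hN : 0 < N) (hQN : 32 * ((Q : ℝ) / N) ^ 2 ≤ (1 - γ) / 100) (hQ2 : 2 * Q ≤ N) (hΔ0 : 0 ≤ Δ) :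
    (((dyadicBlock Q N ×ˢ dyadicBlock Q N).filter (fun p =>
      |log (shiftDiff γ p.1) - log (shiftDiff γ p.2)| ≤ Δ)).card : ℝ) ≤
      10 ^ 11 / (1 - γ) * (1 + log (16 * N)) ^ 3 *
        ((N : ℝ) * Q + Δ * N ^ 2 * Q ^ 2 + Q ^ 3) := by
  classical
  have hθ : 0 < 1 - γ := by linarith
  have hN' : (0 : ℝ) < N := mod_cast hN
  have hN1 : (1 : ℝ) ≤ N := mod_cast hN
  have hQ1 : (1 : ℝ) ≤ Q := mod_cast hQ
  set ℒ := 1 + log (16 * N) with hℒ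
  have hlogN : 0 ≤ log N := log_nonneg hN1
  have hℒN : 1 + log N ≤ ℒ := by rw [hℒ]; gcongr; linarith
  have hℒ1 : 1 ≤ ℒ := by linarith
  set R := Ico Q (2 * Q) ×ˢ Ico Q (2 * Q) with hR
  have hRc : (R.card : ℝ) = Q ^ 2 := by
    rw [hR, card_product, Nat.card_Ico, show 2 * Q - Q = Q by omega]; push_cast; ring
  set P := (dyadicBlock Q N ×ˢ dyadicBlock Q N).filter (fun p =>
      |log (shiftDiff γ p.1) - log (shiftDiff γ p.2)| ≤ Δ) with hP
  have hsep : ∀ q, Q ≤ q → q < 2 * Q → ∀ y ∈ Ico N (2 * N), ∀ y' ∈ Ico N (2 * N), y ≠ y' →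
      3 / 10 * (1 - γ) / N ≤ |log (shiftDiff γ (q, y)) - log (shiftDiff γ (q, y'))| := fun q hq hq2 y hy y' hy' hne => by
    rw [mem_Ico] at hy hy'
    refine le_trans ?_ (shiftDiff_separated h0 h1 hQ hN hQN hQ2 hq hq2 hy.1 hy.2 hy'.1 hy'.2)
    rw [mul_div_assoc', div_le_div_iff_of_pos_right hN']
    refine le_mul_of_one_le_right (by positivity) ?_
    have : (1 : ℤ) ≤ |(y : ℤ) - y'| := Int.one_le_abs (by omega)
    exact_mod_cast this
  by_cases hΔ : 2 * (Δ * N) ≤ (1 - γ) / 100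
  · -- few coincidences
    set J := Nat.log 2 (N / Q) + 1 with hJ
    have hNQ : N / Q ≠ 0 := by
      have := Nat.div_pos (by omega : Q ≤ N) hQ; omega
    have hPle : P.card ≤ ∑ r ∈ R, (closeShift γ Δ N r.1 r.2).card := by
      rw [← card_sigma]
      refine card_le_card_of_injOn (fun p => ⟨(p.1.1, p.2.1), p.1.2⟩) ?_ ?_
      · rintro ⟨⟨q, n⟩, q', n'⟩ hp
        simp only [hP, coe_filter, mem_product, mem_dyadicBlock, Set.mem_ofPred_eq] at hp
        simp only [coe_sigma, Set.mem_sigma_iff, hR, coe_product, coe_Ico, Set.mem_prod, Set.mem_Ico,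
          closeShift, coe_filter, mem_Ico, Set.mem_ofPred_eq]
        exact ⟨⟨hp.1.1.1, hp.1.2.1⟩, hp.1.1.2, n', hp.1.2.2, hp.2⟩
      · rintro ⟨⟨q, n⟩, q', n'⟩ hp ⟨⟨r, m⟩, r', m'⟩ hp' h
        simp only [hP, coe_filter, mem_product, mem_dyadicBlock, Set.mem_ofPred_eq] at hp hp'
        simp only [Sigma.mk.injEq, Prod.mk.injEq, heq_eq_eq] at h
        obtain ⟨⟨rfl, rfl⟩, rfl⟩ := h
        by_contra hne
        have hnm : n' ≠ m' := by rintro rfl; exact hne rfl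
        have s := hsep q' hp.1.2.1.1 hp.1.2.1.2 n' (mem_Ico.2 hp.1.2.2) m' (mem_Ico.2 hp'.1.2.2) hnm
        have t : |log (shiftDiff γ (q', n')) - log (shiftDiff γ (q', m'))| ≤ 2 * Δ := by
          have a := hp.2; have b := hp'.2
          rw [abs_le] at a b ⊢
          constructor <;> linarith [a.1, a.2, b.1, b.2]
        have := s.trans t
        rw [div_le_iff₀ hN'] at this
        linarith
    have hsum : (P.card : ℝ) ≤ ∑ r ∈ R, ((gapSet (closeShift γ Δ N r.1 r.2) (2 ^ J)).card : ℝ) +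
        ∑ j ∈ range J, ∑ r ∈ R, ((dyadicGap (closeShift γ Δ N r.1 r.2) j).card : ℝ) := by
      rw [sum_comm, ← sum_add_distrib]
      refine (Nat.cast_le.2 hPle).trans ?_
      push_cast
      refine sum_le_sum fun r _ => ?_
      exact_mod_cast card_le_gapSet_add (closeShift γ Δ N r.1 r.2) J
    have hlt : N < 2 ^ J * Q := by
      have := Nat.lt_pow_succ_log_self (b := 2) (by norm_num) (N / Q)
      rwa [Nat.div_lt_iff_lt_mul hQ] at this
    have g1 : ∑ r ∈ R, ((gapSet (closeShift γ Δ N r.1 r.2) (2 ^ J)).card : ℝ) ≤ 2 * Q ^ 3 := by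
      have : ∀ r ∈ R, ((gapSet (closeShift γ Δ N r.1 r.2) (2 ^ J)).card : ℝ) ≤ 2 * Q := fun r _ => by
        refine (card_gapSet_le (K := 2 ^ J) (by positivity) (closeShift_subset γ Δ N r.1 r.2)).trans ?_
        have : (N : ℝ) / ((2 ^ J : ℕ) : ℝ) ≤ Q := by
          rw [div_le_iff₀ (by positivity), mul_comm]; exact_mod_cast hlt.le
        linarith
      refine (sum_le_card_nsmul _ _ _ this).trans ?_
      rw [nsmul_eq_mul, hRc]; exact le_of_eq (by ring)
    have g2 : ∀ j ∈ range J, ∑ r ∈ R, ((dyadicGap (closeShift γ Δ N r.1 r.2) j).card : ℝ) ≤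
        10 ^ 9 / (1 - γ) * (ℒ ^ 2 * ((N : ℝ) * Q) + Δ * N ^ 2 * Q ^ 2 + Q ^ 3) := fun j hj => by
      refine sum_card_dyadicGap_le h0 h1 hQ hN hQN hQ2 hΔ0 hΔ ?_
      rw [mem_range, hJ, Nat.lt_succ_iff] at hj
      have a := (Nat.pow_le_pow_right (by norm_num : 0 < 2) hj).trans (Nat.pow_log_le_self 2 hNQ)
      exact (Nat.mul_le_mul_right Q a).trans (Nat.div_mul_le_self N Q)
    have g3 := sum_le_card_nsmul _ _ _ g2
    rw [card_range, nsmul_eq_mul] at g3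
    have hJℒ : (J : ℝ) ≤ 2 * ℒ := by
      have a : Nat.log 2 (N / Q) * log 2 ≤ log N := by
        rw [← log_pow]
        apply log_le_log (by positivity)
        exact_mod_cast (Nat.pow_log_le_self 2 hNQ).trans (Nat.div_le_self N Q)
      have b := log_two_gt_d9
      have c : (0 : ℝ) ≤ Nat.log 2 (N / Q) := Nat.cast_nonneg _
      rw [hJ]; push_cast
      nlinarith
    set E := (N : ℝ) * Q + Δ * N ^ 2 * Q ^ 2 + Q ^ 3 with hE
    have k1 : ℒ ^ 2 * ((N : ℝ) * Q) + Δ * N ^ 2 * Q ^ 2 + Q ^ 3 ≤ ℒ ^ 2 * E := by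
      have : 1 ≤ ℒ ^ 2 := one_le_pow₀ hℒ1
      have a : 0 ≤ Δ * N ^ 2 * Q ^ 2 + (Q : ℝ) ^ 3 := by positivity
      rw [hE]; nlinarith
    have k2 : 2 * (Q : ℝ) ^ 3 ≤ 2 * (1 / (1 - γ)) * (ℒ ^ 3 * E) := by
      have a : (Q : ℝ) ^ 3 ≤ E := by rw [hE]; linarith [show 0 ≤ (N : ℝ) * Q + Δ * N ^ 2 * Q ^ 2 by positivity]
      have b : 1 ≤ ℒ ^ 3 := one_le_pow₀ hℒ1
      have c : 1 ≤ 1 / (1 - γ) := by rw [le_div_iff₀ hθ]; linarith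
      calc 2 * (Q : ℝ) ^ 3 ≤ 2 * E := by linarith
        _ = 2 * 1 * (1 * E) := by ring
        _ ≤ _ := by gcongr
    calc (P.card : ℝ) ≤ 2 * Q ^ 3 + J * (10 ^ 9 / (1 - γ) * (ℒ ^ 2 * ((N : ℝ) * Q) + Δ * N ^ 2 * Q ^ 2 + Q ^ 3)) :=
          hsum.trans (add_le_add g1 g3)
      _ ≤ 2 * (1 / (1 - γ)) * (ℒ ^ 3 * E) + (2 * ℒ) * (10 ^ 9 / (1 - γ) * (ℒ ^ 2 * E)) := by gcongr
      _ = (2 + 2 * 10 ^ 9) / (1 - γ) * ℒ ^ 3 * E := by field_simp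
      _ ≤ 10 ^ 11 / (1 - γ) * ℒ ^ 3 * E := by gcongr; norm_num
  · -- the trivial case
    push Not at hΔ
    have hPle : (P.card : ℝ) ≤ ∑ q' ∈ Ico Q (2 * Q), (((dyadicBlock Q N ×ˢ Ico N (2 * N)).filter (fun p =>
        |log (shiftDiff γ p.1) - log (shiftDiff γ (q', p.2))| ≤ Δ)).card : ℝ) := by
      have e : P.card ≤ ∑ q' ∈ Ico Q (2 * Q), (((dyadicBlock Q N ×ˢ Ico N (2 * N)).filter (fun p =>
        |log (shiftDiff γ p.1) - log (shiftDiff γ (q', p.2))| ≤ Δ)).card) := by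
        rw [← card_sigma]
        refine card_le_card_of_injOn (fun p => ⟨p.2.1, (p.1, p.2.2)⟩) ?_ ?_
        · rintro ⟨p, q', n'⟩ hp
          simp only [hP, coe_filter, mem_product, Set.mem_ofPred_eq] at hp
          rw [mem_dyadicBlock (p := (q', n'))] at hp
          simp only [coe_sigma, Set.mem_sigma_iff, coe_Ico, Set.mem_Ico, coe_filter, mem_Ico, Set.mem_ofPred_eq, mem_product]
          exact ⟨hp.1.2.1, ⟨hp.1.1, hp.1.2.2⟩, hp.2⟩
        · rintro ⟨p, q', n'⟩ _ ⟨r, r', m'⟩ _ h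
          simp only [Sigma.mk.injEq, Prod.mk.injEq, heq_eq_eq] at h
          obtain ⟨rfl, rfl, rfl⟩ := h; rfl
      exact_mod_cast e
    have ht : 0 < 3 / 10 * (1 - γ) / N := by positivity
    have hb : ∀ q' ∈ Ico Q (2 * Q), (((dyadicBlock Q N ×ˢ Ico N (2 * N)).filter (fun p =>
        |log (shiftDiff γ p.1) - log (shiftDiff γ (q', p.2))| ≤ Δ)).card : ℝ) ≤
        (Q * N) * (300 / (1 - γ) * (Δ * N)) := fun q' hq' => by
      rw [mem_Ico] at hq'
      refine (card_close_le (dyadicBlock Q N) (Ico N (2 * N)) (fun p => log (shiftDiff γ p))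
        (fun n => log (shiftDiff γ (q', n))) ht hΔ0 (hsep q' hq'.1 hq'.2)).trans ?_
      have c : ((dyadicBlock Q N).card : ℝ) = Q * N := by
        rw [dyadicBlock, card_product, Nat.card_Ico, Nat.card_Ico, show 2 * Q - Q = Q by omega,
          show 2 * N - N = N by omega]; push_cast; ring
      rw [c]
      gcongr
      have : 1 ≤ 200 / (1 - γ) * (Δ * N) := by
        rw [div_mul_eq_mul_div, le_div_iff₀ hθ]; linarith
      have e : 2 * Δ / (3 / 10 * (1 - γ) / N) = 20 / 3 / (1 - γ) * (Δ * N) := by field_simp; ring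
      rw [e]
      have : 20 / 3 / (1 - γ) * (Δ * N) ≤ 100 / (1 - γ) * (Δ * N) := by gcongr; norm_num
      have e2 : 300 / (1 - γ) * (Δ * N) = 100 / (1 - γ) * (Δ * N) + 200 / (1 - γ) * (Δ * N) := by ring
      linarith
    have := sum_le_card_nsmul _ _ _ hb
    rw [Nat.card_Ico, show 2 * Q - Q = Q by omega, nsmul_eq_mul] at this
    refine hPle.trans (this.trans ?_)
    have b : 1 ≤ ℒ ^ 3 := one_le_pow₀ hℒ1
    calc (Q : ℝ) * (Q * N * (300 / (1 - γ) * (Δ * N))) = 300 / (1 - γ) * 1 * (Δ * N ^ 2 * Q ^ 2) := by ring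
      _ ≤ 10 ^ 11 / (1 - γ) * ℒ ^ 3 * ((N : ℝ) * Q + Δ * N ^ 2 * Q ^ 2 + Q ^ 3) := by
        gcongr
        · norm_num
        · have : 0 ≤ (N : ℝ) * Q + (Q : ℝ) ^ 3 := by positivity
          linarith

lemma norm_sum_sq_eq (a : ℕ → ℂ) (Q : ℕ) :
    ‖∑ q ∈ range Q, a q‖ ^ 2 = ∑ q ∈ range Q, ‖a q‖ ^ 2 +
      2 * (∑ q ∈ range Q, ∑ d ∈ Ico 1 (Q - q), a (q + d) * conj (a q)).re := by
  induction Q with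
  | zero => simp
  | succ Q ih =>
    have e : ∑ q ∈ range (Q + 1), ∑ d ∈ Ico 1 (Q + 1 - q), a (q + d) * conj (a q) =
        ∑ q ∈ range Q, ∑ d ∈ Ico 1 (Q - q), a (q + d) * conj (a q) +
        a Q * conj (∑ q ∈ range Q, a q) := by
      rw [sum_range_succ, show Q + 1 - Q = 1 by omega, Ico_self, sum_empty, add_zero, map_sum,
        mul_sum, ← sum_add_distrib]
      refine sum_congr rfl fun q hq => ?_
      rw [mem_range] at hq
      rw [show Q + 1 - q = (Q - q) + 1 by omega, sum_Ico_succ_top (by omega),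
        show q + (Q - q) = Q by omega]
    rw [e, sum_range_succ, sum_range_succ, Complex.add_re, mul_add, ← add_assoc]
    have : ‖∑ q ∈ range Q, a q + a Q‖ ^ 2 = ‖∑ q ∈ range Q, a q‖ ^ 2 + ‖a Q‖ ^ 2 +
        2 * (a Q * conj (∑ q ∈ range Q, a q)).re := by
      rw [← Complex.normSq_eq_norm_sq, ← Complex.normSq_eq_norm_sq, ← Complex.normSq_eq_norm_sq,
        add_comm (∑ q ∈ range Q, a q), Complex.normSq_add]
      ring
    rw [this, ih]; ring

lemma sum_range_shift {E : Type*} [AddCommMonoid E] (w : ℕ → E) {N q : ℕ} (hq : q ≤ N)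
    (hw : ∀ n, n ∉ Ico N (2 * N) → w n = 0) :
    ∑ m ∈ range (2 * N), w (m + q) = ∑ n ∈ Ico N (2 * N), w n := by
  rw [range_eq_Ico, sum_Ico_add' w 0 (2 * N) q]
  symm
  refine sum_subset ?_ fun n _ hn => hw n hn
  intro n hn
  rw [mem_Ico] at hn ⊢; omega

/-- Weyl–van der Corput differencing, averaged over a family. -/
theorem weyl_shift {ι : Type*} (X : Finset ι) (z : ι → ℕ → ℂ) {N Q : ℕ} (hQ : 0 < Q) (hQN : Q ≤ N)
    (hz : ∀ p n, n ∉ Ico N (2 * N) → z p n = 0) {E T : ℝ}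
    (hE : ∑ p ∈ X, ∑ n ∈ Ico N (2 * N), ‖z p n‖ ^ 2 ≤ E)
    (hT : ∀ D ≤ Q, ‖∑ d ∈ Ico 1 D, ∑ p ∈ X, ∑ n ∈ Ico N (2 * N), z p (n + d) * conj (z p n)‖ ≤ T) :
    ∑ p ∈ X, ‖∑ n ∈ Ico N (2 * N), z p n‖ ^ 2 ≤ 2 * N / Q * (E + 2 * T) := by
  have h1 : ∀ p ∈ X, (Q : ℝ) ^ 2 * ‖∑ n ∈ Ico N (2 * N), z p n‖ ^ 2 ≤
      2 * N * ∑ m ∈ range (2 * N), ‖∑ q ∈ range Q, z p (m + q)‖ ^ 2 := fun p _ => by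
    have e : (Q : ℂ) * ∑ n ∈ Ico N (2 * N), z p n =
        ∑ m ∈ range (2 * N), ∑ q ∈ range Q, z p (m + q) := by
      rw [sum_comm, sum_congr rfl fun q hq => sum_range_shift (z p)
        ((mem_range.1 hq).le.trans hQN) (hz p), sum_const, card_range, nsmul_eq_mul]
    have e2 : (Q : ℝ) ^ 2 * ‖∑ n ∈ Ico N (2 * N), z p n‖ ^ 2 =
        ‖∑ m ∈ range (2 * N), ∑ q ∈ range Q, z p (m + q)‖ ^ 2 := by
      rw [← e, norm_mul, mul_pow, Complex.norm_natCast]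
    rw [e2]
    calc _ ≤ (∑ m ∈ range (2 * N), ‖∑ q ∈ range Q, z p (m + q)‖) ^ 2 := by
          gcongr; exact norm_sum_le _ _
      _ ≤ _ := by
          have := sq_sum_le_card_mul_sum_sq (s := range (2 * N))
            (f := fun m => ‖∑ q ∈ range Q, z p (m + q)‖)
          rw [card_range] at this
          push_cast at this; exact this
  have h2 : ∑ p ∈ X, ∑ m ∈ range (2 * N), ‖∑ q ∈ range Q, z p (m + q)‖ ^ 2 ≤ Q * (E + 2 * T) := by
    simp_rw [norm_sum_sq_eq, sum_add_distrib, ← mul_sum, ← Complex.re_sum]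
    have a1 : ∑ p ∈ X, ∑ m ∈ range (2 * N), ∑ q ∈ range Q, ‖z p (m + q)‖ ^ 2 ≤ Q * E := by
      have : ∀ p ∈ X, ∑ m ∈ range (2 * N), ∑ q ∈ range Q, ‖z p (m + q)‖ ^ 2 =
          Q * ∑ n ∈ Ico N (2 * N), ‖z p n‖ ^ 2 := fun p _ => by
        rw [sum_comm, sum_congr rfl fun q hq => sum_range_shift (fun n => ‖z p n‖ ^ 2)
          ((mem_range.1 hq).le.trans hQN) (fun n hn => by simp [hz p n hn]), sum_const, card_range,
          nsmul_eq_mul]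
      rw [sum_congr rfl this, ← mul_sum]
      gcongr
    have a2 : ∑ p ∈ X, ∑ m ∈ range (2 * N), ∑ q ∈ range Q, ∑ d ∈ Ico 1 (Q - q),
          z p (m + (q + d)) * conj (z p (m + q)) = ∑ q ∈ range Q, ∑ d ∈ Ico 1 (Q - q),
          ∑ p ∈ X, ∑ n ∈ Ico N (2 * N), z p (n + d) * conj (z p n) := by
      have : ∀ p ∈ X, ∑ m ∈ range (2 * N), ∑ q ∈ range Q, ∑ d ∈ Ico 1 (Q - q),
          z p (m + (q + d)) * conj (z p (m + q)) = ∑ q ∈ range Q, ∑ d ∈ Ico 1 (Q - q),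
          ∑ n ∈ Ico N (2 * N), z p (n + d) * conj (z p n) := fun p _ => by
        rw [sum_comm]
        refine sum_congr rfl fun q hq => ?_
        rw [sum_comm]
        refine sum_congr rfl fun d _ => ?_
        rw [← sum_range_shift (fun n => z p (n + d) * conj (z p n))
          ((mem_range.1 hq).le.trans hQN) (fun n hn => by simp [hz p n hn])]
        exact sum_congr rfl fun m _ => by rw [add_assoc]
      rw [sum_congr rfl this, sum_comm]
      exact sum_congr rfl fun q _ => sum_comm
    rw [a2]
    have a3 : (∑ q ∈ range Q, ∑ d ∈ Ico 1 (Q - q),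
          ∑ p ∈ X, ∑ n ∈ Ico N (2 * N), z p (n + d) * conj (z p n)).re ≤ Q * T := by
      refine (Complex.re_le_norm _).trans ((norm_sum_le_of_le _ fun q _ => hT (Q - q) (Nat.sub_le _ _)).trans ?_)
      rw [sum_const, card_range, nsmul_eq_mul]
    nlinarith
  have h3 := sum_le_sum h1
  rw [← mul_sum, ← mul_sum] at h3
  have h4 : (Q : ℝ) ^ 2 * ∑ p ∈ X, ‖∑ n ∈ Ico N (2 * N), z p n‖ ^ 2 ≤
      (Q : ℝ) ^ 2 * (2 * N / Q * (E + 2 * T)) := by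
    calc _ ≤ 2 * N * (Q * (E + 2 * T)) := h3.trans (by gcongr)
      _ = _ := by field_simp
  exact le_of_mul_le_mul_left h4 (by positivity)

lemma norm_sum_Ico_one_le (F : ℕ → ℂ) {Q : ℕ} {B : ℝ} (hB : 0 ≤ B)
    (h : ∀ D ≤ Q, ∀ i, 2 ^ i < Q →
      ‖∑ d ∈ Ico (2 ^ i) (2 * 2 ^ i), if d < D then F d else 0‖ ≤ B) :
    ∀ D ≤ Q, ‖∑ d ∈ Ico 1 D, F d‖ ≤ (Nat.log 2 Q + 1 : ℕ) * B := fun D hD => by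
  rw [← sum_fiberwise_of_maps_to (t := range (Nat.log 2 Q + 1)) (g := fun d => Nat.log 2 d)]
  · have : ∀ i ∈ range (Nat.log 2 Q + 1), ‖∑ d ∈ (Ico 1 D).filter (fun d => Nat.log 2 d = i), F d‖ ≤ B := fun i _ => by
      by_cases hi : 2 ^ i < Q
      · refine le_trans (le_of_eq ?_) (h D hD i hi)
        rw [← sum_filter]
        congr 2
        ext d
        simp only [mem_filter, mem_Ico]
        constructor
        · rintro ⟨⟨a, b⟩, rfl⟩
          refine ⟨⟨Nat.pow_log_le_self 2 (by omega), ?_⟩, b⟩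
          have := Nat.lt_pow_succ_log_self (b := 2) (by norm_num) d
          rw [pow_succ] at this; omega
        · rintro ⟨⟨a, b⟩, c⟩
          have : 0 < 2 ^ i := by positivity
          exact ⟨⟨by omega, c⟩, Nat.log_eq_of_pow_le_of_lt_pow a (by rw [pow_succ]; omega)⟩
      · have : (Ico 1 D).filter (fun d => Nat.log 2 d = i) = ∅ := by
          rw [filter_eq_empty_iff]
          intro d hd hl
          rw [mem_Ico] at hd
          have := Nat.pow_log_le_self 2 (show d ≠ 0 by omega)
          rw [hl] at this; omega
        rw [this]; simpa using hB
    refine (norm_sum_le_of_le _ this).trans ?_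
    rw [sum_const, card_range, nsmul_eq_mul]
  · intro d hd
    rw [mem_Ico] at hd
    rw [mem_range, Nat.lt_succ_iff]
    exact Nat.log_mono_right (by omega)

/-- Bilinear forms in `n^γ` from bilinear forms in the differences `(n+d)^γ - n^γ`. -/
theorem bilBound_of_shiftDiff {ι : Type*} (X : Finset ι) (f : ι → ℝ) {γ : ℝ} {N Q : ℕ} {B : ℝ}
    (hQ : 0 < Q) (hQN : Q ≤ N) (hB0 : 0 ≤ B) (hB : ∀ i, 2 ^ i < Q →
      BilBound X (dyadicBlock (2 ^ i) N) (fun p r => ee (f p * shiftDiff γ r)) B) :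
    BilBound X (Ico N (2 * N)) (fun p n => ee (f p * (n : ℝ) ^ γ))
      √(X.card * (2 * N / Q * (X.card * N + 2 * ((Nat.log 2 Q + 1 : ℕ) * B)))) := fun a b ha hb => by
  set z : ι → ℕ → ℂ := fun p n => if n ∈ Ico N (2 * N) then b n * ee (f p * (n : ℝ) ^ γ) else 0 with hz
  have hzn : ∀ p n, ‖z p n‖ ≤ 1 := by
    intro p n; rw [hz]; dsimp only; split_ifs
    · rw [norm_mul, norm_ee, mul_one]; exact hb n
    · simp
  have hE : ∑ p ∈ X, ∑ n ∈ Ico N (2 * N), ‖z p n‖ ^ 2 ≤ X.card * N := by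
    have : ∀ p ∈ X, ∑ n ∈ Ico N (2 * N), ‖z p n‖ ^ 2 ≤ N := fun p _ => by
      refine (sum_le_card_nsmul _ _ 1 fun n _ => pow_le_one₀ (norm_nonneg _) (hzn p n)).trans ?_
      rw [Nat.card_Ico, show 2 * N - N = N by omega]; simp
    refine (sum_le_card_nsmul _ _ _ this).trans ?_
    rw [nsmul_eq_mul]
  have hT := norm_sum_Ico_one_le (fun d => ∑ p ∈ X, ∑ n ∈ Ico N (2 * N), z p (n + d) * conj (z p n))
    hB0 (by
      intro D _ i hi
      have := hB i hi (fun _ => 1) (fun r => if r.1 < D ∧ r.2 + r.1 ∈ Ico N (2 * N) then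
        b (r.2 + r.1) * conj (b r.2) else 0) (by simp) (by
          intro r; split_ifs
          · rw [norm_mul, RCLike.norm_conj]; exact mul_le_one₀ (hb _) (norm_nonneg _) (hb _)
          · simp)
      refine le_trans (le_of_eq ?_) this
      congr 1
      have e1 : ∀ d ∈ Ico (2 ^ i) (2 * 2 ^ i), (if d < D then ∑ p ∈ X, ∑ n ∈ Ico N (2 * N),
          z p (n + d) * conj (z p n) else 0) = ∑ p ∈ X, ∑ n ∈ Ico N (2 * N),
          if d < D then z p (n + d) * conj (z p n) else 0 := fun d _ => by
        split_ifs
        · rfl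
        · simp
      rw [sum_congr rfl e1, sum_comm]
      refine sum_congr rfl fun p _ => ?_
      rw [dyadicBlock, sum_product]
      refine sum_congr rfl fun d _ => sum_congr rfl fun n hn => ?_
      rw [hz]
      dsimp only
      rw [if_pos hn]
      by_cases c1 : d < D <;> by_cases c2 : n + d ∈ Ico N (2 * N)
      · rw [if_pos c1, if_pos c2, if_pos ⟨c1, c2⟩, shiftDiff, mul_sub, ← ee_mul_conj, map_mul]
        push_cast; ring
      · rw [if_pos c1, if_neg c2, if_neg (fun h => c2 h.2)]; ring
      · rw [if_neg c1, if_neg (fun h => c1 h.1)]; ring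
      · rw [if_neg c1, if_neg (fun h => c1 h.1)]; ring)
  have hw := weyl_shift X z hQ hQN (fun p n hn => if_neg hn) hE hT
  apply le_sqrt_of_sq_le
  have e : ∀ p ∈ X, ∑ n ∈ Ico N (2 * N), a p * b n * ee (f p * (n : ℝ) ^ γ) =
      a p * ∑ n ∈ Ico N (2 * N), z p n := fun p _ => by
    rw [mul_sum]
    refine sum_congr rfl fun n hn => ?_
    rw [hz]; dsimp only; rw [if_pos hn]; ring
  rw [sum_congr rfl e]
  calc _ ≤ (∑ p ∈ X, ‖∑ n ∈ Ico N (2 * N), z p n‖) ^ 2 := by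
        gcongr
        refine norm_sum_le_of_le _ fun p _ => ?_
        rw [norm_mul]; exact mul_le_of_le_one_left (norm_nonneg _) (ha p)
    _ ≤ X.card * ∑ p ∈ X, ‖∑ n ∈ Ico N (2 * N), z p n‖ ^ 2 := sq_sum_le_card_mul_sum_sq
    _ ≤ _ := by gcongr

lemma shiftDiff_bounds {γ : ℝ} (h0 : 0 < γ) (h1 : γ < 1) {Q N : ℕ} (hQ : 0 < Q) (hQ2 : 2 * Q ≤ N)
    {r : ℕ × ℕ} (hr : r ∈ dyadicBlock Q N) :
    γ / 4 * ((Q : ℝ) * (N : ℝ) ^ (γ - 1)) ≤ shiftDiff γ r ∧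
      shiftDiff γ r ≤ 2 * ((Q : ℝ) * (N : ℝ) ^ (γ - 1)) := by
  obtain ⟨q, n⟩ := r
  rw [mem_dyadicBlock] at hr
  obtain ⟨⟨a1, a2⟩, a3, a4⟩ := hr
  dsimp only at a1 a2 a3 a4
  have hN' : (0 : ℝ) < N := mod_cast (by omega : 0 < N)
  have hQ' : (0 : ℝ) < Q := mod_cast hQ
  have b1 : (Q : ℝ) ≤ q := mod_cast a1
  have b2 : (q : ℝ) ≤ 2 * Q := mod_cast a2.le
  have b3 : (N : ℝ) ≤ n := mod_cast a3
  have b4 : (n : ℝ) ≤ 2 * N := mod_cast a4.le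
  have b5 : 2 * (Q : ℝ) ≤ N := mod_cast hQ2
  obtain ⟨c, hc, hce⟩ := exists_hasDerivAt_eq_slope (fun y : ℝ => y ^ γ)
    (fun y => γ * y ^ (γ - 1)) (show (n : ℝ) < n + q by linarith)
    (fun y hy => (hasDerivAt_rpow_const (Or.inl (by linarith [hy.1]))).continuousAt.continuousWithinAt)
    (fun y hy => hasDerivAt_rpow_const (Or.inl (by linarith [hy.1])))
  have e : shiftDiff γ (q, n) = γ * c ^ (γ - 1) * q := by
    rw [eq_div_iff (by linarith)] at hce
    rw [shiftDiff]; dsimp only; rw [← hce]; ring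
  have hc0 : 0 < c := by linarith [hc.1]
  have u1 : c ^ (γ - 1) ≤ (N : ℝ) ^ (γ - 1) :=
    rpow_le_rpow_of_nonpos hN' (by linarith [hc.1]) (by linarith)
  have u2 : 1 / 4 * (N : ℝ) ^ (γ - 1) ≤ c ^ (γ - 1) := by
    calc 1 / 4 * (N : ℝ) ^ (γ - 1) ≤ 4 ^ (γ - 1) * (N : ℝ) ^ (γ - 1) := by
          gcongr
          calc (1 / 4 : ℝ) = 4 ^ (-1 : ℝ) := by rw [rpow_neg_one]; norm_num
            _ ≤ 4 ^ (γ - 1) := rpow_le_rpow_of_exponent_le (by norm_num) (by linarith)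
      _ = (4 * (N : ℝ)) ^ (γ - 1) := (mul_rpow (by norm_num) hN'.le).symm
      _ ≤ _ := rpow_le_rpow_of_nonpos hc0 (by linarith [hc.2]) (by linarith)
  rw [e]
  constructor
  · calc γ / 4 * ((Q : ℝ) * (N : ℝ) ^ (γ - 1)) = γ * (1 / 4 * (N : ℝ) ^ (γ - 1)) * Q := by ring
      _ ≤ _ := by gcongr
  · calc γ * c ^ (γ - 1) * q ≤ 1 * (N : ℝ) ^ (γ - 1) * (2 * Q) := by gcongr
      _ = _ := by ring

/-- The double large sieve for `h m^γ ((n+q)^γ - n^γ)`. -/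
theorem bilBound_mono2_shiftDiff {γ : ℝ} (h0 : 0 < γ) (h1 : γ < 1) : ∃ C : ℝ, 0 < C ∧
    ∀ H M N Q : ℕ, ∀ F : ℝ, 0 < H → 0 < M → 0 < N → 0 < Q →
    32 * ((Q : ℝ) / N) ^ 2 ≤ (1 - γ) / 100 → 2 * Q ≤ N →
    F = (H : ℝ) * (M : ℝ) ^ γ * (Q * (N : ℝ) ^ (γ - 1)) →
    BilBound (dyadicBlock H M) (dyadicBlock Q N) (fun p r => ee (mono2 γ p * shiftDiff γ r))
      √(C * ((1 + log (2 * H : ℕ)) * (1 + log (2 * M : ℕ)) * (1 + log (16 * N)) ^ 3) *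
        ((1 + F) * (((H : ℝ) * M + H ^ 2 * M ^ 2 / F) * (N * Q + N ^ 2 * Q ^ 2 / F + Q ^ 3)))) := by
  set C1 := 128 + 128 / γ with hC1
  set C2 := 10 ^ 11 / (1 - γ)
  refine ⟨4 * exp (4 * π) ^ 2 * (8 * (C1 * (C2 * (1 / γ)))), by positivity, ?_⟩
  intro H M N Q F hH hM hN hQ hQN hQ2 hF
  set f0 := (H : ℝ) * (M : ℝ) ^ γ
  set g0 := (Q : ℝ) * (N : ℝ) ^ (γ - 1)
  have hf00 : 0 < f0 := by positivity
  have hg00 : 0 < g0 := by positivity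
  have hF0 : 0 < F := by rw [hF]; positivity
  have hdls := double_large_sieve (dyadicBlock H M) (dyadicBlock Q N) (mono2 γ) (shiftDiff γ)
    (X0 := 4 * f0) (Y0 := 2 * g0) (by positivity) (by positivity)
    (fun p hp => ⟨hf00.le.trans (mono2_bounds h0 h1 hp).1, (mono2_bounds h0 h1 hp).2⟩)
    (fun r hr => ⟨le_trans (by positivity) (shiftDiff_bounds h0 h1 hQ hQ2 hr).1,
      (shiftDiff_bounds h0 h1 hQ hQ2 hr).2⟩)
  have hNX : (((dyadicBlock H M ×ˢ dyadicBlock H M).filter (fun p =>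
      |mono2 γ p.1 - mono2 γ p.2| ≤ 1 / (2 * g0))).card : ℝ) ≤
      C1 * ((1 + log (2 * H : ℕ)) * (1 + log (2 * M : ℕ))) * (H * M + H ^ 2 * M ^ 2 / F) := by
    have hc := card_close_mono2 h0 H M (η := 1 / F) (by positivity)
    refine le_trans ?_ (hc.trans (le_of_eq ?_))
    · norm_cast
      refine card_le_card fun p hp => ?_
      simp only [mem_filter, mem_product] at hp ⊢
      refine ⟨hp.1, (abs_log_sub_le_div hf00 (mono2_bounds h0 h1 hp.1.1).1
        (mono2_bounds h0 h1 hp.1.2).1).trans ?_⟩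
      rw [div_le_iff₀ hf00]
      refine hp.2.trans ?_
      rw [hF, div_mul_eq_mul_div, one_mul, div_le_div_iff₀ (by positivity) (by positivity)]
      nlinarith [mul_pos hf00 hg00]
    · rw [hC1]; ring
  have hNY : (((dyadicBlock Q N ×ˢ dyadicBlock Q N).filter (fun p =>
      |shiftDiff γ p.1 - shiftDiff γ p.2| ≤ 1 / (4 * f0))).card : ℝ) ≤
      C2 * (1 + log (16 * N)) ^ 3 * (1 / γ * (N * Q + N ^ 2 * Q ^ 2 / F + Q ^ 3)) := by
    have hc := card_close_shiftDiff h0 h1 (Δ := 1 / (γ * F)) hQ hN hQN hQ2 (by positivity)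
    refine le_trans ?_ (hc.trans ?_)
    · norm_cast
      refine card_le_card fun p hp => ?_
      simp only [mem_filter, mem_product] at hp ⊢
      refine ⟨hp.1, (abs_log_sub_le_div (show 0 < γ / 4 * g0 by positivity)
        (shiftDiff_bounds h0 h1 hQ hQ2 hp.1.1).1
        (shiftDiff_bounds h0 h1 hQ hQ2 hp.1.2).1).trans ?_⟩
      rw [div_le_iff₀ (by positivity)]
      refine hp.2.trans (le_of_eq ?_)
      rw [hF]; field_simp
    · have hl : 0 ≤ 1 + log (16 * N) := by
        have := log_nonneg (show (1 : ℝ) ≤ 16 * N by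
          have : (1 : ℝ) ≤ N := mod_cast hN
          linarith)
        linarith
      refine mul_le_mul_of_nonneg_left ?_ (by positivity)
      have hg : 1 ≤ 1 / γ := by rw [le_div_iff₀ h0]; linarith
      have : 0 ≤ (N : ℝ) * Q + Q ^ 3 := by positivity
      have e : 1 / (γ * F) * N ^ 2 * Q ^ 2 = 1 / γ * (N ^ 2 * Q ^ 2 / F) := by field_simp
      rw [e]
      nlinarith
  refine hdls.mono ?_
  have hx : 2 * exp (4 * π) = √(4 * exp (4 * π) ^ 2) := by
    rw [show 4 * exp (4 * π) ^ 2 = (2 * exp (4 * π)) ^ 2 by ring,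
      sqrt_sq (by positivity)]
  rw [hx, ← sqrt_mul (by positivity)]
  apply sqrt_le_sqrt
  have hXY : 1 + 4 * f0 * (2 * g0) ≤ 8 * (1 + F) := by
    rw [hF]; nlinarith [mul_pos hf00 hg00]
  calc _ ≤ 4 * exp (4 * π) ^ 2 * ((8 * (1 + F)) *
        ((C1 * ((1 + log (2 * H : ℕ)) * (1 + log (2 * M : ℕ))) * (H * M + H ^ 2 * M ^ 2 / F)) *
        (C2 * (1 + log (16 * N)) ^ 3 * (1 / γ * (N * Q + N ^ 2 * Q ^ 2 / F + Q ^ 3))))) := by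
        gcongr
    _ = _ := by ring

lemma one_add_log_le_of_le_rpow {x y a c : ℝ} (hx : 1 ≤ log x) (hx0 : 0 < x) (hy : 0 < y)
    (ha : a ≤ 2) (hc : c ≤ 16) (hc0 : 0 < c) (hya : y ≤ x ^ a) :
    1 + log (c * y) ≤ 2 + 4 * log x := by
  have l16 : log c ≤ 3 := by
    have : log c ≤ log 16 := log_le_log hc0 hc
    rw [show (16 : ℝ) = 2 ^ 4 by norm_num, log_pow] at this
    have := log_two_lt_d9
    push_cast at *; linarith
  have : log y ≤ a * log x := by
    rw [← log_rpow hx0]; exact log_le_log hy hya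
  rw [log_mul hc0.ne' hy.ne']
  nlinarith

lemma nat_log_two_add_one_le {x : ℝ} (hx : 1 ≤ log x) {Q : ℕ} (hQ : 0 < Q) (hQx : (Q : ℝ) ≤ x) :
    ((Nat.log 2 Q + 1 : ℕ) : ℝ) ≤ 2 + 4 * log x := by
  have a : Nat.log 2 Q * log 2 ≤ log x := by
    rw [← log_pow]
    refine log_le_log (by positivity) (le_trans ?_ hQx)
    exact_mod_cast Nat.pow_log_le_self 2 (by omega)
  have b := log_two_gt_d9
  push_cast
  nlinarith

lemma mul_bounds_of_near_one {γ s t : ℝ} (h0 : 0 < γ) (h1 : γ < 1) (hs : 0 < s) (ht1 : 1 - s ≤ t)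
    (ht2 : t ≤ 1 + s) : γ - s ≤ γ * t ∧ γ * t ≤ γ + s := by
  constructor <;> nlinarith

lemma card_dyadicBlock (H M : ℕ) : (dyadicBlock H M).card = H * M := by
  rw [dyadicBlock, card_product, Nat.card_Ico, Nat.card_Ico, show 2 * H - H = H by omega,
    show 2 * M - M = M by omega]

/-- Exponent bookkeeping after a Weyl shift of length about `x ^ (2 h + ε)`. -/
lemma weyl_bound_le {x s ε h m n : ℝ} {H M N Q : ℕ} (hx : 1 < x) (hlx : 1 ≤ log x)
    (hlog2 : 6 * (2 + 4 * log x) ^ 1 ≤ x ^ s) (eh : (H : ℝ) = x ^ h) (em : (M : ℝ) = x ^ m)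
    (en : (N : ℝ) = x ^ n) (hs0 : 0 ≤ s) (hMN2 : m + n ≤ 1 + s) (hε : 5 * s ≤ ε) (hQ0 : 0 < Q)
    (hQ1 : x ^ (2 * h + ε) ≤ Q) (hQ2 : (Q : ℝ) ≤ x) :
    ((H * M : ℕ) : ℝ) * (2 * N / Q * ((H * M : ℕ) * N + 2 * ((Nat.log 2 Q + 1 : ℕ) * x ^ (1 + h)))) ≤
      (x ^ (1 - s)) ^ 2 := by
  have hx0 : 0 < x := by linarith
  have hle := fun a b : ℝ => rpow_le_rpow_left_iff (y := a) (z := b) hx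
  have hadd := fun a b : ℝ => (rpow_add hx0 a b).symm
  have hlogQ := nat_log_two_add_one_le hlx hQ0 hQ2
  set L := 2 + 4 * log x
  rw [pow_one] at hlog2
  push_cast at hlogQ ⊢
  have b1 : 2 * (N : ℝ) / Q ≤ 2 * x ^ (n - 2 * h - ε) := by
    rw [div_le_iff₀ (by positivity)]
    calc 2 * (N : ℝ) = 2 * x ^ (n - 2 * h - ε) * x ^ (2 * h + ε) := by
          rw [mul_assoc, hadd, en]; congr 2; ring
      _ ≤ _ := by gcongr
  have b2 : (H : ℝ) * M * N ≤ x ^ (h + 1 + s) := by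
    rw [eh, em, en, hadd, hadd, hle]; linarith
  have b3 : x ^ (1 + h) ≤ x ^ (h + 1 + s) := by rw [hle]; linarith
  have b4 : (H : ℝ) * M = x ^ (h + m) := by rw [eh, em, hadd]
  calc (H : ℝ) * M * (2 * N / Q * (H * M * N + 2 * ((Nat.log 2 Q + 1) * x ^ (1 + h))))
      ≤ x ^ (h + m) * (2 * x ^ (n - 2 * h - ε) * (x ^ (h + 1 + s) + 2 * (L * x ^ (h + 1 + s)))) := by
        rw [b4] at b2 ⊢
        gcongr
    _ = 2 * (1 + 2 * L) * (x ^ (h + m) * x ^ (n - 2 * h - ε) * x ^ (h + 1 + s)) := by ring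
    _ ≤ 6 * L * (x ^ (h + m) * x ^ (n - 2 * h - ε) * x ^ (h + 1 + s)) :=
        mul_le_mul_of_nonneg_right (by linarith) (by positivity)
    _ ≤ x ^ s * (x ^ (h + m) * x ^ (n - 2 * h - ε) * x ^ (h + 1 + s)) := by gcongr
    _ = x ^ (s + (h + m + (n - 2 * h - ε) + (h + 1 + s))) := by rw [hadd, hadd, hadd]
    _ ≤ x ^ (2 * (1 - s)) := by rw [hle]; linarith
    _ = (x ^ (1 - s)) ^ 2 := by rw [rpow_npow_eq hx0]; norm_num

set_option maxHeartbeats 2000000 in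
/-- Type II sums with the longer variable in `[x^(29/58), x^(34/58)]`. -/
theorem typeII_middle {γ : ℝ} (h0 : 50 / 58 < γ) (h1 : γ < 1) : ∃ s : ℝ, 0 < s ∧ ∀ᶠ x : ℝ in atTop,
    ∀ H M N : ℕ, 0 < H → 0 < M → 0 < N → (H : ℝ) ≤ x ^ (1 - γ + s) → x ^ (29 / 58 - s) ≤ N →
    (N : ℝ) ≤ x ^ (34 / 58 + s) → x ^ (1 - s) ≤ (M : ℝ) * N → (M : ℝ) * N ≤ x ^ (1 + s) →
    BilBound (dyadicBlock H M) (Ico N (2 * N)) (fun p n => ee (mono2 γ p * (n : ℝ) ^ γ))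
      (x ^ (1 - s)) := by
  obtain ⟨C, hC, hraw⟩ := bilBound_mono2_shiftDiff (γ := γ) (by linarith) h1
  have hθ : 0 < 1 - γ := by linarith
  set σ := γ - 50 / 58 with hσ
  have hσ0 : 0 < σ := by linarith
  set ε := σ / 10 with hε
  set s := σ / 1000 with hs
  have hs0 : 0 < s := by positivity
  have hε0 : 0 < ε := by positivity
  refine ⟨s, hs0, ?_⟩
  filter_upwards [eventually_const_mul_log_pow_le (12 * C) 5 hs0, eventually_const_mul_log_pow_le 6 1 hs0,
    (tendsto_rpow_atTop hε0).eventually_ge_atTop 2,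
    (tendsto_rpow_atTop (show (0 : ℝ) < 1 / 10 by norm_num)).eventually_ge_atTop (2 + 3200 / (1 - γ)),
    tendsto_log_atTop.eventually_ge_atTop 1, eventually_gt_atTop 2] with x hlog hlog2 hxε hx10 hlx hx2
  intro H M N hH hM hN hHx hNx1 hNx2 hMN1 hMN2
  have hx : 1 < x := by linarith
  have hx0 : 0 < x := by linarith
  obtain ⟨h, hh0, eh⟩ := exists_rpow_eq hx hH
  obtain ⟨m, -, em⟩ := exists_rpow_eq hx hM
  obtain ⟨n, -, en⟩ := exists_rpow_eq hx hN
  have hle := fun a b : ℝ => rpow_le_rpow_left_iff (y := a) (z := b) hx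
  have hadd := fun a b : ℝ => (rpow_add hx0 a b).symm
  have hsub := fun a b : ℝ => (rpow_sub hx0 a b).symm
  rw [eh, hle] at hHx
  rw [en, hle] at hNx1 hNx2
  rw [em, en, hadd, hle] at hMN1 hMN2
  set Q := ⌈x ^ (2 * h + ε)⌉₊
  obtain ⟨hQ1, hQ⟩ := ceil_rpow_bounds hx (show 0 ≤ 2 * h + ε by linarith)
  have hQ2 : (Q : ℝ) ≤ x ^ (2 * h + 2 * ε) := by
    calc (Q : ℝ) ≤ x ^ ε * x ^ (2 * h + ε) := hQ.trans (by gcongr)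
      _ = _ := by rw [hadd]; congr 1; ring
  have hQ0 : 0 < Q := Nat.ceil_pos.2 (by positivity)
  have hQN : Q ≤ N := by
    have : (Q : ℝ) ≤ N := hQ2.trans (by rw [en, hle]; linarith)
    exact_mod_cast this
  have hB : ∀ i, 2 ^ i < Q → BilBound (dyadicBlock H M) (dyadicBlock (2 ^ i) N)
      (fun p r => ee (mono2 γ p * shiftDiff γ r)) (x ^ (1 + h)) := fun i hi => by
    obtain ⟨q, hq0, eq⟩ := exists_rpow_eq hx (show 0 < 2 ^ i by positivity)
    have hq1 : q ≤ 2 * h + 2 * ε := by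
      have : ((2 ^ i : ℕ) : ℝ) ≤ Q := mod_cast hi.le
      have := this.trans hQ2
      rwa [eq, hle] at this
    have hqN : ((2 ^ i : ℕ) : ℝ) / N ≤ 1 / x ^ (1 / 10 : ℝ) := by
      rw [eq, en, hsub, one_div, ← rpow_neg hx0.le, hle]; linarith
    set Z := ((2 ^ i : ℕ) : ℝ) / N with hZ
    have hZ0 : 0 ≤ Z := by positivity
    have h3200 : 0 < 3200 / (1 - γ) := by positivity
    have hZ1 : Z * (2 + 3200 / (1 - γ)) ≤ 1 := by
      calc Z * (2 + 3200 / (1 - γ)) ≤ 1 / x ^ (1 / 10 : ℝ) * x ^ (1 / 10 : ℝ) := by gcongr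
        _ = 1 := by field_simp
    have hZ2 : Z ≤ 1 / 2 := by nlinarith
    have c1 : 32 * Z ^ 2 ≤ (1 - γ) / 100 := by
      have : Z * (3200 / (1 - γ)) ≤ 1 := by nlinarith
      rw [mul_div_assoc', div_le_one hθ] at this
      nlinarith
    have c2 : 2 * 2 ^ i ≤ N := by
      have : ((2 * 2 ^ i : ℕ) : ℝ) ≤ N := by
        rw [hZ, div_le_iff₀ (by positivity)] at hZ2
        push_cast at hZ2 ⊢; linarith
      exact_mod_cast this
    set g := γ * (m + n) with hg
    obtain ⟨hg1, hg2⟩ := mul_bounds_of_near_one (by linarith) h1 hs0 hMN1 hMN2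
    rw [← hg] at hg1 hg2
    set φ := h + g + q - n with hφ
    have hF : x ^ φ = (H : ℝ) * (M : ℝ) ^ γ * (((2 ^ i : ℕ) : ℝ) * (N : ℝ) ^ (γ - 1)) := by
      rw [eq, eh, em, en, ← rpow_mul hx0.le, ← rpow_mul hx0.le, hadd, hadd, hadd, hφ, hg]
      congr 1; ring
    have := hraw H M N (2 ^ i) (x ^ φ) hH hM hN (by positivity) c1 c2 hF
    refine this.mono ?_
    refine (sqrt_le_left (by positivity)).2 ?_
    have hφ0 : 0 ≤ φ := by linarith
    have hF1 : 1 ≤ x ^ φ := one_le_rpow hx.le hφ0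
    have p1 : (1 + x ^ φ) * ((H : ℝ) * M + H ^ 2 * M ^ 2 / x ^ φ) ≤
        2 * (x ^ (φ + h + m) + x ^ (2 * h + 2 * m)) := by
      have e1 : x ^ φ * ((H : ℝ) * M + H ^ 2 * M ^ 2 / x ^ φ) = x ^ (φ + h + m) + x ^ (2 * h + 2 * m) := by
        have : x ^ φ * ((H : ℝ) * M + H ^ 2 * M ^ 2 / x ^ φ) = x ^ φ * (H * M) + H ^ 2 * M ^ 2 := by
          field_simp
        rw [this, eh, em, rpow_npow_eq hx0, rpow_npow_eq hx0, hadd, hadd, hadd]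
        push_cast
        congr 2; ring
      calc _ ≤ (x ^ φ + x ^ φ) * ((H : ℝ) * M + H ^ 2 * M ^ 2 / x ^ φ) := by gcongr
        _ = 2 * (x ^ φ * ((H : ℝ) * M + H ^ 2 * M ^ 2 / x ^ φ)) := by ring
        _ = _ := by rw [e1]
    have p2 : (N : ℝ) * ((2 ^ i : ℕ) : ℝ) + N ^ 2 * ((2 ^ i : ℕ) : ℝ) ^ 2 / x ^ φ + ((2 ^ i : ℕ) : ℝ) ^ 3 =
        x ^ (n + q) + x ^ (2 * n + 2 * q - φ) + x ^ (3 * q) := by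
      rw [eq, en, rpow_npow_eq hx0, rpow_npow_eq hx0, rpow_npow_eq hx0, hadd, hadd, hsub]
      push_cast; rfl
    have p3 : (x ^ (φ + h + m) + x ^ (2 * h + 2 * m)) * (x ^ (n + q) + x ^ (2 * n + 2 * q - φ) + x ^ (3 * q)) ≤
        6 * x ^ (2 + 2 * h - s) := by
      have t : ∀ a b : ℝ, a + b ≤ 2 + 2 * h - s → x ^ a * x ^ b ≤ x ^ (2 + 2 * h - s) := by
        intro a b hab; rw [hadd, hle]; exact hab
      have t1 := t (φ + h + m) (n + q) (by linarith)
      have t2 := t (φ + h + m) (2 * n + 2 * q - φ) (by linarith)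
      have t3 := t (φ + h + m) (3 * q) (by linarith)
      have t4 := t (2 * h + 2 * m) (n + q) (by linarith)
      have t5 := t (2 * h + 2 * m) (2 * n + 2 * q - φ) (by linarith)
      have t6 := t (2 * h + 2 * m) (3 * q) (by linarith)
      linarith
    have hL : (1 + log (2 * H : ℕ)) * (1 + log (2 * M : ℕ)) * (1 + log (16 * N)) ^ 3 ≤
        (2 + 4 * log x) ^ 5 := by
      have l1 : 1 + log (2 * H : ℕ) ≤ 2 + 4 * log x := by
        push_cast
        exact one_add_log_le_of_le_rpow hlx hx0 (by positivity) (a := h) (by linarith) (by norm_num)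
          (by norm_num) eh.le
      have l2 : 1 + log (2 * M : ℕ) ≤ 2 + 4 * log x := by
        push_cast
        exact one_add_log_le_of_le_rpow hlx hx0 (by positivity) (a := m) (by linarith) (by norm_num)
          (by norm_num) em.le
      have l3 : 1 + log (16 * N) ≤ 2 + 4 * log x :=
        one_add_log_le_of_le_rpow hlx hx0 (by positivity) (a := n) (by linarith) (by norm_num)
          (by norm_num) en.le
      have z3 : 0 ≤ log (16 * N) := by
        have := log_natCast_nonneg (16 * N); push_cast at this; exact this
      calc _ ≤ (2 + 4 * log x) * (2 + 4 * log x) * (2 + 4 * log x) ^ 3 := by gcongr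
        _ = _ := by ring
    rw [p2, ← mul_assoc (1 + x ^ φ)]
    set K := x ^ (n + q) + x ^ (2 * n + 2 * q - φ) + x ^ (3 * q)
    calc _ ≤ C * (2 + 4 * log x) ^ 5 * (2 * (x ^ (φ + h + m) + x ^ (2 * h + 2 * m)) * K) := by gcongr
      _ ≤ C * (2 + 4 * log x) ^ 5 * (2 * (6 * x ^ (2 + 2 * h - s))) := by rw [mul_assoc 2]; gcongr
      _ = 12 * C * (2 + 4 * log x) ^ 5 * x ^ (2 + 2 * h - s) := by ring
      _ ≤ x ^ s * x ^ (2 + 2 * h - s) := by gcongr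
      _ = (x ^ (1 + h)) ^ 2 := by rw [hadd, rpow_npow_eq hx0]; congr 1; push_cast; ring
  have hfin := bilBound_of_shiftDiff (dyadicBlock H M) (mono2 γ) hQ0 hQN (by positivity) hB
  refine hfin.mono ?_
  refine (sqrt_le_left (by positivity)).2 ?_
  rw [card_dyadicBlock]
  refine weyl_bound_le hx hlx hlog2 eh em en hs0.le hMN2 (by linarith) hQ0 hQ1 (hQ2.trans ?_)
  conv_rhs => rw [← rpow_one x]
  rw [hle]; linarith

lemma abs_le_mul_pow_succ_of_deriv {f f' : ℝ → ℝ} {C : ℝ} {k : ℕ} (hC : 0 ≤ C)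
    (hf : ∀ y, 0 ≤ y → y ≤ 1 / 2 → HasDerivAt f (f' y) y) (hf0 : f 0 = 0)
    (hb : ∀ y, 0 < y → y ≤ 1 / 2 → |f' y| ≤ C * y ^ k) :
    ∀ z, 0 < z → z ≤ 1 / 2 → |f z| ≤ C * z ^ (k + 1) := fun z hz hz2 => by
  obtain ⟨c, hc, hce⟩ := exists_hasDerivAt_eq_slope f f' hz
    (fun y hy => (hf y hy.1 (by linarith [hy.2])).continuousAt.continuousWithinAt)
    (fun y hy => hf y hy.1.le (by linarith [hy.2]))
  rw [hf0, sub_zero, sub_zero, eq_div_iff hz.ne'] at hce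
  rw [← hce, abs_mul, abs_of_pos hz, pow_succ, ← mul_assoc]
  refine mul_le_mul_of_nonneg_right ((hb c hc.1 (by linarith [hc.2])).trans ?_) hz.le
  have := hc.1
  gcongr
  exact hc.2.le

lemma hasDerivAt_one_add_rpow (a : ℝ) {z : ℝ} (h1 : 0 ≤ z) :
    HasDerivAt (fun z : ℝ => (1 + z) ^ a) (a * (1 + z) ^ (a - 1)) z := by
  have := ((hasDerivAt_id z).const_add 1).rpow_const (p := a) (Or.inl (by simp; linarith))
  refine this.congr_deriv ?_
  simp only [id]; ring

lemma hasDerivAt_one_sub_rpow (a : ℝ) {z : ℝ} (h1 : z ≤ 1 / 2) :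
    HasDerivAt (fun z : ℝ => (1 - z) ^ a) (-(a * (1 - z) ^ (a - 1))) z := by
  have := ((hasDerivAt_id z).const_sub 1).rpow_const (p := a) (Or.inl (by simp; linarith))
  refine this.congr_deriv ?_
  simp only [id]; ring

/-- Fifth order expansion of `ψ(z) = (1+z)^γ - (1-z)^γ`. -/
lemma abs_symDiff_sub_cubic_le {γ : ℝ} (h0 : 0 < γ) (h1 : γ < 1) :
    ∀ z, 0 < z → z ≤ 1 / 2 →
    |symDiff γ z - 2 * γ * z - γ * (γ - 1) * (γ - 2) / 3 * z ^ 3| ≤ 1536 * z ^ 5 := by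
  have A4 : ∀ y : ℝ, 0 < y → y ≤ 1 / 2 → |(1 + y) ^ (γ - 4) - (1 - y) ^ (γ - 4)| ≤ 256 * y ^ 1 := fun y hy hy2 => by
    obtain ⟨c, hc, hce⟩ := exists_hasDerivAt_eq_slope (fun y : ℝ => y ^ (γ - 4))
      (fun y => (γ - 4) * y ^ (γ - 4 - 1)) (show 1 - y < 1 + y by linarith)
      (fun y hy => (hasDerivAt_rpow_const (Or.inl (by linarith [hy.1]))).continuousAt.continuousWithinAt)
      (fun y hy => hasDerivAt_rpow_const (Or.inl (by linarith [hy.1])))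
    have hc1 : 1 / 2 ≤ c := by linarith [hc.1]
    have e : (1 + y) ^ (γ - 4) - (1 - y) ^ (γ - 4) = (γ - 4) * c ^ (γ - 4 - 1) * (2 * y) := by
      rw [eq_div_iff (by linarith)] at hce
      rw [← hce]; ring
    rw [e, abs_mul, abs_mul, abs_of_neg (by linarith : γ - 4 < 0), abs_of_pos (by linarith : 0 < 2 * y),
      abs_of_pos (rpow_pos_of_pos (by linarith) _)]
    have h8 : c ^ (γ - 4 - 1) ≤ 32 := by
      calc c ^ (γ - 4 - 1) ≤ (1 / 2 : ℝ) ^ (γ - 4 - 1) :=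
            rpow_le_rpow_of_nonpos (by norm_num) hc1 (by linarith)
        _ ≤ (1 / 2 : ℝ) ^ (-5 : ℝ) :=
            rpow_le_rpow_of_exponent_ge (by norm_num) (by norm_num) (by linarith)
        _ = 32 := by rw [rpow_neg (by norm_num)]; norm_num
    have hp : 0 < c ^ (γ - 4 - 1) := rpow_pos_of_pos (by linarith) _
    have : -(γ - 4) * c ^ (γ - 4 - 1) ≤ 4 * 32 :=
      mul_le_mul (by linarith) h8 hp.le (by norm_num)
    nlinarith
  have A3 := abs_le_mul_pow_succ_of_deriv (f := fun y => (1 + y) ^ (γ - 3) + (1 - y) ^ (γ - 3) - 2)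
    (f' := fun y => (γ - 3) * ((1 + y) ^ (γ - 4) - (1 - y) ^ (γ - 4))) (C := 768) (k := 1) (by norm_num)
    (fun y hy hy2 => by
      refine (((hasDerivAt_one_add_rpow (γ - 3) hy).add
        (hasDerivAt_one_sub_rpow (γ - 3) hy2)).sub_const 2).congr_deriv ?_
      rw [show γ - 3 - 1 = γ - 4 by ring]; ring)
    (by norm_num)
    (fun y hy hy2 => by
      rw [abs_mul, abs_of_neg (by linarith : γ - 3 < 0)]
      calc _ ≤ 3 * (256 * y ^ 1) := mul_le_mul (by linarith) (A4 y hy hy2) (abs_nonneg _) (by norm_num)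
        _ = _ := by ring)
  have A2 := abs_le_mul_pow_succ_of_deriv
    (f := fun y => (1 + y) ^ (γ - 2) - (1 - y) ^ (γ - 2) - 2 * (γ - 2) * y)
    (f' := fun y => (γ - 2) * ((1 + y) ^ (γ - 3) + (1 - y) ^ (γ - 3) - 2)) (C := 1536) (k := 2) (by norm_num)
    (fun y hy hy2 => by
      refine (((hasDerivAt_one_add_rpow (γ - 2) hy).sub
        (hasDerivAt_one_sub_rpow (γ - 2) hy2)).sub ((hasDerivAt_id y).const_mul (2 * (γ - 2)))).congr_deriv ?_
      rw [show γ - 2 - 1 = γ - 3 by ring]; ring)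
    (by norm_num)
    (fun y hy hy2 => by
      rw [abs_mul, abs_of_neg (by linarith : γ - 2 < 0)]
      calc _ ≤ 2 * (768 * y ^ 2) := mul_le_mul (by linarith) (A3 y hy hy2) (abs_nonneg _) (by norm_num)
        _ = _ := by ring)
  have A1 := abs_le_mul_pow_succ_of_deriv
    (f := fun y => (1 + y) ^ (γ - 1) + (1 - y) ^ (γ - 1) - 2 - (γ - 1) * (γ - 2) * y ^ 2)
    (f' := fun y => (γ - 1) * ((1 + y) ^ (γ - 2) - (1 - y) ^ (γ - 2) - 2 * (γ - 2) * y))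
    (C := 1536) (k := 3) (by norm_num)
    (fun y hy hy2 => by
      refine ((((hasDerivAt_one_add_rpow (γ - 1) hy).add
        (hasDerivAt_one_sub_rpow (γ - 1) hy2)).sub_const 2).sub
          ((hasDerivAt_pow 2 y).const_mul ((γ - 1) * (γ - 2)))).congr_deriv ?_
      rw [show γ - 1 - 1 = γ - 2 by ring]; push_cast; ring)
    (by norm_num)
    (fun y hy hy2 => by
      rw [abs_mul, abs_of_neg (by linarith : γ - 1 < 0)]
      calc _ ≤ 1 * (1536 * y ^ 3) := mul_le_mul (by linarith) (A2 y hy hy2) (abs_nonneg _) (by norm_num)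
        _ = _ := by ring)
  exact abs_le_mul_pow_succ_of_deriv
    (f := fun y => symDiff γ y - 2 * γ * y - γ * (γ - 1) * (γ - 2) / 3 * y ^ 3)
    (f' := fun y => γ * ((1 + y) ^ (γ - 1) + (1 - y) ^ (γ - 1) - 2 - (γ - 1) * (γ - 2) * y ^ 2))
    (C := 1536) (k := 4) (by norm_num)
    (fun y hy hy2 => by
      refine (((hasDerivAt_symDiff (γ := γ) (z := y) (by linarith) (by linarith)).sub
        ((hasDerivAt_id y).const_mul (2 * γ))).sub
          ((hasDerivAt_pow 3 y).const_mul (γ * (γ - 1) * (γ - 2) / 3))).congr_deriv ?_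
      push_cast; ring)
    (by norm_num [symDiff])
    (fun y hy hy2 => by
      rw [abs_mul, abs_of_pos h0]
      calc _ ≤ 1 * (1536 * y ^ 4) := mul_le_mul (by linarith) (A1 y hy hy2) (abs_nonneg _) (by norm_num)
        _ = _ := by ring)

/-- A symmetric difference with step `q₀ + 2j`, compared with the one with step `q₀`. -/
lemma abs_symmetric_shift_sub_le {γ : ℝ} (h0 : 0 < γ) (h1 : γ < 1) {q₀ j n : ℕ} (hq : 0 < q₀)
    (hj : q₀ + 2 * j ≤ n) :
    |((n : ℝ) + q₀ + j) ^ γ - ((n : ℝ) - j) ^ γ - (((q₀ + 2 * j : ℕ) : ℝ) / q₀ * shiftDiff γ (q₀, n) +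
      γ * (γ - 1) * (γ - 2) / 24 * (((q₀ + 2 * j : ℕ) : ℝ) * (((q₀ + 2 * j : ℕ) : ℝ) ^ 2 - (q₀ : ℝ) ^ 2)) *
        ((n : ℝ) + q₀ / 2) ^ (γ - 3))| ≤
      3072 * (((n : ℝ) + q₀ / 2) ^ γ * (((q₀ + 2 * j : ℕ) : ℝ) / (2 * n + q₀)) ^ 5) := by
  have hq' : (0 : ℝ) < q₀ := mod_cast hq
  have hn' : (0 : ℝ) < n := mod_cast (by omega : 0 < n)
  set q : ℝ := ((q₀ + 2 * j : ℕ) : ℝ) with hqd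
  have hqe : q = q₀ + 2 * j := by rw [hqd]; push_cast; ring
  have hqn : q ≤ n := by rw [hqd]; exact_mod_cast hj
  set c : ℝ := (n : ℝ) + q₀ / 2 with hc
  have hc0 : 0 < c := by positivity
  have e2 : 2 * (n : ℝ) + q₀ = 2 * c := by rw [hc]; ring
  set z := q / (2 * c) with hz
  set z₀ := (q₀ : ℝ) / (2 * c) with hz₀
  have hz0 : 0 < z₀ := by positivity
  have hzz : z₀ ≤ z := by rw [hz, hz₀]; gcongr; linarith
  have hz2 : z ≤ 1 / 2 := by rw [hz, div_le_div_iff₀ (by positivity) (by norm_num)]; linarith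
  have d1 : ((n : ℝ) + q₀ + j) ^ γ - ((n : ℝ) - j) ^ γ = c ^ γ * symDiff γ z := by
    rw [symDiff, mul_sub, ← mul_rpow hc0.le (by linarith), ← mul_rpow hc0.le (by linarith)]
    congr 2
    · rw [hz, hqe]; field_simp; rw [hc]; ring
    · rw [hz, hqe]; field_simp; rw [hc]; ring
  have d2 : shiftDiff γ (q₀, n) = c ^ γ * symDiff γ z₀ := by
    rw [shiftDiff_eq (by omega), hz₀, ← e2]
    congr 2
    rw [e2]; ring
  have d3 : c ^ (γ - 3) = c ^ γ / c ^ 3 := by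
    rw [rpow_sub hc0]; norm_num
  rw [d1, d2, e2, ← hz, d3]
  have t1 := abs_symDiff_sub_cubic_le h0 h1 z (by linarith) hz2
  have t2 := abs_symDiff_sub_cubic_le h0 h1 z₀ hz0 (by linarith)
  set κ := γ * (γ - 1) * (γ - 2) / 3 with hκ
  have e : c ^ γ * symDiff γ z - (q / q₀ * (c ^ γ * symDiff γ z₀) +
      γ * (γ - 1) * (γ - 2) / 24 * (q * (q ^ 2 - (q₀ : ℝ) ^ 2)) * (c ^ γ / c ^ 3)) =
      c ^ γ * ((symDiff γ z - 2 * γ * z - κ * z ^ 3) - q / q₀ * (symDiff γ z₀ - 2 * γ * z₀ - κ * z₀ ^ 3)) := by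
    have : γ * (γ - 1) * (γ - 2) / 24 = κ / 8 := by rw [hκ]; ring
    rw [this, hz, hz₀]
    field_simp
    ring
  rw [e, abs_mul, abs_of_pos (rpow_pos_of_pos hc0 γ)]
  have hqq : 0 < q / q₀ := by rw [hqe]; positivity
  have t3 : |q / q₀ * (symDiff γ z₀ - 2 * γ * z₀ - κ * z₀ ^ 3)| ≤ 1536 * z ^ 5 := by
    rw [abs_mul, abs_of_pos hqq]
    calc _ ≤ q / q₀ * (1536 * z₀ ^ 5) := by gcongr
      _ = 1536 * (z * z₀ ^ 4) := by rw [hz, hz₀]; field_simp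
      _ ≤ 1536 * (z * z ^ 4) := by gcongr
      _ = _ := by ring
  calc _ ≤ c ^ γ * (1536 * z ^ 5 + 1536 * z ^ 5) := by
        gcongr
        exact (abs_sub _ _).trans (add_le_add t1 t3)
    _ = _ := by ring

/-- The divisor bound. -/
theorem card_divisors_le_rpow {ε : ℝ} (hε : 0 < ε) :
    ∃ C : ℝ, 1 ≤ C ∧ ∀ n : ℕ, 0 < n → (n.divisors.card : ℝ) ≤ C * (n : ℝ) ^ ε := by
  set K := 1 + 1 / (ε * log 2) with hK
  have hK1 : 1 ≤ K := by rw [hK]; have : 0 < 1 / (ε * log 2) := by positivity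
                         linarith
  set P := ⌈(2 : ℝ) ^ (1 / ε)⌉₊
  refine ⟨K ^ P, one_le_pow₀ hK1, fun n hn => ?_⟩
  rw [Nat.card_divisors hn.ne']
  have hnf : (n : ℝ) ^ ε = ∏ p ∈ n.primeFactors, ((p : ℝ) ^ ε) ^ n.factorization p := by
    conv_lhs => rw [← Nat.prod_factorization_pow_eq_self hn.ne']
    rw [Finsupp.prod, Nat.support_factorization]
    push_cast
    rw [← finsetProd_rpow _ _ (fun p _ => by positivity)]
    refine prod_congr rfl fun p _ => ?_
    rw [← rpow_natCast, ← rpow_natCast, ← rpow_mul (by positivity),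
      ← rpow_mul (by positivity), mul_comm]
  have hterm : ∀ p ∈ n.primeFactors, ((n.factorization p + 1 : ℕ) : ℝ) ≤
      (if p < P then K else 1) * ((p : ℝ) ^ ε) ^ n.factorization p := fun p hp => by
    set a := n.factorization p
    have hp2 : 2 ≤ p := (Nat.prime_of_mem_primeFactors hp).two_le
    have hp2' : (2 : ℝ) ≤ p := mod_cast hp2
    push_cast
    split_ifs with h
    · have h1 : 1 + a * (ε * log 2) ≤ ((p : ℝ) ^ ε) ^ a := by
        calc 1 + a * (ε * log 2) ≤ exp (a * (ε * log 2)) := by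
              have := add_one_le_exp (a * (ε * log 2)); linarith
          _ = ((2 : ℝ) ^ ε) ^ a := by
              rw [rpow_def_of_pos (by norm_num), ← exp_nat_mul]; congr 1; ring
          _ ≤ _ := by gcongr
      calc (a : ℝ) + 1 ≤ K * (1 + a * (ε * log 2)) := by
            have : K * (1 + a * (ε * log 2)) =
              1 + a + a * (ε * log 2) + 1 / (ε * log 2) := by rw [hK]; field_simp; ring
            rw [this]
            have : 0 ≤ a * (ε * log 2) := by positivity
            have : 0 < 1 / (ε * log 2) := by positivity
            linarith
        _ ≤ _ := by gcongr
    · rw [one_mul]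
      have h2 : (2 : ℝ) ≤ (p : ℝ) ^ ε := by
        have : (2 : ℝ) ^ (1 / ε) ≤ p := (Nat.le_ceil _).trans (mod_cast not_lt.1 h)
        calc (2 : ℝ) = ((2 : ℝ) ^ (1 / ε)) ^ ε := by
              rw [← rpow_mul (by norm_num), one_div_mul_cancel hε.ne', rpow_one]
          _ ≤ _ := by gcongr
      calc (a : ℝ) + 1 ≤ 2 ^ a := mod_cast Nat.lt_two_pow_self
        _ ≤ _ := by gcongr
  push_cast at hterm ⊢
  refine (prod_le_prod (fun p _ => by positivity) hterm).trans ?_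
  rw [prod_mul_distrib, ← hnf]
  refine mul_le_mul_of_nonneg_right ?_ (by positivity)
  rw [prod_ite, prod_const_one, mul_one, prod_const]
  refine pow_le_pow_right₀ hK1 ?_
  calc _ ≤ (range P).card := card_le_card fun p hp => mem_range.2 (mem_filter.1 hp).2
    _ = P := card_range P

/-- Pairs with small gcd and prescribed approximate ratio. -/
lemma card_close_small_gcd {η r D0 : ℝ} (hη : 0 ≤ η) (hD : 0 ≤ D0) (A : ℕ) :
    (((Icc 1 A ×ˢ Icc 1 A).filter (fun p => (Nat.gcd p.1 p.2 : ℝ) ≤ D0 ∧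
      |r - (log p.1 - log p.2)| ≤ η)).card : ℝ) ≤ D0 + 4 * η * A ^ 2 := by
  classical
  set I := (Icc 1 A).filter (fun d : ℕ => (d : ℝ) ≤ D0) with hI
  have hmaps : ∀ p ∈ (Icc 1 A ×ˢ Icc 1 A).filter (fun p => (Nat.gcd p.1 p.2 : ℝ) ≤ D0 ∧
      |r - (log p.1 - log p.2)| ≤ η), Nat.gcd p.1 p.2 ∈ I := fun p hp => by
    simp only [mem_filter, mem_product, mem_Icc] at hp
    obtain ⟨⟨⟨h1, h2⟩, h3, h4⟩, h9, h10⟩ := hp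
    simp only [hI, mem_filter, mem_Icc]
    exact ⟨⟨Nat.gcd_pos_of_pos_left _ h1, (Nat.gcd_le_left _ h1).trans h2⟩, h9⟩
  rw [card_eq_sum_card_fiberwise hmaps]
  push_cast
  have hfib : ∀ d ∈ I, ((((Icc 1 A ×ˢ Icc 1 A).filter (fun p => (Nat.gcd p.1 p.2 : ℝ) ≤ D0 ∧
      |r - (log p.1 - log p.2)| ≤ η)).filter (fun p => Nat.gcd p.1 p.2 = d)).card : ℝ) ≤
      2 * η * A ^ 2 * (1 / (d : ℝ) ^ 2) + 1 := fun d hd => by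
    simp only [hI, mem_filter, mem_Icc] at hd
    obtain ⟨⟨hd1, hd2⟩, -⟩ := hd
    have hd0 : (0 : ℝ) < d := mod_cast hd1
    have hR : 0 < A / d := Nat.div_pos hd2 hd1
    have hle : (((Icc 1 A ×ˢ Icc 1 A).filter (fun p => (Nat.gcd p.1 p.2 : ℝ) ≤ D0 ∧
        |r - (log p.1 - log p.2)| ≤ η)).filter (fun p => Nat.gcd p.1 p.2 = d)).card ≤
        (((univ : Finset Unit) ×ˢ coprimePairs (A / d)).filter (fun p =>
          |r - (log p.2.1 - log p.2.2)| ≤ η)).card := by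
      refine card_le_card_of_injOn (fun p => ((), (p.1 / d, p.2 / d))) ?_ ?_
      · rintro ⟨a, a'⟩ hp
        simp only [coe_filter, mem_filter, mem_product, mem_Icc, Set.mem_ofPred_eq] at hp
        obtain ⟨⟨⟨⟨h1, h2⟩, h3, h4⟩, h9, h10⟩, hgd⟩ := hp
        have da : d ∣ a := hgd ▸ Nat.gcd_dvd_left a a'
        have da' : d ∣ a' := hgd ▸ Nat.gcd_dvd_right a a'
        have ca : Nat.Coprime (a / d) (a' / d) := by
          have := Nat.coprime_div_gcd_div_gcd (m := a) (n := a') (by omega)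
          rwa [hgd] at this
        simp only [coprimePairs, coe_filter, mem_filter, mem_product, mem_Icc, Set.mem_ofPred_eq, mem_univ, true_and]
        refine ⟨⟨⟨⟨Nat.div_pos (Nat.le_of_dvd h1 da) hd1, Nat.div_le_div_right h2⟩,
          Nat.div_pos (Nat.le_of_dvd h3 da') hd1, Nat.div_le_div_right h4⟩, ca⟩, ?_⟩
        rw [Nat.cast_div da hd0.ne', Nat.cast_div da' hd0.ne',
          log_div (by positivity) hd0.ne', log_div (by positivity) hd0.ne']
        convert h10 using 2; ring
      · rintro ⟨a, a'⟩ hp ⟨b, b'⟩ hp' h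
        simp only [coe_filter, mem_filter, mem_product, mem_Icc, Set.mem_ofPred_eq] at hp hp'
        simp only [Prod.mk.injEq, true_and] at h ⊢
        have e1 : d ∣ a := hp.2 ▸ Nat.gcd_dvd_left a a'
        have e2 : d ∣ a' := hp.2 ▸ Nat.gcd_dvd_right a a'
        have e3 : d ∣ b := hp'.2 ▸ Nat.gcd_dvd_left b b'
        have e4 : d ∣ b' := hp'.2 ▸ Nat.gcd_dvd_right b b'
        exact ⟨by rw [← Nat.div_mul_cancel e1, h.1, Nat.div_mul_cancel e3],
          by rw [← Nat.div_mul_cancel e2, h.2, Nat.div_mul_cancel e4]⟩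
    refine (Nat.cast_le.2 hle).trans ?_
    refine (card_close_le (univ : Finset Unit) (coprimePairs (A / d)) (fun _ => r)
      (fun p => log p.1 - log p.2) (t := 1 / ((A / d : ℕ) : ℝ) ^ 2) (by positivity) hη
      (fun y hy y' hy' hne => coprimePairs_separated y y' hy hy' hne)).trans ?_
    have : ((A / d : ℕ) : ℝ) ≤ A / d := Nat.cast_div_le
    rw [card_univ, Fintype.card_unit, Nat.cast_one, one_mul, div_div_eq_mul_div, div_one]
    calc 2 * η * ((A / d : ℕ) : ℝ) ^ 2 + 1 ≤ 2 * η * (A / d) ^ 2 + 1 := by gcongr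
      _ = _ := by field_simp
  refine (sum_le_sum hfib).trans ?_
  rw [sum_add_distrib, ← mul_sum, sum_const, nsmul_eq_mul, mul_one]
  have c1 : (I.card : ℝ) ≤ D0 := by
    have : I ⊆ Icc 1 ⌊D0⌋₊ := fun d hd => by
      simp only [hI, mem_filter, mem_Icc] at hd ⊢
      exact ⟨hd.1.1, Nat.le_floor hd.2⟩
    have := card_le_card this
    rw [Nat.card_Icc, Nat.add_sub_cancel] at this
    exact (Nat.cast_le.2 this).trans (Nat.floor_le hD)
  have c2 : ∑ d ∈ I, (1 / (d : ℝ) ^ 2) ≤ 2 := by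
    have := sum_inv_sq_le A (le_refl (1 : ℝ))
    refine le_trans (sum_le_sum_of_subset_of_nonneg ?_ fun _ _ _ => by positivity) (this.trans (by norm_num))
    intro d hd
    simp only [hI, mem_filter, mem_Icc] at hd ⊢
    exact ⟨hd.1, mod_cast hd.1.1⟩
  have : 2 * η * (A : ℝ) ^ 2 * ∑ d ∈ I, (1 / (d : ℝ) ^ 2) ≤ 2 * η * (A : ℝ) ^ 2 * 2 := by gcongr
  linarith

/-- `h m^γ q` for `x = ((h, m), q)`. -/
noncomputable def mono3 (γ : ℝ) (x : (ℕ × ℕ) × ℕ) : ℝ := mono2 γ x.1 * x.2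

lemma log_mono3 {γ : ℝ} {x : (ℕ × ℕ) × ℕ} (h1 : 0 < x.1.1) (h2 : 0 < x.1.2) (h3 : 0 < x.2) :
    log (mono3 γ x) = log x.1.1 + γ * log x.1.2 + log x.2 := by
  have h3' : (0 : ℝ) < x.2 := mod_cast h3
  rw [mono3, log_mul (mono2_pos h1 h2).ne' h3'.ne', log_mono2 h1 h2]

set_option maxHeartbeats 1000000 in
/-- Spacing of `h m^γ q` when `q` is confined to short intervals. -/
theorem card_close_mono3 {γ : ℝ} (h0 : 0 < γ) (h1 : γ < 1) {H M Q B τ : ℕ} {D0 Δ : ℝ} (hH : 0 < H)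
    (hM : 0 < M) (hQ : 0 < Q) (hD : 1 ≤ D0) (hΔ : 0 ≤ Δ)
    (hτ : ∀ k, 0 < k → k ≤ 4 * H * Q → k.divisors.card ≤ τ) :
    ((((dyadicBlock H M ×ˢ Ico Q (2 * Q)) ×ˢ (dyadicBlock H M ×ˢ Ico Q (2 * Q))).filter (fun p =>
      p.1.2 < p.2.2 + 2 * B ∧ p.2.2 < p.1.2 + 2 * B ∧
      |log (mono3 γ p.1) - log (mono3 γ p.2)| ≤ Δ)).card : ℝ) ≤
    1100 / γ * ((τ : ℝ) ^ 2 * ((1 + log (2 * M : ℕ)) * (1 + log (4 * H * Q : ℕ))) *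
      ((H : ℝ) * Q * M + Δ * ((H : ℝ) * Q * M) ^ 2 / D0) + (H : ℝ) ^ 2 * Q * B * (D0 + Δ * M ^ 2)) := by
  classical
  set S := dyadicBlock H M ×ˢ Ico Q (2 * Q) with hS
  set P := (S ×ˢ S).filter (fun p => p.1.2 < p.2.2 + 2 * B ∧ p.2.2 < p.1.2 + 2 * B ∧
      |log (mono3 γ p.1) - log (mono3 γ p.2)| ≤ Δ) with hP
  have hmem : ∀ p ∈ P, ((H ≤ p.1.1.1 ∧ p.1.1.1 < 2 * H) ∧ (M ≤ p.1.1.2 ∧ p.1.1.2 < 2 * M) ∧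
      (Q ≤ p.1.2 ∧ p.1.2 < 2 * Q)) ∧ ((H ≤ p.2.1.1 ∧ p.2.1.1 < 2 * H) ∧
      (M ≤ p.2.1.2 ∧ p.2.1.2 < 2 * M) ∧ (Q ≤ p.2.2 ∧ p.2.2 < 2 * Q)) ∧
      (p.1.2 < p.2.2 + 2 * B ∧ p.2.2 < p.1.2 + 2 * B) ∧
      |(log p.1.1.1 + γ * log p.1.1.2 + log p.1.2) -
        (log p.2.1.1 + γ * log p.2.1.2 + log p.2.2)| ≤ Δ := fun p hp => by
    simp only [hP, hS, mem_filter, mem_product, mem_dyadicBlock, mem_Ico] at hp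
    obtain ⟨⟨⟨⟨a1, a2⟩, a3⟩, ⟨b1, b2⟩, b3⟩, c1, c2, c3⟩ := hp
    rw [log_mono3 (by omega) (by omega) (by omega), log_mono3 (by omega) (by omega) (by omega)] at c3
    exact ⟨⟨a1, a2, a3⟩, ⟨b1, b2, b3⟩, ⟨c1, c2⟩, c3⟩
  have hdiv : ∀ u v L : ℝ, |u + γ * v| ≤ L → |v + 1 / γ * u| ≤ L / γ := fun u v L h => by
    rw [le_div_iff₀ h0, ← abs_of_pos h0, ← abs_mul, abs_of_pos h0]
    rwa [show (v + 1 / γ * u) * γ = u + γ * v by field_simp; ring]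
  have hlog : ∀ p ∈ P, |log p.1.1.2 - log p.2.1.2 + 1 / γ * (log p.1.1.1 + log p.1.2 - log p.2.1.1 -
      log p.2.2)| ≤ Δ / γ := fun p hp => hdiv _ _ Δ (by convert (hmem p hp).2.2.2 using 2; ring)
  set P₁ := P.filter (fun p => D0 ≤ (Nat.gcd p.1.1.2 p.2.1.2 : ℝ)) with hP₁
  set P₂ := P.filter (fun p => ¬ D0 ≤ (Nat.gcd p.1.1.2 p.2.1.2 : ℝ)) with hP₂
  -- large gcd
  have hbig : P₁.card ≤
      τ ^ 2 * (closeQuads (1 / γ) (Δ / γ) D0 (2 * M) (4 * H * Q)).card := by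
    refine card_le_mul_card_image_of_maps_to
      (f := fun p => ((p.1.1.2, p.2.1.2), (p.2.1.1 * p.2.2, p.1.1.1 * p.1.2))) ?_ _ ?_
    · intro p hp
      obtain ⟨hp, hg⟩ := mem_filter.1 hp
      obtain ⟨⟨a1, a2, a3⟩, ⟨b1, b2, b3⟩, -⟩ := hmem p hp
      have k1 : p.2.1.1 * p.2.2 ≤ 4 * H * Q := by nlinarith
      have k2 : p.1.1.1 * p.1.2 ≤ 4 * H * Q := by nlinarith
      have k3 : 0 < p.2.1.1 * p.2.2 := Nat.mul_pos (by omega) (by omega)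
      have k4 : 0 < p.1.1.1 * p.1.2 := Nat.mul_pos (by omega) (by omega)
      simp only [closeQuads, mem_filter, mem_product, mem_Icc]
      refine ⟨⟨⟨⟨by omega, by omega⟩, by omega, by omega⟩, ⟨k3, k1⟩, k4, k2⟩, hg, ?_⟩
      have pos : ∀ i j : ℕ, i ≤ j → 0 < i → ((j : ℝ)) ≠ 0 := fun i j h h' => by
        have : 0 < j := by omega
        positivity
      push_cast
      rw [log_mul (pos _ _ b1.1 hH) (pos _ _ b3.1 hQ), log_mul (pos _ _ a1.1 hH) (pos _ _ a3.1 hQ)]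
      convert hlog p hp using 2; ring
    · rintro ⟨⟨m, m'⟩, k', k⟩ hb
      simp only [closeQuads, mem_filter, mem_product, mem_Icc] at hb
      have d1 := hτ k (by omega) (by omega)
      have d2 := hτ k' (by omega) (by omega)
      calc _ ≤ (k.divisors ×ˢ k'.divisors).card := by
            refine card_le_card_of_injOn (fun p => (p.1.1.1, p.2.1.1)) ?_ ?_
            · intro p hp
              simp only [coe_filter, Set.mem_ofPred_eq, Prod.mk.injEq] at hp
              obtain ⟨-, -, e1, e2⟩ := hp
              simp only [coe_product, Set.mem_prod, mem_coe, Nat.mem_divisors]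
              exact ⟨⟨e2 ▸ dvd_mul_right _ _, by omega⟩, e1 ▸ dvd_mul_right _ _, by omega⟩
            · rintro ⟨⟨⟨a, b⟩, c⟩, ⟨a', b'⟩, c'⟩ hp ⟨⟨⟨d, e⟩, f⟩, ⟨d', e'⟩, f'⟩ hp' h
              simp only [hP₁, coe_filter, mem_filter, Set.mem_ofPred_eq, Prod.mk.injEq] at hp hp' h ⊢
              obtain ⟨⟨hp1, -⟩, ⟨e1, e2⟩, e3, e4⟩ := hp
              obtain ⟨-, ⟨g1, g2⟩, g3, g4⟩ := hp'
              obtain ⟨rfl, rfl⟩ := h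
              obtain ⟨⟨a1, -, -⟩, ⟨b1, -, -⟩, -, -⟩ := hmem _ hp1
              dsimp only at a1 b1
              refine ⟨⟨⟨rfl, by omega⟩, ?_⟩, ⟨rfl, by omega⟩, ?_⟩
              · exact Nat.eq_of_mul_eq_mul_left (by omega) (e4.trans g4.symm)
              · exact Nat.eq_of_mul_eq_mul_left (by omega) (e3.trans g3.symm)
        _ = k.divisors.card * k'.divisors.card := card_product _ _
        _ ≤ τ ^ 2 := by rw [sq]; exact Nat.mul_le_mul d1 d2
  -- small gcd
  set V := (Ico Q (2 * Q) ×ˢ Ico Q (2 * Q)).filter (fun r => r.1 < r.2 + 2 * B ∧ r.2 < r.1 + 2 * B) with hV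
  have hVc : V.card ≤ 4 * B * Q := by
    have : V.card ≤ 4 * B * (Ico Q (2 * Q)).card := by
      refine card_le_mul_card_image_of_maps_to (f := fun r => r.1) ?_ _ ?_
      · intro r hr; exact (mem_product.1 (mem_filter.1 hr).1).1
      · intro q _
        calc _ ≤ (Ico (q + 1 - 2 * B) (q + 2 * B)).card := by
              refine card_le_card_of_injOn (fun r => r.2) ?_ ?_
              · rintro ⟨u, v⟩ hr
                simp only [hV, coe_filter, mem_filter, Set.mem_ofPred_eq] at hr
                simp only [coe_Ico, Set.mem_Ico]
                omega
              · rintro ⟨u, v⟩ hr ⟨u', v'⟩ hr' h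
                simp only [coe_filter, Set.mem_ofPred_eq] at hr hr' h
                obtain ⟨-, rfl⟩ := hr
                obtain ⟨-, rfl⟩ := hr'
                rw [h]
          _ ≤ 4 * B := by rw [Nat.card_Ico]; omega
    rwa [Nat.card_Ico, show 2 * Q - Q = Q by omega] at this
  set n₀ := ⌊D0 + 4 * (Δ / γ) * ((2 * M : ℕ) : ℝ) ^ 2⌋₊
  have hsmall : P₂.card ≤
      n₀ * ((Ico H (2 * H) ×ˢ Ico H (2 * H)) ×ˢ V).card := by
    refine card_le_mul_card_image_of_maps_to
      (f := fun p => ((p.1.1.1, p.2.1.1), (p.1.2, p.2.2))) ?_ _ ?_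
    · intro p hp
      obtain ⟨⟨a1, a2, a3⟩, ⟨b1, b2, b3⟩, c, -⟩ := hmem p (mem_filter.1 hp).1
      simp only [hV, mem_product, mem_filter, mem_Ico]
      exact ⟨⟨a1, b1⟩, ⟨a3, b3⟩, c⟩
    · rintro ⟨⟨h, h'⟩, q, q'⟩ _
      apply Nat.le_floor
      refine le_trans ?_ (card_close_small_gcd (r := -(1 / γ * (log h + log q - log h' - log q')))
        (η := Δ / γ) (by positivity) (by linarith : 0 ≤ D0) (2 * M))
      norm_cast
      refine card_le_card_of_injOn (fun p => (p.1.1.2, p.2.1.2)) ?_ ?_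
      · intro p hp
        simp only [hP₂, coe_filter, mem_filter, Set.mem_ofPred_eq, Prod.mk.injEq] at hp
        obtain ⟨⟨hp, hg⟩, ⟨rfl, rfl⟩, rfl, rfl⟩ := hp
        obtain ⟨⟨a1, a2, a3⟩, ⟨b1, b2, b3⟩, -⟩ := hmem p hp
        simp only [coe_filter, Set.mem_ofPred_eq, mem_product, mem_Icc]
        refine ⟨⟨⟨by omega, by omega⟩, by omega, by omega⟩, (not_le.1 hg).le, ?_⟩
        rw [← abs_neg]
        convert hlog p hp using 2; ring
      · rintro ⟨⟨⟨a, b⟩, c⟩, ⟨a', b'⟩, c'⟩ hp ⟨⟨⟨d, e⟩, f⟩, ⟨d', e'⟩, f'⟩ hp' h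
        simp only [coe_filter, Set.mem_ofPred_eq, Prod.mk.injEq] at hp hp' h ⊢
        omega
  have hsplit : (P.card : ℝ) = P₁.card +
      P₂.card := by
    exact_mod_cast (card_filter_add_card_filter_not (s := P) (fun p => D0 ≤ (Nat.gcd p.1.1.2 p.2.1.2 : ℝ))).symm
  have hcq := card_closeQuads_le (σ := 1 / γ) (by positivity) (show 0 ≤ Δ / γ by positivity) hD (2 * M) (4 * H * Q)
  have l1 : 0 ≤ log (2 * M : ℕ) := log_natCast_nonneg _
  have l2 : 0 ≤ log (4 * H * Q : ℕ) := log_natCast_nonneg _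
  set ℒ := (1 + log (2 * M : ℕ)) * (1 + log (4 * H * Q : ℕ)) with hℒ
  have hℒ1 : 1 ≤ ℒ := by rw [hℒ]; nlinarith [mul_nonneg l1 l2]
  set K := (H : ℝ) * Q * M with hK
  set G := Δ * K ^ 2 / D0 with hG
  have b1 : (P₁.card : ℝ) ≤
      1100 / γ * ((τ : ℝ) ^ 2 * ℒ * (K + G)) := by
    have a1 : ((closeQuads (1 / γ) (Δ / γ) D0 (2 * M) (4 * H * Q)).card : ℝ) ≤
        16 * (8 * K * ℒ + 64 / γ * G) := by
      refine hcq.trans ?_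
      have e : 8 + 8 / (1 / γ) ≤ 16 := by rw [div_div_eq_mul_div]; linarith
      refine mul_le_mul e (le_of_eq ?_) (by positivity) (by norm_num)
      rw [hG, hK]; push_cast; ring
    have a2 : 8 * K * ℒ + 64 / γ * G ≤
        64 / γ * (ℒ * (K + G)) := by
      have c1 : 8 * K * ℒ ≤ 64 / γ * (ℒ * K) := by
        have : (8 : ℝ) ≤ 64 / γ := by rw [le_div_iff₀ h0]; linarith
        calc _ = 8 * (ℒ * K) := by ring
          _ ≤ _ := by gcongr
      have c2 : 64 / γ * (1 * G) ≤ 64 / γ * (ℒ * G) := by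
        gcongr
      rw [mul_add ℒ, mul_add (64 / γ)]
      linarith
    calc _ ≤ (τ : ℝ) ^ 2 * (closeQuads (1 / γ) (Δ / γ) D0 (2 * M) (4 * H * Q)).card := mod_cast hbig
      _ ≤ (τ : ℝ) ^ 2 * (16 * (64 / γ * (ℒ * (K + G)))) := by
          gcongr; linarith
      _ = 1024 / γ * ((τ : ℝ) ^ 2 * ℒ * (K + G)) := by ring
      _ ≤ _ := by gcongr; norm_num
  have b2 : (P₂.card : ℝ) ≤
      1100 / γ * ((H : ℝ) ^ 2 * Q * B * (D0 + Δ * M ^ 2)) := by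
    have a1 : (n₀ : ℝ) ≤ 16 / γ * (D0 + Δ * M ^ 2) := by
      refine (Nat.floor_le (by positivity)).trans ?_
      have : D0 ≤ 16 / γ * D0 := by
        have : (1 : ℝ) ≤ 16 / γ := by rw [le_div_iff₀ h0]; linarith
        nlinarith
      push_cast
      have e : 4 * (Δ / γ) * (2 * (M : ℝ)) ^ 2 = 16 / γ * (Δ * M ^ 2) := by ring
      rw [e, mul_add]; linarith
    have a2 : ((((Ico H (2 * H) ×ˢ Ico H (2 * H)) ×ˢ V).card : ℕ) : ℝ) ≤ (H : ℝ) * H * (4 * B * Q) := by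
      rw [card_product, card_product, Nat.card_Ico, show 2 * H - H = H by omega]
      exact_mod_cast Nat.mul_le_mul_left (H * H) hVc
    calc _ ≤ (n₀ : ℝ) * (((Ico H (2 * H) ×ˢ Ico H (2 * H)) ×ˢ V).card : ℕ) := mod_cast hsmall
      _ ≤ (16 / γ * (D0 + Δ * M ^ 2)) * ((H : ℝ) * H * (4 * B * Q)) := by gcongr
      _ = 64 / γ * ((H : ℝ) ^ 2 * Q * B * (D0 + Δ * M ^ 2)) := by ring
      _ ≤ _ := by gcongr; norm_num
  rw [hsplit, mul_add]
  exact add_le_add b1 b2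

lemma norm_ee_sub_ee_le (s t : ℝ) : ‖ee s - ee t‖ ≤ 7 * |s - t| := by
  have e : ee s - ee t = ee t * (ee (s - t) - 1) := by
    rw [mul_sub, ← ee_add, mul_one]; congr 2; ring
  rw [e, norm_mul, norm_ee, one_mul]
  have := norm_exp_I_mul_ofReal_sub_one_le (x := 2 * π * (s - t))
  rw [ee, mul_comm _ Complex.I]
  push_cast at this ⊢
  refine this.trans ?_
  rw [norm_mul, norm_of_nonneg (by positivity), norm_eq_abs]
  have := pi_lt_d2
  gcongr
  linarith

/-- Recentering the differenced sum over an interval. -/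
lemma sum_shift_recenter {γ f : ℝ} {N lo hi q₀ j : ℕ} (hlo : N ≤ lo) (hhi : hi ≤ 2 * N) :
    ∑ n ∈ Ico N (2 * N), (if lo ≤ n + (q₀ + 2 * j) ∧ n + (q₀ + 2 * j) < hi then
        ee (f * ((n + (q₀ + 2 * j) : ℕ) : ℝ) ^ γ) else 0) *
        conj (if lo ≤ n ∧ n < hi then ee (f * (n : ℝ) ^ γ) else 0) =
      ∑ n ∈ Ico N (2 * N), if lo + j ≤ n then (if n < hi - (q₀ + j) then
        ee (f * (((n : ℝ) + q₀ + j) ^ γ - ((n : ℝ) - j) ^ γ)) else 0) else 0 := by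
  have e1 : ∀ n ∈ Ico N (2 * N), (if lo ≤ n + (q₀ + 2 * j) ∧ n + (q₀ + 2 * j) < hi then
        ee (f * ((n + (q₀ + 2 * j) : ℕ) : ℝ) ^ γ) else 0) *
        conj (if lo ≤ n ∧ n < hi then ee (f * (n : ℝ) ^ γ) else 0) =
      if lo ≤ n ∧ n + (q₀ + 2 * j) < hi then
        ee (f * (((n + (q₀ + 2 * j) : ℕ) : ℝ) ^ γ - (n : ℝ) ^ γ)) else 0 := fun n _ => by
    by_cases h : lo ≤ n ∧ n + (q₀ + 2 * j) < hi
    · rw [if_pos h, if_pos ⟨by omega, h.2⟩, if_pos ⟨h.1, by omega⟩, ee_mul_conj, mul_sub]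
    · rw [if_neg h]
      by_cases h' : lo ≤ n
      · rw [if_neg (by omega), zero_mul]
      · rw [if_neg (c := lo ≤ n ∧ n < hi) (by omega), map_zero, mul_zero]
  have e2 : ∀ n ∈ Ico N (2 * N), (if lo + j ≤ n then (if n < hi - (q₀ + j) then
        ee (f * (((n : ℝ) + q₀ + j) ^ γ - ((n : ℝ) - j) ^ γ)) else 0) else 0) =
      if lo + j ≤ n ∧ n < hi - (q₀ + j) then
        ee (f * (((n : ℝ) + q₀ + j) ^ γ - ((n : ℝ) - j) ^ γ)) else 0 := by
    intro n _; rw [ite_and]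
  rw [sum_congr rfl e1, sum_congr rfl e2, ← sum_filter, ← sum_filter]
  refine sum_nbij' (fun n => n + j) (fun n => n - j) ?_ ?_ ?_ ?_ ?_
  · intro n hn; simp only [mem_filter, mem_Ico] at hn ⊢; omega
  · intro n hn; simp only [mem_filter, mem_Ico] at hn ⊢; omega
  · intro n hn; simp
  · intro n hn; simp only [mem_filter, mem_Ico] at hn; omega
  · intro n hn
    congr 2
    push_cast
    congr 2 <;> ring

/-- The left end of the block of length `2B` and fixed parity containing `q`. -/
def blockBase (Q B q : ℕ) : ℕ := Q + 2 * (B * ((q - Q) / (2 * B))) + (q - Q) % 2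

lemma blockBase_spec {Q B q : ℕ} (hB : 0 < B) (hq : Q ≤ q) :
    Q ≤ blockBase Q B q ∧ ∃ j, j < B ∧ q = blockBase Q B q + 2 * j := by
  have h1 := Nat.div_add_mod (q - Q) (2 * B)
  have h2 := Nat.mod_lt (q - Q) (show 0 < 2 * B by omega)
  rw [mul_assoc] at h1
  rw [blockBase]
  set t := B * ((q - Q) / (2 * B))
  set r := (q - Q) % (2 * B)
  exact ⟨by omega, r / 2, by omega, by omega⟩

lemma card_image_blockBase_le {Q B : ℕ} (hB : 0 < B) (hBQ : B ≤ Q) :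
    (((Ico Q (2 * Q)).image (blockBase Q B)).card : ℝ) ≤ 3 * (Q / B) := by
  have : (Ico Q (2 * Q)).image (blockBase Q B) ⊆
      (range (Q / (2 * B) + 1) ×ˢ range 2).image (fun r => Q + 2 * (B * r.1) + r.2) := fun b hb => by
    obtain ⟨q, hq, rfl⟩ := mem_image.1 hb
    rw [mem_Ico] at hq
    refine mem_image.2 ⟨((q - Q) / (2 * B), (q - Q) % 2), ?_, rfl⟩
    rw [mem_product, mem_range, mem_range]
    exact ⟨Nat.lt_succ_of_le (Nat.div_le_div_right (by omega)), Nat.mod_lt _ (by norm_num)⟩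
  have h := (card_le_card this).trans card_image_le
  rw [card_product, card_range, card_range] at h
  have hB' : (0 : ℝ) < B := mod_cast hB
  have h1 : ((Q / (2 * B) : ℕ) : ℝ) ≤ Q / (2 * B) := by
    have := Nat.cast_div_le (α := ℝ) (m := Q) (n := 2 * B); push_cast at this; exact this
  have h2 : (1 : ℝ) ≤ Q / B := by rw [le_div_iff₀ hB', one_mul]; exact_mod_cast hBQ
  have h3 : (Q : ℝ) / (2 * B) = Q / B / 2 := by field_simp
  have h4 : (((Ico Q (2 * Q)).image (blockBase Q B)).card : ℝ) ≤ ((Q / (2 * B) : ℕ) + 1) * 2 := by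
    exact_mod_cast h
  rw [h3] at h1
  linarith

lemma sum_sqrt_le {ι : Type*} (s : Finset ι) (f : ι → ℝ) (hf : ∀ i ∈ s, 0 ≤ f i) :
    ∑ i ∈ s, √(f i) ≤ √(s.card * ∑ i ∈ s, f i) := by
  apply le_sqrt_of_sq_le
  refine sq_sum_le_card_mul_sum_sq.trans (le_of_eq ?_)
  congr 1
  exact sum_congr rfl fun i hi => sq_sqrt (hf i hi)

set_option maxHeartbeats 1000000 in
/-- One block: the double large sieve after linearising in `q`. -/
lemma bilBound_block {γ : ℝ} (h0 : 0 < γ) (h1 : γ < 1) {H M N Q B q₀ L : ℕ} {F : ℝ}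
    (hH : 0 < H) (hM : 0 < M) (hQ : 0 < Q) (hQN : 128 * ((Q : ℝ) / N) ^ 2 ≤ (1 - γ) / 100) (hQ2 : 4 * Q ≤ N)
    (hF : F = (H : ℝ) * (M : ℝ) ^ γ * (Q * (N : ℝ) ^ (γ - 1))) (hB : 6 * (F * Q * B) ≤ (N : ℝ) ^ 2)
    (hq₀ : Q ≤ q₀) (hq₀2 : q₀ < 2 * Q) (fib : Finset ℕ)
    (hfib : ∀ q ∈ fib, q < 2 * Q ∧ ∃ j, j < B ∧ q = q₀ + 2 * j)
    (hL : 4 * N + 1 < 2 ^ L) (lo hi : ℕ × ℕ → ℕ) (hlo : ∀ p, lo p ≤ 2 * N) (hhi : ∀ p, hi p ≤ 2 * N) :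
    BilBound (dyadicBlock H M ×ˢ fib) (Ico N (2 * N)) (fun x n =>
      if lo x.1 + (x.2 - q₀) / 2 ≤ n then (if n < hi x.1 - (q₀ + (x.2 - q₀) / 2) then
        ee (mono2 γ x.1 * ((x.2 : ℝ) / q₀ * shiftDiff γ (q₀, n) +
          γ * (γ - 1) * (γ - 2) / 24 * ((x.2 : ℝ) * ((x.2 : ℝ) ^ 2 - (q₀ : ℝ) ^ 2)) *
            ((n : ℝ) + q₀ / 2) ^ (γ - 3))) else 0) else 0)
      (L * (L * (exp (2 * π) * (2 * exp (4 * π) * √(16 * (1 + F) *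
        ((((dyadicBlock H M ×ˢ fib) ×ˢ (dyadicBlock H M ×ˢ fib)).filter (fun p =>
          |log (mono3 γ p.1) - log (mono3 γ p.2)| ≤ 1 / F)).card *
          (10 / (γ * (1 - γ)) * (N + N ^ 2 / F)))))))) := by
  have hθ : 0 < 1 - γ := by linarith
  have hN : 0 < N := by omega
  have hN' : (0 : ℝ) < N := mod_cast hN
  have hQ' : (0 : ℝ) < Q := mod_cast hQ
  have hq0' : (Q : ℝ) ≤ q₀ := mod_cast hq₀
  have hq0p : (0 : ℝ) < q₀ := by linarith
  have hq02' : (q₀ : ℝ) ≤ 2 * Q := mod_cast hq₀2.le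
  set f0 := (H : ℝ) * (M : ℝ) ^ γ with hf0
  set g0 := (N : ℝ) ^ (γ - 1) with hg0
  have hf00 : 0 < f0 := by positivity
  have hg00 : 0 < g0 := by positivity
  have hF0 : 0 < F := by rw [hF]; positivity
  set X := dyadicBlock H M ×ˢ fib
  have hfibb : ∀ q ∈ fib, (q₀ : ℝ) ≤ q ∧ (q : ℝ) ≤ 2 * Q ∧ (q : ℝ) - q₀ ≤ 2 * B := fun q hq => by
    obtain ⟨a, j, hj, rfl⟩ := hfib q hq
    refine ⟨mod_cast (by omega : q₀ ≤ q₀ + 2 * j), mod_cast a.le, ?_⟩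
    have : (j : ℝ) ≤ B := mod_cast hj.le
    push_cast; linarith
  have hfX : ∀ x ∈ X, f0 * Q ≤ mono3 γ x ∧ mono3 γ x ≤ 8 * (f0 * Q) := fun x hx => by
    obtain ⟨hx1, hx2⟩ := mem_product.1 hx
    obtain ⟨a1, a2⟩ := mono2_bounds h0 h1 hx1
    obtain ⟨b1, b2, -⟩ := hfibb _ hx2
    rw [← hf0] at a1 a2
    rw [mono3]
    constructor
    · exact mul_le_mul a1 (by linarith) hQ'.le (by linarith)
    · calc _ ≤ 4 * f0 * (2 * Q) := mul_le_mul a2 b2 (by linarith) (by linarith)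
        _ = _ := by ring
  have hgY : ∀ n ∈ Ico N (2 * N), γ / 4 * g0 ≤ shiftDiff γ (q₀, n) / q₀ ∧ shiftDiff γ (q₀, n) / q₀ ≤ 2 * g0 := fun n hn => by
    rw [mem_Ico] at hn
    obtain ⟨a1, a2⟩ := shiftDiff_bounds h0 h1 (Q := q₀) (N := N) (r := (q₀, n)) (by omega) (by omega)
      (by rw [mem_dyadicBlock]; exact ⟨⟨le_refl _, by dsimp only; omega⟩, hn⟩)
    rw [le_div_iff₀ hq0p, div_le_iff₀ hq0p]
    exact ⟨by linarith, by linarith⟩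
  have hdls := double_large_sieve X (Ico N (2 * N)) (mono3 γ) (fun n => shiftDiff γ (q₀, n) / q₀)
    (X0 := 8 * (f0 * Q)) (Y0 := 2 * g0) (by positivity) (by positivity)
    (fun x hx => ⟨le_trans (by positivity) (hfX x hx).1, (hfX x hx).2⟩)
    (fun n hn => ⟨le_trans (by positivity) (hgY n hn).1, (hgY n hn).2⟩)
  set NX := ((X ×ˢ X).filter (fun p =>
          |log (mono3 γ p.1) - log (mono3 γ p.2)| ≤ 1 / F)).card
  have hNXle : ((X ×ˢ X).filter (fun p => |mono3 γ p.1 - mono3 γ p.2| ≤ 1 / (2 * g0))).card ≤ NX := by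
    refine card_le_card fun p hp => ?_
    simp only [mem_filter, mem_product] at hp ⊢
    have hfq : 0 < f0 * Q := by positivity
    refine ⟨hp.1, (abs_log_sub_le_div hfq (hfX _ hp.1.1).1 (hfX _ hp.1.2).1).trans ?_⟩
    rw [div_le_iff₀ hfq]
    refine hp.2.trans ?_
    rw [hF, div_mul_eq_mul_div, one_mul, div_le_div_iff₀ (by positivity) (by positivity)]
    have : 0 < f0 * Q * g0 := by positivity
    linarith
  have hNY : (((Ico N (2 * N) ×ˢ Ico N (2 * N)).filter (fun p =>
      |shiftDiff γ (q₀, p.1) / q₀ - shiftDiff γ (q₀, p.2) / q₀| ≤ 1 / (8 * (f0 * Q)))).card : ℝ) ≤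
      10 / (γ * (1 - γ)) * (N + N ^ 2 / F) := by
    have hsep : ∀ y ∈ Ico N (2 * N), ∀ y' ∈ Ico N (2 * N), y ≠ y' →
      3 / 10 * (1 - γ) / N ≤ |log (shiftDiff γ (q₀, y)) - log (shiftDiff γ (q₀, y'))| := fun y hy y' hy' hne => by
      rw [mem_Ico] at hy hy'
      have hqn : 32 * ((q₀ : ℝ) / N) ^ 2 ≤ (1 - γ) / 100 := by
        calc 32 * ((q₀ : ℝ) / N) ^ 2 ≤ 32 * ((2 * Q) / N) ^ 2 := by gcongr
          _ = 128 * ((Q : ℝ) / N) ^ 2 := by ring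
          _ ≤ _ := hQN
      refine le_trans ?_ (shiftDiff_separated h0 h1 (Q := q₀) (by omega) hN hqn (by omega) le_rfl
        (by omega) hy.1 hy.2 hy'.1 hy'.2)
      rw [mul_div_assoc', div_le_div_iff_of_pos_right hN']
      refine le_mul_of_one_le_right (by positivity) ?_
      have : (1 : ℤ) ≤ |(y : ℤ) - y'| := Int.one_le_abs (by omega)
      exact_mod_cast this
    have hc := card_close_le (Ico N (2 * N)) (Ico N (2 * N)) (fun n => log (shiftDiff γ (q₀, n)))
      (fun n => log (shiftDiff γ (q₀, n))) (t := 3 / 10 * (1 - γ) / N) (η := 1 / (2 * γ * F))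
      (by positivity) (by positivity) hsep
    refine le_trans ?_ (hc.trans ?_)
    · norm_cast
      refine card_le_card fun p hp => ?_
      simp only [mem_filter, mem_product] at hp ⊢
      refine ⟨hp.1, ?_⟩
      have e : log (shiftDiff γ (q₀, p.1)) - log (shiftDiff γ (q₀, p.2)) =
          log (shiftDiff γ (q₀, p.1) / q₀) - log (shiftDiff γ (q₀, p.2) / q₀) := by
        have pos : ∀ n ∈ Ico N (2 * N), shiftDiff γ (q₀, n) ≠ 0 := fun n hn h => by
          have := (hgY n hn).1
          rw [h, zero_div] at this
          have : 0 < γ / 4 * g0 := by positivity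
          linarith
        rw [log_div (pos _ hp.1.1) hq0p.ne', log_div (pos _ hp.1.2) hq0p.ne']; ring
      have hgp : 0 < γ / 4 * g0 := by positivity
      rw [e]
      refine (abs_log_sub_le_div hgp (hgY _ hp.1.1).1 (hgY _ hp.1.2).1).trans ?_
      rw [div_le_iff₀ hgp]
      refine hp.2.trans (le_of_eq ?_)
      rw [hF]; field_simp; norm_num
    · rw [Nat.card_Ico, show 2 * N - N = N by omega]
      have e : (N : ℝ) * (2 * (1 / (2 * γ * F)) / (3 / 10 * (1 - γ) / N) + 1) =
          N + 10 / 3 / (γ * (1 - γ)) * (N ^ 2 / F) := by field_simp; ring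
      rw [e]
      have e1 : (1 : ℝ) ≤ 10 / (γ * (1 - γ)) := by
        rw [le_div_iff₀ (by positivity)]; nlinarith
      have e2 : 10 / 3 / (γ * (1 - γ)) * ((N : ℝ) ^ 2 / F) ≤ 10 / (γ * (1 - γ)) * (N ^ 2 / F) := by
        gcongr; norm_num
      have e3 : (N : ℝ) ≤ 10 / (γ * (1 - γ)) * N := by nlinarith
      rw [mul_add]; linarith
  have hdls2 : BilBound X (Ico N (2 * N)) (fun x n => ee (mono3 γ x * (shiftDiff γ (q₀, n) / q₀)))
      (2 * exp (4 * π) * √(16 * (1 + F) * (NX * (10 / (γ * (1 - γ)) * (N + N ^ 2 / F))))) := by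
    refine hdls.mono ?_
    gcongr
    rw [hF]
    have : 0 < f0 * (Q * g0) := by positivity
    linarith
  set κ := γ * (γ - 1) * (γ - 2) / 24 with hκ
  have hκ1 : |κ| ≤ 1 / 12 := by
    rw [hκ, abs_of_nonneg (by
      have : 0 ≤ (1 - γ) * (2 - γ) := mul_nonneg hθ.le (by linarith)
      have : 0 ≤ γ * ((1 - γ) * (2 - γ)) := mul_nonneg h0.le this
      linarith)]
    have : γ * (1 - γ) ≤ 1 := by nlinarith
    have : γ * (1 - γ) * (2 - γ) ≤ 1 * 2 := mul_le_mul this (by linarith) (by linarith) (by norm_num)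
    linarith
  set nu := (N : ℝ) ^ (γ - 3) with hnu
  have hnu0 : 0 < nu := by positivity
  have hpert := hdls2.perturb
    (fun x => mono2 γ x.1 * (κ * ((x.2 : ℝ) * ((x.2 : ℝ) ^ 2 - (q₀ : ℝ) ^ 2))) * nu)
    (fun n => ((n : ℝ) + q₀ / 2) ^ (γ - 3) / nu) (by
      intro x hx
      obtain ⟨hx1, hx2⟩ := mem_product.1 hx
      obtain ⟨a1, a2⟩ := mono2_bounds h0 h1 hx1
      obtain ⟨b1, b2, b3⟩ := hfibb _ hx2
      rw [← hf0] at a1 a2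
      have c1 : 0 ≤ (x.2 : ℝ) ^ 2 - (q₀ : ℝ) ^ 2 := by nlinarith
      have c2 : (x.2 : ℝ) ^ 2 - (q₀ : ℝ) ^ 2 ≤ 2 * B * (4 * Q) := by
        calc (x.2 : ℝ) ^ 2 - (q₀ : ℝ) ^ 2 = (x.2 - q₀) * (x.2 + q₀) := by ring
          _ ≤ 2 * B * (4 * Q) := mul_le_mul b3 (by linarith) (by linarith) (by positivity)
      have c3 : 0 ≤ (x.2 : ℝ) * ((x.2 : ℝ) ^ 2 - (q₀ : ℝ) ^ 2) := mul_nonneg (Nat.cast_nonneg _) c1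
      rw [abs_mul, abs_mul, abs_mul, abs_of_pos hnu0, abs_of_nonneg c3,
        abs_of_nonneg (by linarith : 0 ≤ mono2 γ x.1)]
      have hnue : nu = g0 / N ^ 2 := by
        rw [hnu, hg0, show γ - 3 = (γ - 1) - 2 by ring, rpow_sub hN']; norm_num
      calc mono2 γ x.1 * (|κ| * (x.2 * ((x.2 : ℝ) ^ 2 - (q₀ : ℝ) ^ 2))) * nu
          ≤ 4 * f0 * (1 / 12 * (2 * Q * (2 * B * (4 * Q)))) * nu := by gcongr
        _ = 16 / 3 * (F * Q * B) / N ^ 2 := by rw [hnue, hF]; ring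
        _ ≤ 1 := by
          rw [div_le_one (by positivity)]
          have : 0 ≤ F * Q * B := by positivity
          linarith)
    (by
      intro n hn
      rw [mem_Ico] at hn
      have : (N : ℝ) ≤ n := mod_cast hn.1
      rw [abs_of_nonneg (by positivity), div_le_one hnu0]
      exact rpow_le_rpow_of_nonpos hN' (by linarith) (by linarith))
  have hker := hpert.congr (K' := fun x n => ee (mono2 γ x.1 * ((x.2 : ℝ) / q₀ * shiftDiff γ (q₀, n) +
          κ * ((x.2 : ℝ) * ((x.2 : ℝ) ^ 2 - (q₀ : ℝ) ^ 2)) * ((n : ℝ) + q₀ / 2) ^ (γ - 3)))) (by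
    intro x _ n _
    rw [← ee_add, mono3]
    congr 1
    field_simp
    ring)
  have hbits : ∀ x ∈ X, (x.2 - q₀) / 2 ≤ N := fun x hx => by
    obtain ⟨a, j, hj, e⟩ := hfib _ (mem_product.1 hx).2
    omega
  have hc2 := (hker.swap.lt_coupling L (fun n => n) (fun x => hi x.1 - (q₀ + (x.2 - q₀) / 2))
    (by intro n hn; rw [mem_Ico] at hn; omega) (by intro x hx; have := hhi x.1; omega)).swap
  exact hc2.le_coupling L (fun x => lo x.1 + (x.2 - q₀) / 2) (fun n => n)
    (by intro x hx; have := hlo x.1; have := hbits x hx; omega)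
    (by intro n hn; rw [mem_Ico] at hn; omega)

/-- The sum over a dyadic block of the products of `e(f(p) n^γ)` and its shift by `d`, restricted to `[lo, hi)`. -/
noncomputable def diffSum (γ : ℝ) (H M N : ℕ) (lo hi : ℕ × ℕ → ℕ) (d : ℕ) : ℂ :=
  ∑ p ∈ dyadicBlock H M, ∑ n ∈ Ico N (2 * N),
    (if lo p ≤ n + d ∧ n + d < hi p then ee (mono2 γ p * ((n + d : ℕ) : ℝ) ^ γ) else 0) *
      conj (if lo p ≤ n ∧ n < hi p then ee (mono2 γ p * (n : ℝ) ^ γ) else 0)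

set_option maxHeartbeats 1000000 in
/-- The differenced type I sum over a dyadic range of shifts, cut into blocks. -/
theorem norm_differenced_sum_le {γ : ℝ} (h0 : 0 < γ) (h1 : γ < 1) : ∃ C : ℝ, 0 < C ∧
    ∀ (H M N Q B L τ D : ℕ) (F D0 : ℝ) (lo hi : ℕ × ℕ → ℕ), 0 < H → 0 < M → 0 < Q → 0 < B → B ≤ Q →
    128 * ((Q : ℝ) / N) ^ 2 ≤ (1 - γ) / 100 → 4 * Q ≤ N →
    F = (H : ℝ) * (M : ℝ) ^ γ * (Q * (N : ℝ) ^ (γ - 1)) → 6 * (F * Q * B) ≤ (N : ℝ) ^ 2 → 1 ≤ D0 →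
    (∀ k, 0 < k → k ≤ 4 * H * Q → k.divisors.card ≤ τ) → 4 * N + 1 < 2 ^ L →
    (∀ p, N ≤ lo p ∧ lo p ≤ 2 * N) → (∀ p, hi p ≤ 2 * N) →
    ‖∑ d ∈ Ico Q (2 * Q), if d < D then diffSum γ H M N lo hi d else 0‖ ≤
    C * (L : ℝ) ^ 2 * √((1 + F) * (N + N ^ 2 / F) * ((Q : ℝ) / B * ((τ : ℝ) ^ 2 *
      ((1 + log (2 * M : ℕ)) * (1 + log (4 * H * Q : ℕ))) *
      ((H : ℝ) * Q * M + ((H : ℝ) * Q * M) ^ 2 / (F * D0)) + (H : ℝ) ^ 2 * Q * B * (D0 + M ^ 2 / F)))) +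
    C * ((H : ℝ) * M * Q * N * (H * (M : ℝ) ^ γ * (N : ℝ) ^ γ * (Q / N) ^ 5)) := by
  set E := exp (2 * π) * (2 * exp (4 * π)) with hE
  set C0 := 16 * (10 / (γ * (1 - γ))) * 3 * (1100 / γ) with hC0
  have hC00 : 0 < C0 := by positivity
  refine ⟨E * √C0 + 258048, by positivity, ?_⟩
  intro H M N Q B L τ D F D0 lo hi hH hM hQ hB hBQ hQN hQ4 hF hFB hD0 hτ hL hlo hhi
  have hN : 0 < N := by omega
  have hN' : (0 : ℝ) < N := mod_cast hN
  have hF0 : 0 < F := by rw [hF]; positivity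
  set base := blockBase Q B with hbase
  set I := (Ico Q (2 * Q)).image base
  set fib : ℕ → Finset ℕ := fun q₀ => (Ico Q (2 * Q)).filter (fun q => base q = q₀) with hfibd
  have hfib : ∀ q₀ ∈ I, ∀ q ∈ fib q₀, q < 2 * Q ∧ ∃ j, j < B ∧ q = q₀ + 2 * j := fun q₀ _ q hq => by
    obtain ⟨hq1, rfl⟩ := mem_filter.1 hq
    rw [mem_Ico] at hq1
    exact ⟨hq1.2, (blockBase_spec hB hq1.1).2⟩
  have hIm : ∀ q₀ ∈ I, Q ≤ q₀ ∧ q₀ < 2 * Q := fun q₀ hq => by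
    obtain ⟨q, hq1, rfl⟩ := mem_image.1 hq
    rw [mem_Ico] at hq1
    obtain ⟨a, j, -, b⟩ := blockBase_spec (B := B) hB hq1.1
    exact ⟨a, by rw [hbase]; omega⟩
  set NX : ℕ → ℕ := fun q₀ => (((dyadicBlock H M ×ˢ fib q₀) ×ˢ (dyadicBlock H M ×ˢ fib q₀)).filter (fun p =>
          |log (mono3 γ p.1) - log (mono3 γ p.2)| ≤ 1 / F)).card
  set G := (τ : ℝ) ^ 2 * ((1 + log (2 * M : ℕ)) * (1 + log (4 * H * Q : ℕ))) *
      ((H : ℝ) * Q * M + ((H : ℝ) * Q * M) ^ 2 / (F * D0)) + (H : ℝ) ^ 2 * Q * B * (D0 + M ^ 2 / F) with hG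
  have hsumNX : ∑ q₀ ∈ I, (NX q₀ : ℝ) ≤ 1100 / γ * G := by
    have hc := card_close_mono3 h0 h1 (B := B) (D0 := D0) (Δ := 1 / F) hH hM hQ hD0 (by positivity) hτ
    have e : 1100 / γ * ((τ : ℝ) ^ 2 * ((1 + log (2 * M : ℕ)) * (1 + log (4 * H * Q : ℕ))) *
      ((H : ℝ) * Q * M + 1 / F * ((H : ℝ) * Q * M) ^ 2 / D0) + (H : ℝ) ^ 2 * Q * B * (D0 + 1 / F * M ^ 2)) =
      1100 / γ * G := by
      rw [hG, show 1 / F * ((H : ℝ) * Q * M) ^ 2 / D0 = ((H : ℝ) * Q * M) ^ 2 / (F * D0) by field_simp,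
        show 1 / F * (M : ℝ) ^ 2 = M ^ 2 / F by ring]
    rw [e] at hc
    refine le_trans ?_ hc
    rw [card_eq_sum_card_fiberwise (f := fun p => base p.1.2) (t := I)]
    · push_cast
      refine sum_le_sum fun q₀ hq₀ => ?_
      norm_cast
      refine card_le_card fun p hp => ?_
      simp only [hfibd, mem_filter, mem_product, mem_Ico] at hp ⊢
      obtain ⟨⟨⟨a1, a2, a3⟩, b1, b2, b3⟩, c⟩ := hp
      obtain ⟨-, j, hj, ej⟩ := blockBase_spec (B := B) hB a2.1
      obtain ⟨-, j', hj', ej'⟩ := blockBase_spec (B := B) hB b2.1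
      rw [hbase] at a3 b3
      exact ⟨⟨⟨⟨a1, a2⟩, b1, b2⟩, by omega, by omega, c⟩, a3⟩
    · intro p hp
      exact mem_image_of_mem _ (mem_product.1 (mem_product.1 (mem_filter.1 hp).1).1).2
  have hG0 : 0 ≤ 1100 / γ * G := le_trans (sum_nonneg fun _ _ => Nat.cast_nonneg _) hsumNX
  -- the main terms and errors of a block
  set err := 258048 * (H * (M : ℝ) ^ γ * (N : ℝ) ^ γ * (Q / N) ^ 5) with herr
  have herr0 : 0 ≤ err := by positivity
  have hblock : ∀ q₀ ∈ I, ‖∑ d ∈ fib q₀, if d < D then diffSum γ H M N lo hi d else 0‖ ≤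
      (L : ℝ) ^ 2 * E * √(16 * (1 + F) * (NX q₀ * (10 / (γ * (1 - γ)) * (N + N ^ 2 / F)))) +
      (fib q₀).card * (H * M * N * err) := fun q₀ hq₀ => by
    obtain ⟨hq1, hq2⟩ := hIm q₀ hq₀
    have hbil := bilBound_block h0 h1 hH hM hQ hQN hQ4 hF hFB hq1 hq2 (fib q₀) (hfib q₀ hq₀) hL lo hi
      (fun p => (hlo p).2) hhi (fun x => if x.2 < D then 1 else 0) (fun _ => 1)
      (by intro x; split_ifs <;> simp) (by simp)
    set K : (ℕ × ℕ) × ℕ → ℕ → ℂ := fun x n =>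
      if lo x.1 + (x.2 - q₀) / 2 ≤ n then (if n < hi x.1 - (q₀ + (x.2 - q₀) / 2) then
        ee (mono2 γ x.1 * ((x.2 : ℝ) / q₀ * shiftDiff γ (q₀, n) +
          γ * (γ - 1) * (γ - 2) / 24 * ((x.2 : ℝ) * ((x.2 : ℝ) ^ 2 - (q₀ : ℝ) ^ 2)) *
            ((n : ℝ) + q₀ / 2) ^ (γ - 3))) else 0) else 0 with hK
    have hmain : ‖∑ d ∈ fib q₀, if d < D then ∑ p ∈ dyadicBlock H M, ∑ n ∈ Ico N (2 * N), K (p, d) n else 0‖ ≤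
        (L : ℝ) ^ 2 * E * √(16 * (1 + F) * (NX q₀ * (10 / (γ * (1 - γ)) * (N + N ^ 2 / F)))) := by
      refine le_trans (le_of_eq ?_) (hbil.trans (le_of_eq ?_))
      · congr 1
        rw [sum_product_right]
        refine sum_congr rfl fun d _ => ?_
        split_ifs with h
        · exact sum_congr rfl fun p _ => sum_congr rfl fun n _ => by rw [one_mul, one_mul]
        · symm; exact sum_eq_zero fun p _ => sum_eq_zero fun n _ => by ring
      · rw [hE]; ring
    rw [← sub_add_cancel (∑ d ∈ fib q₀, if d < D then diffSum γ H M N lo hi d else 0)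
        (∑ d ∈ fib q₀, if d < D then ∑ p ∈ dyadicBlock H M, ∑ n ∈ Ico N (2 * N), K (p, d) n else 0)]
    refine (norm_add_le _ _).trans ?_
    rw [add_comm]
    refine add_le_add hmain ?_
    rw [← sum_sub_distrib, ← nsmul_eq_mul, ← sum_const]
    refine norm_sum_le_of_le _ fun d hd => ?_
    obtain ⟨hd2, j, hj, rfl⟩ := hfib q₀ hq₀ d hd
    split_ifs with hdD
    swap
    · rw [sub_zero, norm_zero]; positivity
    rw [diffSum, ← sum_sub_distrib]
    have hcard : (H : ℝ) * M * N * err = ∑ p ∈ dyadicBlock H M, ∑ n ∈ Ico N (2 * N), err := by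
      rw [sum_const, sum_const, card_dyadicBlock, Nat.card_Ico, show 2 * N - N = N by omega,
        nsmul_eq_mul, nsmul_eq_mul]; push_cast; ring
    rw [hcard]
    refine norm_sum_le_of_le _ fun p hp => ?_
    rw [sum_shift_recenter (hlo p).1 (hhi p), ← sum_sub_distrib]
    refine norm_sum_le_of_le _ fun n hn => ?_
    rw [mem_Ico] at hn
    rw [hK]
    dsimp only
    rw [show (q₀ + 2 * j - q₀) / 2 = j by omega]
    split_ifs
    · refine (norm_ee_sub_ee_le _ _).trans ?_
      rw [← mul_sub, abs_mul]
      obtain ⟨m1, m2⟩ := mono2_bounds h0 h1 hp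
      have hm0 : 0 ≤ mono2 γ p := le_trans (by positivity) m1
      rw [abs_of_nonneg hm0]
      have ha := abs_symmetric_shift_sub_le h0 h1 (q₀ := q₀) (j := j) (n := n) (by omega) (by omega)
      have hn1 : (N : ℝ) ≤ n := mod_cast hn.1
      have hn2 : (n : ℝ) ≤ 2 * N := mod_cast hn.2.le
      have hq2' : (q₀ : ℝ) ≤ 2 * N := mod_cast (by omega : q₀ ≤ 2 * N)
      have hd2' : ((q₀ + 2 * j : ℕ) : ℝ) ≤ 2 * Q := mod_cast hd2.le
      have c1 : ((n : ℝ) + q₀ / 2) ^ γ ≤ 3 * (N : ℝ) ^ γ := by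
        calc ((n : ℝ) + q₀ / 2) ^ γ ≤ (3 * (N : ℝ)) ^ γ := by
              apply rpow_le_rpow (by positivity) (by linarith) h0.le
          _ = 3 ^ γ * (N : ℝ) ^ γ := mul_rpow (by norm_num) hN'.le
          _ ≤ 3 ^ (1 : ℝ) * (N : ℝ) ^ γ := by gcongr; norm_num
          _ = _ := by rw [rpow_one]
      have c2 : ((q₀ + 2 * j : ℕ) : ℝ) / (2 * n + q₀) ≤ Q / N := by
        rw [div_le_div_iff₀ (by linarith) hN']
        calc ((q₀ + 2 * j : ℕ) : ℝ) * N ≤ 2 * Q * N := by gcongr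
          _ ≤ Q * (2 * n + q₀) := by nlinarith
      calc _ ≤ 7 * (4 * (H * (M : ℝ) ^ γ) * (3072 * (3 * (N : ℝ) ^ γ * (Q / N) ^ 5))) := by
            gcongr
            refine ha.trans ?_
            gcongr
        _ = err := by rw [herr]; ring
    all_goals simpa using herr0
  rw [← sum_fiberwise_of_maps_to (t := I) (fun q hq => mem_image_of_mem base hq)]
  refine (norm_sum_le_of_le _ hblock).trans ?_
  rw [sum_add_distrib, ← mul_sum, ← sum_mul]
  have hcf : ∑ q₀ ∈ I, ((fib q₀).card : ℝ) = Q := by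
    have := card_eq_sum_card_fiberwise (s := Ico Q (2 * Q)) (f := base) (t := I)
      (fun q hq => mem_image_of_mem _ hq)
    rw [Nat.card_Ico, show 2 * Q - Q = Q by omega] at this
    exact_mod_cast this.symm
  rw [hcf]
  have hsq : ∑ q₀ ∈ I, √(16 * (1 + F) * (NX q₀ * (10 / (γ * (1 - γ)) * (N + N ^ 2 / F)))) ≤
      √C0 * √((1 + F) * (N + N ^ 2 / F) * (Q / B * G)) := by
    refine (sum_sqrt_le I _ fun q₀ _ => by positivity).trans ?_
    rw [← sqrt_mul hC00.le]
    apply sqrt_le_sqrt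
    rw [← mul_sum, ← sum_mul]
    calc (I.card : ℝ) * (16 * (1 + F) * ((∑ q₀ ∈ I, (NX q₀ : ℝ)) * (10 / (γ * (1 - γ)) * (N + N ^ 2 / F))))
        ≤ (3 * (Q / B)) * (16 * (1 + F) * ((1100 / γ * G) * (10 / (γ * (1 - γ)) * (N + N ^ 2 / F)))) := by
          have n1 : 0 ≤ 10 / (γ * (1 - γ)) * (N + N ^ 2 / F) := by positivity
          have n2 : 0 ≤ ∑ q₀ ∈ I, (NX q₀ : ℝ) := sum_nonneg fun _ _ => Nat.cast_nonneg _
          have n3 : 0 ≤ 16 * (1 + F) := by positivity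
          exact mul_le_mul (card_image_blockBase_le hB hBQ)
            (mul_le_mul_of_nonneg_left (mul_le_mul_of_nonneg_right hsumNX n1) n3)
            (mul_nonneg n3 (mul_nonneg n2 n1)) (by positivity)
      _ = _ := by rw [hC0]; ring
  refine add_le_add ?_ ?_
  · calc _ ≤ (L : ℝ) ^ 2 * E * (√C0 * √((1 + F) * (N + N ^ 2 / F) * (Q / B * G))) :=
          mul_le_mul_of_nonneg_left hsq (by positivity)
      _ = (E * √C0) * (L : ℝ) ^ 2 * √((1 + F) * (N + N ^ 2 / F) * (Q / B * G)) := by ring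
      _ ≤ _ := mul_le_mul_of_nonneg_right (mul_le_mul_of_nonneg_right (by linarith) (sq_nonneg _))
          (sqrt_nonneg _)
  · calc (Q : ℝ) * (H * M * N * err) = 258048 * ((H : ℝ) * M * Q * N * (H * (M : ℝ) ^ γ * (N : ℝ) ^ γ * (Q / N) ^ 5)) := by
          rw [herr]; ring
      _ ≤ _ := by
          have : 0 < E * √C0 := by positivity
          exact mul_le_mul_of_nonneg_right (by linarith) (by positivity)

lemma sq_le_of_mul_le_one {Z θ : ℝ} (hZ : 0 ≤ Z) (hθ : 0 < θ) (h : Z * (4 + 12800 / θ) ≤ 1) :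
    128 * Z ^ 2 ≤ θ / 100 := by
  have h1 : 0 ≤ Z * (12800 / θ) := by positivity
  have h3 : Z * (12800 / θ) ≤ 1 := by linarith
  rw [mul_div_assoc', div_le_one hθ] at h3
  have : Z ^ 2 ≤ Z := by nlinarith
  linarith

/-- Type I sums with a very long smooth variable. -/
theorem typeI_long {γ : ℝ} (h0 : 50 / 58 < γ) (h1 : γ < 1) {s : ℝ} (hs0 : 0 < s) (hs1 : s ≤ 1 / 580000) :
    ∀ᶠ x : ℝ in atTop, ∀ (H M N : ℕ) (lo hi : ℕ × ℕ → ℕ), 0 < H → 0 < M → 0 < N →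
    (H : ℝ) ≤ x ^ (1 - γ + s) → x ^ (75 / 116 : ℝ) ≤ N → x ^ (1 - s) ≤ (M : ℝ) * N →
    (M : ℝ) * N ≤ x ^ (1 + s) → (∀ p, N ≤ lo p) → (∀ p, hi p ≤ 2 * N) →
    ∑ p ∈ dyadicBlock H M, ‖∑ n ∈ Ico (lo p) (hi p), ee (mono2 γ p * (n : ℝ) ^ γ)‖ ≤ x ^ (1 - s) := by
  have hγ0 : 0 < γ := by linarith
  obtain ⟨C, hC, hv⟩ := vdc_rpow hγ0 h1
  filter_upwards [(tendsto_rpow_atTop hs0).eventually_ge_atTop (3 * C), eventually_gt_atTop 2] with x hxC hx2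
  intro H M N lo hi hH hM hN hHx hNx hMN1 hMN2 hlo hhi
  have hx : 1 < x := by linarith
  have hx0 : 0 < x := by linarith
  obtain ⟨h, hh0, eh⟩ := exists_rpow_eq hx hH
  obtain ⟨m, -, em⟩ := exists_rpow_eq hx hM
  obtain ⟨n, -, en⟩ := exists_rpow_eq hx hN
  have hle := fun a b : ℝ => rpow_le_rpow_left_iff (y := a) (z := b) hx
  have hadd := fun a b : ℝ => (rpow_add hx0 a b).symm
  rw [eh, hle] at hHx
  rw [en, hle] at hNx
  rw [em, en, hadd, hle] at hMN1 hMN2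
  set g := γ * (m + n) with hg
  obtain ⟨hg1, hg2⟩ := mul_bounds_of_near_one hγ0 h1 hs0 hMN1 hMN2
  rw [← hg] at hg1 hg2
  have hb : ∀ p ∈ dyadicBlock H M, ‖∑ n ∈ Ico (lo p) (hi p), ee (mono2 γ p * (n : ℝ) ^ γ)‖ ≤
      C * (2 * x ^ ((h + g) / 2) + x ^ (n - (h + g) / 2)) := fun p hp => by
    obtain ⟨m1, m2⟩ := mono2_bounds hγ0 h1 hp
    have e0 : (H : ℝ) * (M : ℝ) ^ γ * (N : ℝ) ^ γ = x ^ (h + g) := by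
      rw [eh, em, en, ← rpow_mul hx0.le, ← rpow_mul hx0.le, hadd, hadd]
      congr 1; rw [hg]; ring
    have hHM : 0 < (H : ℝ) * (M : ℝ) ^ γ := by positivity
    have hm0 : 0 < mono2 γ p := by linarith
    have := hv N (lo p) (hi p) (mono2 γ p) 0 hN (hlo p) (hhi p) (abs_pos.2 hm0.ne')
    rw [abs_of_pos hm0] at this
    simp only [zero_mul, add_zero] at this
    refine this.trans ?_
    have u1 : x ^ (h + g) ≤ mono2 γ p * (N : ℝ) ^ γ := by rw [← e0]; gcongr
    have u2 : mono2 γ p * (N : ℝ) ^ γ ≤ 2 ^ 2 * x ^ (h + g) := by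
      rw [← e0]
      calc _ ≤ 4 * ((H : ℝ) * (M : ℝ) ^ γ) * (N : ℝ) ^ γ := by gcongr
        _ = _ := by ring
    have v1 : x ^ ((h + g) / 2) ≤ √(mono2 γ p * (N : ℝ) ^ γ) := by
      rw [← sqrt_rpow_eq hx0]; exact sqrt_le_sqrt u1
    have v2 : √(mono2 γ p * (N : ℝ) ^ γ) ≤ 2 * x ^ ((h + g) / 2) := by
      refine (sqrt_le_sqrt u2).trans (le_of_eq ?_)
      rw [sqrt_mul (by norm_num), sqrt_sq (by norm_num), sqrt_rpow_eq hx0]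
    have v3 : (N : ℝ) / √(mono2 γ p * (N : ℝ) ^ γ) ≤ x ^ (n - (h + g) / 2) := by
      rw [rpow_sub hx0, ← en]; gcongr
    gcongr
  refine (sum_le_card_nsmul _ _ _ hb).trans ?_
  rw [card_dyadicBlock, nsmul_eq_mul]
  push_cast
  have w1 : x ^ (h + m) * x ^ ((h + g) / 2) ≤ x ^ (1 - 2 * s) := by rw [hadd, hle]; linarith
  have w2 : x ^ (h + m) * x ^ (n - (h + g) / 2) ≤ x ^ (1 - 2 * s) := by rw [hadd, hle]; linarith
  calc (H : ℝ) * M * (C * (2 * x ^ ((h + g) / 2) + x ^ (n - (h + g) / 2)))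
      = C * (2 * (x ^ (h + m) * x ^ ((h + g) / 2)) + x ^ (h + m) * x ^ (n - (h + g) / 2)) := by
        rw [eh, em, hadd]; ring
    _ ≤ C * (2 * x ^ (1 - 2 * s) + x ^ (1 - 2 * s)) := by gcongr
    _ = 3 * C * x ^ (1 - 2 * s) := by ring
    _ ≤ x ^ s * x ^ (1 - 2 * s) := by gcongr
    _ = _ := by rw [hadd]; congr 1; ring

set_option maxHeartbeats 4000000 in
/-- The differenced type I sums, for a smooth variable in `[x^(34/58), x^(38/58)]`. -/
lemma differenced_exponents {γ : ℝ} (h0 : 50 / 58 < γ) (h1 : γ < 1) {s ε : ℝ} (hs0 : 0 < s)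
    (hs1 : s ≤ 1 / 580000) (hε : ε = 1 / 5800) :
    ∀ᶠ x : ℝ in atTop, ∀ (H M N Q D : ℕ) (h : ℝ) (lo hi : ℕ × ℕ → ℕ), 0 < H → 0 < M → 0 < N →
    (H : ℝ) = x ^ h → h ≤ 1 - γ + s → x ^ (34 / 58 - s) ≤ N → (N : ℝ) ≤ x ^ (38 / 58 : ℝ) →
    x ^ (1 - s) ≤ (M : ℝ) * N → (M : ℝ) * N ≤ x ^ (1 + s) → 0 < Q → (Q : ℝ) ≤ x ^ (2 * h + 2 * ε) →
    (∀ p, N ≤ lo p ∧ lo p ≤ 2 * N) → (∀ p, hi p ≤ 2 * N) →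
    ‖∑ d ∈ Ico Q (2 * Q), if d < D then diffSum γ H M N lo hi d else 0‖ ≤ x ^ (1 + h) := by
  have hγ0 : 0 < γ := by linarith
  have hθ : 0 < 1 - γ := by linarith
  obtain ⟨C, hC, hraw⟩ := norm_differenced_sum_le hγ0 h1
  obtain ⟨Cd, hCd, hdiv⟩ := card_divisors_le_rpow (show 0 < s / 4 by linarith)
  filter_upwards [eventually_const_mul_log_pow_le 200 2 (show 0 < s by linarith),
    eventually_const_mul_log_pow_le (2 * C) 2 (show 0 < s by linarith),
    (tendsto_rpow_atTop (show 0 < s / 4 by linarith)).eventually_ge_atTop Cd,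
    (tendsto_rpow_atTop (show (0 : ℝ) < 1 / 10 by norm_num)).eventually_ge_atTop (4 + 12800 / (1 - γ)),
    tendsto_log_atTop.eventually_ge_atTop 1, eventually_gt_atTop 2]
    with x hlog hlog2 hxd hx10 hlx hx2
  intro H M N Q D h lo hi hH hM hN eh hHx hNx1 hNx2 hMN1 hMN2 hQ hQx hlo hhi
  have hx : 1 < x := by linarith
  have hx0 : 0 < x := by linarith
  obtain ⟨m, -, em⟩ := exists_rpow_eq hx hM
  obtain ⟨n, -, en⟩ := exists_rpow_eq hx hN
  obtain ⟨q, hq0, eq⟩ := exists_rpow_eq hx hQ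
  have hle := fun a b : ℝ => rpow_le_rpow_left_iff (y := a) (z := b) hx
  have hadd := fun a b : ℝ => (rpow_add hx0 a b).symm
  have hsub := fun a b : ℝ => (rpow_sub hx0 a b).symm
  have hh0 : 0 ≤ h := by
    have : (1 : ℝ) ≤ H := mod_cast hH
    rwa [eh, ← rpow_zero x, hle] at this
  rw [en, hle] at hNx1 hNx2
  rw [em, en, hadd, hle] at hMN1 hMN2
  rw [eq, hle] at hQx
  set g := γ * (m + n) with hg
  obtain ⟨hg1, hg2⟩ := mul_bounds_of_near_one hγ0 h1 hs0 hMN1 hMN2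
  rw [← hg] at hg1 hg2
  set φ := h + g + q - n with hφ
  have hφ0 : 0 ≤ φ := by linarith
  have hF : x ^ φ = (H : ℝ) * (M : ℝ) ^ γ * ((Q : ℝ) * (N : ℝ) ^ (γ - 1)) := by
    rw [eq, eh, em, en, ← rpow_mul hx0.le, ← rpow_mul hx0.le, hadd, hadd, hadd, hφ, hg]
    congr 1; ring
  have hx10' : (4 : ℝ) ≤ x ^ (1 / 10 : ℝ) := by
    have : 0 < 12800 / (1 - γ) := by positivity
    linarith
  have hN' : (0 : ℝ) < N := mod_cast hN
  have hQ' : (0 : ℝ) < Q := mod_cast hQ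
  -- smallness of `Q / N`
  have hqN : (Q : ℝ) / N ≤ 1 / x ^ (1 / 10 : ℝ) := by
    rw [eq, en, hsub, one_div, ← rpow_neg hx0.le, hle]; linarith
  have c1 : 128 * ((Q : ℝ) / N) ^ 2 ≤ (1 - γ) / 100 := by
    refine sq_le_of_mul_le_one (by positivity) hθ ?_
    calc _ ≤ 1 / x ^ (1 / 10 : ℝ) * x ^ (1 / 10 : ℝ) := by gcongr
      _ = 1 := by field_simp
  have c2 : 4 * Q ≤ N := by
    have : 4 * (Q : ℝ) ≤ N := by
      rw [div_le_div_iff₀ hN' (by positivity)] at hqN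
      have := mul_le_mul_of_nonneg_left hx10' hQ'.le
      linarith
    exact_mod_cast this
  -- the block length
  set y := (N : ℝ) ^ 2 / (6 * (x ^ φ * Q)) with hy
  have hye : y = x ^ (2 * n - φ - q) / 6 := by
    rw [hy, en, eq, rpow_npow_eq hx0, hadd, mul_comm (6 : ℝ), ← div_div, hsub]; push_cast; congr 2; ring
  have hy1 : 1 ≤ y := by
    rw [hye, le_div_iff₀ (by norm_num), one_mul]
    calc (6 : ℝ) ≤ 4 * 4 := by norm_num
      _ ≤ x ^ (1 / 10 : ℝ) * x ^ (1 / 10 : ℝ) := by gcongr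
      _ ≤ _ := by rw [hadd, hle]; linarith
  set B := min Q ⌊y⌋₊ with hB
  have hfl : 0 < ⌊y⌋₊ := Nat.floor_pos.2 hy1
  have hB0 : 0 < B := lt_min hQ hfl
  have hBy : (B : ℝ) ≤ y := (Nat.cast_le.2 (min_le_right _ _)).trans (Nat.floor_le (by linarith))
  have c3 : 6 * (x ^ φ * Q * B) ≤ (N : ℝ) ^ 2 := by
    have := mul_le_mul_of_nonneg_left hBy (show 0 ≤ 6 * (x ^ φ * Q) by positivity)
    have e : 6 * (x ^ φ * Q) * y = (N : ℝ) ^ 2 := by rw [hy]; field_simp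
    linarith
  have hQB : (Q : ℝ) / B ≤ 1 + 12 * x ^ (φ + 2 * q - 2 * n) := by
    rcases min_choice Q ⌊y⌋₊ with hc | hc
    · have : (Q : ℝ) / B = 1 := by rw [hB, hc]; field_simp
      rw [this]; have : 0 < x ^ (φ + 2 * q - 2 * n) := by positivity
      linarith
    · have h2 : y / 2 ≤ B := by
        rw [hB, hc]
        have := Nat.lt_floor_add_one y
        have : (1 : ℝ) ≤ ⌊y⌋₊ := mod_cast hfl
        linarith
      have : (Q : ℝ) / B ≤ Q / (y / 2) := by gcongr
      have e : (Q : ℝ) / (y / 2) = 12 * x ^ (φ + 2 * q - 2 * n) := by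
        rw [hye, eq, show φ + 2 * q - 2 * n = q - (2 * n - φ - q) by ring, rpow_sub hx0 q]
        field_simp; norm_num
      linarith
  -- divisors
  set τ := ⌊x ^ (s / 2)⌋₊
  have hτx : (τ : ℝ) ≤ x ^ (s / 2) := Nat.floor_le (by positivity)
  have hHQx : 4 * (H : ℝ) * Q ≤ x := by
    calc 4 * (H : ℝ) * Q = 4 * x ^ (h + q) := by rw [eh, eq, mul_assoc, hadd]
      _ ≤ x ^ (1 / 10 : ℝ) * x ^ (h + q) := by gcongr
      _ = x ^ (1 / 10 + (h + q)) := by rw [hadd]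
      _ ≤ x ^ (1 : ℝ) := by rw [hle]; linarith
      _ = x := rpow_one x
  have c4 : ∀ k, 0 < k → k ≤ 4 * H * Q → k.divisors.card ≤ τ := fun k hk hk2 => by
    apply Nat.le_floor
    refine (hdiv k hk).trans ?_
    have : (k : ℝ) ≤ x := le_trans (mod_cast hk2) hHQx
    calc Cd * (k : ℝ) ^ (s / 4) ≤ x ^ (s / 4) * x ^ (s / 4) := by gcongr
      _ = _ := by rw [hadd]; congr 1; ring
  -- bits
  set L := Nat.log 2 (8 * N) + 1 with hL
  have h8N : ((8 * N : ℕ) : ℝ) ≤ x := by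
    push_cast
    calc 8 * (N : ℝ) ≤ x ^ (1 / 10 : ℝ) * x ^ (1 / 10 : ℝ) * N := by
          have := mul_le_mul hx10' hx10' (by norm_num) (by linarith)
          gcongr; linarith
      _ = x ^ (1 / 10 + 1 / 10 + n) := by rw [en, hadd, hadd]
      _ ≤ x ^ (1 : ℝ) := by rw [hle]; linarith
      _ = x := rpow_one x
  have hLx : (L : ℝ) ≤ 2 + 4 * log x := nat_log_two_add_one_le hlx (by omega) h8N
  have c5 : 4 * N + 1 < 2 ^ L := by
    have := Nat.lt_pow_succ_log_self (b := 2) (by norm_num) (8 * N)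
    rw [hL]; omega
  have key := hraw H M N Q B L τ D (x ^ φ) (x ^ (3 / 58 : ℝ)) lo hi hH hM hQ hB0 (min_le_left _ _) c1 c2 hF c3
    (one_le_rpow hx.le (by norm_num)) c4 c5 hlo hhi
  refine key.trans ?_
  -- the error term
  have herr : (H : ℝ) * M * Q * N * (H * (M : ℝ) ^ γ * (N : ℝ) ^ γ * (Q / N) ^ 5) ≤ x ^ (1 + h - s) := by
    have e : (H : ℝ) * M * Q * N * (H * (M : ℝ) ^ γ * (N : ℝ) ^ γ * (Q / N) ^ 5) =
        x ^ (h + m + q + n + (h + g + 5 * (q - n))) := by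
      rw [eh, em, eq, en, ← rpow_mul hx0.le, ← rpow_mul hx0.le, hsub, rpow_npow_eq hx0,
        hadd, hadd, hadd, hadd, hadd, hadd, hadd]
      congr 1; rw [hg]; push_cast; ring
    rw [e, hle]; linarith
  -- the main term
  set ℓ := (1 + log (2 * M : ℕ)) * (1 + log (4 * H * Q : ℕ)) with hℓ
  have hℓx : 200 * ℓ ≤ x ^ s := by
    refine le_trans ?_ hlog
    have lM : 1 + log (2 * M : ℕ) ≤ 2 + 4 * log x := by
      push_cast
      exact one_add_log_le_of_le_rpow hlx hx0 (by positivity) (a := m) (by linarith) (by norm_num)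
        (by norm_num) em.le
    have lQ : 1 + log (4 * H * Q : ℕ) ≤ 2 + 4 * log x := by
      have : log (4 * H * Q : ℕ) ≤ log x :=
        log_le_log (by positivity) (by push_cast; exact hHQx)
      linarith
    rw [hℓ, sq]; gcongr
  have hτ2 : (τ : ℝ) ^ 2 * ℓ ≤ x ^ (2 * s) / 200 := by
    have : (τ : ℝ) ^ 2 ≤ x ^ s := by
      calc (τ : ℝ) ^ 2 ≤ (x ^ (s / 2)) ^ 2 := by gcongr
        _ = _ := by rw [rpow_npow_eq hx0]; congr 1; push_cast; ring
    calc (τ : ℝ) ^ 2 * ℓ ≤ x ^ s * (x ^ s / 200) := by gcongr; linarith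
      _ = _ := by rw [mul_div_assoc', hadd]; congr 2; ring
  have hsq : √((1 + x ^ φ) * (N + N ^ 2 / x ^ φ) * ((Q : ℝ) / B * ((τ : ℝ) ^ 2 * ℓ *
      ((H : ℝ) * Q * M + ((H : ℝ) * Q * M) ^ 2 / (x ^ φ * x ^ (3 / 58 : ℝ))) +
      (H : ℝ) ^ 2 * Q * B * (x ^ (3 / 58 : ℝ) + M ^ 2 / x ^ φ)))) ≤ x ^ (1 + h - s) := by
    rw [sqrt_le_left (by positivity)]
    have p1 : (1 + x ^ φ) * (N + N ^ 2 / x ^ φ) ≤ 2 * (x ^ (φ + n) + x ^ (2 * n)) := by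
      have hF1 : 1 ≤ x ^ φ := one_le_rpow hx.le hφ0
      calc _ ≤ (x ^ φ + x ^ φ) * (N + N ^ 2 / x ^ φ) := by gcongr
        _ = 2 * (x ^ φ * N + N ^ 2) := by field_simp; ring
        _ = _ := by rw [en, hadd, rpow_npow_eq hx0]; norm_num
    have e1 : (H : ℝ) * Q * M + ((H : ℝ) * Q * M) ^ 2 / (x ^ φ * x ^ (3 / 58 : ℝ)) =
        x ^ (h + q + m) + x ^ (2 * (h + q + m) - φ - 3 / 58) := by
      rw [eh, eq, em, hadd, hadd, rpow_npow_eq hx0, hadd, hsub]; push_cast; congr 2; ring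
    have e2 : (Q : ℝ) / B * ((H : ℝ) ^ 2 * Q * B * (x ^ (3 / 58 : ℝ) + M ^ 2 / x ^ φ)) =
        x ^ (2 * h + 2 * q) * (x ^ (3 / 58 : ℝ) + x ^ (2 * m - φ)) := by
      have : (Q : ℝ) / B * ((H : ℝ) ^ 2 * Q * B * (x ^ (3 / 58 : ℝ) + M ^ 2 / x ^ φ)) =
        (H : ℝ) ^ 2 * (Q : ℝ) ^ 2 * (x ^ (3 / 58 : ℝ) + M ^ 2 / x ^ φ) := by field_simp
      rw [this, eh, eq, em, rpow_npow_eq hx0, rpow_npow_eq hx0, rpow_npow_eq hx0, hadd, hsub]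
      push_cast; rfl
    set W := x ^ (2 + 2 * h - 4 * s) with hW
    have t : ∀ a b c : ℝ, a + b + c ≤ 2 + 2 * h - 4 * s → x ^ a * (x ^ b * x ^ c) ≤ W := by
      intro a b c habc; rw [hadd, hadd, hW, hle]; linarith
    set b' := φ + 2 * q - 2 * n with hb'
    set c₁ := h + q + m with hc₁
    set c₂ := 2 * (h + q + m) - φ - 3 / 58 with hc₂
    have s1 := t (φ + n) 0 c₁ (by rw [hc₁]; linarith)
    have s2 := t (φ + n) 0 c₂ (by rw [hc₂]; linarith)
    have s3 := t (φ + n) b' c₁ (by rw [hb', hc₁]; linarith)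
    have s4 := t (φ + n) b' c₂ (by rw [hb', hc₂]; linarith)
    have s5 := t (2 * n) 0 c₁ (by rw [hc₁]; linarith)
    have s6 := t (2 * n) 0 c₂ (by rw [hc₂]; linarith)
    have s7 := t (2 * n) b' c₁ (by rw [hb', hc₁]; linarith)
    have s8 := t (2 * n) b' c₂ (by rw [hb', hc₂]; linarith)
    have s9 := t (φ + n) (2 * h + 2 * q) (3 / 58) (by linarith)
    have s10 := t (φ + n) (2 * h + 2 * q) (2 * m - φ) (by linarith)
    have s11 := t (2 * n) (2 * h + 2 * q) (3 / 58) (by linarith)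
    have s12 := t (2 * n) (2 * h + 2 * q) (2 * m - φ) (by linarith)
    rw [rpow_zero] at s1 s2 s5 s6
    set A := x ^ (φ + n) + x ^ (2 * n) with hA
    set K := x ^ (2 * h + 2 * q) * (x ^ (3 / 58 : ℝ) + x ^ (2 * m - φ)) with hK
    have q1 : A * ((1 + 12 * x ^ b') * (x ^ c₁ + x ^ c₂)) ≤ 52 * W := by rw [hA]; linarith
    have q2 : A * K ≤ 4 * W := by rw [hA, hK]; linarith
    have hW0 : 0 < W := by positivity
    have hc0 : 0 ≤ x ^ c₁ + x ^ c₂ := by positivity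
    rw [mul_add ((Q : ℝ) / B), e2, e1]
    have r1 : (Q : ℝ) / B * ((τ : ℝ) ^ 2 * ℓ * (x ^ c₁ + x ^ c₂)) ≤
        (1 + 12 * x ^ b') * (x ^ (2 * s) / 200 * (x ^ c₁ + x ^ c₂)) :=
      mul_le_mul hQB (mul_le_mul_of_nonneg_right hτ2 hc0) (by positivity) (by positivity)
    calc _ ≤ 2 * A * ((1 + 12 * x ^ b') * (x ^ (2 * s) / 200 * (x ^ c₁ + x ^ c₂)) + K) :=
          mul_le_mul p1 (by linarith) (by positivity) (by positivity)
      _ = x ^ (2 * s) / 100 * (A * ((1 + 12 * x ^ b') * (x ^ c₁ + x ^ c₂))) + 2 * (A * K) := by ring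
      _ ≤ x ^ (2 * s) / 100 * (52 * W) + 2 * (4 * W) := by gcongr
      _ ≤ x ^ (2 * s) * W := by
          have hx2s' : 200 ≤ x ^ s := by
            refine le_trans ?_ hlog
            have : 1 ≤ (2 + 4 * log x) ^ 2 := one_le_pow₀ (by linarith)
            linarith
          have : x ^ s ≤ x ^ (2 * s) := by rw [hle]; linarith
          have := mul_le_mul_of_nonneg_right (hx2s'.trans this) hW0.le
          linarith
      _ = _ := by rw [hW, hadd, rpow_npow_eq hx0]; congr 1; push_cast; ring
  have hLL : (L : ℝ) ^ 2 ≤ (2 + 4 * log x) ^ 2 := by gcongr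
  have h1L : 1 ≤ (2 + 4 * log x) ^ 2 := one_le_pow₀ (by linarith)
  calc _ ≤ C * (2 + 4 * log x) ^ 2 * x ^ (1 + h - s) + C * (2 + 4 * log x) ^ 2 * x ^ (1 + h - s) := by
        refine add_le_add ?_ ?_
        · exact mul_le_mul (mul_le_mul_of_nonneg_left hLL hC.le) hsq (sqrt_nonneg _) (by positivity)
        · exact mul_le_mul (le_mul_of_one_le_right hC.le h1L) herr (by positivity) (by positivity)
    _ = 2 * C * (2 + 4 * log x) ^ 2 * x ^ (1 + h - s) := by ring
    _ ≤ x ^ s * x ^ (1 + h - s) := by gcongr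
    _ = _ := by rw [hadd]; congr 1; ring

/-- A Weyl shift of sums over intervals depending on the outer variable. -/
lemma sum_norm_sq_Ico_le {ι : Type*} (X : Finset ι) (f : ι → ℕ → ℂ) {N Q : ℕ} {B : ℝ} {lo hi : ι → ℕ}
    (hf : ∀ p n, ‖f p n‖ ≤ 1) (hQ : 0 < Q) (hQN : Q ≤ N) (hB0 : 0 ≤ B) (hlo : ∀ p, N ≤ lo p)
    (hhi : ∀ p, hi p ≤ 2 * N) (hB : ∀ D, ∀ i, 2 ^ i < Q →
      ‖∑ d ∈ Ico (2 ^ i) (2 * 2 ^ i), if d < D then ∑ p ∈ X, ∑ n ∈ Ico N (2 * N),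
        (if lo p ≤ n + d ∧ n + d < hi p then f p (n + d) else 0) *
        conj (if lo p ≤ n ∧ n < hi p then f p n else 0) else 0‖ ≤ B) :
    (∑ p ∈ X, ‖∑ n ∈ Ico (lo p) (hi p), f p n‖) ^ 2 ≤
      X.card * (2 * N / Q * (X.card * N + 2 * ((Nat.log 2 Q + 1 : ℕ) * B))) := by
  set z : ι → ℕ → ℂ := fun p n => if lo p ≤ n ∧ n < hi p then f p n else 0 with hz
  have hzn : ∀ p n, ‖z p n‖ ≤ 1 := by
    intro p n; rw [hz]; dsimp only; split_ifs
    · exact hf p n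
    · simp
  have hE : ∑ p ∈ X, ∑ n ∈ Ico N (2 * N), ‖z p n‖ ^ 2 ≤ X.card * N := by
    have : ∀ p ∈ X, ∑ n ∈ Ico N (2 * N), ‖z p n‖ ^ 2 ≤ N := fun p _ => by
      refine (sum_le_card_nsmul _ _ 1 fun n _ => pow_le_one₀ (norm_nonneg _) (hzn p n)).trans ?_
      rw [Nat.card_Ico, show 2 * N - N = N by omega]; simp
    refine (sum_le_card_nsmul _ _ _ this).trans ?_
    rw [nsmul_eq_mul]
  have hT := norm_sum_Ico_one_le (fun d => ∑ p ∈ X, ∑ n ∈ Ico N (2 * N), z p (n + d) * conj (z p n))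
    hB0 (fun D _ i hi => hB D i hi)
  have hw := weyl_shift X z hQ hQN (fun p n hn => if_neg fun h => hn
    (mem_Ico.2 ⟨(hlo p).trans h.1, h.2.trans_le (hhi p)⟩)) hE hT
  have e : ∀ p ∈ X, ‖∑ n ∈ Ico (lo p) (hi p), f p n‖ = ‖∑ n ∈ Ico N (2 * N), z p n‖ := fun p _ => by
    rw [hz]; dsimp only
    rw [← sum_filter]
    congr 2
    ext n
    have := hlo p; have := hhi p
    simp only [mem_filter, mem_Ico]; omega
  rw [sum_congr rfl e]
  exact sq_sum_le_card_mul_sum_sq.trans (mul_le_mul_of_nonneg_left hw (by positivity))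

theorem typeI {γ : ℝ} (h0 : 50 / 58 < γ) (h1 : γ < 1) {s : ℝ} (hs0 : 0 < s) (hs1 : s ≤ 1 / 580000) :
    ∀ᶠ x : ℝ in atTop, ∀ (H M N : ℕ) (lo hi : ℕ × ℕ → ℕ), 0 < H → 0 < M → 0 < N →
    (H : ℝ) ≤ x ^ (1 - γ + s) → x ^ (34 / 58 - s) ≤ N → x ^ (1 - s) ≤ (M : ℝ) * N →
    (M : ℝ) * N ≤ x ^ (1 + s) → (∀ p, N ≤ lo p ∧ lo p ≤ 2 * N) → (∀ p, hi p ≤ 2 * N) →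
    ∑ p ∈ dyadicBlock H M, ‖∑ n ∈ Ico (lo p) (hi p), ee (mono2 γ p * (n : ℝ) ^ γ)‖ ≤ x ^ (1 - s) := by
  obtain ⟨ε, hε⟩ : ∃ ε : ℝ, ε = 1 / 5800 := ⟨_, rfl⟩
  have hε0 : 0 < ε := by rw [hε]; norm_num
  filter_upwards [typeI_long h0 h1 hs0 hs1, differenced_exponents h0 h1 hs0 hs1 hε,
    eventually_const_mul_log_pow_le 6 1 hs0, (tendsto_rpow_atTop hε0).eventually_ge_atTop 2,
    tendsto_log_atTop.eventually_ge_atTop 1, eventually_gt_atTop 2] with x hlong hdiff hlog2 hxε hlx hx2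
  intro H M N lo hi hH hM hN hHx hNx hMN1 hMN2 hlo hhi
  rcases le_total (x ^ (75 / 116 : ℝ)) N with hc | hc
  · exact hlong H M N lo hi hH hM hN hHx hc hMN1 hMN2 (fun p => (hlo p).1) hhi
  have hx : 1 < x := by linarith
  have hx0 : 0 < x := by linarith
  obtain ⟨h, hh0, eh⟩ := exists_rpow_eq hx hH
  obtain ⟨m, -, em⟩ := exists_rpow_eq hx hM
  obtain ⟨n, -, en⟩ := exists_rpow_eq hx hN
  have hle := fun a b : ℝ => rpow_le_rpow_left_iff (y := a) (z := b) hx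
  have hadd := fun a b : ℝ => (rpow_add hx0 a b).symm
  have hHx' : h ≤ 1 - γ + s := by rwa [eh, hle] at hHx
  have hNx' : 34 / 58 - s ≤ n := by rwa [en, hle] at hNx
  have hMN2' : m + n ≤ 1 + s := by rwa [em, en, hadd, hle] at hMN2
  set Q := ⌈x ^ (2 * h + ε)⌉₊
  obtain ⟨hQ1, hQ⟩ := ceil_rpow_bounds hx (show 0 ≤ 2 * h + ε by linarith)
  have hQ2 : (Q : ℝ) ≤ x ^ (2 * h + 2 * ε) := by
    calc (Q : ℝ) ≤ x ^ ε * x ^ (2 * h + ε) := hQ.trans (by gcongr)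
      _ = _ := by rw [hadd]; congr 1; ring
  have hQ0 : 0 < Q := Nat.ceil_pos.2 (by positivity)
  have hQN : Q ≤ N := by
    have : (Q : ℝ) ≤ N := hQ2.trans (by rw [en, hle]; linarith)
    exact_mod_cast this
  have key := sum_norm_sq_Ico_le (dyadicBlock H M) (fun p n => ee (mono2 γ p * (n : ℝ) ^ γ))
    (B := x ^ (1 + h)) (fun p n => (norm_ee _).le) hQ0 hQN (by positivity) (fun p => (hlo p).1) hhi
    (fun D i hi' => hdiff H M N (2 ^ i) D h lo hi hH hM hN eh hHx' hNx
      (hc.trans (by rw [hle]; norm_num)) hMN1 hMN2 (by positivity)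
      (le_trans (mod_cast hi'.le) hQ2) hlo hhi)
  rw [card_dyadicBlock] at key
  refine (sq_le_sq₀ (by positivity) (by positivity)).1 (key.trans ?_)
  refine weyl_bound_le hx hlx hlog2 eh em en hs0.le hMN2' (by linarith) hQ0 hQ1 (hQ2.trans ?_)
  conv_rhs => rw [← rpow_one x]
  rw [hle]; linarith

/-- `n` has no prime factor smaller than `z`. -/
def Rough (z n : ℕ) : Prop := ∀ p : ℕ, p.Prime → p ∣ n → z ≤ p

noncomputable instance (z n : ℕ) : Decidable (Rough z n) := Classical.propDecidable _

lemma rough_succ_of_not_prime {z n : ℕ} (hz : ¬ z.Prime) : Rough (z + 1) n ↔ Rough z n := by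
  refine forall_congr' fun p => forall_congr' fun hp => forall_congr' fun _ => ?_
  have : p ≠ z := fun h => hz (h ▸ hp)
  omega

lemma rough_succ_iff {q n : ℕ} (hq : q.Prime) : Rough (q + 1) n ↔ Rough q n ∧ ¬ q ∣ n := by
  constructor
  · intro h
    exact ⟨fun p hp hn => (Nat.le_succ q).trans (h p hp hn), fun hn => by have := h q hq hn; omega⟩
  · rintro ⟨h, hn⟩ p hp hpn
    have := h p hp hpn
    have : p ≠ q := fun h => hn (h ▸ hpn)
    omega

lemma rough_mul_iff {z a n : ℕ} (ha : ∀ p : ℕ, p.Prime → p ∣ a → z ≤ p) : Rough z (a * n) ↔ Rough z n :=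
  ⟨fun h p hp hn => h p hp (hn.mul_left a), fun h p hp hn =>
    ((Nat.Prime.dvd_mul hp).1 hn).elim (ha p hp) (h p hp)⟩

lemma sum_divisorsAntidiagonal_ite_dvd {q n : ℕ} (hq : 0 < q) (F G : ℕ × ℕ → ℤ) :
    ∑ d ∈ n.divisorsAntidiagonal, (if q ∣ d.1 then F (d.1 / q, d.2) else G d) =
      ∑ d ∈ n.divisorsAntidiagonal, (if q ∣ d.1 then 0 else G d) +
        if q ∣ n then ∑ d ∈ (n / q).divisorsAntidiagonal, F d else 0 := by
  have e : ∀ d ∈ n.divisorsAntidiagonal, (if q ∣ d.1 then F (d.1 / q, d.2) else G d) =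
      (if q ∣ d.1 then 0 else G d) + if q ∣ d.1 then F (d.1 / q, d.2) else 0 := by
    intro d _; split_ifs <;> ring
  rw [sum_congr rfl e, sum_add_distrib]
  congr 1
  rw [← sum_filter]
  split_ifs with h
  · obtain ⟨m, rfl⟩ := h
    rw [Nat.mul_div_cancel_left _ hq]
    refine sum_nbij' (fun d => (d.1 / q, d.2)) (fun d => (q * d.1, d.2)) ?_ ?_ ?_ ?_ (fun _ _ => rfl)
    · rintro ⟨a, b⟩ hd
      simp only [mem_filter, Nat.mem_divisorsAntidiagonal] at hd ⊢
      obtain ⟨⟨h1, h2⟩, c, rfl⟩ := hd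
      rw [Nat.mul_div_cancel_left _ hq]
      refine ⟨Nat.eq_of_mul_eq_mul_left hq (by rw [← h1]; ring), fun h => h2 (by simp [h])⟩
    · rintro ⟨a, b⟩ hd
      simp only [mem_filter, Nat.mem_divisorsAntidiagonal] at hd ⊢
      refine ⟨⟨by rw [← hd.1]; ring, Nat.mul_ne_zero hq.ne' hd.2⟩, dvd_mul_right _ _⟩
    · rintro ⟨a, b⟩ hd
      simp only [mem_filter] at hd
      simp [Nat.mul_div_cancel' hd.2]
    · rintro ⟨a, b⟩ _
      simp [Nat.mul_div_cancel_left _ hq]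
  · refine sum_eq_zero fun d hd => ?_
    simp only [mem_filter, Nat.mem_divisorsAntidiagonal] at hd
    exact absurd (hd.2.trans ⟨d.2, hd.1.1.symm⟩) h

lemma minFac_mul_eq {q u : ℕ} (hq : q.Prime) (hu : u ≠ 1) (h : ∀ p : ℕ, p.Prime → p ∣ u → p < q) :
    (q * u).minFac = u.minFac := by
  have hp := Nat.minFac_prime hu
  refine le_antisymm (Nat.minFac_le_of_dvd hp.two_le ((Nat.minFac_dvd u).mul_left q)) ?_
  have h1 : q * u ≠ 1 := fun h1 => hu (Nat.eq_one_of_mul_eq_one_left h1)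
  rcases (Nat.Prime.dvd_mul (Nat.minFac_prime h1)).1 (Nat.minFac_dvd _) with h2 | h2
  · rw [(Nat.prime_dvd_prime_iff_eq (Nat.minFac_prime h1) hq).1 h2]
    exact (h _ hp (Nat.minFac_dvd u)).le
  · exact Nat.minFac_le_of_dvd (Nat.minFac_prime h1).two_le h2

/-- Buchstab's identity with a truncation at level `y`. -/
theorem exists_buchstab (z : ℕ) : ∀ y, 2 ≤ y → ∃ f g : ℕ → ℤ, (∀ d, |f d| ≤ 1) ∧ (∀ d, |g d| ≤ 1) ∧
    (∀ d, f d ≠ 0 → d < y ∧ ∀ p : ℕ, p.Prime → p ∣ d → p < z) ∧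
    (∀ u, g u ≠ 0 → y ≤ u ∧ u < y * u.minFac ∧ ∀ p : ℕ, p.Prime → p ∣ u → p < z) ∧
    ∀ n, n ≠ 0 → (if Rough z n then (1 : ℤ) else 0) =
      ∑ d ∈ n.divisorsAntidiagonal, (f d.1 + if Rough d.1.minFac d.2 then g d.1 else 0) := by
  induction z with
  | zero =>
    intro y hy
    refine ⟨fun d => if d = 1 then 1 else 0, fun _ => 0, fun d => by dsimp only; split_ifs <;> simp, by simp,
      fun d hd => ?_, by simp, fun n hn => ?_⟩
    · have : d = 1 := by by_contra h; simp [h] at hd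
      subst this
      exact ⟨hy, fun p hp h => absurd (Nat.dvd_one.1 h) hp.ne_one⟩
    · rw [if_pos (show Rough 0 n from fun p _ _ => Nat.zero_le p), Nat.sum_divisorsAntidiagonal
        (fun a b => ((if a = 1 then (1 : ℤ) else 0) + if Rough a.minFac b then 0 else 0))]
      simp [hn]
  | succ q ih =>
    intro y hy
    obtain ⟨f, g, hf1, hg1, hf, hg, hfg⟩ := ih y hy
    by_cases hq : q.Prime
    swap
    · refine ⟨f, g, hf1, hg1, fun d hd => ⟨(hf d hd).1, fun p hp h => ((hf d hd).2 p hp h).trans (Nat.lt_succ_self q)⟩,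
        fun u hu => ⟨(hg u hu).1, (hg u hu).2.1, fun p hp h => ((hg u hu).2.2 p hp h).trans (Nat.lt_succ_self q)⟩, ?_⟩
      intro n hn
      rw [← hfg n hn]
      simp only [rough_succ_of_not_prime hq]
    have hfq : ∀ d, q ∣ d → f d = 0 := fun d hd => by
      by_contra h; exact lt_irrefl _ ((hf d h).2 q hq hd)
    have hgq : ∀ d, q ∣ d → g d = 0 := fun d hd => by
      by_contra h; exact lt_irrefl _ ((hg d h).2.2 q hq hd)
    have hrough : ∀ n, n ≠ 0 → (if Rough (q + 1) n then (1 : ℤ) else 0) =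
        (if Rough q n then 1 else 0) - if q ∣ n then (if Rough q (n / q) then 1 else 0) else 0 := fun n hn => by
      by_cases h : q ∣ n
      · obtain ⟨m, rfl⟩ := h
        rw [if_neg (fun h => ((rough_succ_iff hq).1 h).2 (dvd_mul_right _ _)), if_pos (dvd_mul_right _ _),
          Nat.mul_div_cancel_left _ hq.pos]
        simp only [rough_mul_iff (z := q) (a := q) (n := m) fun p hp h =>
          ((Nat.prime_dvd_prime_iff_eq hp hq).1 h).ge]
        ring
      · simp only [rough_succ_iff hq, h, not_false_eq_true, and_true, if_false, sub_zero]
    rcases lt_or_ge q y with hqy | hqy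
    · have hq0 := hq.pos
      set y' := (y + q - 1) / q with hy'
      have hy2 : 2 ≤ y' := by rw [hy', Nat.le_div_iff_mul_le hq0]; omega
      have key1 : ∀ e, e < y' → q * e < y := fun e he => by
        have : (e + 1) * q ≤ y + q - 1 := (Nat.le_div_iff_mul_le hq0).1 he
        have e1 : (e + 1) * q = q * e + q := by ring
        omega
      have key2 : ∀ u, y' ≤ u → y ≤ q * u := fun u hu => by
        have : y + q - 1 < (u + 1) * q := (Nat.div_lt_iff_lt_mul hq0).1 (Nat.lt_succ_of_le hu)
        have e1 : (u + 1) * q = q * u + q := by ring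
        omega
      obtain ⟨f', g', hf1', hg1', hf', hg', hfg'⟩ := ih y' hy2
      have hsmall : ∀ {u d : ℕ}, d = q * u → (∀ p : ℕ, p.Prime → p ∣ u → p < q) →
          ∀ p : ℕ, p.Prime → p ∣ d → p < q + 1 := by
        rintro u d rfl h p hp hpd
        rcases (Nat.Prime.dvd_mul hp).1 hpd with h1 | h1
        · rw [(Nat.prime_dvd_prime_iff_eq hp hq).1 h1]; exact Nat.lt_succ_self q
        · exact (h p hp h1).trans (Nat.lt_succ_self q)
      refine ⟨fun d => if q ∣ d then -f' (d / q) else f d, fun d => if q ∣ d then -g' (d / q) else g d,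
        ?_, ?_, ?_, ?_, ?_⟩
      · intro d; dsimp only; split_ifs
        · rw [abs_neg]; exact hf1' _
        · exact hf1 d
      · intro d; dsimp only; split_ifs
        · rw [abs_neg]; exact hg1' _
        · exact hg1 d
      · intro d hd
        by_cases h : q ∣ d
        · obtain ⟨e, rfl⟩ := h
          simp only [dvd_mul_right, if_true, Nat.mul_div_cancel_left _ hq0, ne_eq, neg_eq_zero] at hd
          exact ⟨key1 e (hf' e hd).1, hsmall rfl (hf' e hd).2⟩
        · simp only [h, if_false] at hd
          exact ⟨(hf d hd).1, fun p hp h => ((hf d hd).2 p hp h).trans (Nat.lt_succ_self q)⟩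
      · intro d hd
        by_cases h : q ∣ d
        · obtain ⟨u, rfl⟩ := h
          simp only [dvd_mul_right, if_true, Nat.mul_div_cancel_left _ hq0, ne_eq, neg_eq_zero] at hd
          obtain ⟨a1, a2, a3⟩ := hg' u hd
          refine ⟨key2 u a1, ?_, hsmall rfl a3⟩
          rw [minFac_mul_eq hq (by omega) a3]
          obtain ⟨t, ht⟩ := Nat.minFac_dvd u
          have hm := Nat.minFac_pos u
          have h1 : t < y' := by
            rw [mul_comm y', ] at a2
            nth_rewrite 1 [ht] at a2
            exact lt_of_mul_lt_mul_left a2 (Nat.zero_le _)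
          have h2 := key1 t h1
          calc q * u = q * t * u.minFac := by nth_rewrite 1 [ht]; ring
            _ < _ := Nat.mul_lt_mul_of_pos_right h2 hm
        · simp only [h, if_false] at hd
          exact ⟨(hg d hd).1, (hg d hd).2.1, fun p hp h => ((hg d hd).2.2 p hp h).trans (Nat.lt_succ_self q)⟩
      · intro n hn
        have e : ∀ d ∈ n.divisorsAntidiagonal, ((if q ∣ d.1 then -f' (d.1 / q) else f d.1) +
            if Rough d.1.minFac d.2 then (if q ∣ d.1 then -g' (d.1 / q) else g d.1) else 0) =
            if q ∣ d.1 then (fun d : ℕ × ℕ => -(f' d.1 + if Rough d.1.minFac d.2 then g' d.1 else 0)) (d.1 / q, d.2)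
              else (f d.1 + if Rough d.1.minFac d.2 then g d.1 else 0) := fun d hd => by
          by_cases h : q ∣ d.1
          · obtain ⟨u, hu⟩ := h
            rw [hu]
            simp only [dvd_mul_right, if_true, Nat.mul_div_cancel_left _ hq0]
            by_cases hgu : g' u = 0
            · simp [hgu]
            · obtain ⟨a1, -, a3⟩ := hg' u hgu
              rw [minFac_mul_eq hq (by omega) a3]
              split_ifs <;> ring
          · simp only [h, if_false]
        rw [sum_congr rfl e, sum_divisorsAntidiagonal_ite_dvd hq0
          (fun d : ℕ × ℕ => -(f' d.1 + if Rough d.1.minFac d.2 then g' d.1 else 0)) (fun d => f d.1 + if Rough d.1.minFac d.2 then g d.1 else 0), hrough n hn, hfg n hn, sub_eq_add_neg]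
        congr 1
        · refine sum_congr rfl fun d _ => ?_
          split_ifs with h1 h2 h2
          · rw [hfq _ h2, hgq _ h2]; simp
          · rfl
          · rw [hfq _ h2]; simp
          · rfl
        · split_ifs with h h2
          · rw [sum_neg_distrib, ← hfg' _ (Nat.div_ne_zero_iff_of_dvd h |>.2 ⟨hn, hq0.ne'⟩), if_pos h2]
          · rw [sum_neg_distrib, ← hfg' _ (Nat.div_ne_zero_iff_of_dvd h |>.2 ⟨hn, hq0.ne'⟩), if_neg h2]
          · simp
    · refine ⟨f, fun d => if d = q then -1 else g d, hf1, ?_, fun d hd => ⟨(hf d hd).1,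
        fun p hp h => ((hf d hd).2 p hp h).trans (Nat.lt_succ_self q)⟩, ?_, ?_⟩
      · intro d; dsimp only; split_ifs
        · simp
        · exact hg1 d
      · intro d hd
        by_cases h : d = q
        · subst h
          refine ⟨hqy, ?_, fun p hp h => ?_⟩
          · rw [hq.minFac_eq]; have := hq.pos; nlinarith
          · rw [(Nat.prime_dvd_prime_iff_eq hp hq).1 h]; exact Nat.lt_succ_self _
        · simp only [h, if_false] at hd
          exact ⟨(hg d hd).1, (hg d hd).2.1, fun p hp h => ((hg d hd).2.2 p hp h).trans (Nat.lt_succ_self q)⟩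
      · intro n hn
        have e : ∀ d ∈ n.divisorsAntidiagonal, (f d.1 + if Rough d.1.minFac d.2 then
            (if d.1 = q then -1 else g d.1) else 0) = (f d.1 + if Rough d.1.minFac d.2 then g d.1 else 0) +
            if d.1 = q then (if Rough q d.2 then -1 else 0) else 0 := fun d _ => by
          by_cases h : d.1 = q
          · rw [h, hq.minFac_eq, hgq q dvd_rfl]; simp
          · simp [h]
        rw [sum_congr rfl e, sum_add_distrib, hrough n hn, hfg n hn, sub_eq_add_neg]
        congr 1
        rw [Nat.sum_divisorsAntidiagonal (fun a b => if a = q then (if Rough q b then (-1 : ℤ) else 0) else 0)]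
        simp only [sum_ite_eq', Nat.mem_divisors, hn, ne_eq, not_false_eq_true, and_true]
        split_ifs <;> simp

lemma sum_Ico_one_two_pow {E : Type*} [AddCommMonoid E] (g : ℕ → E) (L : ℕ) :
    ∑ m ∈ Ico 1 (2 ^ L), g m = ∑ i ∈ range L, ∑ m ∈ Ico (2 ^ i) (2 * 2 ^ i), g m := by
  induction L with
  | zero => simp
  | succ L ih =>
    rw [sum_range_succ, ← ih, pow_succ, mul_comm, sum_Ico_consecutive _ Nat.one_le_two_pow (by omega)]

lemma sum_Ico_divisorsAntidiagonal {E : Type*} [AddCommMonoid E] (g : ℕ → ℕ → E) {X L : ℕ}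
    (hX : 4 * X ≤ 2 ^ L) : ∑ n ∈ Ico X (4 * X), ∑ e ∈ n.divisorsAntidiagonal, g e.1 e.2 =
      ∑ m ∈ Ico 1 (2 ^ L), ∑ l ∈ Ico 1 (2 ^ L), if X ≤ m * l ∧ m * l < 4 * X then g m l else 0 := by
  rw [← sum_product', ← sum_filter, sum_sigma']
  refine sum_nbij' (fun x => x.2) (fun e => ⟨e.1 * e.2, e⟩) ?_ ?_ ?_ ?_ (fun _ _ => rfl)
  · rintro ⟨n, a, b⟩ h
    simp only [mem_sigma, mem_Ico, Nat.mem_divisorsAntidiagonal, mem_filter, mem_product] at h ⊢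
    obtain ⟨⟨h1, h2⟩, rfl, h3⟩ := h
    have ha : 0 < a := Nat.pos_of_ne_zero fun h => h3 (by simp [h])
    have hb : 0 < b := Nat.pos_of_ne_zero fun h => h3 (by simp [h])
    exact ⟨⟨⟨ha, (Nat.le_mul_of_pos_right a hb).trans_lt (h2.trans_le hX)⟩, hb,
      (Nat.le_mul_of_pos_left b ha).trans_lt (h2.trans_le hX)⟩, h1, h2⟩
  · rintro ⟨a, b⟩ h
    simp only [mem_sigma, mem_Ico, Nat.mem_divisorsAntidiagonal, mem_filter, mem_product] at h ⊢
    exact ⟨h.2, trivial, by omega⟩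
  · rintro ⟨n, a, b⟩ h
    simp only [mem_sigma, Nat.mem_divisorsAntidiagonal] at h
    obtain ⟨-, rfl, -⟩ := h
    rfl
  · intro e _; rfl

lemma norm_sum_divisorsAntidiagonal_le (g : ℕ → ℕ → ℂ) {X L : ℕ} {D : ℝ} (hX : 4 * X ≤ 2 ^ L)
    (h : ∀ i < L, ∀ j < L, ‖∑ m ∈ Ico (2 ^ i) (2 * 2 ^ i), ∑ l ∈ Ico (2 ^ j) (2 * 2 ^ j),
      if X ≤ m * l ∧ m * l < 4 * X then g m l else 0‖ ≤ D) :
    ‖∑ n ∈ Ico X (4 * X), ∑ e ∈ n.divisorsAntidiagonal, g e.1 e.2‖ ≤ (L : ℝ) ^ 2 * D := by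
  rw [sum_Ico_divisorsAntidiagonal g hX, sum_Ico_one_two_pow]
  have e : ∀ i ∈ range L, ‖∑ m ∈ Ico (2 ^ i) (2 * 2 ^ i), ∑ l ∈ Ico 1 (2 ^ L),
      if X ≤ m * l ∧ m * l < 4 * X then g m l else 0‖ ≤ L * D := fun i hi => by
    rw [sum_congr rfl fun m _ => sum_Ico_one_two_pow _ L, sum_comm]
    refine (norm_sum_le_of_le _ fun j hj => h i (mem_range.1 hi) j (mem_range.1 hj)).trans ?_
    rw [sum_const, card_range, nsmul_eq_mul]
  refine (norm_sum_le_of_le _ e).trans ?_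
  rw [sum_const, card_range, nsmul_eq_mul]
  exact le_of_eq (by ring)

/-- Dyadic decomposition of a bilinear form over `X ≤ m l < 4 X` with an order condition. -/
theorem norm_bilinear_le {k : ℕ → ℂ} {X L A A' : ℕ} {B c d : ℝ} (hX0 : 0 < X) (hX : 4 * X ≤ 2 ^ L)
    (hB : 0 ≤ B) (hc : 0 ≤ c) (hd : 0 ≤ d)
    (hII : ∀ i j : ℕ, A < 2 * 2 ^ i → 2 ^ i < A' → X ≤ 4 * (2 ^ i * 2 ^ j) → 2 ^ i * 2 ^ j < 4 * X →
      BilBound (Ico (2 ^ i) (2 * 2 ^ i)) (Ico (2 ^ j) (2 * 2 ^ j)) (fun m l => k (m * l)) B)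
    (α β : ℕ → ℂ) (hα : ∀ m, m < 2 ^ L → ‖α m‖ ≤ c) (hβ : ∀ l, l < 2 ^ L → ‖β l‖ ≤ d)
    (hα2 : ∀ m, α m ≠ 0 → A ≤ m ∧ m < A') (σ τ : ℕ → ℕ) (hσ : ∀ m, m < 2 ^ L → σ m < 2 ^ L)
    (hτ : ∀ l, l < 2 ^ L → τ l < 2 ^ L) :
    ‖∑ n ∈ Ico X (4 * X), ∑ e ∈ n.divisorsAntidiagonal,
      if σ e.1 ≤ τ e.2 then α e.1 * β e.2 * k (e.1 * e.2) else 0‖ ≤ (L + 1) ^ 5 * (c * d * B) := by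
  refine (norm_sum_divisorsAntidiagonal_le (fun m l => if σ m ≤ τ l then α m * β l * k (m * l) else 0)
    (D := c * d * ((L + 1) ^ 3 * B)) hX ?_).trans ?_
  swap
  · calc (L : ℝ) ^ 2 * (c * d * ((L + 1) ^ 3 * B)) ≤ (L + 1) ^ 2 * (c * d * ((L + 1) ^ 3 * B)) := by
          gcongr; linarith
      _ = _ := by ring
  intro i hi j hj
  have hpi : 2 * 2 ^ i ≤ 2 ^ L := by rw [← pow_succ']; exact Nat.pow_le_pow_right (by norm_num) hi
  have hpj : 2 * 2 ^ j ≤ 2 ^ L := by rw [← pow_succ']; exact Nat.pow_le_pow_right (by norm_num) hj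
  by_cases hcase : A < 2 * 2 ^ i ∧ 2 ^ i < A' ∧ X ≤ 4 * (2 ^ i * 2 ^ j) ∧ 2 ^ i * 2 ^ j < 4 * X
  · have hL : 2 ^ L < 2 ^ (L + 1) := by rw [pow_succ]; have := Nat.one_le_two_pow (n := L); omega
    have h1 := hII i j hcase.1 hcase.2.1 hcase.2.2.1 hcase.2.2.2
    have h2 := h1.le_coupling (L + 1) σ τ (fun m hm => (hσ m ((mem_Ico.1 hm).2.trans_le hpi)).trans hL)
      (fun l hl => by have := hτ l ((mem_Ico.1 hl).2.trans_le hpj); omega)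
    have h3 := h2.lt_coupling (L + 1) (fun m => (X - 1) / m) (fun l => l)
      (fun m _ => ((Nat.div_le_self _ _).trans_lt (by omega : X - 1 < 2 ^ L)).trans hL)
      (fun l hl => ((mem_Ico.1 hl).2.trans_le hpj).trans hL)
    have h4 := h3.le_coupling (L + 1) (fun m => m) (fun l => (4 * X - 1) / l)
      (fun m hm => ((mem_Ico.1 hm).2.trans_le hpi).trans hL)
      (fun l _ => by
        have : (4 * X - 1) / l < 2 ^ L := (Nat.div_le_self _ _).trans_lt (by omega)
        omega)
    have h5 := h4.apply_of_le (a := α) (b := β) hc hd (fun m hm => hα m ((mem_Ico.1 hm).2.trans_le hpi))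
      (fun l hl => hβ l ((mem_Ico.1 hl).2.trans_le hpj))
    push_cast at h5
    refine le_trans (le_of_eq ?_) (h5.trans (le_of_eq (by ring)))
    congr 1
    refine sum_congr rfl fun m hm => sum_congr rfl fun l hl => ?_
    have hm0 : 0 < m := (Nat.two_pow_pos i).trans_le (mem_Ico.1 hm).1
    have hl0 : 0 < l := (Nat.two_pow_pos j).trans_le (mem_Ico.1 hl).1
    have e1 : (X - 1) / m < l ↔ X ≤ m * l := by
      rw [Nat.div_lt_iff_lt_mul hm0, mul_comm l m]; omega
    have e2 : m ≤ (4 * X - 1) / l ↔ m * l < 4 * X := by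
      rw [Nat.le_div_iff_mul_le hl0]; omega
    simp only [e1, e2]
    by_cases c1 : X ≤ m * l <;> by_cases c2 : m * l < 4 * X <;> by_cases c3 : σ m ≤ τ l <;> simp [c1, c2, c3]
  · rw [sum_eq_zero, norm_zero]
    · positivity
    intro m hm
    refine sum_eq_zero fun l hl => ?_
    rw [mem_Ico] at hm hl
    split_ifs with h1 h2
    · have : α m = 0 := by
        by_contra h
        obtain ⟨a1, a2⟩ := hα2 m h
        refine hcase ⟨by omega, by omega, ?_, (Nat.mul_le_mul hm.1 hl.1).trans_lt h1.2⟩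
        calc X ≤ m * l := h1.1
          _ ≤ (2 * 2 ^ i) * (2 * 2 ^ j) := Nat.mul_le_mul hm.2.le hl.2.le
          _ = _ := by ring
      rw [this]; ring
    · rfl
    · rfl

theorem norm_linear_le {k : ℕ → ℂ} {X L A' : ℕ} {B c : ℝ} (hX0 : 0 < X) (hX : 4 * X ≤ 2 ^ L)
    (hB : 0 ≤ B) (hc : 0 ≤ c)
    (hI : ∀ (i j : ℕ) (lo hi : ℕ → ℕ), 2 ^ i < A' → X ≤ 4 * (2 ^ i * 2 ^ j) → 2 ^ i * 2 ^ j < 4 * X →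
      (∀ m, 2 ^ j ≤ lo m ∧ lo m ≤ 2 * 2 ^ j) → (∀ m, hi m ≤ 2 * 2 ^ j) →
      ∑ m ∈ Ico (2 ^ i) (2 * 2 ^ i), ‖∑ l ∈ Ico (lo m) (hi m), k (m * l)‖ ≤ B)
    (α : ℕ → ℂ) (hα : ∀ m, m < 2 ^ L → ‖α m‖ ≤ c) (hα2 : ∀ m, α m ≠ 0 → m < A') :
    ‖∑ n ∈ Ico X (4 * X), ∑ e ∈ n.divisorsAntidiagonal, α e.1 * k (e.1 * e.2)‖ ≤ (L : ℝ) ^ 2 * (c * B) := by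
  refine norm_sum_divisorsAntidiagonal_le (fun m l => α m * k (m * l)) hX ?_
  intro i hi j hj
  have hpi : 2 * 2 ^ i ≤ 2 ^ L := by rw [← pow_succ']; exact Nat.pow_le_pow_right (by norm_num) hi
  by_cases hcase : 2 ^ i < A' ∧ X ≤ 4 * (2 ^ i * 2 ^ j) ∧ 2 ^ i * 2 ^ j < 4 * X
  · have h1 := hI i j (fun m => min (2 * 2 ^ j) (max (2 ^ j) ((X - 1) / m + 1)))
      (fun m => min (2 * 2 ^ j) ((4 * X - 1) / m + 1)) hcase.1 hcase.2.1 hcase.2.2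
      (fun m => ⟨by omega, min_le_left _ _⟩) (fun m => min_le_left _ _)
    refine le_trans (norm_sum_le _ _) (le_trans ?_ (mul_le_mul_of_nonneg_left h1 hc))
    rw [mul_sum]
    refine sum_le_sum fun m hm => ?_
    have hm0 : 0 < m := (Nat.two_pow_pos i).trans_le (mem_Ico.1 hm).1
    rw [← sum_filter, ← mul_sum, norm_mul]
    have e : (Ico (2 ^ j) (2 * 2 ^ j)).filter (fun l => X ≤ m * l ∧ m * l < 4 * X) =
        Ico (min (2 * 2 ^ j) (max (2 ^ j) ((X - 1) / m + 1))) (min (2 * 2 ^ j) ((4 * X - 1) / m + 1)) := by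
      ext l
      have e1 : (X - 1) / m < l ↔ X ≤ m * l := by
        rw [Nat.div_lt_iff_lt_mul hm0, mul_comm l m]; omega
      have e2 : l ≤ (4 * X - 1) / m ↔ m * l < 4 * X := by
        rw [Nat.le_div_iff_mul_le hm0, mul_comm l m]; omega
      rw [mem_filter, mem_Ico, mem_Ico, ← e1, ← e2]
      omega
    rw [e]
    exact mul_le_mul_of_nonneg_right (hα m ((mem_Ico.1 hm).2.trans_le hpi)) (norm_nonneg _)
  · rw [sum_eq_zero, norm_zero]
    · positivity
    intro m hm
    refine sum_eq_zero fun l hl => ?_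
    rw [mem_Ico] at hm hl
    split_ifs with h1
    · have : α m = 0 := by
        by_contra h
        have a2 := hα2 m h
        refine hcase ⟨by omega, ?_, (Nat.mul_le_mul hm.1 hl.1).trans_lt h1.2⟩
        calc X ≤ m * l := h1.1
          _ ≤ (2 * 2 ^ i) * (2 * 2 ^ j) := Nat.mul_le_mul hm.2.le hl.2.le
          _ = _ := by ring
      rw [this]; ring
    · rfl

/-- The number of primes in `[z, w)` dividing `n`. -/
def middlePrimes (z w n : ℕ) : ℕ := (n.primeFactors.filter fun p => z ≤ p ∧ p < w).card

/-- A minorant of the indicator of primes built from sifted sums. -/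
noncomputable def sieveWeight (z w n : ℕ) : ℤ := (if Rough z n then 1 - (middlePrimes z w n : ℤ) else 0) -
  ((n.divisorsAntidiagonal.filter fun e => e.1.Prime ∧ w ≤ e.1 ∧ e.1 ≤ e.2 ∧ Rough z e.2).card : ℤ)

lemma middlePrimes_le_three {z w n : ℕ} (hn : n ≠ 0) (h : n < z ^ 4) : middlePrimes z w n ≤ 3 := by
  by_contra! h4
  refine absurd h (not_lt.2 ?_)
  have hz : 0 < z := Nat.pos_of_ne_zero fun h0 => by simp [h0] at h
  calc z ^ 4 ≤ z ^ (middlePrimes z w n) := Nat.pow_le_pow_right hz h4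
    _ ≤ ∏ p ∈ n.primeFactors.filter fun p => z ≤ p ∧ p < w, p :=
      pow_card_le_prod _ _ _ fun p hp => (mem_filter.1 hp).2.1
    _ ≤ n := Nat.le_of_dvd (Nat.pos_of_ne_zero hn)
      ((prod_dvd_prod_of_subset _ _ _ (filter_subset _ _)).trans (Nat.prod_primeFactors_dvd n))

lemma middlePrimes_mul_left {z w d l : ℕ} (hd : ∀ p : ℕ, p.Prime → p ∣ d → p < z) (hd0 : d ≠ 0) (hl0 : l ≠ 0) :
    middlePrimes z w (d * l) = middlePrimes z w l := by
  rw [middlePrimes, middlePrimes]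
  congr 1
  ext p
  simp only [mem_filter, Nat.primeFactors_mul hd0 hl0, mem_union, Nat.mem_primeFactors]
  constructor
  · rintro ⟨⟨h1, h2, -⟩ | h1, h3⟩
    · exact absurd (hd p h1 h2) (by omega)
    · exact ⟨h1, h3⟩
  · exact fun h => ⟨Or.inr h.1, h.2⟩

/-- The Dirichlet coefficients of `1 - middlePrimes`. -/
def middleCoef (z w d : ℕ) : ℤ := if d = 1 then 1 else if d.Prime ∧ z ≤ d ∧ d < w then -1 else 0

lemma sum_middle_aux {z w n : ℕ} (hn : n ≠ 0) (c : ℤ) :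
    ∑ e ∈ n.divisorsAntidiagonal, (if e.1 = 1 then 1 else if e.1.Prime ∧ z ≤ e.1 ∧ e.1 < w then c else 0) =
      1 + c * middlePrimes z w n := by
  rw [Nat.sum_divisorsAntidiagonal (fun d _ => if d = 1 then (1 : ℤ) else
    if d.Prime ∧ z ≤ d ∧ d < w then c else 0)]
  have e : ∀ d ∈ n.divisors, (if d = 1 then (1 : ℤ) else if d.Prime ∧ z ≤ d ∧ d < w then c else 0) =
      (if d = 1 then 1 else 0) + if d.Prime ∧ z ≤ d ∧ d < w then c else 0 := fun d _ => by
    by_cases h : d = 1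
    · subst h; simp [Nat.not_prime_one]
    · simp [h]
  rw [sum_congr rfl e, sum_add_distrib]
  congr 1
  · simp [hn]
  · rw [← sum_filter, sum_const, nsmul_eq_mul, mul_comm, middlePrimes]
    congr 3
    ext p
    simp only [mem_filter, Nat.mem_divisors, Nat.mem_primeFactors]
    tauto

lemma abs_sum_mul_middleCoef_le {z w n : ℕ} (hn : n ≠ 0) (f : ℕ → ℤ) (hf : ∀ d, |f d| ≤ 1) :
    |∑ e ∈ n.divisorsAntidiagonal, f e.1 * middleCoef z w e.2| ≤ 1 + middlePrimes z w n := by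
  rw [Nat.sum_divisorsAntidiagonal' (fun a b => f a * middleCoef z w b),
    ← Nat.sum_divisorsAntidiagonal (fun a b => f b * middleCoef z w a)]
  refine (abs_sum_le_sum_abs _ _).trans ?_
  have := sum_middle_aux (z := z) (w := w) hn 1
  rw [one_mul] at this
  rw [← this]
  refine sum_le_sum fun e _ => ?_
  rw [abs_mul]
  refine (mul_le_of_le_one_left (abs_nonneg _) (hf _)).trans ?_
  rw [middleCoef]
  split_ifs <;> simp

lemma sum_convolution_middle {z w n : ℕ} (f : ℕ → ℤ) (hf : f 0 = 0) :
    ∑ e ∈ n.divisorsAntidiagonal, f e.1 * (1 - (middlePrimes z w e.2 : ℤ)) =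
      ∑ e ∈ n.divisorsAntidiagonal, ∑ d ∈ e.1.divisorsAntidiagonal, f d.1 * middleCoef z w d.2 := by
  have := DFunLike.congr_fun (mul_assoc (show ArithmeticFunction ℤ from ⟨f, hf⟩)
    (show ArithmeticFunction ℤ from ⟨middleCoef z w, by simp [middleCoef, Nat.not_prime_zero]⟩)
    (ArithmeticFunction.zeta : ArithmeticFunction ℤ)) n
  simp only [ArithmeticFunction.mul_apply] at this
  refine Eq.trans (sum_congr rfl fun e he => ?_) (this.symm.trans (sum_congr rfl fun e he => ?_))
  · have h0 := Nat.ne_zero_of_mem_divisorsAntidiagonal he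
    have h1 := sum_middle_aux (z := z) (w := w) h0.2 (-1)
    rw [show 1 - (middlePrimes z w e.2 : ℤ) = 1 + -1 * middlePrimes z w e.2 by ring, ← h1]
    congr 1
    refine sum_congr rfl fun d hd => ?_
    rw [ArithmeticFunction.natCoe_apply, ArithmeticFunction.zeta_apply_ne
      (Nat.ne_zero_of_mem_divisorsAntidiagonal hd).2]
    simp [middleCoef]
  · rw [ArithmeticFunction.natCoe_apply, ArithmeticFunction.zeta_apply_ne
      (Nat.ne_zero_of_mem_divisorsAntidiagonal he).2]
    rw [Nat.cast_one, mul_one]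
    exact ArithmeticFunction.mul_apply

/-- A bound for the sieve weight against `k` from bilinear and linear information on `k`. -/
theorem norm_sum_sieveWeight_le {k : ℕ → ℂ} {X L y z w : ℕ} {B : ℝ} (hX0 : 0 < X) (hX : 4 * X ≤ 2 ^ L)
    (hB : 0 ≤ B) (hy : 2 ≤ y) (hyz : y ^ 2 ≤ z) (hLz : 2 ^ L ≤ z ^ 4) (hyw : 4 * X ≤ (y * w) ^ 2)
    (hII : ∀ i j : ℕ, (y < 2 * 2 ^ i ∧ 2 ^ i < z ∨ w < 2 * 2 ^ i ∧ 2 ^ i < y * w) →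
      X ≤ 4 * (2 ^ i * 2 ^ j) → 2 ^ i * 2 ^ j < 4 * X →
      BilBound (Ico (2 ^ i) (2 * 2 ^ i)) (Ico (2 ^ j) (2 * 2 ^ j)) (fun m l => k (m * l)) B)
    (hI : ∀ (i j : ℕ) (lo hi : ℕ → ℕ), 2 ^ i < w → X ≤ 4 * (2 ^ i * 2 ^ j) → 2 ^ i * 2 ^ j < 4 * X →
      (∀ m, 2 ^ j ≤ lo m ∧ lo m ≤ 2 * 2 ^ j) → (∀ m, hi m ≤ 2 * 2 ^ j) →
      ∑ m ∈ Ico (2 ^ i) (2 * 2 ^ i), ‖∑ l ∈ Ico (lo m) (hi m), k (m * l)‖ ≤ B) :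
    ‖∑ n ∈ Ico X (4 * X), (sieveWeight z w n : ℂ) * k n‖ ≤ 11 * (L + 1) ^ 5 * B := by
  obtain ⟨f, g, hf1, hg1, hf, hg, hfg⟩ := exists_buchstab z y hy
  have hL0 : (0 : ℝ) ≤ L := by positivity
  have hf0 : f 0 = 0 := by
    by_contra h
    obtain ⟨p, hp, hpp⟩ := Nat.exists_infinite_primes z
    exact absurd ((hf 0 h).2 p hpp (dvd_zero p)) (by omega)
  have hw0 : 0 < w := Nat.pos_of_ne_zero fun h => by rw [h] at hyw; simp at hyw; omega
  set c : ℕ → ℤ := fun m => ∑ d ∈ m.divisorsAntidiagonal, f d.1 * middleCoef z w d.2 with hc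
  have hmid : ∀ m, m < 2 ^ L → m ≠ 0 → middlePrimes z w m ≤ 3 := fun m hm h0 =>
    middlePrimes_le_three h0 (hm.trans_le hLz)
  have hc4 : ∀ m, m < 2 ^ L → |c m| ≤ 4 := fun m hm => by
    rcases Nat.eq_zero_or_pos m with rfl | h0
    · simp [hc]
    · have h1 := abs_sum_mul_middleCoef_le (z := z) (w := w) h0.ne' f hf1
      have h2 := hmid m hm h0.ne'
      rw [hc]; dsimp only; omega
  have hcs : ∀ m, c m ≠ 0 → m < y * w := fun m hm => by
    obtain ⟨d, hd, hd0⟩ := exists_ne_zero_of_sum_ne_zero hm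
    rw [Nat.mem_divisorsAntidiagonal] at hd
    have h1 := (hf d.1 (left_ne_zero_of_mul hd0)).1
    have h2 : d.2 ≤ w := by
      have := right_ne_zero_of_mul hd0
      rw [middleCoef] at this
      split_ifs at this with h3 h4
      · omega
      · exact h4.2.2.le
      · exact absurd rfl this
    rw [← hd.1]
    exact (Nat.mul_le_mul_left _ h2).trans_lt (Nat.mul_lt_mul_of_pos_right h1 hw0)
  set τ : ℕ → ℕ := fun l => if l ≤ 1 then 2 ^ L - 1 else l.minFac with hτ
  have hL4 : 4 ≤ 2 ^ L := by omega
  have hgz : ∀ u, g u ≠ 0 → y ≤ u ∧ u < z := fun u hu => by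
    obtain ⟨a1, a2, a3⟩ := hg u hu
    refine ⟨a1, ?_⟩
    by_cases hp : u.Prime
    · exact a3 u hp dvd_rfl
    · have h1 := Nat.minFac_sq_le_self (by omega) hp
      have h2 : u.minFac < y := by
        rw [sq] at h1
        exact lt_of_mul_lt_mul_right (h1.trans_lt a2) (Nat.zero_le _)
      calc u < y * u.minFac := a2
        _ ≤ y * y := Nat.mul_le_mul_left _ h2.le
        _ ≤ z := by rw [← sq]; exact hyz
  have hrτ : ∀ n ∈ Ico X (4 * X), ∀ e ∈ n.divisorsAntidiagonal, (Rough e.1.minFac e.2 ↔ e.1.minFac ≤ τ e.2) := fun n hn e he => by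
    have h0 := Nat.ne_zero_of_mem_divisorsAntidiagonal he
    rw [Nat.mem_divisorsAntidiagonal] at he
    rw [mem_Ico] at hn
    have h1 : e.1 < 2 ^ L := by
      have := Nat.le_mul_of_pos_right e.1 (Nat.pos_of_ne_zero h0.2)
      omega
    rw [hτ]; dsimp only
    split_ifs with h2
    · have : e.2 = 1 := by omega
      rw [this]
      refine iff_of_true (fun p hp h => absurd (Nat.dvd_one.1 h) hp.ne_one) ?_
      have := Nat.minFac_le (Nat.pos_of_ne_zero h0.1)
      omega
    · exact ⟨fun h => h _ (Nat.minFac_prime (by omega)) (Nat.minFac_dvd _),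
        fun h p hp hpe => h.trans (Nat.minFac_le_of_dvd hp.two_le hpe)⟩
  have hdec : ∀ n ∈ Ico X (4 * X), (sieveWeight z w n : ℂ) * k n =
      ∑ e ∈ n.divisorsAntidiagonal, (if e.1 < w then (c e.1 : ℂ) else 0) * k (e.1 * e.2) +
      ∑ e ∈ n.divisorsAntidiagonal, (if 0 ≤ 0 then
        (if w ≤ e.1 then (c e.1 : ℂ) else 0) * 1 * k (e.1 * e.2) else 0) +
      ∑ e ∈ n.divisorsAntidiagonal, (if e.1.minFac ≤ τ e.2 then
        (g e.1 : ℂ) * ((1 - (middlePrimes z w e.2 : ℤ) : ℤ) : ℂ) * k (e.1 * e.2) else 0) -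
      ∑ e ∈ n.divisorsAntidiagonal, (if e.1 ≤ e.2 then
        (if e.1.Prime ∧ w ≤ e.1 ∧ e.1 < y * w then 1 else 0) * (if Rough z e.2 then 1 else 0) *
          k (e.1 * e.2) else 0) := fun n hn => by
    have hn0 : n ≠ 0 := by rw [mem_Ico] at hn; omega
    have e1 : (if Rough z n then 1 - (middlePrimes z w n : ℤ) else 0) =
        ∑ e ∈ n.divisorsAntidiagonal, c e.1 + ∑ e ∈ n.divisorsAntidiagonal,
          if e.1.minFac ≤ τ e.2 then g e.1 * (1 - (middlePrimes z w e.2 : ℤ)) else 0 := by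
      have h1 : (if Rough z n then 1 - (middlePrimes z w n : ℤ) else 0) =
          (if Rough z n then 1 else 0) * (1 - (middlePrimes z w n : ℤ)) := by split_ifs <;> ring
      rw [h1, hfg n hn0, ← sum_convolution_middle f hf0, ← sum_add_distrib, sum_mul]
      refine sum_congr rfl fun e he => ?_
      have hr := hrτ n hn e he
      have h0 := Nat.ne_zero_of_mem_divisorsAntidiagonal he
      rw [Nat.mem_divisorsAntidiagonal] at he
      simp only [hr]
      rw [add_mul]
      congr 1
      · by_cases hfe : f e.1 = 0
        · simp [hfe]
        · rw [← he.1, middlePrimes_mul_left (hf _ hfe).2 h0.1 h0.2]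
      · by_cases hge : g e.1 = 0
        · simp [hge]
        · rw [← he.1, middlePrimes_mul_left (hg _ hge).2.2 h0.1 h0.2]
          split_ifs <;> ring
    have e2 : ((n.divisorsAntidiagonal.filter fun e => e.1.Prime ∧ w ≤ e.1 ∧ e.1 ≤ e.2 ∧ Rough z e.2).card : ℂ) =
        ∑ e ∈ n.divisorsAntidiagonal, (if e.1 ≤ e.2 then
        (if e.1.Prime ∧ w ≤ e.1 ∧ e.1 < y * w then 1 else 0) * (if Rough z e.2 then 1 else 0) else 0) := by
      rw [card_filter]
      push_cast
      refine sum_congr rfl fun e he => ?_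
      rw [Nat.mem_divisorsAntidiagonal] at he
      have h1 : e.1 ≤ e.2 → e.1 < y * w := fun h => by
        rw [mem_Ico] at hn
        have : e.1 ^ 2 < (y * w) ^ 2 := by
          rw [sq e.1]
          have := Nat.mul_le_mul_left e.1 h
          omega
        exact lt_of_pow_lt_pow_left₀ 2 (Nat.zero_le _) this
      by_cases c1 : e.1 ≤ e.2 <;> by_cases c2 : e.1.Prime <;> by_cases c3 : w ≤ e.1 <;>
        by_cases c4 : Rough z e.2 <;> simp [c1, c2, c3, c4] <;> exact h1 c1
    rw [sieveWeight, e1]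
    push_cast
    rw [e2, sub_mul, add_mul, sum_mul, sum_mul, sum_mul]
    congr 1
    · congr 1
      · rw [← sum_add_distrib]
        refine sum_congr rfl fun e he => ?_
        rw [(Nat.mem_divisorsAntidiagonal.1 he).1]
        rcases lt_or_ge e.1 w with h | h
        · simp [h, not_le.2 h]
        · simp [h, not_lt.2 h]
      · refine sum_congr rfl fun e he => ?_
        rw [(Nat.mem_divisorsAntidiagonal.1 he).1]
        split_ifs <;> simp
    · refine sum_congr rfl fun e he => ?_
      rw [(Nat.mem_divisorsAntidiagonal.1 he).1]
      split_ifs <;> simp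
  rw [sum_congr rfl hdec, sum_sub_distrib, sum_add_distrib, sum_add_distrib]
  have hcn : ∀ m, m < 2 ^ L → ‖(c m : ℂ)‖ ≤ 4 := fun m hm => by
    rw [Complex.norm_intCast]; exact_mod_cast hc4 m hm
  have b1 := norm_linear_le hX0 hX hB (show (0 : ℝ) ≤ 4 by norm_num) hI
    (fun m => if m < w then (c m : ℂ) else 0) (fun m hm => by
      split_ifs
      · exact hcn m hm
      · simp) (fun m hm => by by_contra h; simp [h] at hm)
  have b2 := norm_bilinear_le hX0 hX hB (show (0 : ℝ) ≤ 4 by norm_num) zero_le_one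
    (fun i j h1 h2 => hII i j (Or.inr ⟨h1, h2⟩))
    (fun m => if w ≤ m then (c m : ℂ) else 0) (fun _ => 1) (fun m hm => by
      split_ifs
      · exact hcn m hm
      · simp) (by simp) (fun m hm => by
      by_cases h : w ≤ m
      · simp only [h, if_true] at hm
        exact ⟨h, hcs m (mod_cast hm)⟩
      · simp [h] at hm) (fun _ => 0) (fun _ => 0) (fun _ _ => by omega) (fun _ _ => by omega)
  have b3 := norm_bilinear_le hX0 hX hB zero_le_one (show (0 : ℝ) ≤ 2 by norm_num)
    (fun i j h1 h2 => hII i j (Or.inl ⟨h1, h2⟩))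
    (fun m => (g m : ℂ)) (fun l => if l = 0 then 0 else ((1 - (middlePrimes z w l : ℤ) : ℤ) : ℂ)) (fun m _ => by
      rw [Complex.norm_intCast]; exact_mod_cast hg1 m) (fun l hl => by
      split_ifs with h
      · simp
      · have := hmid l hl h
        rw [Complex.norm_intCast]
        have : |1 - (middlePrimes z w l : ℤ)| ≤ 2 := by rw [abs_le]; omega
        exact_mod_cast this) (fun m hm => hgz m (mod_cast hm)) Nat.minFac τ (fun m hm => by
      rcases Nat.eq_zero_or_pos m with rfl | h
      · rw [Nat.minFac_zero]; omega
      · exact (Nat.minFac_le h).trans_lt hm) (fun l hl => by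
      rw [hτ]; dsimp only; split_ifs
      · omega
      · exact (Nat.minFac_le (by omega)).trans_lt hl)
  have b4 := norm_bilinear_le hX0 hX hB zero_le_one zero_le_one
    (fun i j h1 h2 => hII i j (Or.inr ⟨h1, h2⟩))
    (fun m => if m.Prime ∧ w ≤ m ∧ m < y * w then 1 else 0) (fun l => if Rough z l then 1 else 0)
    (fun m _ => by split_ifs <;> simp) (fun m _ => by split_ifs <;> simp)
    (fun m hm => by
      by_cases h : m.Prime ∧ w ≤ m ∧ m < y * w
      · exact h.2
      · simp [h] at hm) (fun m => m) (fun l => l) (fun m hm => hm) (fun l hl => hl)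
  have b3' : ∀ n ∈ Ico X (4 * X), ∑ e ∈ n.divisorsAntidiagonal, (if e.1.minFac ≤ τ e.2 then
        (g e.1 : ℂ) * ((1 - (middlePrimes z w e.2 : ℤ) : ℤ) : ℂ) * k (e.1 * e.2) else 0) =
      ∑ e ∈ n.divisorsAntidiagonal, (if e.1.minFac ≤ τ e.2 then
        (g e.1 : ℂ) * (if e.2 = 0 then 0 else ((1 - (middlePrimes z w e.2 : ℤ) : ℤ) : ℂ)) *
          k (e.1 * e.2) else 0) := fun n _ => by
    refine sum_congr rfl fun e he => ?_
    rw [if_neg (Nat.ne_zero_of_mem_divisorsAntidiagonal he).2]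
  rw [sum_congr rfl b3']
  refine (norm_sub_le _ _).trans ((add_le_add (norm_add₃_le.trans (add_le_add (add_le_add b1 b2) b3)) b4).trans ?_)
  have h25 : (L : ℝ) ^ 2 ≤ (L + 1) ^ 5 :=
    (pow_le_pow_left₀ hL0 (by linarith) 2).trans (pow_le_pow_right₀ (by linarith) (by norm_num))
  have := mul_le_mul_of_nonneg_right h25 hB
  linarith

lemma ee_mono2_mul (γ : ℝ) (h m l : ℕ) :
    ee (mono2 γ (h, m) * (l : ℝ) ^ γ) = ee (h * ((m * l : ℕ) : ℝ) ^ γ) := by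
  rw [mono2, Nat.cast_mul, mul_rpow (by positivity) (by positivity), mul_assoc]

lemma BilBound.of_dyadicBlock {γ B : ℝ} {H M N : ℕ} {a : ℕ → ℂ} (ha : ∀ h, ‖a h‖ ≤ 1)
    (hb : BilBound (dyadicBlock H M) (Ico N (2 * N)) (fun p l => ee (mono2 γ p * (l : ℝ) ^ γ)) B) :
    BilBound (Ico M (2 * M)) (Ico N (2 * N))
      (fun m l => ∑ h ∈ Ico H (2 * H), a h * ee (h * ((m * l : ℕ) : ℝ) ^ γ)) B := fun α β hα hβ => by
  have := hb (fun p => a p.1 * α p.2) β (fun p => by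
    rw [norm_mul]; exact mul_le_one₀ (ha _) (norm_nonneg _) (hα _)) hβ
  refine le_trans (le_of_eq ?_) this
  rw [dyadicBlock, sum_product_right]
  congr 1
  refine sum_congr rfl fun m _ => ?_
  rw [sum_comm]
  refine sum_congr rfl fun l _ => ?_
  rw [mul_sum]
  refine sum_congr rfl fun h _ => ?_
  dsimp only
  rw [ee_mono2_mul]; ring

lemma sum_norm_of_dyadicBlock {γ B : ℝ} {H M : ℕ} {a : ℕ → ℂ} (ha : ∀ h, ‖a h‖ ≤ 1) (lo hi : ℕ → ℕ)
    (hb : ∑ p ∈ dyadicBlock H M, ‖∑ n ∈ Ico (lo p.2) (hi p.2), ee (mono2 γ p * (n : ℝ) ^ γ)‖ ≤ B) :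
    ∑ m ∈ Ico M (2 * M), ‖∑ l ∈ Ico (lo m) (hi m),
      ∑ h ∈ Ico H (2 * H), a h * ee (h * ((m * l : ℕ) : ℝ) ^ γ)‖ ≤ B := by
  refine le_trans ?_ hb
  rw [dyadicBlock, sum_product, sum_comm]
  refine sum_le_sum fun m _ => ?_
  rw [sum_comm]
  refine norm_sum_le_of_le _ fun h _ => ?_
  rw [← mul_sum, norm_mul]
  refine (mul_le_of_le_one_left (norm_nonneg _) (ha h)).trans (le_of_eq ?_)
  congr 1
  refine sum_congr rfl fun l _ => ?_
  rw [ee_mono2_mul]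

/-- Cancellation in the sieve weight against the characters `e(h n ^ γ)`. -/
theorem norm_sum_sieveWeight_ee_le {γ : ℝ} (h0 : 50 / 58 < γ) (h1 : γ < 1) : ∃ s : ℝ, 0 < s ∧
    ∀ᶠ X : ℕ in atTop, ∀ (H : ℕ) (a : ℕ → ℂ), 0 < H → (H : ℝ) ≤ (X : ℝ) ^ (1 - γ + s) → (∀ h, ‖a h‖ ≤ 1) →
      ‖∑ n ∈ Ico X (4 * X), (sieveWeight ⌈(X : ℝ) ^ (18 / 58 : ℝ)⌉₊ ⌈(X : ℝ) ^ (24 / 58 : ℝ)⌉₊ n : ℂ) *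
        ∑ h ∈ Ico H (2 * H), a h * ee (h * (n : ℝ) ^ γ)‖ ≤ (X : ℝ) ^ (1 - s) := by
  obtain ⟨s1, hs1, hA⟩ := typeII_short h0 h1
  obtain ⟨s2, hs2, hC⟩ := typeII_middle h0 h1
  obtain ⟨s, hs0, hs3, hs4, hs5⟩ : ∃ s : ℝ, 0 < s ∧ s ≤ s1 ∧ s ≤ s2 ∧ s ≤ 1 / 580000 :=
    ⟨min s1 (min s2 (1 / 580000)), by positivity, min_le_left _ _,
      (min_le_right _ _).trans (min_le_left _ _), (min_le_right _ _).trans (min_le_right _ _)⟩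
  refine ⟨s / 2, by linarith, ?_⟩
  refine tendsto_natCast_atTop_atTop.eventually ((?_ : ∀ᶠ x : ℝ in atTop, ∀ X : ℕ, (X : ℝ) = x →
    ∀ (H : ℕ) (a : ℕ → ℂ), 0 < H → (H : ℝ) ≤ x ^ (1 - γ + s / 2) → (∀ h, ‖a h‖ ≤ 1) →
      ‖∑ n ∈ Ico X (4 * X), (sieveWeight ⌈x ^ (18 / 58 : ℝ)⌉₊ ⌈x ^ (24 / 58 : ℝ)⌉₊ n : ℂ) *
        ∑ h ∈ Ico H (2 * H), a h * ee (h * (n : ℝ) ^ γ)‖ ≤ x ^ (1 - s / 2))) |>.mono (fun X h => h X rfl)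
  filter_upwards [hA, hC, typeI h0 h1 hs0 hs5, eventually_const_mul_log_pow_le (11 * 3 ^ 5) 5 (half_pos hs0),
    (tendsto_rpow_atTop hs0).eventually_ge_atTop 64,
    tendsto_log_atTop.eventually_ge_atTop 1, eventually_gt_atTop 2] with x hA hC hI hlog hxs hlx hx2
  intro X hXx H a hH hHx ha
  have hx : 1 < x := by linarith
  have hx0 : 0 < x := by linarith
  have hle := fun a b : ℝ => rpow_le_rpow_left_iff (y := a) (z := b) hx
  have hadd := fun a b : ℝ => (rpow_add hx0 a b).symm
  have hceil := fun b : ℝ => ceil_rpow_bounds (b := b) hx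
  have hup : ∀ {A C b : ℝ}, A ≤ C * x ^ b → C ≤ 64 → A ≤ x ^ (b + s) := fun {A C b} hA hC => by
    calc A ≤ C * x ^ b := hA
      _ ≤ x ^ s * x ^ b := by gcongr; linarith
      _ = _ := by rw [hadd, add_comm]
  have hdn : ∀ {A C b : ℝ}, x ^ b ≤ C * A → C ≤ 64 → 0 ≤ A → x ^ (b - s) ≤ A := fun {A C b} hA hC hA0 => by
    rw [rpow_sub hx0, div_le_iff₀ (by positivity)]
    calc x ^ b ≤ C * A := hA
      _ ≤ A * x ^ s := by rw [mul_comm]; gcongr; linarith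
  obtain ⟨hy1, hy2⟩ := hceil (8 / 58) (by norm_num)
  obtain ⟨hz1, hz2⟩ := hceil (18 / 58) (by norm_num)
  obtain ⟨hw1, hw2⟩ := hceil (24 / 58) (by norm_num)
  set y := ⌈x ^ (8 / 58 : ℝ)⌉₊
  set z := ⌈x ^ (18 / 58 : ℝ)⌉₊
  set w := ⌈x ^ (24 / 58 : ℝ)⌉₊
  have hX1 : 1 < X := by
    have : (1 : ℝ) < X := by rw [hXx]; exact hx
    exact_mod_cast this
  have hxrpow : x ^ (1 : ℝ) = x := rpow_one x
  have hs64 : 64 ≤ x ^ (1 / 58 : ℝ) := hxs.trans (by rw [hle]; linarith)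
  have hcast : ∀ i j : ℕ, X ≤ 4 * (2 ^ i * 2 ^ j) → 2 ^ i * 2 ^ j < 4 * X →
      x ≤ 4 * (((2 ^ i : ℕ) : ℝ) * ((2 ^ j : ℕ) : ℝ)) ∧ ((2 ^ i : ℕ) : ℝ) * ((2 ^ j : ℕ) : ℝ) ≤ 4 * x := fun i j h1 h2 => by
    rw [← hXx]
    exact ⟨mod_cast h1, mod_cast h2.le⟩
  have hB0 : 0 ≤ x ^ (1 - s) := by positivity
  have hHs : (H : ℝ) ≤ x ^ (1 - γ + s) := hHx.trans (by rw [hle]; linarith)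
  have key := norm_sum_sieveWeight_le (k := fun n => ∑ h ∈ Ico H (2 * H), a h * ee (h * (n : ℝ) ^ γ))
    (X := X) (L := Nat.log 2 X + 3) (y := y) (z := z) (w := w) (B := x ^ (1 - s)) (by omega) ?_ hB0 ?_ ?_ ?_ ?_ ?_ ?_
  · refine key.trans ?_
    have hl := nat_log_two_add_one_le hlx (show 0 < X by omega) hXx.le
    push_cast at hl ⊢
    calc 11 * ((Nat.log 2 X : ℝ) + 3 + 1) ^ 5 * x ^ (1 - s)
        ≤ 11 * (3 * (2 + 4 * log x)) ^ 5 * x ^ (1 - s) := by gcongr; linarith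
      _ = 11 * 3 ^ 5 * (2 + 4 * log x) ^ 5 * x ^ (1 - s) := by ring
      _ ≤ x ^ (s / 2) * x ^ (1 - s) := by gcongr
      _ = _ := by rw [hadd]; congr 1; ring
  · have := Nat.lt_pow_succ_log_self (b := 2) (by norm_num) X
    rw [pow_succ] at this
    rw [pow_add]; omega
  · have : (1 : ℝ) < y := lt_of_lt_of_le (one_lt_rpow hx (by norm_num)) hy1
    exact_mod_cast this
  · have : (y : ℝ) ^ 2 ≤ z := by
      calc (y : ℝ) ^ 2 ≤ (2 * x ^ (8 / 58 : ℝ)) ^ 2 := by gcongr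
        _ = 4 * x ^ (16 / 58 : ℝ) := by rw [mul_pow, rpow_npow_eq hx0]; norm_num
        _ ≤ x ^ (1 / 58 : ℝ) * x ^ (16 / 58 : ℝ) := by gcongr; linarith
        _ ≤ x ^ (18 / 58 : ℝ) := by rw [hadd, hle]; norm_num
        _ ≤ z := hz1
    exact_mod_cast this
  · have h1 : 2 ^ (Nat.log 2 X + 3) ≤ 8 * X := by
      have := Nat.pow_log_le_self 2 (show X ≠ 0 by omega)
      rw [pow_add]; omega
    have h2 : 8 * (X : ℝ) ≤ (z : ℝ) ^ 4 := by
      calc 8 * (X : ℝ) ≤ x ^ (1 / 58 : ℝ) * x ^ (1 : ℝ) := by rw [hXx, hxrpow]; gcongr; linarith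
        _ ≤ (x ^ (18 / 58 : ℝ)) ^ 4 := by rw [hadd, rpow_npow_eq hx0, hle]; norm_num
        _ ≤ _ := by gcongr
    exact h1.trans (mod_cast h2)
  · have h2 : 4 * (X : ℝ) ≤ ((y : ℝ) * w) ^ 2 := by
      calc 4 * (X : ℝ) ≤ x ^ (1 / 58 : ℝ) * x ^ (1 : ℝ) := by rw [hXx, hxrpow]; gcongr; linarith
        _ ≤ (x ^ (8 / 58 : ℝ) * x ^ (24 / 58 : ℝ)) ^ 2 := by
            rw [hadd, hadd, rpow_npow_eq hx0, hle]; norm_num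
        _ ≤ _ := by gcongr
    exact_mod_cast h2
  · intro i j hij hX4 hX5
    obtain ⟨g1, g2⟩ := hcast i j hX4 hX5
    have hi0 : 0 < 2 ^ i := Nat.two_pow_pos i
    have hj0 : 0 < 2 ^ j := Nat.two_pow_pos j
    generalize 2 ^ i = M at *
    generalize 2 ^ j = N at *
    have hM0 : (0 : ℝ) < M := mod_cast hi0
    have g1' : x ^ (1 - s) ≤ (M : ℝ) * N := hdn (C := 4) (by rwa [hxrpow]) (by norm_num) (by positivity)
    have g2' : (M : ℝ) * N ≤ x ^ (1 + s) := hup (C := 4) (by rwa [hxrpow]) (by norm_num)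
    rcases hij with ⟨c1, c2⟩ | ⟨c1, c2⟩
    · have c1' : (y : ℝ) ≤ 2 * M := mod_cast c1.le
      have c2' : (M : ℝ) ≤ z := mod_cast c2.le
      refine (BilBound.of_dyadicBlock ha (hA H M N hH hi0 hj0 (hHs.trans ?_) ?_ ?_ (le_trans ?_ g1')
        (g2'.trans ?_))).mono ?_
      · rw [hle]; linarith
      · exact le_trans (by rw [hle]; linarith) (hdn (C := 2) (hy1.trans c1') (by norm_num) hM0.le)
      · exact (hup (C := 2) (c2'.trans hz2) (by norm_num)).trans (by rw [hle]; linarith)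
      all_goals rw [hle]; linarith
    · have c1' : (w : ℝ) ≤ 2 * M := mod_cast c1.le
      have c2' : (M : ℝ) ≤ y * w := mod_cast c2.le
      have hMw : x ^ (24 / 58 : ℝ) ≤ 2 * M := hw1.trans c1'
      have hMyw : (M : ℝ) ≤ 4 * x ^ (32 / 58 : ℝ) := by
        calc (M : ℝ) ≤ y * w := c2'
          _ ≤ (2 * x ^ (8 / 58 : ℝ)) * (2 * x ^ (24 / 58 : ℝ)) := by gcongr
          _ = 4 * (x ^ (8 / 58 : ℝ) * x ^ (24 / 58 : ℝ)) := by ring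
          _ = _ := by rw [hadd]; norm_num
      rcases le_total (x ^ (29 / 58 - s)) N with hc | hc
      · refine (BilBound.of_dyadicBlock ha (hC H M N hH hi0 hj0 (hHs.trans ?_) (le_trans ?_ hc) ?_ (le_trans ?_ g1')
          (g2'.trans ?_))).mono ?_
        · rw [hle]; linarith
        · rw [hle]; linarith
        · refine (hup (b := 34 / 58) (C := 8) ?_ (by norm_num)).trans (by rw [hle]; linarith)
          have e : x ^ (24 / 58 : ℝ) * N ≤ x ^ (24 / 58 : ℝ) * (8 * x ^ (34 / 58 : ℝ)) := by
            calc x ^ (24 / 58 : ℝ) * N ≤ 2 * M * N := by gcongr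
              _ ≤ 8 * x := by linarith
              _ = 8 * (x ^ (24 / 58 : ℝ) * x ^ (34 / 58 : ℝ)) := by rw [hadd]; norm_num
              _ = _ := by ring
          exact le_of_mul_le_mul_left e (by positivity)
        all_goals rw [hle]; linarith
      · have hM29 : x ^ (29 / 58 : ℝ) ≤ M := by
          have e : x ^ (29 / 58 - s) * x ^ (29 / 58 : ℝ) ≤ x ^ (29 / 58 - s) * M := by
            rw [hadd]
            calc x ^ (29 / 58 - s + 29 / 58) = x ^ (1 - s) := by congr 1; ring
              _ ≤ M * N := g1'
              _ ≤ _ := by rw [mul_comm]; gcongr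
          exact le_of_mul_le_mul_left e (by positivity)
        refine BilBound.congr (BilBound.swap (BilBound.of_dyadicBlock ha (hC H N M hH hj0 hi0 (hHs.trans ?_)
          (le_trans ?_ hM29) ?_ (le_trans ?_ (g1'.trans_eq (mul_comm _ _)))
          ((mul_comm _ _).trans_le (g2'.trans ?_)))) |>.mono ?_) (fun m _ l _ => by rw [mul_comm l m])
        · rw [hle]; linarith
        · rw [hle]; linarith
        · exact (hup (C := 4) hMyw (by norm_num)).trans (by rw [hle]; linarith)
        all_goals rw [hle]; linarith
  · intro i j lo hi hiw hX4 hX5 hlo hhi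
    obtain ⟨g1, g2⟩ := hcast i j hX4 hX5
    have hiw' : ((2 ^ i : ℕ) : ℝ) ≤ w := mod_cast hiw.le
    refine sum_norm_of_dyadicBlock ha lo hi (hI H (2 ^ i) (2 ^ j) (fun p => lo p.2) (fun p => hi p.2) hH
      (Nat.two_pow_pos i) (Nat.two_pow_pos j) hHs ?_ (hdn (C := 4) (by rwa [hxrpow]) (by norm_num) (by positivity))
      (hup (C := 4) (by rwa [hxrpow]) (by norm_num)) (fun p => hlo _) (fun p => hhi _))
    refine hdn (C := 8) ?_ (by norm_num) (by positivity)
    have e : x ^ (24 / 58 : ℝ) * x ^ (34 / 58 : ℝ) ≤ x ^ (24 / 58 : ℝ) * (8 * ((2 ^ j : ℕ) : ℝ)) := by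
      calc x ^ (24 / 58 : ℝ) * x ^ (34 / 58 : ℝ) = x := by rw [hadd]; norm_num
        _ ≤ 4 * (((2 ^ i : ℕ) : ℝ) * ((2 ^ j : ℕ) : ℝ)) := g1
        _ ≤ 4 * ((2 * x ^ (24 / 58 : ℝ)) * ((2 ^ j : ℕ) : ℝ)) := by
            have := hiw'.trans hw2
            gcongr
        _ = _ := by ring
    exact le_of_mul_le_mul_left e (by positivity)

/-- `n` is a product of three primes, each at least `z`. -/
def ThreePrimes (z n : ℕ) : Prop := ∃ p q r : ℕ, p.Prime ∧ q.Prime ∧ r.Prime ∧ z ≤ p ∧ p ≤ q ∧ q ≤ r ∧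
  n = p * q * r

noncomputable instance (z n : ℕ) : Decidable (ThreePrimes z n) := Classical.propDecidable _

lemma Rough.of_dvd {z m n : ℕ} (h : Rough z n) (hm : m ∣ n) : Rough z m :=
  fun p hp hpm => h p hp (hpm.trans hm)

lemma sieveWeight_le {z w n : ℕ} (hn : 2 ≤ n) : sieveWeight z w n ≤ if n.Prime then 1 else 0 := by
  rw [sieveWeight]
  by_cases hr : Rough z n
  · rw [if_pos hr]
    split_ifs with hp
    · omega
    rcases Nat.eq_zero_or_pos (middlePrimes z w n) with h | h
    · have hn1 : n ≠ 1 := by omega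
      have ha := Nat.minFac_prime hn1
      obtain ⟨b, hb⟩ := Nat.minFac_dvd n
      have hw : w ≤ n.minFac := by
        by_contra! hlt
        rw [middlePrimes, card_eq_zero] at h
        refine notMem_empty n.minFac (h ▸ mem_filter.2 ⟨?_, hr _ ha (Nat.minFac_dvd n), hlt⟩)
        exact Nat.mem_primeFactors.2 ⟨ha, Nat.minFac_dvd n, by omega⟩
      have hab : n.minFac ≤ b := by
        have h1 := Nat.minFac_sq_le_self (by omega) hp
        rw [sq] at h1
        nth_rewrite 3 [hb] at h1
        exact Nat.le_of_mul_le_mul_left h1 ha.pos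
      have : 0 < (n.divisorsAntidiagonal.filter fun e =>
          e.1.Prime ∧ w ≤ e.1 ∧ e.1 ≤ e.2 ∧ Rough z e.2).card :=
        card_pos.2 ⟨(n.minFac, b), mem_filter.2 ⟨Nat.mem_divisorsAntidiagonal.2 ⟨hb.symm, by omega⟩,
          ha, hw, hab, hr.of_dvd ⟨n.minFac, by rw [mul_comm]; exact hb⟩⟩⟩
      omega
    · omega
  · rw [if_neg hr]
    split_ifs <;> omega

lemma prime_dvd_mul_eq {p a b : ℕ} (hp : p.Prime) (ha : a.Prime) (hb : b.Prime) (h : p ∣ a * b) :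
    p = a ∨ p = b :=
  ((Nat.Prime.dvd_mul hp).1 h).imp (Nat.prime_dvd_prime_iff_eq hp ha).1 (Nat.prime_dvd_prime_iff_eq hp hb).1

lemma exists_least_prime_factor {n : ℕ} (hn : n ≠ 1) :
    ∃ a m : ℕ, a.Prime ∧ n = a * m ∧ ∀ p : ℕ, p.Prime → p ∣ m → a ≤ p := by
  obtain ⟨m, hm⟩ := Nat.minFac_dvd n
  exact ⟨n.minFac, m, Nat.minFac_prime hn, hm, fun p hp hpm =>
    Nat.minFac_le_of_dvd hp.two_le (hpm.trans ⟨n.minFac, by rw [mul_comm]; exact hm⟩)⟩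

lemma le_sieveWeight {z w n : ℕ} (hz : 2 ≤ z) (hzw : z ≤ w) (h4 : n < z ^ 4) (hw2 : w ^ 2 ≤ n)
    (hwz : n < w * z ^ 2) :
    (if n.Prime then 1 else 0) - (if ThreePrimes z n then 2 else 0) ≤ sieveWeight z w n := by
  have hwn : w < n := by nlinarith
  have hT0 : (0 : ℤ) ≤ if ThreePrimes z n then 2 else 0 := by split_ifs <;> norm_num
  have hG : ∀ {S : Finset (ℕ × ℕ)}, (∀ p q : ℕ, p * q = n → p.Prime → w ≤ p → p ≤ q → Rough z q → (p, q) ∈ S) →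
      (n.divisorsAntidiagonal.filter fun e => e.1.Prime ∧ w ≤ e.1 ∧ e.1 ≤ e.2 ∧ Rough z e.2).card ≤ S.card := fun {S} h => by
    refine card_le_card fun e he => ?_
    simp only [mem_filter, Nat.mem_divisorsAntidiagonal] at he
    exact h e.1 e.2 he.1.1 he.2.1 he.2.2.1 he.2.2.2.1 he.2.2.2.2
  have hβ : ∀ {S : Finset ℕ}, (∀ p : ℕ, p.Prime → p ∣ n → p < w → p ∈ S) → middlePrimes z w n ≤ S.card := fun {S} h => by
    refine card_le_card fun p hp => ?_
    simp only [mem_filter, Nat.mem_primeFactors] at hp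
    exact h p hp.1.1 hp.1.2.1 hp.2.2
  rw [sieveWeight]
  by_cases hr : Rough z n
  swap
  · have hp : ¬ n.Prime := fun hp => hr fun p hpp hpn => by
      rw [(Nat.prime_dvd_prime_iff_eq hpp hp).1 hpn]; omega
    have := hG (S := ∅) fun p q hpq hp hwp _ hq => absurd (by
      rw [← hpq]
      exact (rough_mul_iff fun r hr' h => by rw [(Nat.prime_dvd_prime_iff_eq hr' hp).1 h]; omega).2 hq) hr
    rw [card_empty] at this
    rw [if_neg hr, if_neg hp]; omega
  rw [if_pos hr]
  have hn1 : n ≠ 1 := by omega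
  by_cases hp : n.Prime
  · have h1 := hG (S := ∅) fun p q hpq hpp hwp hpq' _ => by
      rcases Nat.prime_mul_iff.1 (hpq ▸ hp) with h | h <;> omega
    have h2 := hβ (S := ∅) fun p hpp hpn hlt => by
      rw [(Nat.prime_dvd_prime_iff_eq hpp hp).1 hpn] at hlt; omega
    rw [card_empty] at h1 h2
    rw [if_pos hp]; omega
  rw [if_neg hp]
  obtain ⟨a, m, ha, rfl, ham⟩ := exists_least_prime_factor hn1
  have hm1 : m ≠ 1 := fun h => hp (by rwa [h, mul_one])
  obtain ⟨b, l, hb, rfl, hbl⟩ := exists_least_prime_factor hm1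
  have hab : a ≤ b := ham b hb (dvd_mul_right _ _)
  have hza : z ≤ a := hr a ha (dvd_mul_right _ _)
  by_cases hl1 : l = 1
  · subst hl1
    rw [mul_one] at *
    rcases lt_or_ge a w with haw | haw
    · have hbw : w ≤ b := by
        by_contra! h
        have := Nat.mul_lt_mul'' haw h
        rw [sq] at hw2; omega
      have h1 := hG (S := ∅) fun p q hpq hpp hwp hpq' _ => by
        rcases prime_dvd_mul_eq hpp ha hb ⟨q, hpq.symm⟩ with rfl | rfl
        · omega
        · have : q = a := Nat.eq_of_mul_eq_mul_left hb.pos (by rw [hpq, mul_comm])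
          omega
      have h2 := hβ (S := {a}) fun p hpp hpn hlt => by
        rcases prime_dvd_mul_eq hpp ha hb hpn with rfl | rfl
        · simp
        · omega
      rw [card_empty] at h1
      rw [card_singleton] at h2
      omega
    · have h1 := hG (S := {(a, b)}) fun p q hpq hpp hwp hpq' _ => by
        rcases prime_dvd_mul_eq hpp ha hb ⟨q, hpq.symm⟩ with rfl | rfl
        · rw [Nat.eq_of_mul_eq_mul_left ha.pos hpq]; simp
        · have : q = a := Nat.eq_of_mul_eq_mul_left hb.pos (by rw [hpq, mul_comm])
          have : p = a := by omega
          simp [*]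
      have h2 := hβ (S := ∅) fun p hpp hpn hlt => by
        rcases prime_dvd_mul_eq hpp ha hb hpn with rfl | rfl <;> omega
      rw [card_empty] at h2
      rw [card_singleton] at h1
      omega
  · obtain ⟨c, r, hc, rfl, hcr⟩ := exists_least_prime_factor hl1
    have hbc : b ≤ c := hbl c hc (dvd_mul_right _ _)
    have hr' : r = 1 := by
      by_contra h
      have h6 : b ≤ r.minFac := hbl _ (Nat.minFac_prime h) ((Nat.minFac_dvd r).mul_left c)
      have h7 : r ≠ 0 := fun h0 => by simp [h0] at hwn
      have := Nat.minFac_le (Nat.pos_of_ne_zero h7)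
      refine absurd h4 (not_lt.2 ?_)
      calc z ^ 4 = z * (z * (z * z)) := by ring
        _ ≤ a * (b * (c * r)) := by gcongr <;> omega
    subst hr'
    rw [mul_one] at *
    have h3 := middlePrimes_le_three (w := w) (by omega) h4
    have h1 := hG (S := ∅) fun p q hpq hpp hwp hpq' _ => by
      have hq : z ^ 2 ≤ q := by
        rcases (Nat.Prime.dvd_mul hpp).1 (⟨q, hpq.symm⟩ : p ∣ a * (b * c)) with h | h
        · rw [(Nat.prime_dvd_prime_iff_eq hpp ha).1 h] at hpq
          rw [Nat.eq_of_mul_eq_mul_left ha.pos hpq, sq]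
          exact Nat.mul_le_mul (by omega) (by omega)
        · rcases prime_dvd_mul_eq hpp hb hc h with e | e <;> rw [e] at hpq
          · rw [Nat.eq_of_mul_eq_mul_left hb.pos (show b * q = b * (a * c) by rw [hpq]; ring), sq]
            exact Nat.mul_le_mul (by omega) (by omega)
          · rw [Nat.eq_of_mul_eq_mul_left hc.pos (show c * q = c * (a * b) by rw [hpq]; ring), sq]
            exact Nat.mul_le_mul (by omega) (by omega)
      have := Nat.mul_le_mul hwp hq
      omega
    rw [card_empty] at h1
    rw [if_pos ⟨a, b, c, ha, hb, hc, hza, hab, hbc, (mul_assoc a b c).symm⟩]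
    omega

lemma theta_succ (n : ℕ) : Chebyshev.theta (n + 1 : ℕ) =
    Chebyshev.theta n + if (n + 1).Prime then log (n + 1 : ℕ) else 0 := by
  simp only [Chebyshev.theta_eq_sum_Icc, Nat.floor_natCast]
  rw [sum_filter, sum_filter, ← Nat.range_succ_eq_Icc_zero, sum_range_succ, Nat.range_succ_eq_Icc_zero]

lemma sum_log_div_prime_le {A B : ℕ} (hA : 0 < A) (hAB : A ≤ B) :
    ∑ p ∈ Ioc A B with p.Prime, log p / p ≤ log 4 * (1 + log B - log A) := by
  have key : ∑ p ∈ Ioc A B with p.Prime, log p / p ≤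
      Chebyshev.theta B / B + log 4 * (log B - log A) := by
    induction B, hAB using Nat.le_induction with
    | base =>
      simp only [Ioc_self, filter_empty, sum_empty, sub_self, mul_zero, add_zero]
      exact div_nonneg (Chebyshev.theta_nonneg _) (by positivity)
    | succ B hB ih =>
      have hB0 : (0 : ℝ) < B := mod_cast hA.trans_le hB
      have hθ := Chebyshev.theta_le_log4_mul_x hB0.le
      rw [sum_filter] at ih ⊢
      rw [sum_Ioc_succ_top (by omega), theta_succ]
      have h1 : Chebyshev.theta B / B - Chebyshev.theta B / (B + 1 : ℕ) ≤
          log 4 * (log (B + 1 : ℕ) - log B) := by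
        have h2 := one_sub_inv_le_log_of_pos (show 0 < ((B + 1 : ℕ) : ℝ) / B by positivity)
        rw [log_div (by positivity) hB0.ne'] at h2
        calc Chebyshev.theta B / B - Chebyshev.theta B / (B + 1 : ℕ)
            = (Chebyshev.theta B / B) * (1 - (((B + 1 : ℕ) : ℝ) / B)⁻¹) := by field_simp
          _ ≤ log 4 * (1 - (((B + 1 : ℕ) : ℝ) / B)⁻¹) := by
              refine mul_le_mul_of_nonneg_right ((div_le_iff₀ hB0).2 hθ) ?_
              rw [sub_nonneg]; apply inv_le_one_of_one_le₀
              rw [le_div_iff₀ hB0]; push_cast; linarith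
          _ ≤ _ := mul_le_mul_of_nonneg_left h2 (log_nonneg (by norm_num))
      rw [add_div]
      by_cases hp : (B + 1).Prime <;> simp only [hp, if_true, if_false, zero_div] <;> linarith
  have hB0 : (0 : ℝ) < B := mod_cast hA.trans_le hAB
  have := (div_le_iff₀ hB0).2 (Chebyshev.theta_le_log4_mul_x hB0.le)
  linarith

lemma card_threePrimes_mul_log_le {X z R : ℕ} (hX : 2 ≤ X) (hz : 2 ≤ z) (hR : 4 * X ≤ (R + 1) ^ 2 * z) :
    (((Ico X (4 * X)).filter (ThreePrimes z)).card : ℝ) * log X ≤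
      12 * log 4 * X * (∑ p ∈ Ioc (z - 1) R with p.Prime, 1 / (p : ℝ)) ^ 2 := by
  set P := (Ioc (z - 1) R).filter Nat.Prime
  set S : ℕ × ℕ → Finset ℕ := fun e =>
    (Icc 0 (4 * X / (e.1 * e.2))).filter (fun r => r.Prime ∧ X ≤ r ^ 3)
  have hPpos : ∀ p ∈ P, 0 < p := fun p hp => (mem_filter.1 hp).2.pos
  have hsub : (Ico X (4 * X)).filter (ThreePrimes z) ⊆
      (P ×ˢ P).biUnion fun e => (S e).image fun r => e.1 * e.2 * r := fun n hn => by
    rw [mem_filter, mem_Ico] at hn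
    obtain ⟨⟨h1, h2⟩, p, q, r, hp, hq, hr, hzp, hpq, hqr, rfl⟩ := hn
    have hqR : q ≤ R := by
      by_contra! h
      have : (R + 1) ^ 2 * z ≤ p * q * r := by
        calc (R + 1) ^ 2 * z = z * (R + 1) * (R + 1) := by ring
          _ ≤ p * q * r := by gcongr <;> omega
      omega
    refine mem_biUnion.2 ⟨(p, q), mem_product.2 ⟨?_, ?_⟩, mem_image.2 ⟨r, ?_, rfl⟩⟩
    · exact mem_filter.2 ⟨mem_Ioc.2 ⟨by dsimp only; omega, by dsimp only; omega⟩, hp⟩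
    · exact mem_filter.2 ⟨mem_Ioc.2 ⟨by dsimp only; omega, hqR⟩, hq⟩
    · refine mem_filter.2 ⟨mem_Icc.2 ⟨Nat.zero_le _, ?_⟩, hr, h1.trans ?_⟩
      · rw [Nat.le_div_iff_mul_le (Nat.mul_pos hp.pos hq.pos), mul_comm]; exact h2.le
      · calc p * q * r ≤ r * r * r := by gcongr; omega
          _ = r ^ 3 := by ring
  have hX0 : (0 : ℝ) < X := mod_cast (by omega : 0 < X)
  have hSc : ∀ e ∈ P ×ˢ P, ((S e).card : ℝ) * log X ≤
      12 * log 4 * X * (1 / (e.1 : ℝ) * (1 / (e.2 : ℝ))) := fun e he => by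
    rw [mem_product] at he
    have h1 : (0 : ℝ) < e.1 := mod_cast hPpos _ he.1
    have h2 : (0 : ℝ) < e.2 := mod_cast hPpos _ he.2
    have h3 : ∀ r ∈ S e, log X ≤ 3 * log r := fun r hr => by
      have : (X : ℝ) ≤ (r : ℝ) ^ 3 := mod_cast (mem_filter.1 hr).2.2
      have := log_le_log hX0 this
      rwa [log_pow] at this
    have h4 : ∑ r ∈ S e, log r ≤ Chebyshev.theta ((4 * X / (e.1 * e.2) : ℕ) : ℝ) := by
      rw [Chebyshev.theta_eq_sum_Icc, Nat.floor_natCast]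
      refine sum_le_sum_of_subset_of_nonneg (fun r hr => ?_) fun r _ _ => log_natCast_nonneg r
      rw [mem_filter] at hr ⊢
      exact ⟨hr.1, hr.2.1⟩
    have h5 : (((4 * X / (e.1 * e.2) : ℕ)) : ℝ) ≤ 4 * X * (1 / (e.1 : ℝ) * (1 / (e.2 : ℝ))) := by
      refine Nat.cast_div_le.trans (le_of_eq ?_)
      push_cast; field_simp
    calc ((S e).card : ℝ) * log X = ∑ r ∈ S e, log X := by rw [sum_const, nsmul_eq_mul]
      _ ≤ 3 * ∑ r ∈ S e, log r := by rw [mul_sum]; exact sum_le_sum h3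
      _ ≤ 3 * (log 4 * (4 * X * (1 / (e.1 : ℝ) * (1 / (e.2 : ℝ))))) := by
          refine mul_le_mul_of_nonneg_left (h4.trans ((Chebyshev.theta_le_log4_mul_x (by positivity)).trans ?_))
            (by norm_num)
          exact mul_le_mul_of_nonneg_left h5 (log_nonneg (by norm_num))
      _ = _ := by ring
  have hc : (((Ico X (4 * X)).filter (ThreePrimes z)).card : ℝ) ≤ ∑ e ∈ P ×ˢ P, ((S e).card : ℝ) := by
    exact_mod_cast (card_le_card hsub).trans (card_biUnion_le.trans (sum_le_sum fun e _ => card_image_le))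
  calc _ ≤ (∑ e ∈ P ×ˢ P, ((S e).card : ℝ)) * log X :=
        mul_le_mul_of_nonneg_right hc (log_natCast_nonneg X)
    _ ≤ ∑ e ∈ P ×ˢ P, 12 * log 4 * X * (1 / (e.1 : ℝ) * (1 / (e.2 : ℝ))) := by
        rw [sum_mul]; exact sum_le_sum hSc
    _ = _ := by rw [← mul_sum, sum_product, sq, sum_mul_sum]

lemma le_card_primes_mul_log {X : ℕ} (hX : 0 < X) :
    4 * X * log 2 - log (4 * X + 1) - 2 * √(4 * X) * log (4 * X) - log 4 * X ≤
      (((Ico X (4 * X)).filter Nat.Prime).card : ℝ) * log (4 * X) := by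
  have h1 := Chebyshev.theta_ge (4 * X)
  have h2 := Chebyshev.theta_le_log4_mul_x (show (0 : ℝ) ≤ X by positivity)
  have h3 : Chebyshev.theta (4 * X : ℕ) - Chebyshev.theta X ≤
      (((Ico X (4 * X)).filter Nat.Prime).card : ℝ) * log (4 * X) := by
    have hsub : (Icc 0 X).filter Nat.Prime ⊆ (Icc 0 (4 * X)).filter Nat.Prime :=
      filter_subset_filter _ (Icc_subset_Icc_right (by omega))
    simp only [Chebyshev.theta_eq_sum_Icc, Nat.floor_natCast]
    rw [← sum_sdiff hsub, add_sub_cancel_right, ← nsmul_eq_mul]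
    have hsub2 : (Icc 0 (4 * X)).filter Nat.Prime \ (Icc 0 X).filter Nat.Prime ⊆
        (Ico X (4 * X)).filter Nat.Prime := fun p hp => by
      simp only [Finset.mem_sdiff, mem_filter, mem_Icc, mem_Ico] at hp ⊢
      have : p ≠ 4 * X := fun h => by
        rcases Nat.prime_mul_iff.1 (h ▸ hp.1.2 : (4 * X).Prime) with ⟨h4, -⟩ | ⟨-, h4⟩
        · exact absurd h4 (by norm_num)
        · omega
      have := hp.1.2
      exact ⟨⟨by by_contra h; exact hp.2 ⟨by omega, this⟩, by omega⟩, this⟩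
    refine (sum_le_sum_of_subset_of_nonneg hsub2 fun p _ _ => log_natCast_nonneg p).trans ?_
    refine sum_le_card_nsmul _ _ _ fun p hp => ?_
    rw [mem_filter, mem_Ico] at hp
    refine log_le_log (mod_cast hp.2.pos) ?_
    exact_mod_cast hp.1.2.le
  push_cast at h1 h3
  linarith

set_option maxHeartbeats 1000000 in
/-- The sieve weight has positive mass on `[X, 4 X)`. -/
theorem le_sum_sieveWeight : ∀ᶠ X : ℕ in atTop, (X : ℝ) / (2 * log X) ≤
    ((∑ n ∈ Ico X (4 * X), sieveWeight ⌈(X : ℝ) ^ (18 / 58 : ℝ)⌉₊ ⌈(X : ℝ) ^ (24 / 58 : ℝ)⌉₊ n : ℤ) : ℝ) := by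
  refine tendsto_natCast_atTop_atTop.eventually ((?_ : ∀ᶠ x : ℝ in atTop, ∀ X : ℕ, (X : ℝ) = x →
    x / (2 * log x) ≤ ((∑ n ∈ Ico X (4 * X),
      sieveWeight ⌈x ^ (18 / 58 : ℝ)⌉₊ ⌈x ^ (24 / 58 : ℝ)⌉₊ n : ℤ) : ℝ))) |>.mono (fun X h => h X rfl)
  filter_upwards [(tendsto_rpow_atTop (show (0 : ℝ) < 1 / 58 by norm_num)).eventually_ge_atTop 64,
    eventually_const_mul_log_pow_le 10000 1 (show (0 : ℝ) < 1 / 2 by norm_num),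
    tendsto_log_atTop.eventually_ge_atTop 3000, eventually_gt_atTop 2] with x hx64 hlog hl hx2
  intro X hXx
  have hx : 1 < x := by linarith
  have hx0 : 0 < x := by linarith
  have hle := fun a b : ℝ => rpow_le_rpow_left_iff (y := a) (z := b) hx
  have hadd := fun a b : ℝ => (rpow_add hx0 a b).symm
  have hX2 : 2 < X := by
    have : (2 : ℝ) < X := by rw [hXx]; exact hx2
    exact_mod_cast this
  have hceil := fun b : ℝ => ceil_rpow_bounds (b := b) hx
  obtain ⟨hz1, -⟩ := hceil (18 / 58) (by norm_num)
  obtain ⟨hw1, hw2⟩ := hceil (24 / 58) (by norm_num)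
  have hzw : ⌈x ^ (18 / 58 : ℝ)⌉₊ ≤ ⌈x ^ (24 / 58 : ℝ)⌉₊ := Nat.ceil_le_ceil (by rw [hle]; norm_num)
  set z := ⌈x ^ (18 / 58 : ℝ)⌉₊
  set w := ⌈x ^ (24 / 58 : ℝ)⌉₊
  have hz64 : (64 : ℝ) ≤ z := hx64.trans (le_trans (by rw [hle]; norm_num) hz1)
  have hz64' : 64 ≤ z := mod_cast hz64
  have hx4 : 4 * x ≤ x ^ (1 / 58 : ℝ) * x ^ (1 : ℝ) := by
    rw [rpow_one]; exact mul_le_mul_of_nonneg_right (by linarith) hx0.le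
  have c1 : 4 * X ≤ z ^ 4 := by
    have : 4 * (X : ℝ) ≤ (z : ℝ) ^ 4 := by
      rw [hXx]
      calc 4 * x ≤ (x ^ (18 / 58 : ℝ)) ^ 4 := hx4.trans (by rw [hadd, rpow_npow_eq hx0, hle]; norm_num)
        _ ≤ _ := by gcongr
    exact_mod_cast this
  have c2 : w ^ 2 ≤ X := by
    have : (w : ℝ) ^ 2 ≤ X := by
      rw [hXx]
      calc (w : ℝ) ^ 2 ≤ (2 * x ^ (24 / 58 : ℝ)) ^ 2 := by gcongr
        _ = 4 * x ^ (48 / 58 : ℝ) := by rw [mul_pow, rpow_npow_eq hx0]; norm_num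
        _ ≤ x ^ (1 / 58 : ℝ) * x ^ (48 / 58 : ℝ) := by gcongr; linarith
        _ ≤ x ^ (1 : ℝ) := by rw [hadd, hle]; norm_num
        _ = x := rpow_one x
    exact_mod_cast this
  have c3 : 4 * X ≤ w * z ^ 2 := by
    have : 4 * (X : ℝ) ≤ w * (z : ℝ) ^ 2 := by
      rw [hXx]
      calc 4 * x ≤ x ^ (24 / 58 : ℝ) * (x ^ (18 / 58 : ℝ)) ^ 2 :=
            hx4.trans (by rw [hadd, rpow_npow_eq hx0, hadd, hle]; norm_num)
        _ ≤ _ := by gcongr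
    exact_mod_cast this
  have hlow : (((Ico X (4 * X)).filter Nat.Prime).card : ℝ) -
      2 * ((Ico X (4 * X)).filter (ThreePrimes z)).card ≤
      ((∑ n ∈ Ico X (4 * X), sieveWeight z w n : ℤ) : ℝ) := by
    have h : (((Ico X (4 * X)).filter Nat.Prime).card : ℤ) - 2 * ((Ico X (4 * X)).filter (ThreePrimes z)).card ≤
        ∑ n ∈ Ico X (4 * X), sieveWeight z w n := by
      rw [card_filter, card_filter]
      push_cast
      rw [mul_sum, ← sum_sub_distrib]
      refine sum_le_sum fun n hn => ?_
      rw [mem_Ico] at hn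
      simpa only [mul_ite, mul_one, mul_zero] using
        le_sieveWeight (by omega) hzw (by omega) (by omega) (by omega)
    exact_mod_cast h
  set R := ⌊2 * x ^ (20 / 58 : ℝ)⌋₊
  have hR1 : 2 * x ^ (20 / 58 : ℝ) < (R : ℝ) + 1 := Nat.lt_floor_add_one _
  have hR2 : (R : ℝ) ≤ 2 * x ^ (20 / 58 : ℝ) := Nat.floor_le (by positivity)
  have hT := card_threePrimes_mul_log_le (X := X) (z := z) (R := R) (by omega) (by omega) (by
    have : 4 * (X : ℝ) ≤ ((R : ℝ) + 1) ^ 2 * z := by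
      rw [hXx]
      calc 4 * x = (2 * x ^ (20 / 58 : ℝ)) ^ 2 * x ^ (18 / 58 : ℝ) := by
            rw [mul_pow, rpow_npow_eq hx0, mul_assoc, hadd]; norm_num
        _ ≤ _ := by gcongr
    exact_mod_cast this)
  have hzR : z - 1 ≤ R := by
    have : (z : ℝ) ≤ R + 1 := by
      have h1 : (z : ℝ) ≤ 2 * x ^ (18 / 58 : ℝ) := (hceil (18 / 58) (by norm_num)).2
      have h2 : x ^ (18 / 58 : ℝ) ≤ x ^ (20 / 58 : ℝ) := by rw [hle]; norm_num
      linarith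
    have : z ≤ R + 1 := mod_cast this
    omega
  have hS := sum_log_div_prime_le (A := z - 1) (B := R) (by omega) hzR
  have l2a := log_two_gt_d9
  have l2b := log_two_lt_d9
  have l4 : log 4 = 2 * log 2 := by
    rw [show (4 : ℝ) = 2 ^ 2 by norm_num, log_pow]; norm_num
  set l := log x
  have hR0 : (0 : ℝ) < R := mod_cast (by omega : 0 < R)
  have lR : log R ≤ log 2 + 20 / 58 * l := by
    have := log_le_log hR0 hR2
    rwa [log_mul (by norm_num) (by positivity), log_rpow hx0] at this
  have lz : 18 / 58 * l ≤ log z := by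
    have := log_le_log (by positivity) hz1
    rwa [log_rpow hx0] at this
  have lz' : 18 / 58 * l - log 2 ≤ log (z - 1 : ℕ) := by
    have h1 : (z : ℝ) / 2 ≤ (z - 1 : ℕ) := by rw [Nat.cast_sub (by omega)]; push_cast; linarith
    have := log_le_log (by positivity) h1
    rw [log_div (by positivity) (by norm_num)] at this
    linarith
  set S1 := ∑ p ∈ Ioc (z - 1) R with p.Prime, 1 / (p : ℝ) with hS1
  have hS0 : 0 ≤ S1 := sum_nonneg fun _ _ => by positivity
  have hS1 : S1 ≤ 16 / 100 := by
    have h1 : S1 * (18 / 58 * l) ≤ log 4 * (1 + log R - log (z - 1 : ℕ)) := by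
      refine le_trans ?_ hS
      rw [hS1, sum_mul]
      refine sum_le_sum fun p hp => ?_
      rw [mem_filter, mem_Ioc] at hp
      rw [one_div_mul_eq_div]
      refine div_le_div_of_nonneg_right (lz.trans (log_le_log (by positivity) ?_)) (by positivity)
      exact_mod_cast (by omega : z ≤ p)
    have h2 : log 4 * (1 + log R - log (z - 1 : ℕ)) ≤ 1.3863 * (3 + 2 / 58 * l) :=
      mul_le_mul (by rw [l4]; linarith) (by linarith) (by
        have := log_le_log (mod_cast (by omega : 0 < z - 1)) (Nat.cast_le (α := ℝ).2 hzR)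
        linarith) (by norm_num)
    by_contra! h
    have h3 := mul_lt_mul_of_pos_right h (show 0 < 18 / 58 * l by linarith)
    linarith
  rw [hXx] at hT
  have hT2 : (((Ico X (4 * X)).filter (ThreePrimes z)).card : ℝ) * l ≤ 0.426 * x := by
    have h1 : S1 ^ 2 ≤ (16 / 100) ^ 2 := pow_le_pow_left₀ hS0 hS1 2
    have h2 : 12 * log 4 * x ≤ 12 * 1.3863 * x :=
      mul_le_mul_of_nonneg_right (by rw [l4]; linarith) hx0.le
    calc _ ≤ _ := hT
      _ ≤ 12 * 1.3863 * x * (16 / 100) ^ 2 := mul_le_mul h2 h1 (by positivity) (by positivity)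
      _ ≤ _ := by linarith
  have hπ := le_card_primes_mul_log (X := X) (by omega)
  rw [hXx] at hπ
  set C := (((Ico X (4 * X)).filter Nat.Prime).card : ℝ)
  have hC0 : 0 ≤ C := by positivity
  have l4x : log (4 * x) ≤ 1.001 * l := by
    rw [log_mul (by norm_num) hx0.ne', l4]; linarith
  have hsq : x ^ (1 / 2 : ℝ) * x ^ (1 / 2 : ℝ) = x := by rw [hadd]; norm_num
  have hx12 : 1 ≤ x ^ (1 / 2 : ℝ) := one_le_rpow hx.le (by norm_num)
  have herr : log (4 * x + 1) + 2 * √(4 * x) * log (4 * x) ≤ 0.001 * x := by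
    have h1 : √(4 * x) = 2 * x ^ (1 / 2 : ℝ) := by
      rw [sqrt_mul (by norm_num), show (4 : ℝ) = 2 ^ 2 by norm_num, sqrt_sq (by norm_num),
        sqrt_eq_rpow]
    have h2 : log (4 * x + 1) ≤ 2 * l := by
      have := log_le_log (by positivity) (show 4 * x + 1 ≤ 8 * x by linarith)
      rw [log_mul (by norm_num) hx0.ne', show (8 : ℝ) = 2 ^ 3 by norm_num, log_pow] at this
      push_cast at this; linarith
    have h3 : l ≤ x ^ (1 / 2 : ℝ) / 40000 := by rw [pow_one] at hlog; linarith
    rw [h1]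
    calc _ ≤ 2 * l * x ^ (1 / 2 : ℝ) + 2 * (2 * x ^ (1 / 2 : ℝ)) * (1.001 * l) := by
          refine add_le_add (h2.trans (le_mul_of_one_le_right (by linarith) hx12)) ?_
          exact mul_le_mul_of_nonneg_left l4x (by positivity)
      _ = 6.004 * (x ^ (1 / 2 : ℝ) * l) := by ring
      _ ≤ 6.004 * (x ^ (1 / 2 : ℝ) * (x ^ (1 / 2 : ℝ) / 40000)) := by gcongr
      _ = 6.004 / 40000 * x := by rw [mul_div_assoc', hsq]; ring
      _ ≤ _ := by linarith
  have hC1 : 1.385 * x ≤ C * (1.001 * l) := by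
    have := mul_le_mul_of_nonneg_left l4x hC0
    rw [l4] at hπ
    have : 0.693 * x ≤ log 2 * x := mul_le_mul_of_nonneg_right (by linarith) hx0.le
    linarith
  rw [div_le_iff₀ (by linarith)]
  have := mul_le_mul_of_nonneg_right hlow (show 0 ≤ 2 * l by linarith)
  linarith

lemma exists_pow_geom_coeff (K r : ℕ) : ∃ g : ℕ → ℕ, ∀ t : ℝ,
    (∑ j ∈ range K, ee (j * t)) ^ r = ∑ i ∈ range (r * K + 1), (g i : ℂ) * ee (i * t) := by
  have he : ∀ (t : ℝ) (j : ℕ), ee (j * t) = ee t ^ j := fun t j => by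
    rw [ee, ee, ← Complex.exp_nat_mul]; congr 1; push_cast; ring
  set G : Polynomial ℕ := (∑ j ∈ range K, Polynomial.X ^ j) ^ r with hG
  have hd : G.natDegree < r * K + 1 := by
    refine Nat.lt_succ_of_le (Polynomial.natDegree_pow_le.trans (Nat.mul_le_mul_left r ?_))
    refine Polynomial.natDegree_sum_le_of_forall_le _ _ fun j hj => ?_
    exact (Polynomial.natDegree_X_pow_le j).trans (mem_range.1 hj).le
  refine ⟨G.coeff, fun t => ?_⟩
  simp only [he]
  have := Polynomial.aeval_eq_sum_range' hd (ee t)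
  simp only [nsmul_eq_mul] at this
  rw [← this, hG]
  simp

lemma sum_dist_le {M i : ℕ} (hi : i < M) (f : ℕ → ℝ) (hf : ∀ h, 0 ≤ f h) :
    ∑ j ∈ range M, (if i = j then 0 else f (Nat.dist i j)) ≤ 2 * ∑ h ∈ Ico 1 M, f h := by
  have e : ∑ j ∈ range M, (if i = j then 0 else f (Nat.dist i j)) =
      ∑ j ∈ (range M).filter (fun j => j < i), f (i - j) +
        ∑ j ∈ (range M).filter (fun j => i < j), f (j - i) := by
    rw [sum_filter, sum_filter, ← sum_add_distrib]
    refine sum_congr rfl fun j _ => ?_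
    rcases lt_trichotomy j i with h | h | h
    · rw [if_neg h.ne', if_pos h, if_neg h.not_gt, add_zero, Nat.dist_eq_sub_of_le_right h.le]
    · simp [h]
    · rw [if_neg h.ne, if_neg h.not_gt, if_pos h, zero_add, Nat.dist_eq_sub_of_le h.le]
  have aux : ∀ (s : Finset ℕ) (φ : ℕ → ℕ), Set.InjOn φ s → (∀ j ∈ s, φ j ∈ Ico 1 M) →
      ∑ j ∈ s, f (φ j) ≤ ∑ h ∈ Ico 1 M, f h := fun s φ h1 h2 => by
    rw [← sum_image h1]
    exact sum_le_sum_of_subset_of_nonneg (image_subset_iff.2 h2) fun _ _ _ => hf _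
  have a1 := aux ((range M).filter (fun j => j < i)) (fun j => i - j)
    (fun a ha b hb h => by
      simp only [coe_filter, mem_range, Set.mem_ofPred_eq] at ha hb; dsimp only at h; omega)
    (fun j hj => by rw [mem_filter, mem_range] at hj; rw [mem_Ico]; omega)
  have a2 := aux ((range M).filter (fun j => i < j)) (fun j => j - i)
    (fun a ha b hb h => by
      simp only [coe_filter, mem_range, Set.mem_ofPred_eq] at ha hb; dsimp only at h; omega)
    (fun j hj => by rw [mem_filter, mem_range] at hj; rw [mem_Ico]; omega)
  rw [e]; linarith

/-- A lower bound for the mass of a weight near the zeros of `u`, by powers of the Fejér kernel. -/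
theorem le_sum_mul_kernel (I : Finset ℕ) (ρ u : ℕ → ℝ) {K r : ℕ} {E : ℝ}
    (hE : ∑ h ∈ Ico 1 (r * K + 1), ‖∑ n ∈ I, (ρ n : ℂ) * ee (h * u n)‖ ≤ E)
    (hpos : 2 * E ≤ ∑ n ∈ I, ρ n) :
    (K : ℝ) ^ (2 * r) / (r * K + 1) * (∑ n ∈ I, ρ n - 2 * E) ≤
      ∑ n ∈ I, ρ n * ‖∑ j ∈ range K, ee (j * u n)‖ ^ (2 * r) := by
  obtain ⟨g, hg⟩ := exists_pow_geom_coeff K r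
  set M := r * K + 1 with hM
  set σ := ∑ n ∈ I, ρ n with hσ
  set S : ℕ → ℝ := fun h => ‖∑ n ∈ I, (ρ n : ℂ) * ee (h * u n)‖ with hS
  set T : ℕ → ℕ → ℂ := fun i j => ∑ n ∈ I, (ρ n : ℂ) * (ee (i * u n) * conj (ee (j * u n))) with hT
  set D : ℝ := ∑ i ∈ range M, (g i : ℝ) ^ 2 with hD
  have hD0 : (K : ℝ) ^ (2 * r) / (r * K + 1) ≤ D := by
    have h1 : (∑ i ∈ range M, (g i : ℝ)) = (K : ℝ) ^ r := by
      have := hg 0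
      simp only [mul_zero, ee_zero, mul_one, sum_const, card_range, nsmul_eq_mul] at this
      exact_mod_cast this.symm
    have h2 := sq_sum_le_card_mul_sum_sq (s := range M) (f := fun i => (g i : ℝ))
    rw [h1, card_range, ← pow_mul, mul_comm r 2] at h2
    rw [div_le_iff₀ (by positivity), mul_comm D]
    refine h2.trans (le_of_eq ?_)
    rw [hM]; push_cast; rfl
  have hTd : ∀ i j, ‖T i j‖ = S (Nat.dist i j) := by
    have h1 : ∀ i j, j ≤ i → ‖T i j‖ = S (i - j) := fun i j hij => by
      rw [hT, hS]; dsimp only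
      congr 1
      refine sum_congr rfl fun n _ => ?_
      rw [ee_mul_conj, Nat.cast_sub hij, sub_mul]
    intro i j
    rcases le_total j i with h | h
    · rw [h1 i j h, Nat.dist_eq_sub_of_le_right h]
    · rw [Nat.dist_eq_sub_of_le h, ← h1 j i h, ← RCLike.norm_conj, hT]
      dsimp only
      rw [map_sum]
      congr 1
      refine sum_congr rfl fun n _ => ?_
      rw [map_mul, map_mul, Complex.conj_conj, Complex.conj_ofReal, mul_comm (conj _)]
  have hV : ((∑ n ∈ I, ρ n * ‖∑ j ∈ range K, ee (j * u n)‖ ^ (2 * r) : ℝ) : ℂ) =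
      ∑ i ∈ range M, ∑ j ∈ range M, (g i : ℂ) * g j * T i j := by
    push_cast
    have e : ∀ n ∈ I, (ρ n : ℂ) * (‖∑ j ∈ range K, ee (j * u n)‖ : ℂ) ^ (2 * r) =
        ∑ i ∈ range M, ∑ j ∈ range M, (g i : ℂ) * g j * ((ρ n : ℂ) * (ee (i * u n) * conj (ee (j * u n)))) := fun n _ => by
      rw [mul_comm 2 r, pow_mul, ← Complex.ofReal_pow, ← norm_pow, hg, ← Complex.mul_conj', map_sum,
        sum_mul_sum, mul_sum]
      refine sum_congr rfl fun i _ => ?_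
      rw [mul_sum]
      refine sum_congr rfl fun j _ => ?_
      rw [map_mul, Complex.conj_natCast]; ring
    rw [sum_congr rfl e, sum_comm]
    refine sum_congr rfl fun i _ => ?_
    rw [sum_comm]
    refine sum_congr rfl fun j _ => ?_
    rw [hT, mul_sum]
  have hdiff : ((∑ n ∈ I, ρ n * ‖∑ j ∈ range K, ee (j * u n)‖ ^ (2 * r) - D * σ : ℝ) : ℂ) =
      ∑ i ∈ range M, ∑ j ∈ range M, if i = j then 0 else (g i : ℂ) * g j * T i j := by
    rw [Complex.ofReal_sub, hV, hD, sum_mul]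
    push_cast
    rw [← sum_sub_distrib]
    refine sum_congr rfl fun i hi => ?_
    have hTi : T i i = (σ : ℂ) := by
      rw [hT, hσ]; push_cast
      refine sum_congr rfl fun n _ => ?_
      rw [ee_mul_conj, sub_self, ee_zero, mul_one]
    have : ∀ j ∈ range M, (g i : ℂ) * g j * T i j =
        (if i = j then (g i : ℂ) ^ 2 * σ else 0) + if i = j then 0 else (g i : ℂ) * g j * T i j := fun j _ => by
      split_ifs with h
      · subst h; rw [hTi]; ring
      · ring
    rw [sum_congr rfl this, sum_add_distrib, sum_ite_eq, if_pos hi]; ring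
  have hoff : |∑ n ∈ I, ρ n * ‖∑ j ∈ range K, ee (j * u n)‖ ^ (2 * r) - D * σ| ≤ D * (2 * E) := by
    rw [← norm_eq_abs, ← Complex.norm_real, hdiff]
    set q : ℕ → ℕ → ℝ := fun i j => if i = j then 0 else S (Nat.dist i j) with hq
    have hS0 : ∀ h, 0 ≤ S h := fun h => norm_nonneg _
    have hqs : ∀ i j, q i j = q j i := fun i j => by rw [hq]; simp only [eq_comm, Nat.dist_comm]
    have hq0 : ∀ i j, 0 ≤ q i j := fun i j => by rw [hq]; dsimp only; split_ifs; exacts [le_rfl, hS0 _]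
    calc _ ≤ ∑ i ∈ range M, ∑ j ∈ range M, ((g i : ℝ) ^ 2 / 2 * q i j + (g j : ℝ) ^ 2 / 2 * q i j) := by
          refine norm_sum_le_of_le _ fun i _ => norm_sum_le_of_le _ fun j _ => ?_
          have h1 : ‖if i = j then 0 else (g i : ℂ) * g j * T i j‖ = (g i : ℝ) * g j * q i j := by
            rw [hq]; dsimp only
            split_ifs
            · simp
            · rw [norm_mul, norm_mul, hTd, Complex.norm_natCast, Complex.norm_natCast]
          rw [h1, ← add_mul]
          refine mul_le_mul_of_nonneg_right ?_ (hq0 i j)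
          linarith [sq_nonneg ((g i : ℝ) - g j)]
      _ = ∑ i ∈ range M, (g i : ℝ) ^ 2 * ∑ j ∈ range M, q i j := by
          simp only [sum_add_distrib]
          rw [sum_comm (f := fun i j => (g j : ℝ) ^ 2 / 2 * q i j), ← sum_add_distrib]
          refine sum_congr rfl fun i _ => ?_
          rw [← sum_add_distrib, mul_sum]
          refine sum_congr rfl fun j _ => ?_
          rw [hqs j i]; ring
      _ ≤ ∑ i ∈ range M, (g i : ℝ) ^ 2 * (2 * E) := by
          refine sum_le_sum fun i hi => mul_le_mul_of_nonneg_left ?_ (by positivity)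
          exact (sum_dist_le (mem_range.1 hi) S hS0).trans (mul_le_mul_of_nonneg_left hE (by norm_num))
      _ = _ := by rw [← sum_mul]
  have := (abs_le.1 hoff).1
  calc _ ≤ D * (σ - 2 * E) := mul_le_mul_of_nonneg_right hD0 (by linarith)
    _ ≤ _ := by linarith

lemma norm_geom_ee_le (K : ℕ) {t δ : ℝ} (hδ : 0 < δ) (ht : ∀ m : ℤ, δ ≤ |t - m|) :
    ‖∑ j ∈ range K, ee (j * t)‖ ≤ 1 / δ := by
  have e : ∀ j ∈ Ico 0 K, ee (j * t) = ee (j * Int.fract t) := fun j _ => by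
    rw [← ee_sub_int_mul (j * t) ⌊t⌋ j, Int.fract]; congr 1; ring
  rw [range_eq_Ico, sum_congr rfl e]
  have h1 := ht ⌊t⌋
  have h2 := ht (⌊t⌋ + 1)
  have h3 : t - ⌊t⌋ = Int.fract t := rfl
  rw [h3, abs_of_nonneg (Int.fract_nonneg t)] at h1
  push_cast at h2
  rw [show t - (⌊t⌋ + 1) = -(1 - Int.fract t) by rw [← h3]; ring, abs_neg,
    abs_of_pos (by linarith [Int.fract_lt_one t])] at h2
  refine kusmin_landau (fun j => j * Int.fract t) 0 K hδ (fun n _ _ => ?_) (fun n _ _ => ?_) <;>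
    push_cast
  · constructor <;> linarith
  · linarith

lemma floor_rpow_of_near {γ c δ : ℝ} {n : ℕ} (h0 : 0 < γ) (h1 : γ < 1) (hc : c = 1 / γ)
    (hδ : 2 * δ ≤ γ * ((n : ℝ) + 1) ^ (γ - 1)) {m : ℤ} (hm : |(n : ℝ) ^ γ + δ - m| < δ) :
    ∃ k : ℕ, 0 < k ∧ n = ⌊(k : ℝ) ^ c⌋₊ := by
  obtain ⟨a1, a2⟩ := abs_lt.1 hm
  have hn1 : (0 : ℝ) < n + 1 := by positivity
  have hnγ : (0 : ℝ) ≤ (n : ℝ) ^ γ := by positivity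
  have hb : (n : ℝ) ^ γ + 2 * δ ≤ ((n : ℝ) + 1) ^ γ := by
    have h3 := rpow_one_add_le_one_add_mul_self (s := -(1 / ((n : ℝ) + 1))) (p := γ) (by
      rw [neg_le_neg_iff, div_le_one hn1]; linarith [Nat.cast_nonneg (α := ℝ) n]) h0.le h1.le
    have e : (n : ℝ) ^ γ = ((n : ℝ) + 1) ^ γ * (1 + -(1 / ((n : ℝ) + 1))) ^ γ := by
      rw [← mul_rpow hn1.le]
      · congr 1; field_simp; ring
      · have : 1 / ((n : ℝ) + 1) ≤ 1 := by rw [div_le_one hn1]; linarith [Nat.cast_nonneg (α := ℝ) n]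
        linarith
    have e2 : ((n : ℝ) + 1) ^ (γ - 1) = ((n : ℝ) + 1) ^ γ / (n + 1) := by
      rw [rpow_sub hn1, rpow_one]
    have := mul_le_mul_of_nonneg_left h3 (rpow_nonneg hn1.le γ)
    rw [← e] at this
    rw [e2] at hδ
    calc (n : ℝ) ^ γ + 2 * δ ≤ ((n : ℝ) + 1) ^ γ * (1 + γ * -(1 / (n + 1))) + γ * (((n : ℝ) + 1) ^ γ / (n + 1)) := by
          linarith
      _ = _ := by field_simp; ring
  have hm0 : (0 : ℝ) < m := by linarith
  have hm0' : 0 < m := mod_cast hm0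
  lift m to ℕ using hm0'.le
  refine ⟨m, mod_cast hm0', ?_⟩
  have hinv : ∀ y : ℝ, 0 ≤ y → (y ^ γ) ^ c = y := fun y hy => by
    rw [← rpow_mul hy, hc, mul_one_div_cancel h0.ne', rpow_one]
  have hc0 : 0 < c := by rw [hc]; positivity
  push_cast at *
  symm
  rw [Nat.floor_eq_iff (by positivity)]
  constructor
  · rw [← hinv n (by positivity)]
    exact rpow_le_rpow hnγ (by linarith) hc0.le
  · rw [← hinv (n + 1) hn1.le]
    exact rpow_lt_rpow hm0.le (by linarith) hc0

/-- Many primes in `[X, 4 X)` have the form `⌊k ^ c⌋`. -/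
theorem le_card_floor_primes {γ c : ℝ} (h0 : 50 / 58 < γ) (h1 : γ < 1) (hc : c = 1 / γ) :
    ∀ᶠ X : ℕ in atTop, ∀ A : Finset ℕ, (∀ n ∈ Ico X (4 * X), n.Prime → (∃ k : ℕ, 0 < k ∧ n = ⌊(k : ℝ) ^ c⌋₊) → n ∈ A) →
      (X : ℝ) ^ (γ - (1 - γ) / 4) ≤ A.card := by
  obtain ⟨s, hs0, hexp⟩ := norm_sum_sieveWeight_ee_le h0 h1
  obtain ⟨κ, hκ0, hκ1, hκ2⟩ : ∃ κ : ℝ, 0 < κ ∧ 8 * κ ≤ s ∧ 16 * κ ≤ 1 - γ :=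
    ⟨min (s / 8) ((1 - γ) / 16), lt_min (by linarith) (by linarith), by
      have := min_le_left (s / 8) ((1 - γ) / 16); linarith, by
      have := min_le_right (s / 8) ((1 - γ) / 16); linarith⟩
  obtain ⟨r, hr⟩ := exists_nat_gt (3 / κ)
  have hrκ : 3 ≤ r * κ := ((div_lt_iff₀ hκ0).1 hr).le
  have hr1 : (1 : ℝ) ≤ r := by
    have : 3 / κ ≥ 0 := by positivity
    exact_mod_cast lt_of_le_of_lt this hr
  filter_upwards [hexp, le_sum_sieveWeight, tendsto_natCast_atTop_atTop.eventually
    ((eventually_const_mul_log_pow_le 16 1 hκ0).and (((tendsto_rpow_atTop hκ0).eventually_ge_atTop (8 * r + 400)).and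
      ((tendsto_log_atTop.eventually_ge_atTop 1).and (eventually_gt_atTop (8 : ℝ)))))]
      with X hexp hsum ⟨hlog, hxκ, hlx, hx8⟩ A hA
  have hX8 : 8 < X := mod_cast hx8
  set x := (X : ℝ)
  set z := ⌈x ^ (18 / 58 : ℝ)⌉₊
  set w := ⌈x ^ (24 / 58 : ℝ)⌉₊
  have hx : 1 < x := by linarith
  have hx0 : 0 < x := by linarith
  have hle := fun a b : ℝ => rpow_le_rpow_left_iff (y := a) (z := b) hx
  have hadd := fun a b : ℝ => (rpow_add hx0 a b).symm
  set K := ⌈x ^ (1 - γ + κ)⌉₊ with hK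
  have hK1 : x ^ (1 - γ + κ) ≤ K := Nat.le_ceil _
  have hone : 1 ≤ x ^ (1 - γ + κ) := one_le_rpow hx.le (by linarith)
  have hK2 : (K : ℝ) ≤ 2 * x ^ (1 - γ + κ) := by
    have := Nat.ceil_lt_add_one (zero_le_one.trans hone)
    rw [← hK] at this; linarith
  have hrK : (r : ℝ) * K + 1 ≤ x ^ (1 - γ + 2 * κ) := by
    have : 1 ≤ r * x ^ (1 - γ + κ) := one_le_mul_of_one_le_of_one_le hr1 hone
    calc (r : ℝ) * K + 1 ≤ r * (2 * x ^ (1 - γ + κ)) + r * x ^ (1 - γ + κ) := by gcongr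
      _ = 3 * r * x ^ (1 - γ + κ) := by ring
      _ ≤ x ^ κ * x ^ (1 - γ + κ) := by gcongr; linarith
      _ = _ := by rw [hadd]; congr 1; ring
  set δ := γ / 2 * (4 * x) ^ (γ - 1) with hδ
  have hδ0 : 0 < δ := by positivity
  set u : ℕ → ℝ := fun n => (n : ℝ) ^ γ + δ with hu
  set ρ : ℕ → ℝ := fun n => sieveWeight z w n with hρ
  set S : ℕ → ℂ := fun h => ∑ n ∈ Ico X (4 * X), (ρ n : ℂ) * ee (h * u n) with hS
  set L := Nat.log 2 (r * K)
  have hrK0 : 0 < r * K := by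
    have : (0 : ℝ) < ((r * K : ℕ) : ℝ) := by push_cast; positivity
    exact_mod_cast this
  have hLlog : ((L + 1 : ℕ) : ℝ) ≤ 2 + 4 * log x := by
    refine nat_log_two_add_one_le hlx hrK0 ?_
    push_cast
    calc (r : ℝ) * K ≤ x ^ (1 - γ + 2 * κ) := by linarith
      _ ≤ x ^ (1 : ℝ) := by rw [hle]; linarith
      _ = x := rpow_one x
  have hblock : ∀ i ∈ range (L + 1), ∑ h ∈ Ico (2 ^ i) (2 * 2 ^ i), ‖S h‖ ≤ x ^ (1 - s) := fun i hi => by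
    have hi2 : 2 ^ i ≤ r * K := Nat.pow_le_of_le_log hrK0.ne' (Nat.lt_succ_iff.1 (mem_range.1 hi))
    choose θ hθ using fun h : ℕ => Complex.exists_norm_mul_eq_self (S h)
    have := hexp (2 ^ i) (fun h => conj (θ h) * ee (h * δ)) (by positivity) (by
      have h3 : ((2 ^ i : ℕ) : ℝ) ≤ ((r * K : ℕ) : ℝ) := mod_cast hi2
      push_cast at h3 ⊢
      refine h3.trans ((by linarith : (r : ℝ) * K ≤ x ^ (1 - γ + 2 * κ)).trans ?_)
      rw [hle]; linarith) (fun h => by rw [norm_mul, norm_ee, RCLike.norm_conj, (hθ h).1, mul_one])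
    refine le_trans (le_of_eq ?_) this
    have e : (∑ h ∈ Ico (2 ^ i) (2 * 2 ^ i), (‖S h‖ : ℂ)) = ∑ n ∈ Ico X (4 * X), (sieveWeight z w n : ℂ) *
        ∑ h ∈ Ico (2 ^ i) (2 * 2 ^ i), conj (θ h) * ee (h * δ) * ee (h * (n : ℝ) ^ γ) := by
      simp only [mul_sum]
      rw [sum_comm]
      refine sum_congr rfl fun h _ => ?_
      have h4 : (‖S h‖ : ℂ) = conj (θ h) * S h := by
        have h5 : conj (θ h) * θ h = 1 := by
          rw [← Complex.normSq_eq_conj_mul_self, Complex.normSq_eq_norm_sq, (hθ h).1]; norm_num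
        calc (‖S h‖ : ℂ) = conj (θ h) * θ h * ‖S h‖ := by rw [h5, one_mul]
          _ = conj (θ h) * (θ h * ‖S h‖) := by ring
          _ = _ := by rw [(hθ h).2]
      rw [h4, hS, mul_sum]
      refine sum_congr rfl fun n _ => ?_
      rw [hu, hρ]; dsimp only
      rw [mul_add, ee_add]; push_cast; ring
    rw [← e, ← Complex.ofReal_sum, Complex.norm_real, norm_of_nonneg (sum_nonneg fun _ _ => norm_nonneg _)]
  set l := log x
  have hE : ∑ h ∈ Ico 1 (r * K + 1), ‖S h‖ ≤ x / (8 * l) := by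
    have hsub : Ico 1 (r * K + 1) ⊆ Ico 1 (2 ^ (L + 1)) :=
      Ico_subset_Ico_right (Nat.lt_pow_succ_log_self (by norm_num) _)
    refine (sum_le_sum_of_subset_of_nonneg hsub fun _ _ _ => norm_nonneg _).trans ?_
    rw [sum_Ico_one_two_pow]
    refine (sum_le_card_nsmul _ _ _ hblock).trans ?_
    rw [card_range, nsmul_eq_mul, le_div_iff₀ (by linarith)]
    rw [pow_one] at hlog
    calc ((L + 1 : ℕ) : ℝ) * x ^ (1 - s) * (8 * l) ≤ x ^ κ * x ^ (1 - s) * x ^ κ := by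
          gcongr
          · linarith
          · linarith
      _ ≤ x ^ (1 : ℝ) := by rw [hadd, hadd, hle]; linarith
      _ = x := rpow_one x
  have hsum' : x / (2 * l) ≤ ∑ n ∈ Ico X (4 * X), ρ n := by push_cast at hsum; exact hsum
  have hxl : x / (2 * l) = 4 * (x / (8 * l)) := by field_simp; norm_num
  have hxl0 : 0 < x / (8 * l) := by positivity
  have hmain := le_sum_mul_kernel (Ico X (4 * X)) ρ u hE (by linarith)
  have hV0 : ∀ n, ‖∑ j ∈ range K, ee (j * u n)‖ ^ (2 * r) ≤ (K : ℝ) ^ (2 * r) := fun n =>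
    pow_le_pow_left₀ (norm_nonneg _) ((norm_sum_ee_le_card _ _).trans (by rw [card_range])) _
  have hup : ∀ n ∈ Ico X (4 * X), ρ n * ‖∑ j ∈ range K, ee (j * u n)‖ ^ (2 * r) ≤
      (if n ∈ A then (K : ℝ) ^ (2 * r) else 0) + (1 / δ) ^ (2 * r) := fun n hn => by
    have hn' := mem_Ico.1 hn
    have hw0 : ρ n ≤ if n.Prime then 1 else 0 := by
      have := (Int.cast_le (R := ℝ)).2 (sieveWeight_le (z := z) (w := w) (show 2 ≤ n by omega))
      push_cast at this; exact this
    have hδr : 0 ≤ (1 / δ) ^ (2 * r) := by positivity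
    refine (mul_le_mul_of_nonneg_right hw0 (by positivity)).trans ?_
    by_cases hp : n.Prime
    swap
    · rw [if_neg hp, zero_mul]; split_ifs <;> positivity
    rw [if_pos hp, one_mul]
    by_cases hnA : n ∈ A
    · rw [if_pos hnA]; linarith [hV0 n]
    rw [if_neg hnA, zero_add]
    refine pow_le_pow_left₀ (norm_nonneg _) (norm_geom_ee_le K hδ0 fun m => ?_) _
    by_contra! hm
    refine hnA (hA n hn hp (floor_rpow_of_near (by linarith) h1 hc ?_ hm))
    rw [hδ]
    have h3 : (4 * x) ^ (γ - 1) ≤ ((n : ℝ) + 1) ^ (γ - 1) := by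
      refine rpow_le_rpow_of_nonpos (by positivity) ?_ (by linarith)
      have : ((n + 1 : ℕ) : ℝ) ≤ ((4 * X : ℕ) : ℝ) := mod_cast hn'.2
      push_cast at this; exact this
    have := mul_le_mul_of_nonneg_left h3 (show 0 ≤ γ by linarith)
    linarith
  have hup2 := hmain.trans (sum_le_sum hup)
  rw [sum_add_distrib, ← sum_filter, sum_const, sum_const, Nat.card_Ico, nsmul_eq_mul, nsmul_eq_mul] at hup2
  have hcard : (((Ico X (4 * X)).filter (· ∈ A)).card : ℝ) ≤ A.card := by
    exact_mod_cast card_le_card fun n hn => (mem_filter.1 hn).2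
  have hδK : x ^ (κ / 2) ≤ δ * K := by
    have h4 : (1 / 4 : ℝ) ≤ 4 ^ (γ - 1) := by
      rw [show (1 / 4 : ℝ) = 4 ^ (-1 : ℝ) by rw [rpow_neg_one]; norm_num]
      exact rpow_le_rpow_of_exponent_le (by norm_num) (by linarith)
    have h5 : 20 ≤ x ^ (κ / 2) := by
      have : (x ^ (κ / 2)) ^ 2 = x ^ κ := by rw [rpow_npow_eq hx0]; congr 1; push_cast; ring
      refine (sq_le_sq₀ (by norm_num) (by positivity)).1 ?_
      rw [this]; linarith
    calc x ^ (κ / 2) = 1 / 20 * (20 * x ^ (κ / 2)) := by ring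
      _ ≤ 1 / 20 * (x ^ (κ / 2) * x ^ (κ / 2)) := by gcongr
      _ = 2 / 5 * (1 / 4 * x ^ (γ - 1)) * (1 / 2 * x ^ (1 - γ + κ)) := by
          rw [hadd, show κ / 2 + κ / 2 = (γ - 1) + (1 - γ + κ) by ring, rpow_add hx0]; ring
      _ ≤ γ / 2 * (4 ^ (γ - 1) * x ^ (γ - 1)) * K :=
          mul_le_mul (mul_le_mul (by linarith) (mul_le_mul_of_nonneg_right h4 (by positivity)) (by positivity)
            (by positivity)) (by linarith) (by positivity) (by positivity)
      _ = _ := by rw [hδ, mul_rpow (by norm_num) hx0.le]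
  have hsmall : 3 * x * (1 / δ) ^ (2 * r) ≤ (K : ℝ) ^ (2 * r) := by
    have h6 : 3 * x ≤ (δ * K) ^ (2 * r) := by
      calc 3 * x ≤ x ^ (3 : ℝ) := by
            have : x ^ (3 : ℝ) = x * x * x := by norm_cast; ring
            rw [this]; nlinarith
        _ ≤ (x ^ (κ / 2)) ^ (2 * r) := by
            rw [rpow_npow_eq hx0, hle]; push_cast; linarith
        _ ≤ _ := by gcongr
    rw [one_div, inv_pow, ← div_eq_mul_inv, div_le_iff₀ (by positivity), ← mul_pow, mul_comm (K : ℝ)]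
    exact h6
  have hX3 : ((4 * X - X : ℕ) : ℝ) = 3 * x := by rw [show 4 * X - X = 3 * X by omega]; push_cast; rfl
  rw [hX3] at hup2
  have hKr : (0 : ℝ) < (K : ℝ) ^ (2 * r) := by positivity
  have hfin : 2 * (x / (8 * l)) / (r * K + 1) ≤ A.card + 1 := by
    refine le_of_mul_le_mul_left ?_ hKr
    calc (K : ℝ) ^ (2 * r) * (2 * (x / (8 * l)) / (r * K + 1))
        = (K : ℝ) ^ (2 * r) / (r * K + 1) * (2 * (x / (8 * l))) := by ring
      _ ≤ (K : ℝ) ^ (2 * r) / (r * K + 1) * (∑ n ∈ Ico X (4 * X), ρ n - 2 * (x / (8 * l))) := by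
          gcongr; linarith
      _ ≤ _ := hup2
      _ ≤ A.card * (K : ℝ) ^ (2 * r) + (K : ℝ) ^ (2 * r) :=
          add_le_add (mul_le_mul_of_nonneg_right hcard hKr.le) hsmall
      _ = _ := by ring
  have hbig : 2 * x ^ (γ - (1 - γ) / 4) ≤ 2 * (x / (8 * l)) / (r * K + 1) := by
    rw [mul_div_assoc]
    refine mul_le_mul_of_nonneg_left ?_ (by norm_num)
    rw [div_div, le_div_iff₀ (by positivity)]
    rw [pow_one] at hlog
    calc x ^ (γ - (1 - γ) / 4) * (8 * l * (r * K + 1)) ≤ x ^ (γ - (1 - γ) / 4) * (x ^ κ * x ^ (1 - γ + 2 * κ)) := by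
          gcongr; linarith
      _ ≤ x ^ (1 : ℝ) := by rw [hadd, hadd, hle]; linarith
      _ = x := rpow_one x
  have h1' : 1 ≤ x ^ (γ - (1 - γ) / 4) := one_le_rpow hx.le (by linarith)
  linarith

/-- The residues `a ∈ [1, p]` with `P(a)` coprime to `p`. -/
def unitValues (P : Polynomial ℤ) (p : ℕ) : Finset ℕ :=
  (Icc 1 p).filter fun a : ℕ => Int.gcd (P.eval (a : ℤ)) (p : ℤ) = 1

lemma gcd_eval_eq_one_iff (P : Polynomial ℤ) {p : ℕ} (hp : p.Prime) (a : ℕ) :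
    Int.gcd (P.eval (a : ℤ)) (p : ℤ) = 1 ↔ ¬ (p : ℤ) ∣ P.eval (a : ℤ) := by
  rw [Int.gcd_comm, Int.gcd, Int.natAbs_natCast, ← Nat.coprime_iff_gcd_eq_one, hp.coprime_iff_not_dvd,
    Int.natCast_dvd]

lemma lt_of_mem_unitValues {P : Polynomial ℤ} (hP : P.eval 0 = 0) {p a : ℕ} (hp : p.Prime)
    (ha : a ∈ unitValues P p) : 1 ≤ a ∧ a < p := by
  rw [unitValues, mem_filter, mem_Icc, gcd_eval_eq_one_iff P hp] at ha
  refine ⟨ha.1.1, lt_of_le_of_ne ha.1.2 fun h => ha.2 ?_⟩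
  have := Polynomial.sub_dvd_eval_sub (a : ℤ) 0 P
  rw [hP, sub_zero, sub_zero, h] at this
  rwa [h]

lemma le_card_unitValues_add {P : Polynomial ℤ} (hP : P ≠ 0) {p : ℕ} (hp : p.Prime) :
    p ≤ (unitValues P p).card + (P.natDegree + P.leadingCoeff.natAbs) := by
  have h1 := card_filter_add_card_filter_not (s := Icc 1 p)
    (fun a : ℕ => Int.gcd (P.eval (a : ℤ)) (p : ℤ) = 1)
  rw [Nat.card_Icc, Nat.add_sub_cancel] at h1
  rw [unitValues]
  refine h1.symm.le.trans (Nat.add_le_add_left ?_ _)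
  by_cases hd : (p : ℤ) ∣ P.leadingCoeff
  · have h2 : p ≤ P.leadingCoeff.natAbs := Nat.le_of_dvd
      (Int.natAbs_pos.2 (Polynomial.leadingCoeff_ne_zero.2 hP)) (Int.natCast_dvd.1 hd)
    refine (card_filter_le _ _).trans ?_
    rw [Nat.card_Icc]; omega
  · have := Fact.mk hp
    set R := P.map (Int.castRingHom (ZMod p)) with hR
    have hR0 : R ≠ 0 := fun h => hd (by
      rw [← ZMod.intCast_zmod_eq_zero_iff_dvd]
      have := congrArg (fun S => S.coeff P.natDegree) h
      simpa [hR, Polynomial.coeff_map] using this)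
    have hle : ((Icc 1 p).filter (fun a : ℕ => ¬ Int.gcd (P.eval (a : ℤ)) (p : ℤ) = 1)).card ≤
        R.roots.toFinset.card := by
      refine card_le_card_of_injOn (fun a => (a : ZMod p)) (fun a ha => ?_) (fun a ha b hb hab => ?_)
      · rw [mem_coe, mem_filter, gcd_eval_eq_one_iff P hp, not_not] at ha
        rw [mem_coe, Multiset.mem_toFinset, Polynomial.mem_roots hR0, Polynomial.IsRoot.def, hR]
        have h3 := Polynomial.eval_natCast_map (Int.castRingHom (ZMod p)) P a
        rwa [eq_intCast, (ZMod.intCast_zmod_eq_zero_iff_dvd _ _).2 ha.2] at h3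
      · rw [mem_coe, mem_filter, mem_Icc] at ha hb
        have h4 := (ZMod.natCast_eq_natCast_iff a b p).1 hab
        by_contra hne
        rcases lt_or_gt_of_ne hne with h | h
        · have := Nat.le_of_dvd (by omega) ((Nat.modEq_iff_dvd' h.le).1 h4); omega
        · have := Nat.le_of_dvd (by omega) ((Nat.modEq_iff_dvd' h.le).1 h4.symm); omega
    have := (Multiset.toFinset_card_le R.roots).trans (Polynomial.card_roots' R)
    have : R.natDegree ≤ P.natDegree := Polynomial.natDegree_map_le
    omega

lemma eq_of_abs_div_sub_lt {b b' q : ℕ} {N Λ : ℝ} {k : ℤ} (hN : 0 < N) (hb : b ∈ Icc 1 q) (hb' : b' ∈ Icc 1 q)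
    (hq : Λ * q < N) (h : |(b : ℝ) / q - b' / q - k| * N < Λ) : b = b' := by
  rw [mem_Icc] at hb hb'
  have hq0 : (0 : ℝ) < q := mod_cast (by omega : 0 < q)
  have e : (b : ℝ) / q - b' / q - k = ((b - b' - k * q : ℤ) : ℝ) / q := by push_cast; field_simp
  rw [e, abs_div, abs_of_pos hq0, div_mul_eq_mul_div, div_lt_iff₀ hq0] at h
  have h1 : ((|(b - b' - k * q : ℤ)| : ℤ) : ℝ) < 1 := by
    rw [Int.cast_abs]
    by_contra! h2
    have := mul_le_mul_of_nonneg_right h2 hN.le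
    linarith
  have h2 : ((b : ℤ) - b' - k * q) = 0 := Int.abs_lt_one_iff.1 (mod_cast h1)
  have h3 : (q : ℤ) ∣ b - b' := ⟨k, by linarith⟩
  have h4 := Int.eq_zero_of_abs_lt_dvd h3 (by rw [abs_lt]; omega)
  omega

/-- The value of `a q - b p` modulo `p q`. -/
def crossResidue (p q : ℕ) (e : ℕ × ℕ) : ℕ := (e.1 * q + (q - e.2) * p) % (p * q)

lemma crossResidue_injOn {p q : ℕ} (h : p.Coprime q) :
    Set.InjOn (crossResidue p q) (Icc 1 p ×ˢ Icc 1 q : Finset (ℕ × ℕ)) := by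
  rintro ⟨a, b⟩ hab ⟨a', b'⟩ hab' heq
  simp only [coe_product, Set.mem_prod, mem_coe, mem_Icc] at hab hab'
  have h0 : a * q + (q - b) * p ≡ a' * q + (q - b') * p [MOD p * q] := heq
  have key : ∀ {u v m : ℕ}, u ≡ v [MOD m] → u < v + m → v < u + m → u = v := fun {u v m} h1 h2 h3 => by
    rcases le_total u v with h4 | h4
    · have := Nat.eq_zero_of_dvd_of_lt ((Nat.modEq_iff_dvd' h4).1 h1) (by omega); omega
    · have := Nat.eq_zero_of_dvd_of_lt ((Nat.modEq_iff_dvd' h4).1 h1.symm) (by omega); omega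
  have z1 : ∀ c, c * p ≡ 0 [MOD p] := fun c => (Nat.modEq_zero_iff_dvd).2 (dvd_mul_left _ _)
  have z2 : ∀ c, c * q ≡ 0 [MOD q] := fun c => (Nat.modEq_zero_iff_dvd).2 (dvd_mul_left _ _)
  have h1 : a * q ≡ a' * q [MOD p] := Nat.ModEq.add_right_cancel ((z1 _).trans (z1 _).symm) (h0.of_mul_right q)
  have h2 : (q - b) * p ≡ (q - b') * p [MOD q] :=
    Nat.ModEq.add_left_cancel ((z2 _).trans (z2 _).symm) (h0.of_mul_left p)
  have h3 := key (h1.cancel_right_of_coprime h) (by omega) (by omega)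
  have h4 := key (h2.cancel_right_of_coprime h.symm) (by omega) (by omega)
  rw [Prod.mk.injEq]; omega

lemma close_iff_crossResidue {p q : ℕ} (hp : 0 < p) (hq : 0 < q) {N Λ : ℝ} (hN : Λ < N) (hΛ : 0 < Λ)
    {e : ℕ × ℕ} (he : e.2 ≤ q) :
    (∃ k : ℤ, ((e.1 : ℝ) / p - (e.2 : ℝ) / q - k) * N ∈ Set.Ioo 0 Λ) ↔
      0 < crossResidue p q e ∧ (crossResidue p q e : ℝ) * N < Λ * (p * q) := by
  have hc : ((crossResidue p q e : ℕ) : ℤ) = (e.1 * q - e.2 * p + p * q : ℤ) % (p * q) := by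
    rw [crossResidue]; push_cast [Nat.cast_sub he]; congr 1; ring
  have hval : ∀ k : ℤ, ((e.1 : ℝ) / p - (e.2 : ℝ) / q - k) * N ∈ Set.Ioo 0 Λ ↔
      0 < (e.1 * q - e.2 * p - k * (p * q) : ℤ) ∧
        ((e.1 * q - e.2 * p - k * (p * q) : ℤ) : ℝ) * N < Λ * (p * q) := fun k => by
    have e1 : ((e.1 : ℝ) / p - (e.2 : ℝ) / q - k) * N =
        ((e.1 * q - e.2 * p - k * (p * q) : ℤ) : ℝ) * N / (p * q) := by
      push_cast; field_simp
    rw [Set.mem_Ioo, e1, div_lt_iff₀ (by positivity), div_pos_iff_of_pos_right (by positivity),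
      mul_pos_iff_of_pos_right (hΛ.trans hN), Int.cast_pos]
  constructor
  · rintro ⟨k, hk⟩
    obtain ⟨h1, h2⟩ := (hval k).1 hk
    set t : ℤ := e.1 * q - e.2 * p - k * (p * q) with ht
    have h3 : t < p * q := by
      by_contra! h4
      have h5 : ((p * q : ℤ) : ℝ) ≤ t := mod_cast h4
      push_cast at h5
      have := mul_le_mul h5 hN.le hΛ.le (by positivity)
      linarith
    have h4 : ((crossResidue p q e : ℕ) : ℤ) = t := by
      rw [hc, show (e.1 * q - e.2 * p + p * q : ℤ) = t + (p * q) * (k + 1) by rw [ht]; ring,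
        Int.add_mul_emod_self_left, Int.emod_eq_of_lt h1.le h3]
    have h5 : ((crossResidue p q e : ℕ) : ℝ) = (t : ℝ) := mod_cast congrArg (Int.cast (R := ℝ)) h4
    exact ⟨by omega, by rw [h5]; exact h2⟩
  · rintro ⟨h1, h2⟩
    refine ⟨(e.1 * q - e.2 * p + p * q : ℤ) / (p * q) - 1, (hval _).2 ?_⟩
    have h4 : (e.1 * q - e.2 * p - ((e.1 * q - e.2 * p + p * q : ℤ) / (p * q) - 1) * (p * q) : ℤ) =
        (crossResidue p q e : ℕ) := by
      have := Int.emod_add_mul_ediv (e.1 * q - e.2 * p + p * q : ℤ) (p * q)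
      rw [hc]; linear_combination -this
    rw [h4]
    exact ⟨mod_cast h1, mod_cast h2⟩

lemma card_mul_lt {n : ℕ} {N Y : ℝ} (hN : 0 < N) (hY : 0 < Y) (hn : Y ≤ n * N) :
    |(((range n).filter fun r : ℕ => 0 < r ∧ (r : ℝ) * N < Y).card : ℝ) - Y / N| ≤ 1 := by
  have e : (range n).filter (fun r : ℕ => 0 < r ∧ (r : ℝ) * N < Y) = Ioo 0 ⌈Y / N⌉₊ := by
    ext r
    simp only [mem_filter, mem_range, mem_Ioo, Nat.lt_ceil, lt_div_iff₀ hN]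
    refine ⟨fun h => h.2, fun h => ⟨?_, h⟩⟩
    have := lt_of_mul_lt_mul_right (h.2.trans_le hn) hN.le
    exact_mod_cast this
  have h0 : 0 < Y / N := by positivity
  have h1 := Nat.le_ceil (Y / N)
  have h2 := Nat.ceil_lt_add_one h0.le
  rw [e, Nat.card_Ioo, Nat.sub_zero, Nat.cast_sub (Nat.ceil_pos.2 h0), abs_le]
  push_cast
  constructor <;> linarith

open scoped Classical in
lemma card_close_pairs {p q κ : ℕ} (hp : p.Prime) (hq : q.Prime) (hpq : p ≠ q) {N Λ : ℝ} (hΛ : 0 < Λ)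
    (hNp : Λ * p < N) (hNq : Λ * q < N) {A B : Finset ℕ} (hA : A ⊆ Icc 1 p) (hB : B ⊆ Icc 1 q)
    (hAκ : p ≤ A.card + κ) (hBκ : q ≤ B.card + κ) :
    |(((A ×ˢ B).filter fun e => ∃ k : ℤ, ((e.1 : ℝ) / p - (e.2 : ℝ) / q - k) * N ∈ Set.Ioo 0 Λ).card : ℝ) -
      Λ * (p * q) / N| ≤ 1 + 2 * κ := by
  have hp1 : (1 : ℝ) ≤ p := mod_cast hp.one_le
  have hq1 : (1 : ℝ) ≤ q := mod_cast hq.one_le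
  have hΛN : Λ < N := (le_mul_of_one_le_right hΛ.le hp1).trans_lt hNp
  have hN0 : 0 < N := hΛ.trans hΛN
  set c : ℕ × ℕ → Prop := fun e => ∃ k : ℤ, ((e.1 : ℝ) / p - (e.2 : ℝ) / q - k) * N ∈ Set.Ioo 0 Λ
  set G := Icc 1 p ×ˢ Icc 1 q with hG
  have hcard : (G.filter c).card = ((range (p * q)).filter fun r : ℕ => 0 < r ∧ (r : ℝ) * N < Λ * (p * q)).card := by
    have hinj := crossResidue_injOn ((Nat.coprime_primes hp hq).2 hpq)
    have himg : G.image (crossResidue p q) = range (p * q) := by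
      refine eq_of_subset_of_card_le (image_subset_iff.2 fun e _ =>
        mem_range.2 (Nat.mod_lt _ (Nat.mul_pos hp.pos hq.pos))) ?_
      rw [card_image_of_injOn hinj, card_range, card_product, Nat.card_Icc, Nat.card_Icc]; simp
    rw [← himg, filter_image, card_image_of_injOn (hinj.mono (coe_subset.2 (filter_subset _ _)))]
    congr 1
    refine filter_congr fun e he => ?_
    rw [hG, mem_product, mem_Icc, mem_Icc] at he
    exact close_iff_crossResidue hp.pos hq.pos hΛN hΛ he.2.2
  have hR := card_mul_lt (n := p * q) (N := N) (Y := Λ * (p * q)) hN0 (by positivity) (by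
    push_cast; rw [mul_comm]; exact mul_le_mul_of_nonneg_left hΛN.le (by positivity))
  rw [← hcard] at hR
  have hsub : G.filter c ⊆ ((A ×ˢ B).filter c ∪ (G.filter c).filter (fun e => e.1 ∉ A)) ∪
      (G.filter c).filter (fun e => e.2 ∉ B) := fun e he => by
    simp only [mem_union, mem_filter, mem_product] at he ⊢
    tauto
  have hle : (A ×ˢ B).filter c ⊆ G.filter c := filter_subset_filter _ (product_subset_product hA hB)
  have hcompl : ∀ {A : Finset ℕ} {p : ℕ}, A ⊆ Icc 1 p → p ≤ A.card + κ → (Icc 1 p \ A).card ≤ κ := fun {A p} h1 h2 => by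
    rw [card_sdiff_of_subset h1, Nat.card_Icc]; omega
  have hb1 : ((G.filter c).filter (fun e => e.1 ∉ A)).card ≤ κ := by
    refine le_trans (card_le_card_of_injOn Prod.fst (fun e he => ?_) ?_) (hcompl hA hAκ)
    · rw [mem_coe, mem_filter, mem_filter, hG, mem_product] at he
      exact mem_coe.2 (mem_sdiff.2 ⟨he.1.1.1, he.2⟩)
    · rintro ⟨a, b⟩ h ⟨a', b'⟩ h' (rfl : a = a')
      simp only [mem_coe, mem_filter, hG, mem_product] at h h'
      obtain ⟨k, hk⟩ := h.1.2
      obtain ⟨k', hk'⟩ := h'.1.2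
      rw [Prod.mk.injEq]
      refine ⟨rfl, eq_of_abs_div_sub_lt (k := k' - k) hN0 h.1.1.2 h'.1.1.2 hNq ?_⟩
      rw [← abs_of_pos hN0, ← abs_mul, abs_lt]
      push_cast
      constructor <;> linarith [hk.1, hk.2, hk'.1, hk'.2]
  have hb2 : ((G.filter c).filter (fun e => e.2 ∉ B)).card ≤ κ := by
    refine le_trans (card_le_card_of_injOn Prod.snd (fun e he => ?_) ?_) (hcompl hB hBκ)
    · rw [mem_coe, mem_filter, mem_filter, hG, mem_product] at he
      exact mem_coe.2 (mem_sdiff.2 ⟨he.1.1.2, he.2⟩)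
    · rintro ⟨a, b⟩ h ⟨a', b'⟩ h' (rfl : b = b')
      simp only [mem_coe, mem_filter, hG, mem_product] at h h'
      obtain ⟨k, hk⟩ := h.1.2
      obtain ⟨k', hk'⟩ := h'.1.2
      rw [Prod.mk.injEq]
      refine ⟨eq_of_abs_div_sub_lt (k := k - k') hN0 h.1.1.1 h'.1.1.1 hNp ?_, rfl⟩
      rw [← abs_of_pos hN0, ← abs_mul, abs_lt]
      push_cast
      constructor <;> linarith [hk.1, hk.2, hk'.1, hk'.2]
  have h1 : (G.filter c).card ≤ ((A ×ˢ B).filter c).card + 2 * κ := by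
    have := (card_le_card hsub).trans ((card_union_le _ _).trans (Nat.add_le_add_right (card_union_le _ _) _))
    omega
  have h1' : ((G.filter c).card : ℝ) ≤ ((A ×ˢ B).filter c).card + 2 * κ := mod_cast h1
  have h2' : (((A ×ˢ B).filter c).card : ℝ) ≤ (G.filter c).card := mod_cast card_le_card hle
  rw [abs_le] at hR ⊢
  constructor <;> linarith [hR.1, hR.2]

lemma fareyPrimeSet_eq_image (P : Polynomial ℤ) (B : Finset ℕ) :
    fareyPrimeSet P B = (B.sigma fun p => unitValues P p).image fun x => (x.2 : ℚ) / (x.1 : ℚ) := by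
  ext r
  simp only [fareyPrimeSet, mem_biUnion, mem_image, mem_sigma, unitValues]
  constructor
  · rintro ⟨p, hp, a, ha, rfl⟩; exact ⟨⟨p, a⟩, ⟨hp, ha⟩, rfl⟩
  · rintro ⟨⟨p, a⟩, ⟨hp, ha⟩, rfl⟩; exact ⟨p, hp, a, ha, rfl⟩

lemma injOn_farey {P : Polynomial ℤ} (hP : P.eval 0 = 0) {B : Finset ℕ} (hB : ∀ p ∈ B, p.Prime) :
    Set.InjOn (fun x : (_ : ℕ) × ℕ => (x.2 : ℚ) / (x.1 : ℚ)) (B.sigma fun p => unitValues P p) := by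
  rintro ⟨p, a⟩ h ⟨q, b⟩ h' heq
  simp only [coe_sigma, Set.mem_sigma_iff, mem_coe] at h h' heq
  have hp := hB p h.1
  have hq := hB q h'.1
  have ha := lt_of_mem_unitValues hP hp h.2
  have hb := lt_of_mem_unitValues hP hq h'.2
  have hp0 : (p : ℚ) ≠ 0 := mod_cast hp.ne_zero
  have hq0 : (q : ℚ) ≠ 0 := mod_cast hq.ne_zero
  have e : a * q = b * p := by
    have := (div_eq_div_iff hp0 hq0).1 heq
    exact_mod_cast this
  have hpq : p = q := by
    rcases (Nat.Prime.dvd_mul hp).1 (Dvd.intro_left b e.symm) with h1 | h1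
    · exact absurd (Nat.le_of_dvd (by omega) h1) (by omega)
    · exact (Nat.prime_dvd_prime_iff_eq hp hq).1 h1
  subst hpq
  rw [Nat.eq_of_mul_eq_mul_right hp.pos e]

lemma card_fareyPrimeSet {P : Polynomial ℤ} (hP : P.eval 0 = 0) {B : Finset ℕ} (hB : ∀ p ∈ B, p.Prime) :
    (fareyPrimeSet P B).card = ∑ p ∈ B, (unitValues P p).card := by
  rw [fareyPrimeSet_eq_image, card_image_of_injOn (injOn_farey hP hB), card_sigma]

/-- A quantitative form of Poissonian pair correlation for prime denominators. -/
theorem abs_pairCorr_sub_le {P : Polynomial ℤ} (hP : P.eval 0 = 0) {B : Finset ℕ} {Q κ : ℕ}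
    (hB : ∀ p ∈ B, p.Prime) (hBQ : ∀ p ∈ B, p ≤ Q) (hκ : ∀ p ∈ B, p ≤ (unitValues P p).card + κ)
    {Λ N u : ℝ} (hΛ : 0 < Λ) (hN : N = (fareyPrimeSet P B).card) (hΛN : Λ * (Q + 1) < N)
    (hu : (B.card : ℝ) ^ 2 / N ≤ u) :
    |pairCorr (fareyPrimeSet P B) Λ - Λ| ≤ (1 + 2 * κ) * u + Λ * (B.card * Q ^ 2 / N ^ 2) +
      Λ * (2 * κ * u + (κ * u) ^ 2) := by
  classical
  have hΛN' : Λ < N := lt_of_le_of_lt (le_mul_of_one_le_right hΛ.le (by linarith [Nat.cast_nonneg (α := ℝ) Q])) hΛN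
  have hN0 : 0 < N := hΛ.trans hΛN'
  have hpN : ∀ p ∈ B, Λ * p < N := fun p hp => lt_of_le_of_lt (mul_le_mul_of_nonneg_left (by
    have : (p : ℝ) ≤ Q := mod_cast hBQ p hp
    linarith) hΛ.le) hΛN
  have hk0 : ∀ k : ℤ, ¬ (-(k : ℝ) * N ∈ Set.Ioo 0 Λ) := fun k hk => by
    have h1 : (0 : ℝ) < -k := pos_of_mul_pos_left hk.1 hN0.le
    have h2 : (1 : ℝ) ≤ -k := mod_cast (show (0 : ℤ) < -k from mod_cast h1)
    have := le_mul_of_one_le_left hN0.le h2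
    linarith [hk.2]
  set C : ℕ → ℕ → ℝ := fun p q => (((unitValues P p ×ˢ unitValues P q).filter fun e =>
    ∃ k : ℤ, ((e.1 : ℝ) / p - (e.2 : ℝ) / q - k) * N ∈ Set.Ioo 0 Λ).card : ℝ) with hC
  have hW : pairCorr (fareyPrimeSet P B) Λ = (∑ p ∈ B, ∑ q ∈ B, C p q) / N := by
    rw [pairCorr, ← hN]
    congr 1
    set ψ : (_ : ℕ) × ℕ → ℚ := fun x => (x.2 : ℚ) / (x.1 : ℚ) with hψ
    have hinj := injOn_farey hP hB
    set J := B.sigma fun p => unitValues P p with hJ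
    have hprod : fareyPrimeSet P B ×ˢ fareyPrimeSet P B = (J ×ˢ J).image (Prod.map ψ ψ) := by
      rw [fareyPrimeSet_eq_image, prodMap_image_product]
    have hinj2 : Set.InjOn (Prod.map ψ ψ) (J ×ˢ J : Finset _) := by
      rw [coe_product]; exact hinj.prodMap hinj
    rw [hprod, filter_image, card_image_of_injOn (hinj2.mono (coe_subset.2 (filter_subset _ _))),
      card_filter, sum_product, hJ, sum_sigma]
    push_cast
    refine sum_congr rfl fun p hp => ?_
    simp only [sum_sigma]
    rw [sum_comm]
    refine sum_congr rfl fun q hq => ?_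
    rw [hC]; dsimp only
    rw [card_filter, sum_product]
    push_cast
    refine sum_congr rfl fun a _ => sum_congr rfl fun b _ => ?_
    congr 1
    rw [eq_iff_iff]
    simp only [Prod.map, hψ]
    push_cast
    refine and_iff_right_of_imp ?_
    rintro ⟨k, hk⟩ heq
    have heq' : (a : ℝ) / p = b / q := by
      have := congrArg (Rat.cast (K := ℝ)) heq
      push_cast at this
      exact this
    rw [heq', sub_self, zero_sub] at hk
    exact hk0 k hk
  set s : ℝ := ∑ p ∈ B, (p : ℝ) with hs
  have hsN : N ≤ s := by
    rw [hN, card_fareyPrimeSet hP hB, hs]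
    push_cast
    refine sum_le_sum fun p _ => ?_
    have := card_filter_le (Icc 1 p) fun a : ℕ => Int.gcd (P.eval (a : ℤ)) (p : ℤ) = 1
    rw [Nat.card_Icc, Nat.add_sub_cancel] at this
    exact_mod_cast this
  have hsN2 : s ≤ N + κ * B.card := by
    have h1 : s ≤ ∑ p ∈ B, (((unitValues P p).card : ℝ) + κ) := sum_le_sum fun p hp => mod_cast hκ p hp
    rw [sum_add_distrib, sum_const, nsmul_eq_mul] at h1
    rw [hN, card_fareyPrimeSet hP hB]
    push_cast
    linarith
  have hterm : ∀ p ∈ B, ∀ q ∈ B, |C p q - Λ * (p * q) / N| ≤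
      (1 + 2 * κ) + if p = q then Λ * Q ^ 2 / N else 0 := fun p hp q hq => by
    by_cases hpq : p = q
    · subst hpq
      have h0 : C p p = 0 := by
        rw [hC]; dsimp only
        rw [Nat.cast_eq_zero, card_eq_zero, filter_eq_empty_iff]
        rintro ⟨a, b⟩ hab ⟨k, hk⟩
        rw [mem_product] at hab
        have : a = b := eq_of_abs_div_sub_lt (k := k) hN0 (mem_filter.1 hab.1).1 (mem_filter.1 hab.2).1
          (hpN p hp) (by rw [← abs_of_pos hN0, ← abs_mul, abs_of_pos hk.1]; exact hk.2)
        dsimp only at hk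
        rw [this, sub_self, zero_sub] at hk
        exact hk0 k hk
      have hpQ : (p : ℝ) ≤ Q := mod_cast hBQ p hp
      rw [h0, zero_sub, abs_neg, abs_of_nonneg (by positivity), if_pos rfl]
      have : Λ * (p * p) / N ≤ Λ * Q ^ 2 / N := by rw [sq]; gcongr
      have : (0 : ℝ) ≤ κ := by positivity
      linarith
    · rw [if_neg hpq, add_zero]
      exact card_close_pairs (hB p hp) (hB q hq) hpq hΛ (hpN p hp) (hpN q hq) (filter_subset _ _)
        (filter_subset _ _) (hκ p hp) (hκ q hq)
  have hdev : |∑ p ∈ B, ∑ q ∈ B, C p q - Λ * s ^ 2 / N| ≤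
      (B.card : ℝ) ^ 2 * (1 + 2 * κ) + B.card * (Λ * Q ^ 2 / N) := by
    have e : Λ * s ^ 2 / N = ∑ p ∈ B, ∑ q ∈ B, Λ * (p * q) / N := by
      rw [sq, hs, sum_mul_sum, mul_sum, sum_div]
      refine sum_congr rfl fun p _ => ?_
      rw [mul_sum, sum_div]
    rw [e, ← sum_sub_distrib]
    simp only [← sum_sub_distrib]
    calc _ ≤ ∑ p ∈ B, ∑ q ∈ B, ((1 + 2 * (κ : ℝ)) + if p = q then Λ * Q ^ 2 / N else 0) :=
          (abs_sum_le_sum_abs _ _).trans (sum_le_sum fun p hp =>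
            (abs_sum_le_sum_abs _ _).trans (sum_le_sum fun q hq => hterm p hp q hq))
      _ = ∑ p ∈ B, ((B.card : ℝ) * (1 + 2 * κ) + Λ * Q ^ 2 / N) := by
          refine sum_congr rfl fun p hp => ?_
          rw [sum_add_distrib, sum_const, nsmul_eq_mul, sum_ite_eq, if_pos hp]
      _ = _ := by rw [sum_const, nsmul_eq_mul]; ring
  set b := (B.card : ℝ) with hb
  have hbu : b / N ≤ u := by
    refine le_trans (div_le_div_of_nonneg_right ?_ hN0.le) hu
    rw [hb]
    exact_mod_cast Nat.le_self_pow (by norm_num) _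
  have h1 : |(∑ p ∈ B, ∑ q ∈ B, C p q) / N - Λ * (s / N) ^ 2| ≤ (1 + 2 * κ) * u + Λ * (b * Q ^ 2 / N ^ 2) := by
    have e : (∑ p ∈ B, ∑ q ∈ B, C p q) / N - Λ * (s / N) ^ 2 = (∑ p ∈ B, ∑ q ∈ B, C p q - Λ * s ^ 2 / N) / N := by
      field_simp
    rw [e, abs_div, abs_of_pos hN0]
    refine (div_le_div_of_nonneg_right hdev hN0.le).trans ?_
    have e2 : (b ^ 2 * (1 + 2 * κ) + b * (Λ * Q ^ 2 / N)) / N =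
        (1 + 2 * κ) * (b ^ 2 / N) + Λ * (b * Q ^ 2 / N ^ 2) := by field_simp
    rw [e2]
    gcongr
  have h2 : 1 ≤ s / N := (one_le_div hN0).2 hsN
  have h3 : s / N ≤ 1 + κ * u := by
    refine (div_le_div_of_nonneg_right hsN2 hN0.le).trans ?_
    rw [add_div, div_self hN0.ne', mul_div_assoc]
    gcongr
  have h4 : (s / N) ^ 2 ≤ (1 + κ * u) ^ 2 := pow_le_pow_left₀ (by linarith) h3 2
  have h5 : 1 ≤ (s / N) ^ 2 := one_le_pow₀ h2
  have h6 := mul_le_mul_of_nonneg_left h4 hΛ.le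
  have h7 := mul_le_mul_of_nonneg_left h5 hΛ.le
  rw [hW]
  rw [abs_le] at h1 ⊢
  constructor <;> nlinarith [h1.1, h1.2]

lemma card_psPrimes_le {c γ : ℝ} (hγ0 : 0 < γ) (hγ1 : γ < 1) (hc : γ = 1 / c) {Q : ℕ} (hQ : 1 ≤ Q) :
    ((psPrimes c Q).card : ℝ) ≤ 2 * (Q : ℝ) ^ γ := by
  classical
  have hc0 : 0 < c := by rw [hc, one_div] at hγ0; exact inv_pos.1 hγ0
  have hsub : psPrimes c Q ⊆ (Icc 1 ⌊((Q : ℝ) + 1) ^ γ⌋₊).image fun n : ℕ => ⌊(n : ℝ) ^ c⌋₊ := fun p hp => by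
    rw [psPrimes, mem_filter, mem_Icc] at hp
    obtain ⟨⟨h1, h2⟩, -, n, hn, rfl⟩ := hp
    refine mem_image.2 ⟨n, mem_Icc.2 ⟨hn, Nat.le_floor ?_⟩, rfl⟩
    have h3 : (n : ℝ) ^ c ≤ Q + 1 := by
      have := (Nat.lt_floor_add_one ((n : ℝ) ^ c)).le
      have h4 : (⌊(n : ℝ) ^ c⌋₊ : ℝ) ≤ Q := mod_cast h2
      linarith
    have := rpow_le_rpow (by positivity) h3 hγ0.le
    rwa [← rpow_mul (by positivity), hc, mul_one_div_cancel hc0.ne', rpow_one, ← hc] at this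
  have h1 : ((psPrimes c Q).card : ℝ) ≤ ⌊((Q : ℝ) + 1) ^ γ⌋₊ := by
    have := (card_le_card hsub).trans card_image_le
    rw [Nat.card_Icc, Nat.add_sub_cancel] at this
    exact_mod_cast this
  have hQ' : (1 : ℝ) ≤ Q := mod_cast hQ
  calc ((psPrimes c Q).card : ℝ) ≤ ((Q : ℝ) + 1) ^ γ := h1.trans (Nat.floor_le (by positivity))
    _ ≤ (2 * Q) ^ γ := rpow_le_rpow (by positivity) (by linarith) hγ0.le
    _ = 2 ^ γ * (Q : ℝ) ^ γ := mul_rpow (by norm_num) (by positivity)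
    _ ≤ _ := by
      gcongr
      calc (2 : ℝ) ^ γ ≤ 2 ^ (1 : ℝ) := rpow_le_rpow_of_exponent_le (by norm_num) hγ1.le
        _ = 2 := rpow_one 2

lemma le_card_fareyPrimeSet_psPrimes {c γ : ℝ} (h0 : 50 / 58 < γ) (h1 : γ < 1) (hc : c = 1 / γ)
    {P : Polynomial ℤ} (hP : P.eval 0 = 0) (hP0 : P ≠ 0) : ∀ᶠ Q : ℕ in atTop,
      (Q : ℝ) ^ (1 + γ - (1 - γ) / 2) ≤ ((fareyPrimeSet P (psPrimes c Q)).card : ℝ) := by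
  set κ := P.natDegree + P.leadingCoeff.natAbs
  have hdiv : Tendsto (fun Q : ℕ => Q / 4) atTop atTop := Nat.tendsto_div_const_atTop (by norm_num)
  filter_upwards [hdiv.eventually (le_card_floor_primes h0 h1 hc), hdiv.eventually_ge_atTop (2 * κ + 1),
    eventually_ge_atTop 8, tendsto_natCast_atTop_atTop.eventually ((tendsto_rpow_atTop
      (show 0 < (1 - γ) / 4 by linarith)).eventually_ge_atTop 128)] with Q hA hX hQ8 h128
  have hprime : ∀ p ∈ psPrimes c Q, p.Prime := fun p hp => by
    classical rw [psPrimes, mem_filter] at hp; exact hp.2.1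
  set X := Q / 4
  have hA' := hA ((psPrimes c Q).filter (X ≤ ·)) fun n hn hp hk => by
    rw [mem_Ico] at hn
    classical exact mem_filter.2 ⟨mem_filter.2 ⟨mem_Icc.2 ⟨hp.one_le, by omega⟩, hp, hk⟩, hn.1⟩
  have hQ0 : (0 : ℝ) < Q := mod_cast (by omega : 0 < Q)
  have hX8 : (Q : ℝ) / 8 ≤ X := by
    have : (Q : ℝ) ≤ ((8 * X : ℕ) : ℝ) := mod_cast (by omega : Q ≤ 8 * X)
    push_cast at this; linarith
  rw [card_fareyPrimeSet hP hprime]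
  push_cast
  have hlow : (((psPrimes c Q).filter (X ≤ ·)).card : ℝ) * (X / 2) ≤
      ∑ p ∈ psPrimes c Q, ((unitValues P p).card : ℝ) := by
    rw [← nsmul_eq_mul]
    refine (card_nsmul_le_sum _ _ _ fun p hp => ?_).trans
      (sum_le_sum_of_subset_of_nonneg (filter_subset _ _) fun _ _ _ => by positivity)
    rw [mem_filter] at hp
    have h3 := le_card_unitValues_add hP0 (hprime p hp.1)
    have h4 : X ≤ 2 * (unitValues P p).card := by omega
    have : (X : ℝ) ≤ ((2 * (unitValues P p).card : ℕ) : ℝ) := mod_cast h4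
    push_cast at this; linarith
  refine le_trans ?_ hlow
  set g := γ - (1 - γ) / 4 with hg
  have hg1 : (Q : ℝ) ^ g / 8 ≤ (X : ℝ) ^ g := by
    calc (Q : ℝ) ^ g / 8 ≤ (Q : ℝ) ^ g / 8 ^ g := by
          refine div_le_div_of_nonneg_left (by positivity) (by positivity) ?_
          calc (8 : ℝ) ^ g ≤ 8 ^ (1 : ℝ) := rpow_le_rpow_of_exponent_le (by norm_num) (by linarith)
            _ = 8 := rpow_one 8
      _ = ((Q : ℝ) / 8) ^ g := (div_rpow hQ0.le (by norm_num) _).symm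
      _ ≤ _ := rpow_le_rpow (by positivity) hX8 (by linarith)
  calc (Q : ℝ) ^ (1 + γ - (1 - γ) / 2) = 1 / 128 * (128 * (Q : ℝ) ^ (1 + γ - (1 - γ) / 2)) := by ring
    _ ≤ 1 / 128 * ((Q : ℝ) ^ ((1 - γ) / 4) * (Q : ℝ) ^ (1 + γ - (1 - γ) / 2)) := by gcongr
    _ = 1 / 128 * ((Q : ℝ) ^ g * (Q : ℝ) ^ (1 : ℝ)) := by
        rw [← rpow_add hQ0, ← rpow_add hQ0]; congr 2; rw [hg]; ring
    _ = (Q : ℝ) ^ g / 8 * (Q / 8 / 2) := by rw [rpow_one]; ring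
    _ ≤ _ := mul_le_mul (hg1.trans hA') (by linarith) (by positivity) (by positivity)

/-- **Corollary.** For fixed `c ∈ (1, 1.16)`, the limiting pair correlation of the polynomial
Farey fractions with Piatetski-Shapiro prime denominators exists and is Poissonian. -/
theorem pairCorr_piatetskiShapiro_poissonian (cexp : ℝ) (hc1 : 1 < cexp) (hc2 : cexp < 1.16)
    (ν : ℕ) (hν : 2 ≤ ν) (c : ℕ → ℤ) (hcν : c ν ≠ 0)
    (P : Polynomial ℤ)
    (hP : P = ∑ i ∈ Finset.Icc 1 ν, Polynomial.C (c i) * Polynomial.X ^ i)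
    (hdisc : (P.map (Int.castRingHom ℚ)).Separable) :
    ∀ Λ : ℝ, 0 < Λ →
      Tendsto (fun Q : ℕ => pairCorr (fareyPrimeSet P (psPrimes cexp Q)) Λ) atTop (nhds Λ) := fun Λ hΛ => by
  set γ := 1 / cexp with hγ
  have hc0 : 0 < cexp := by linarith
  have h0 : 50 / 58 < γ := by rw [hγ, lt_div_iff₀ hc0]; linarith
  have h1 : γ < 1 := by rw [hγ, div_lt_one hc0]; exact hc1
  have hcγ : cexp = 1 / γ := by rw [hγ, one_div_one_div]
  have hPe : P.eval 0 = 0 := by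
    rw [hP, Polynomial.eval_finsetSum]
    refine sum_eq_zero fun i hi => ?_
    have : i ≠ 0 := by rw [mem_Icc] at hi; omega
    simp [this]
  have hP0 : P ≠ 0 := fun h => by
    have h2 : P.coeff ν = c ν := by
      rw [hP, Polynomial.finsetSum_coeff]
      simp only [Polynomial.coeff_C_mul_X_pow]
      rw [sum_ite_eq, if_pos (mem_Icc.2 ⟨by omega, le_rfl⟩)]
    rw [h, Polynomial.coeff_zero] at h2
    exact hcν h2.symm
  set κ := P.natDegree + P.leadingCoeff.natAbs
  have hr : ∀ {a : ℝ}, a < 0 → Tendsto (fun Q : ℕ => (Q : ℝ) ^ a) atTop (nhds 0) := fun {a} ha => by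
    have := (tendsto_rpow_neg_atTop (neg_pos.2 ha)).comp tendsto_natCast_atTop_atTop
    simpa only [neg_neg, Function.comp_def] using this
  set u : ℕ → ℝ := fun Q => 4 * (Q : ℝ) ^ (-((1 - γ) / 2)) with hu
  set v : ℕ → ℝ := fun Q => 2 * (Q : ℝ) ^ (1 - 2 * γ) with hv
  have hu0 : Tendsto u atTop (nhds 0) := by simpa using (hr (show -((1 - γ) / 2) < 0 by linarith)).const_mul 4
  have hv0 : Tendsto v atTop (nhds 0) := by simpa using (hr (show 1 - 2 * γ < 0 by linarith)).const_mul 2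
  have hbound : Tendsto (fun Q => (1 + 2 * (κ : ℝ)) * u Q + Λ * v Q + Λ * (2 * κ * u Q + (κ * u Q) ^ 2))
      atTop (nhds 0) := by
    have := ((hu0.const_mul (1 + 2 * (κ : ℝ))).add (hv0.const_mul Λ)).add
      (((hu0.const_mul (2 * (κ : ℝ))).add ((hu0.const_mul (κ : ℝ)).pow 2)).const_mul Λ)
    simpa using this
  rw [tendsto_iff_dist_tendsto_zero]
  refine squeeze_zero' (Eventually.of_forall fun _ => dist_nonneg) ?_ hbound
  filter_upwards [le_card_fareyPrimeSet_psPrimes h0 h1 hcγ hPe hP0, eventually_ge_atTop 1,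
    tendsto_natCast_atTop_atTop.eventually ((tendsto_rpow_atTop
      (show 0 < γ - (1 - γ) / 2 by linarith)).eventually_gt_atTop (2 * Λ))] with Q hN hQ hQΛ
  set N : ℝ := ((fareyPrimeSet P (psPrimes cexp Q)).card : ℝ) with hNdef
  have hQ0 : (0 : ℝ) < Q := mod_cast hQ
  have hQ1 : (1 : ℝ) ≤ Q := mod_cast hQ
  have hb := card_psPrimes_le (by linarith) h1 hγ hQ
  have hE0 : 0 < (Q : ℝ) ^ (1 + γ - (1 - γ) / 2) := by positivity
  have hN0 : 0 < N := hE0.trans_le hN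
  have hsq : ∀ a : ℝ, ((Q : ℝ) ^ a) ^ 2 = (Q : ℝ) ^ (2 * a) := fun a => by
    rw [rpow_npow_eq hQ0]; norm_num
  rw [dist_eq]
  refine (abs_pairCorr_sub_le (κ := κ) (Q := Q) (N := N) (u := u Q) hPe (fun p hp => ?_) (fun p hp => ?_)
    (fun p hp => ?_) hΛ rfl ?_ ?_).trans ?_
  · classical rw [psPrimes, mem_filter] at hp; exact hp.2.1
  · classical rw [psPrimes, mem_filter, mem_Icc] at hp; exact hp.1.2
  · classical rw [psPrimes, mem_filter] at hp; exact le_card_unitValues_add hP0 hp.2.1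
  · refine lt_of_lt_of_le ?_ hN
    rw [show 1 + γ - (1 - γ) / 2 = (γ - (1 - γ) / 2) + 1 by ring, rpow_add hQ0, rpow_one]
    calc Λ * (Q + 1) ≤ 2 * Λ * Q := by linarith [mul_le_mul_of_nonneg_left hQ1 hΛ.le]
      _ < _ := mul_lt_mul_of_pos_right hQΛ hQ0
  · rw [div_le_iff₀ hN0]
    calc ((psPrimes cexp Q).card : ℝ) ^ 2 ≤ (2 * (Q : ℝ) ^ γ) ^ 2 :=
          pow_le_pow_left₀ (Nat.cast_nonneg _) hb 2
      _ = 4 * ((Q : ℝ) ^ (-((1 - γ) / 2)) * (Q : ℝ) ^ (1 + γ - (1 - γ) / 2)) := by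
          rw [mul_pow, hsq, ← rpow_add hQ0]; norm_num; congr 1; ring
      _ = u Q * (Q : ℝ) ^ (1 + γ - (1 - γ) / 2) := by simp only [hu]; ring
      _ ≤ _ := mul_le_mul_of_nonneg_left hN (by positivity)
  · have : ((psPrimes cexp Q).card : ℝ) * Q ^ 2 / N ^ 2 ≤ v Q := by
      rw [div_le_iff₀ (pow_pos hN0 2)]
      calc ((psPrimes cexp Q).card : ℝ) * Q ^ 2 ≤ 2 * (Q : ℝ) ^ γ * ((Q : ℝ) ^ (1 : ℝ)) ^ 2 := by
            rw [rpow_one]; gcongr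
        _ = 2 * (Q : ℝ) ^ (1 - 2 * γ) * ((Q : ℝ) ^ (1 + γ - (1 - γ) / 2)) ^ 2 := by
            rw [hsq, hsq, mul_assoc, mul_assoc, ← rpow_add hQ0, ← rpow_add hQ0]; congr 2; ring
        _ ≤ _ := mul_le_mul_of_nonneg_left (pow_le_pow_left₀ hE0.le hN 2) (by positivity)
    have := mul_le_mul_of_nonneg_left this hΛ.le
    linarith
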